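/- For every ε > 0 and every K > 0 there exists a constant C = C(ε,K) > 0 such that for all x ≥ 3, all 2 ≤ y ≤ exp((log x)/(log log x)^{1+ε}), and all real v with 0 ≤ v ≤ K·ū^{1/4}, one has |D(x,y;v) − Φ(v)| ≤ C · Φ(v) · (1 + v⁴)/ū. -/

import Mathlib

open Complex Finset MeasureTheory
open scoped Real Classical

noncomputable section

/-- The set of primes `p ≤ y`. -/
def primesLe (y : ℝ) : Finset ℕ := (Finset.Iic ⌊y⌋₊).filter Nat.Prime

/-- `α` satisfies the saddle-point equation `∑_{p ≤ y} log p/(p^α − 1) = log x`. -/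
def saddleEq (x y α : ℝ) : Prop :=
  ∑ p ∈ primesLe y, Real.log p / ((p : ℝ) ^ α - 1) = Real.log x

/-- `ū = min{u, π(y)}` where `u = log x/log y`. -/
def ubar (x y : ℝ) : ℝ := min (Real.log x / Real.log y) ((primesLe y).card)

def sigma2 (y α : ℝ) : ℝ :=
  ∑ p ∈ primesLe y, (Real.log p) ^ 2 * (p : ℝ) ^ α / ((p : ℝ) ^ α - 1) ^ 2

def sigma2t (y α : ℝ) : ℝ :=
  ∑ p ∈ primesLe y, (Real.log p) ^ 2 / ((p : ℝ) ^ α - 1) ^ 2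

/-- `ϱ = (1/2)(σ₂ − σ̃₂/3)^{1/2}`. -/
def rhoXY (y α : ℝ) : ℝ := (1 / 2) * Real.sqrt (sigma2 y α - sigma2t y α / 3)

/-- `n` is `y`-friable: every prime factor of `n` is at most `y`. -/
def friable (y : ℝ) (n : ℕ) : Prop := ∀ p : ℕ, p.Prime → p ∣ n → (p : ℝ) ≤ y

/-- `S(x,y)`: the set of `y`-friable integers `1 ≤ n ≤ x`. -/
def Sxy (x y : ℝ) : Finset ℕ := (Finset.Icc 1 ⌊x⌋₊).filter (friable y)

/-- `Ψ(x,y) = #S(x,y)`. -/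
def Psi (x y : ℝ) : ℕ := (Sxy x y).card

/-- `D(x,y;γ) = Ψ(x,y)⁻¹ ∑_{n ∈ S(x,y)} τ(n)⁻¹ #{d ∣ n : d ≥ √n e^γ}`. -/
def Dxy (x y γ : ℝ) : ℝ :=
  (Psi x y : ℝ)⁻¹ * ∑ n ∈ Sxy x y,
    ((n.divisors.card : ℝ))⁻¹ *
      ((n.divisors.filter (fun d => Real.sqrt n * Real.exp γ ≤ (d : ℝ))).card : ℝ)

/-- `Φ(v) = ∫_v^∞ e^{-z²/2} dz/√(2π)`. -/
def PhiGauss (v : ℝ) : ℝ :=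
  ∫ z in Set.Ioi v, Real.exp (-z ^ 2 / 2) / Real.sqrt (2 * Real.pi)

/-- `g(z) = log((z^{1/2} − z^{-1/2})/log z)`, with `g(1) = 0`. -/
def gfun (z : ℂ) : ℂ :=
  if z = 1 then 0
  else Complex.log ((z ^ (2⁻¹ : ℂ) - z ^ (-2⁻¹ : ℂ)) / Complex.log z)

/-- `Ξ(a,b) = −(1/2)log(1−a) − (1/2)log(1−b) − g((1−a)/(1−b))`. -/
def Xi (a b : ℂ) : ℂ :=
  -(2⁻¹ : ℂ) * Complex.log (1 - a) - (2⁻¹ : ℂ) * Complex.log (1 - b) -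
    gfun ((1 - a) / (1 - b))

/-- `f_y(s,w) = ∑_{p ≤ y} Ξ(p^{-s}, p^{-w})`. -/
def fy (y : ℝ) (s w : ℂ) : ℂ := ∑ p ∈ primesLe y, Xi ((p : ℂ) ^ (-s)) ((p : ℂ) ^ (-w))

/-- `F_y(s,w) = exp(f_y(s,w))`. -/
def Fy (y : ℝ) (s w : ℂ) : ℂ := Complex.exp (fy y s w)

/-- `F_y(σ,κ)` at real arguments, as a (positive) real number. -/
def FyR (y σ κ : ℝ) : ℝ := Real.exp ((fy y (σ : ℂ) (κ : ℂ)).re)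

/-- `∂_{kℓ}f(s,w)`: partial derivative `k` times in the first variable and `ℓ` times
in the second. -/
def pdv (k l : ℕ) (f : ℂ → ℂ → ℂ) (s w : ℂ) : ℂ :=
  iteratedDeriv k (fun z => iteratedDeriv l (f z) w) s

/-- `Hess[f_y] = (∂₂₀f_y)(∂₀₂f_y) − (∂₁₁f_y)²`. -/
def HessC (y : ℝ) (s w : ℂ) : ℂ :=
  pdv 2 0 (fy y) s w * pdv 0 2 (fy y) s w - (pdv 1 1 (fy y) s w) ^ 2

/-- The domain `D_δ(α;y)`. -/
def Ddom (δ α y : ℝ) : Set (ℝ × ℝ) :=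
  {p | 0 < p.1 ∧ p.1 ≤ 1 ∧ 0 < p.2 ∧ p.2 ≤ 1 ∧ 0 ≤ (p.1 - α) * (α - p.2) ∧
    1 / (1 + δ) ≤ (1 - (2 : ℝ) ^ (-p.1)) / (1 - (2 : ℝ) ^ (-p.2)) ∧
    (1 - (2 : ℝ) ^ (-p.1)) / (1 - (2 : ℝ) ^ (-p.2)) ≤ 1 + δ ∧
    |p.1 - p.2| * Real.log y ≤ δ}

/-- `φ_k(s,y)`: the `k`-th derivative in `s` of `φ₀(s,y) = −∑_{p ≤ y} log(1−p^{-s})`. -/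
def phiD (y : ℝ) (k : ℕ) (s : ℂ) : ℂ :=
  iteratedDeriv k (fun z => -∑ p ∈ primesLe y, Complex.log (1 - (p : ℂ) ^ (-z))) s

/-- `φ₂(σ,y) = ∑_{p ≤ y} (log p)² p^σ/(p^σ−1)²` for real `σ`. -/
def phi2R (y σ : ℝ) : ℝ :=
  ∑ p ∈ primesLe y, (Real.log p) ^ 2 * (p : ℝ) ^ σ / ((p : ℝ) ^ σ - 1) ^ 2

open scoped ComplexConjugate
open ArithmeticFunction (moebius)
open Real (add_one_le_exp exp_le_exp exp_le_one_iff exp_nonneg exp_one_lt_d9 exp_pos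
  le_log_iff_exp_le le_norm_self log_div log_le_log log_nonneg log_pos log_pow log_rpow
  log_two_gt_d9 log_two_lt_d9 norm_eq_abs norm_of_nonneg one_le_exp one_le_sqrt one_lt_rpow
  pi_gt_three pi_pos rpow_add rpow_le_rpow_of_exponent_le rpow_mul rpow_natCast rpow_neg rpow_one
  sq_sqrt sqrt_eq_rpow toNNReal)
open Chebyshev (theta theta_le_log4_mul_x)
open Filter (atTop eventually_atTop eventually_ge_atTop)
open ProbabilityTheory (complexMGF gaussianPDFReal gaussianReal integrable_exp_mul_gaussianReal
  mgf)

local notation "log" => Real.log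
local notation "sin" => Real.sin
local notation "cos" => Real.cos

/-- The restriction of a function to a finset. -/
local notation:max l:max "⇂" s:max => fun p : s => l p

variable {A N T Y L b c l r t x y z α δ κ η σ : ℝ}

/-! ### A Selberg-type upper bound sieve for intervals -/

/-- Möbius inversion restricted to multiples of `e`. -/
lemma sum_moebius_multiples {R e q : ℕ} (he : 0 < e) (hq : 0 < q) (hqR : q ≤ R) :
    ∑ d ∈ Icc 1 R, (if e ∣ d ∧ d ∣ q then (moebius (q / d) : ℝ) else 0) =
      if e = q then 1 else 0 := by
  rw [← sum_filter]
  by_cases heq : e ∣ q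
  · obtain ⟨r, rfl⟩ := heq
    have hr : 0 < r := Nat.pos_of_mul_pos_left hq
    have h1 : ∑ d ∈ (Icc 1 R).filter (fun d => e ∣ d ∧ d ∣ e * r), (moebius (e * r / d) : ℝ) =
        ∑ d ∈ r.divisors, (moebius (r / d) : ℝ) := by
      symm
      apply sum_bij (fun d _ => e * d)
      · intro d hd
        have hd' := Nat.dvd_of_mem_divisors hd
        have hdpos := Nat.pos_of_mem_divisors hd
        simp only [mem_filter, mem_Icc]
        refine ⟨⟨Nat.mul_pos he hdpos, ?_⟩, dvd_mul_right _ _, Nat.mul_dvd_mul_left _ hd'⟩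
        exact (Nat.mul_le_mul_left _ (Nat.le_of_dvd hr hd')).trans hqR
      · intro a _ b _ h
        exact Nat.eq_of_mul_eq_mul_left he h
      · intro b hb
        simp only [mem_filter, mem_Icc] at hb; obtain ⟨_, ⟨d, rfl⟩, h2⟩ := hb
        exact ⟨d, Nat.mem_divisors.2 ⟨Nat.dvd_of_mul_dvd_mul_left he h2, hr.ne'⟩, rfl⟩
      · intro d _
        rw [Nat.mul_div_mul_left _ _ he]
    rw [h1, Nat.sum_div_divisors r (fun d => (moebius d : ℝ))]
    have h2 := congrArg (fun f => f r) ArithmeticFunction.moebius_mul_coe_zeta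
    simp only [ArithmeticFunction.coe_mul_zeta_apply] at h2
    have h3 : (∑ d ∈ r.divisors, (moebius d : ℝ)) =
        ((∑ d ∈ r.divisors, moebius d : ℤ) : ℝ) := by push_cast; rfl
    rw [h3, h2, ArithmeticFunction.one_apply]
    by_cases hr1 : r = 1
    · simp [hr1]
    · have : e ≠ e * r := by
        intro h; apply hr1; exact Nat.eq_of_mul_eq_mul_left he (by rw [← h, mul_one])
      simp [hr1, this]
  · rw [filter_false_of_mem, sum_empty, if_neg]
    · rintro rfl; exact heq dvd_rfl
    · rintro d _ ⟨h1, h2⟩; exact heq (h1.trans h2)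

/-- The sifting density `G(R) = ∑_{q ≤ R} μ(q)²/φ(q)`. -/
def sieveG (R : ℕ) : ℝ :=
  ∑ q ∈ Icc 1 R, (moebius q : ℝ) ^ 2 / (Nat.totient q : ℝ)

/-- Sieve weights. -/
def sieveB (R d : ℕ) : ℝ :=
  d * ∑ q ∈ Icc 1 R, (if d ∣ q then (moebius (q / d) : ℝ) else 0) *
    ((moebius q : ℝ) / (Nat.totient q : ℝ))

lemma sum_sieveB_div {R e : ℕ} (he : e ∈ Icc 1 R) :
    ∑ d ∈ Icc 1 R, (if e ∣ d then sieveB R d / d else 0) =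
      (moebius e : ℝ) / (Nat.totient e : ℝ) := by
  have he1 := (mem_Icc.1 he).1
  have h1 : ∀ d ∈ Icc 1 R, (if e ∣ d then sieveB R d / d else 0) =
      ∑ q ∈ Icc 1 R, (if e ∣ d ∧ d ∣ q then (moebius (q / d) : ℝ) else 0) *
    ((moebius q : ℝ) / (Nat.totient q : ℝ)) := by
    intro d hd
    have hd0 : (d : ℝ) ≠ 0 := by have := (mem_Icc.1 hd).1; positivity
    by_cases h : e ∣ d
    · simp only [h, true_and, if_true, sieveB]
      field_simp
    · simp [h]
  rw [sum_congr rfl h1, sum_comm]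
  have h2 : ∀ q ∈ Icc 1 R, ∑ d ∈ Icc 1 R, (if e ∣ d ∧ d ∣ q then (moebius (q / d) : ℝ) else 0) *
    ((moebius q : ℝ) / (Nat.totient q : ℝ)) =
      if e = q then ((moebius q : ℝ) / (Nat.totient q : ℝ)) else 0 := by
    intro q hq; rw [← sum_mul, sum_moebius_multiples he1 (mem_Icc.1 hq).1 (mem_Icc.1 hq).2]
    split_ifs <;> simp
  rw [sum_congr rfl h2, sum_ite_eq, if_pos he]

lemma gcd_eq_sum_totient {R d d' : ℕ} (hd : d ∈ Icc 1 R) :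
    ((Nat.gcd d d' : ℕ) : ℝ) =
      ∑ e ∈ Icc 1 R, (Nat.totient e : ℝ) * (if e ∣ d then 1 else 0) * (if e ∣ d' then 1 else 0) := by
  obtain ⟨h1, h2⟩ := mem_Icc.1 hd
  have h3 : ∀ e ∈ Icc 1 R, (Nat.totient e : ℝ) * (if e ∣ d then 1 else 0) *
      (if e ∣ d' then 1 else 0) = if e ∣ Nat.gcd d d' then (Nat.totient e : ℝ) else 0 := by
    intro e _
    have h := Nat.dvd_gcd_iff (k := e) (m := d) (n := d')
    split_ifs <;> simp_all
  rw [sum_congr rfl h3, ← sum_filter]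
  have h4 : (Icc 1 R).filter (fun e => e ∣ Nat.gcd d d') = (Nat.gcd d d').divisors := by
    ext e; simp only [mem_filter, mem_Icc, Nat.mem_divisors]
    have hg : Nat.gcd d d' ≠ 0 := (Nat.gcd_pos_of_pos_left _ h1).ne'
    constructor
    · rintro ⟨_, h⟩; exact ⟨h, hg⟩
    · rintro ⟨h, _⟩
      refine ⟨⟨Nat.pos_of_dvd_of_pos h (Nat.pos_of_ne_zero hg), ?_⟩, h⟩
      exact (Nat.le_of_dvd h1 (h.trans (Nat.gcd_dvd_left _ _))).trans h2
  rw [h4]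
  conv_lhs => rw [← Nat.sum_totient (Nat.gcd d d')]
  push_cast; rfl

lemma sieve_quadratic (R : ℕ) :
    ∑ d ∈ Icc 1 R, ∑ d' ∈ Icc 1 R, sieveB R d * sieveB R d' / (Nat.lcm d d' : ℝ) = sieveG R := by
  have h1 : ∀ d ∈ Icc 1 R, ∀ d' ∈ Icc 1 R, sieveB R d * sieveB R d' / (Nat.lcm d d' : ℝ) =
      ∑ e ∈ Icc 1 R, (Nat.totient e : ℝ) * ((if e ∣ d then sieveB R d / d else 0) *
        (if e ∣ d' then sieveB R d' / d' else 0)) := by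
    intro d hd d' hd'
    have hd0 : (d : ℝ) ≠ 0 := by have := (mem_Icc.1 hd).1; positivity
    have hd0' : (d' : ℝ) ≠ 0 := by have := (mem_Icc.1 hd').1; positivity
    have hl0 : (Nat.lcm d d' : ℝ) ≠ 0 := by
      have := Nat.lcm_pos (mem_Icc.1 hd).1 (mem_Icc.1 hd').1; positivity
    have hgl : (Nat.gcd d d' : ℝ) * Nat.lcm d d' = d * d' := mod_cast Nat.gcd_mul_lcm d d'
    have : sieveB R d * sieveB R d' / (Nat.lcm d d' : ℝ) =
        (sieveB R d / d) * (sieveB R d' / d') * Nat.gcd d d' := by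
      field_simp
      linear_combination (-(sieveB R d * sieveB R d')) * hgl
    rw [this, gcd_eq_sum_totient hd, mul_sum]; refine sum_congr rfl fun e _ => ?_
    split_ifs <;> simp; ring
  rw [sum_congr rfl fun d hd => sum_congr rfl (h1 d hd)]
  rw [sum_congr rfl fun d _ => sum_comm, sum_comm]
  refine sum_congr rfl fun e he => ?_
  simp_rw [← mul_sum, ← sum_mul]
  rw [sum_sieveB_div he]
  have : (Nat.totient e : ℝ) ≠ 0 := by have := Nat.totient_pos.2 (mem_Icc.1 he).1; positivity
  field_simp

lemma card_multiples_Ioc (a b d : ℕ) (hab : a ≤ b) (hd : 0 < d) :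
    |((((Ioc a b).filter (fun n => d ∣ n)).card : ℝ)) - ((b : ℝ) - a) / d| ≤ 1 := by
  have h1 : (((Ioc a b).filter (fun n => d ∣ n)).card) + a / d = b / d := by
    rw [← Nat.Ioc_filter_dvd_card_eq_div, ← Nat.Ioc_filter_dvd_card_eq_div,
      add_comm, ← card_union_of_disjoint]
    · congr 1
      ext n; simp only [mem_union, mem_filter, mem_Ioc]; grind
    · rw [disjoint_left]; intro n; simp only [mem_filter, mem_Ioc]; grind
  have h2 : ((((Ioc a b).filter (fun n => d ∣ n)).card : ℝ)) = (b / d : ℕ) - (a / d : ℕ) := by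
    rw [← h1]; push_cast; ring
  have hd' : (0 : ℝ) < d := by positivity
  have e1 := Nat.div_add_mod b d
  have e2 := Nat.div_add_mod a d
  have m1 := Nat.mod_lt b hd
  have m2 := Nat.mod_lt a hd
  have e1' : (d : ℝ) * (b / d : ℕ) + (b % d : ℕ) = b := mod_cast e1
  have e2' : (d : ℝ) * (a / d : ℕ) + (a % d : ℕ) = a := mod_cast e2
  have m1' : ((b % d : ℕ) : ℝ) < d := mod_cast m1
  have m2' : ((a % d : ℕ) : ℝ) < d := mod_cast m2
  rw [h2]
  have : ((b / d : ℕ) : ℝ) - (a / d : ℕ) - ((b : ℝ) - a) / d = ((a % d : ℕ) - (b % d : ℕ) : ℝ) / d := by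
    field_simp; rw [← e1', ← e2']; ring_nf
  rw [this, abs_div, abs_of_pos hd', div_le_one hd', abs_le]
  constructor <;> linarith

lemma abs_sieveB_le {R d : ℕ} (hd : d ∈ Icc 1 R) : |sieveB R d| ≤ (R : ℝ) ^ 2 := by
  have hdR : (d : ℝ) ≤ R := mod_cast (mem_Icc.1 hd).2
  unfold sieveB; rw [abs_mul, Nat.abs_cast, sq]
  apply mul_le_mul hdR _ (abs_nonneg _) (by positivity)
  refine (abs_sum_le_sum_abs _ _).trans ?_
  have : ∀ q ∈ Icc 1 R, |(if d ∣ q then (moebius (q / d) : ℝ) else 0) *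
    ((moebius q : ℝ) / (Nat.totient q : ℝ))| ≤ 1 := by
    intro q hq
    have ht : (1 : ℝ) ≤ Nat.totient q := mod_cast Nat.totient_pos.2 (mem_Icc.1 hq).1
    have hm : ∀ n : ℕ, |(moebius n : ℝ)| ≤ 1 := by
      intro n; exact_mod_cast ArithmeticFunction.abs_moebius_le_one (n := n)
    rw [abs_mul, abs_div, Nat.abs_cast]
    have h1 : |(if d ∣ q then (moebius (q / d) : ℝ) else 0)| ≤ 1 := by
      split_ifs
      · exact hm _
      · simp
    have h2 : |(moebius q : ℝ)| / (Nat.totient q : ℝ) ≤ 1 :=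
      (div_le_one (by linarith)).2 ((hm q).trans ht)
    exact mul_le_one₀ h1 (by positivity) h2
  refine (sum_le_sum this).trans ?_; simp

/-- Upper bound for the number of integers in `(a, b]` without divisors in `[2, R]`. -/
theorem sieve_Ioc (R a b : ℕ) (hR : 1 ≤ R) (hab : a ≤ b) (s : Finset ℕ) (hs : s ⊆ Ioc a b)
    (hcop : ∀ n ∈ s, ∀ d ∈ Icc 1 R, d ∣ n → d = 1) :
    (s.card : ℝ) ≤ ((b : ℝ) - a) / sieveG R + (R : ℝ) ^ 6 := by
  set f : ℕ → ℝ := fun n => ∑ d ∈ Icc 1 R, if d ∣ n then sieveB R d else 0 with hf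
  have hG1 : 1 ≤ sieveG R := by
    unfold sieveG
    have := single_le_sum (f := fun q : ℕ => (moebius q : ℝ) ^ 2 / (Nat.totient q : ℝ))
      (fun q _ => by positivity) (mem_Icc.2 ⟨le_rfl, hR⟩)
    simpa using this
  have hB1 : sieveB R 1 = sieveG R := by
    unfold sieveB sieveG; simp only [Nat.cast_one, one_mul, one_dvd, if_true, Nat.div_one]
    refine sum_congr rfl fun q _ => by ring
  have hfs : ∀ n ∈ s, f n = sieveG R := by
    intro n hn; rw [hf, ← hB1]; simp only; rw [sum_eq_single 1]
    · simp
    · intro d hd hd1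
      rw [if_neg]; intro h; exact hd1 (hcop n hn d hd h)
    · intro h; exact absurd (mem_Icc.2 ⟨le_rfl, hR⟩) h
  have hsum : ∑ n ∈ Ioc a b, f n ^ 2 ≤ ((b : ℝ) - a) * sieveG R + (R : ℝ) ^ 6 := by
    have h1 : ∑ n ∈ Ioc a b, f n ^ 2 = ∑ d ∈ Icc 1 R, ∑ d' ∈ Icc 1 R,
        sieveB R d * sieveB R d' * (((Ioc a b).filter (fun n => Nat.lcm d d' ∣ n)).card : ℝ) := by
      have : ∀ n, f n ^ 2 = ∑ d ∈ Icc 1 R, ∑ d' ∈ Icc 1 R, sieveB R d * sieveB R d' *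
          (if Nat.lcm d d' ∣ n then 1 else 0) := by
        intro n; rw [sq, hf]; simp only; rw [sum_mul_sum]
        refine sum_congr rfl fun d _ => sum_congr rfl fun d' _ => ?_
        have h := Nat.lcm_dvd_iff (k := n) (m := d) (n := d')
        split_ifs <;> simp_all
      simp_rw [this]
      rw [sum_comm]; refine sum_congr rfl fun d _ => ?_
      rw [sum_comm]; refine sum_congr rfl fun d' _ => ?_
      rw [← mul_sum, sum_boole]
    rw [h1, ← sieve_quadratic, mul_sum]
    have h2 : ∀ d ∈ Icc 1 R, ∀ d' ∈ Icc 1 R,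
        sieveB R d * sieveB R d' * (((Ioc a b).filter (fun n => Nat.lcm d d' ∣ n)).card : ℝ) ≤
        ((b : ℝ) - a) * (sieveB R d * sieveB R d' / (Nat.lcm d d' : ℝ)) + (R : ℝ) ^ 4 := by
      intro d hd d' hd'
      have hl := Nat.lcm_pos (mem_Icc.1 hd).1 (mem_Icc.1 hd').1
      have h3 := card_multiples_Ioc a b _ hab hl
      have h4 : |sieveB R d * sieveB R d' *
          ((((Ioc a b).filter (fun n => Nat.lcm d d' ∣ n)).card : ℝ) -
            ((b : ℝ) - a) / (Nat.lcm d d' : ℕ))| ≤ (R : ℝ) ^ 2 * (R : ℝ) ^ 2 * 1 := by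
        rw [abs_mul, abs_mul]; gcongr
        · exact abs_sieveB_le hd
        · exact abs_sieveB_le hd'
      have h5 := (abs_le.1 h4).2
      have e : sieveB R d * sieveB R d' *
          ((((Ioc a b).filter (fun n => Nat.lcm d d' ∣ n)).card : ℝ) -
            ((b : ℝ) - a) / (Nat.lcm d d' : ℕ)) = sieveB R d * sieveB R d' *
          (((Ioc a b).filter (fun n => Nat.lcm d d' ∣ n)).card : ℝ) -
            ((b : ℝ) - a) * (sieveB R d * sieveB R d' / (Nat.lcm d d' : ℝ)) := by ring
      rw [e] at h5; linarith [h5, show (R : ℝ) ^ 2 * (R : ℝ) ^ 2 * 1 = (R : ℝ) ^ 4 by ring]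
    refine (sum_le_sum fun d hd => sum_le_sum (h2 d hd)).trans ?_
    simp_rw [sum_add_distrib, ← mul_sum]
    simp only [sum_const, Nat.card_Icc, add_tsub_cancel_right, nsmul_eq_mul]
    exact le_of_eq (by ring)
  have hle : (s.card : ℝ) * sieveG R ^ 2 ≤ ((b : ℝ) - a) * sieveG R + (R : ℝ) ^ 6 := by
    refine le_trans ?_ hsum
    refine le_trans ?_ (sum_le_sum_of_subset_of_nonneg hs fun n _ _ => sq_nonneg _)
    rw [sum_congr rfl fun n hn => by rw [hfs n hn]]
    simp
  have hR6 : (R : ℝ) ^ 6 / sieveG R ^ 2 ≤ (R : ℝ) ^ 6 :=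
    div_le_self (by positivity) (by nlinarith)
  have : (s.card : ℝ) ≤ (((b : ℝ) - a) * sieveG R + (R : ℝ) ^ 6) / sieveG R ^ 2 := by
    rw [le_div_iff₀ (by positivity)]; exact hle
  refine this.trans ?_; rw [add_div]
  have h6 : ((b : ℝ) - a) * sieveG R / sieveG R ^ 2 = ((b : ℝ) - a) / sieveG R := by field_simp
  rw [h6]; linarith

/-- `∑_{n ≤ R} 1/n ≤ 2 G(R)`. -/
theorem sieveG_ge (R : ℕ) (hR : 1 ≤ R) : log R / 2 ≤ sieveG R := by
  have hsq : ∑ q ∈ (Icc 1 R).filter Squarefree, (1 : ℝ) / q ≤ sieveG R := by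
    unfold sieveG; rw [sum_filter]; refine sum_le_sum fun q hq => ?_
    have hq1 := (mem_Icc.1 hq).1
    have ht : (0 : ℝ) < Nat.totient q := mod_cast Nat.totient_pos.2 hq1
    split_ifs with h
    · have : (moebius q : ℝ) ^ 2 = 1 := by
        exact_mod_cast ArithmeticFunction.moebius_sq_eq_one_of_squarefree h
      rw [this]; exact one_div_le_one_div_of_le ht (mod_cast Nat.totient_le q)
    · positivity
  have hharm : log R ≤ ∑ n ∈ Icc 1 R, (1 : ℝ) / n := by
    have h1 := log_add_one_le_harmonic R
    have h2 : log R ≤ log (R + 1) :=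
      log_le_log (by positivity) (by linarith)
    rw [harmonic_eq_sum_Icc] at h1; push_cast at h1; simp only [one_div]; linarith
  have hprod : ∑ n ∈ Icc 1 R, (1 : ℝ) / n ≤
      (∑ q ∈ (Icc 1 R).filter Squarefree, (1 : ℝ) / q) * ∑ k ∈ Icc 1 R, (1 : ℝ) / (k : ℝ) ^ 2 := by
    rw [sum_mul_sum, ← sum_product']
    have hex : ∀ n : ℕ, ∃ x : ℕ × ℕ, n ∈ Icc 1 R →
        x.1 ∈ (Icc 1 R).filter Squarefree ∧ x.2 ∈ Icc 1 R ∧ x.2 ^ 2 * x.1 = n := by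
      intro n
      by_cases hn : n ∈ Icc 1 R
      · obtain ⟨a, b, h, hsf⟩ := Nat.sq_mul_squarefree n
        have hn' := mem_Icc.1 hn
        have ha : 0 < a := Nat.pos_of_ne_zero (by rintro rfl; simp at h; omega)
        have hb : 0 < b := Nat.pos_of_ne_zero (by rintro rfl; simp at h; omega)
        refine ⟨(a, b), fun _ => ⟨mem_filter.2 ⟨mem_Icc.2 ⟨ha, ?_⟩, hsf⟩, mem_Icc.2 ⟨hb, ?_⟩, h⟩⟩
        · have : a ≤ b ^ 2 * a := Nat.le_mul_of_pos_left _ (by positivity)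
          omega
        · have : b ≤ b ^ 2 * a := by nlinarith
          omega
      · exact ⟨(0, 0), fun h => absurd h hn⟩
    choose g hg using hex
    have hinj : Set.InjOn g (Icc 1 R : Finset ℕ) := by
      intro a ha b hb hab; rw [← (hg a ha).2.2, ← (hg b hb).2.2, hab]
    calc ∑ n ∈ Icc 1 R, (1 : ℝ) / n
        = ∑ x ∈ (Icc 1 R).image g, (1 : ℝ) / x.1 * (1 / (x.2 : ℝ) ^ 2) := by
          rw [sum_image hinj]; refine sum_congr rfl fun n hn => ?_
          have h := (hg n hn).2.2
          have h' : ((g n).2 : ℝ) ^ 2 * (g n).1 = n := mod_cast h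
          rw [← h']; rw [one_div_mul_one_div]; ring_nf
      _ ≤ _ := by
          apply sum_le_sum_of_subset_of_nonneg
          · intro x hx
            obtain ⟨n, hn, rfl⟩ := mem_image.1 hx
            exact mem_product.2 ⟨(hg n hn).1, (hg n hn).2.1⟩
          · intro x _ _; positivity
  have hk : ∑ k ∈ Icc 1 R, (1 : ℝ) / (k : ℝ) ^ 2 ≤ 2 := by
    have : ∀ R : ℕ, 1 ≤ R → ∑ k ∈ Icc 1 R, (1 : ℝ) / (k : ℝ) ^ 2 ≤ 2 - 1 / R := by
      intro R hR
      induction R, hR using Nat.le_induction with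
      | base => norm_num
      | succ n hn ih =>
        rw [sum_Icc_succ_top (by omega)]
        have hn0 : (0 : ℝ) < n := mod_cast hn
        have : (1 : ℝ) / ((n + 1 : ℕ) : ℝ) ^ 2 ≤ 1 / n - 1 / ((n + 1 : ℕ) : ℝ) := by
          push_cast
          rw [div_sub_div _ _ hn0.ne' (by positivity), div_le_div_iff₀ (by positivity) (by positivity)]
          nlinarith
        linarith
    have h := this R hR
    have : (0 : ℝ) ≤ 1 / R := by positivity
    linarith
  have h0 : 0 ≤ ∑ q ∈ (Icc 1 R).filter Squarefree, (1 : ℝ) / q :=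
    sum_nonneg fun q _ => by positivity
  nlinarith

/-! ### Primes in a dyadic-type block -/

/-- Primes in `(z/8, z]`. -/
def blk (z : ℝ) : Finset ℕ := (Iic ⌊z⌋₊).filter (fun p => p.Prime ∧ z / 8 < (p : ℝ))

lemma mem_blk (hz : 0 ≤ z) {p : ℕ} :
    p ∈ blk z ↔ p.Prime ∧ z / 8 < (p : ℝ) ∧ (p : ℝ) ≤ z := by
  unfold blk; rw [mem_filter, mem_Iic, Nat.le_floor_iff hz]
  tauto

lemma theta_blk (hz : 0 ≤ z) :
    ∑ p ∈ blk z, log p = theta z - theta (z / 8) := by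
  have h : theta z = ∑ p ∈ blk z, log p + theta (z / 8) := by
    unfold theta; rw [← sum_union]
    · refine sum_congr ?_ fun _ _ => rfl
      ext p
      simp only [mem_union, mem_blk hz, mem_filter, mem_Ioc, Nat.le_floor_iff hz,
        Nat.le_floor_iff (show 0 ≤ z / 8 by positivity)]
      constructor
      · rintro ⟨⟨h1, h2⟩, h3⟩
        by_cases h : z / 8 < p
        · exact Or.inl ⟨h3, h, h2⟩
        · exact Or.inr ⟨⟨h1, not_lt.1 h⟩, h3⟩
      · rintro (⟨h1, h2, h3⟩ | ⟨⟨h1, h2⟩, h3⟩)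
        · exact ⟨⟨h1.pos, h3⟩, h1⟩
        · exact ⟨⟨h1, by linarith⟩, h3⟩
    · rw [disjoint_left]
      intro p hp hp'; rw [mem_blk hz] at hp
      simp only [mem_filter, mem_Ioc, Nat.le_floor_iff (show 0 ≤ z / 8 by positivity)] at hp'
      linarith [hp.2.1, hp'.1.2]
  linarith

lemma eventually_log_le_rpow (c r : ℝ) (hc : 0 < c) (hr : 0 < r) :
    ∀ᶠ z : ℝ in atTop, log z ≤ c * z ^ r := by
  filter_upwards [(isLittleO_log_rpow_atTop hr).bound hc, eventually_ge_atTop 1] with z h h1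
  rw [norm_of_nonneg (log_nonneg h1), norm_of_nonneg (Real.rpow_nonneg (by linarith) _)] at h
  exact h

lemma eventually_const_le_rpow (c r : ℝ) (hr : 0 < r) :
    ∀ᶠ z : ℝ in atTop, c ≤ z ^ r :=
  (tendsto_rpow_atTop hr).eventually_ge_atTop c

lemma eventually_blk_card :
    ∀ᶠ z : ℝ in atTop, (2 / 5) * z / log z ≤ (blk z).card := by
  have e1 := eventually_log_le_rpow (1 / 100) (1 / 4) (by norm_num) (by norm_num)
  filter_upwards [e1, eventually_ge_atTop 100000] with z h1 h2
  have hz : 0 ≤ z := by linarith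
  have hlog : 0 < log z := log_pos (by linarith)
  have hle : ∑ p ∈ blk z, log p ≤ (blk z).card * log z := by
    rw [← nsmul_eq_mul]; refine sum_le_card_nsmul _ _ _ fun p hp => ?_
    rw [mem_blk hz] at hp; exact log_le_log (mod_cast hp.1.pos) hp.2.2
  rw [theta_blk hz] at hle
  have t1 := Chebyshev.theta_ge' (x := z) (by linarith)
  have t2 := theta_le_log4_mul_x (x := z / 8) (by linarith)
  have l4 : log 4 = 2 * log 2 := by rw [show (4 : ℝ) = 2 ^ 2 by norm_num, log_pow]; norm_num
  have l2 := log_two_gt_d9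
  have l2' := log_two_lt_d9
  have hs : √z * log z ≤ z / 100 := by
    have : √z * z ^ ((1 : ℝ) / 4) ≤ z := by
      rw [sqrt_eq_rpow, ← rpow_add (by linarith)]
      calc z ^ ((1 : ℝ) / 2 + 1 / 4) ≤ z ^ (1 : ℝ) :=
            rpow_le_rpow_of_exponent_le (by linarith) (by norm_num)
        _ = z := rpow_one z
    have h0 := Real.sqrt_nonneg z
    nlinarith
  have hl3 : log (z + 2) ≤ z / 100 := by
    have h3 : log (z + 2) ≤ log (z ^ 2) :=
      log_le_log (by linarith) (by nlinarith)
    rw [log_pow] at h3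
    have hs1 : 100 ≤ √z := by
      rw [show (100 : ℝ) = √(10000) by rw [show (10000 : ℝ) = 100 ^ 2 by norm_num]; simp]
      exact Real.sqrt_le_sqrt (by linarith)
    push_cast at h3; nlinarith
  rw [div_le_iff₀ hlog]; rw [l4] at t2; nlinarith

/-- Brun–Titchmarsh type bound for short intervals inside `(z/8, z]`. -/
lemma eventually_primes_short :
    ∀ᶠ z : ℝ in atTop, ∀ lo hi : ℝ, 0 ≤ lo → lo ≤ hi →
      (((blk z).filter (fun p : ℕ => lo ≤ (p : ℝ) ∧ (p : ℝ) ≤ hi)).card : ℝ) ≤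
        (hi - lo + 1) * (400 / log z) + z ^ (0.06 : ℝ) := by
  filter_upwards [eventually_ge_atTop 1000, eventually_const_le_rpow 2 (1 / 200) (by norm_num),
    eventually_const_le_rpow 8 (0.99) (by norm_num)] with z h1 h2 h3 lo hi hlo hlh
  have hz : 0 < z := by linarith
  have hlog : 0 < log z := log_pos (by linarith)
  set R := ⌊z ^ (0.01 : ℝ)⌋₊ with hR
  have hz01 : 4 ≤ z ^ (0.01 : ℝ) := by
    have : z ^ (0.01 : ℝ) = (z ^ ((1 : ℝ) / 200)) ^ 2 := by
      rw [← rpow_natCast, ← rpow_mul hz.le]; norm_num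
    rw [this]; nlinarith
  have hRle : (R : ℝ) ≤ z ^ (0.01 : ℝ) := Nat.floor_le (by positivity)
  have hRge : z ^ ((1 : ℝ) / 200) ≤ R := by
    have h4 := (Nat.sub_one_lt_floor (z ^ (0.01 : ℝ)))
    have : z ^ (0.01 : ℝ) = (z ^ ((1 : ℝ) / 200)) ^ 2 := by
      rw [← rpow_natCast, ← rpow_mul hz.le]; norm_num
    rw [← hR] at h4; rw [this] at h4; nlinarith
  have hR1 : 1 ≤ R := by
    have : (1 : ℝ) ≤ R := by linarith
    exact_mod_cast this
  have hG := sieveG_ge R hR1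
  have hlogR : log z / 200 ≤ log R := by
    have := log_le_log (by positivity) hRge
    rw [log_rpow hz] at this; linarith
  have hGpos : log z / 400 ≤ sieveG R := by linarith
  have hab : ⌈lo⌉₊ - 1 ≤ ⌊hi⌋₊ := by
    have h5 : ⌈lo⌉₊ ≤ ⌊hi⌋₊ + 1 := by
      refine Nat.ceil_le.2 ?_; push_cast
      have := Nat.lt_floor_add_one hi
      linarith
    omega
  have hs := sieve_Ioc R (⌈lo⌉₊ - 1) ⌊hi⌋₊ hR1 hab
    ((blk z).filter (fun p : ℕ => lo ≤ (p : ℝ) ∧ (p : ℝ) ≤ hi)) ?_ ?_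
  · refine hs.trans ?_
    have h6 : ((⌊hi⌋₊ : ℕ) : ℝ) - ((⌈lo⌉₊ - 1 : ℕ) : ℝ) ≤ hi - lo + 1 := by
      have h7 : ((⌊hi⌋₊ : ℕ) : ℝ) ≤ hi := Nat.floor_le (by linarith)
      have h8 : lo ≤ (⌈lo⌉₊ : ℝ) := Nat.le_ceil lo
      have h9 : (⌈lo⌉₊ : ℝ) ≤ ((⌈lo⌉₊ - 1 : ℕ) : ℝ) + 1 := by
        exact_mod_cast (by omega : ⌈lo⌉₊ ≤ (⌈lo⌉₊ - 1) + 1)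
      linarith
    have hR6 : (R : ℝ) ^ 6 ≤ z ^ (0.06 : ℝ) := by
      calc (R : ℝ) ^ 6 ≤ (z ^ (0.01 : ℝ)) ^ 6 := by gcongr
        _ = z ^ (0.06 : ℝ) := by rw [← rpow_natCast, ← rpow_mul hz.le]; norm_num
    have h10 : (((⌊hi⌋₊ : ℕ) : ℝ) - ((⌈lo⌉₊ - 1 : ℕ) : ℝ)) / sieveG R ≤
        (hi - lo + 1) * (400 / log z) := by
      calc _ ≤ (hi - lo + 1) / sieveG R := by
            gcongr; exact le_trans (by positivity) hGpos
        _ ≤ (hi - lo + 1) / (log z / 400) := by gcongr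
        _ = _ := by field_simp
    linarith
  · intro p hp
    simp only [mem_filter, mem_blk hz.le] at hp; obtain ⟨⟨hp1, hp2, hp3⟩, hp4, hp5⟩ := hp
    rw [mem_Ioc]
    have h11 : ⌈lo⌉₊ ≤ p := Nat.ceil_le.2 hp4
    have := hp1.pos
    exact ⟨by omega, Nat.le_floor hp5⟩
  · intro p hp d hd hdp
    simp only [mem_filter, mem_blk hz.le] at hp; obtain ⟨⟨hp1, hp2, hp3⟩, hp4, hp5⟩ := hp
    rcases (Nat.dvd_prime hp1).1 hdp with h | h
    · exact h
    · exfalso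
      have hdR : (d : ℝ) ≤ R := mod_cast (mem_Icc.1 hd).2
      rw [h] at hdR
      have : z = z ^ (0.01 : ℝ) * z ^ (0.99 : ℝ) := by rw [← rpow_add hz]; norm_num
      have h12 : z / 8 ≥ z ^ (0.01 : ℝ) := by
        rw [ge_iff_le, le_div_iff₀ (by norm_num)]
        calc z ^ (0.01 : ℝ) * 8 ≤ z ^ (0.01 : ℝ) * z ^ (0.99 : ℝ) := by gcongr
          _ = z := this.symm
      linarith

lemma near_multiple_of_sin_small (x κ : ℝ) (h : |sin x| ≤ κ) :
    ∃ j : ℤ, |x - j * π| ≤ 2 * κ := by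
  have hpi := pi_pos
  refine ⟨round (x / π), ?_⟩; set j := round (x / π) with hj
  have h1 : |x - j * π| ≤ π / 2 := by
    have := abs_sub_round (x / π)
    have e : x - j * π = (x / π - j) * π := by field_simp
    rw [e, abs_mul, abs_of_pos hpi]; nlinarith
  have h2 : |sin (x - j * π)| = |sin x| := by
    rw [Real.sin_sub_int_mul_pi, abs_mul, abs_zpow, abs_neg, abs_one, one_zpow, one_mul]
  have h3 := Real.mul_abs_le_abs_sin h1
  rw [h2] at h3
  have h4 : π < 4 := by linarith [Real.pi_lt_d2]
  have h5 : 2 / π ≥ 1 / 2 := by rw [ge_iff_le, div_le_div_iff₀ (by norm_num) hpi]; linarith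
  nlinarith [abs_nonneg (x - j * π)]

/-- For `1/10 ≤ t ≤ z^{0.6}` a positive proportion of the primes in the block have
`sin (t log p / 2)` bounded away from zero. -/
lemma eventually_blk_sin :
    ∀ᶠ z : ℝ in atTop, ∀ t : ℝ, 1 / 10 ≤ t → t ≤ z ^ (0.6 : ℝ) → (1 / 5) * z / log z ≤
        ((blk z).filter (fun p : ℕ => 1 / 10 ^ 9 ≤ |sin (t * log p / 2)|)).card := by
  filter_upwards [eventually_blk_card, eventually_primes_short, eventually_ge_atTop 1000,
    eventually_log_le_rpow (1 / 10 ^ 6) (0.3) (by norm_num) (by norm_num)]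
    with z hcard hshort h1 hlz t ht1 ht2
  have hz : 0 < z := by linarith
  have hlog : 0 < log z := log_pos (by linarith)
  set κ : ℝ := 1 / 10 ^ 9 with hκ
  set good := (blk z).filter (fun p : ℕ => κ ≤ |sin (t * log p / 2)|) with hgood
  set bad := (blk z).filter (fun p : ℕ => ¬ κ ≤ |sin (t * log p / 2)|) with hbad
  have hsplit : good.card + bad.card = (blk z).card := card_filter_add_card_filter_not _
  -- indices
  set a : ℤ := ⌊t * log (z / 8) / (2 * π) - 1⌋ with ha
  set b : ℤ := ⌈t * log z / (2 * π) + 1⌉ with hb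
  have hpi3 := pi_gt_three
  have hsub : bad ⊆ (Icc a b).biUnion (fun j => (blk z).filter (fun p : ℕ =>
      rexp (2 * π * j / t) * rexp (-(4 * κ / t)) ≤ (p : ℝ) ∧
      (p : ℝ) ≤ min z (rexp (2 * π * j / t) * rexp (4 * κ / t)))) := by
    intro p hp; rw [hbad, mem_filter, not_le] at hp; obtain ⟨hp1, hp2⟩ := hp
    obtain ⟨j, hj⟩ := near_multiple_of_sin_small _ _ hp2.le
    have hp3 := (mem_blk hz.le).1 hp1
    have hp0 : (0 : ℝ) < p := mod_cast hp3.1.pos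
    have hlz1 : log (z / 8) ≤ log p := log_le_log (by positivity) hp3.2.1.le
    have hlz2 : log p ≤ log z := log_le_log hp0 hp3.2.2
    rw [abs_le] at hj; obtain ⟨hj1, hj2⟩ := hj
    have ht0 : 0 < t := by linarith
    have hmul1 := mul_le_mul_of_nonneg_left hlz1 ht0.le
    have hmul2 := mul_le_mul_of_nonneg_left hlz2 ht0.le
    rw [mem_biUnion]; refine ⟨j, mem_Icc.2 ⟨?_, ?_⟩, mem_filter.2 ⟨hp1, ?_, le_min hp3.2.2 ?_⟩⟩
    · have : (a : ℝ) ≤ t * log (z / 8) / (2 * π) - 1 := Int.floor_le _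
      have h2 : t * log (z / 8) / (2 * π) - 1 ≤ j := by
        rw [sub_le_iff_le_add, div_le_iff₀ (by positivity)]
        nlinarith
      exact_mod_cast this.trans h2
    · have : t * log z / (2 * π) + 1 ≤ (b : ℝ) := Int.le_ceil _
      have h2 : (j : ℝ) ≤ t * log z / (2 * π) + 1 := by
        rw [← sub_le_iff_le_add, le_div_iff₀ (by positivity)]
        nlinarith
      exact_mod_cast h2.trans this
    · rw [← Real.exp_add, ← le_log_iff_exp_le hp0]
      rw [← sub_eq_add_neg, ← sub_div, div_le_iff₀ ht0, mul_comm (log _) t]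
      clear_value κ
      linarith only [hj1]
    · rw [← Real.exp_add, ← Real.log_le_iff_le_exp hp0]
      rw [← add_div, le_div_iff₀ ht0, mul_comm (log _) t]
      clear_value κ
      linarith only [hj2]
  have ht0 : 0 < t := by linarith
  have hbound : ∀ j ∈ Icc a b, (((blk z).filter (fun p : ℕ =>
      rexp (2 * π * j / t) * rexp (-(4 * κ / t)) ≤ (p : ℝ) ∧
      (p : ℝ) ≤ min z (rexp (2 * π * j / t) * rexp (4 * κ / t)))).card : ℝ) ≤
      (16 * κ * z / t + 1) * (400 / log z) + z ^ (0.06 : ℝ) := by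
    intro j _; set E := rexp (2 * π * j / t)
    set d := 4 * κ / t with hd
    have hd0 : 0 < d := by positivity
    have hd1 : d ≤ 1 / 4 := by rw [hd, hκ, div_le_iff₀ ht0]; norm_num at ht1 ⊢; linarith
    by_cases hcase : E * rexp (-d) ≤ min z (E * rexp d)
    · refine (hshort _ _ (by positivity) hcase).trans ?_
      have : min z (E * rexp d) - E * rexp (-d) ≤ 16 * κ * z / t := by
        have hEz : E * rexp (-d) ≤ z := hcase.trans (min_le_left _ _)
        have e1 : E * rexp d = E * rexp (-d) * rexp (2 * d) := by
          rw [mul_assoc, ← Real.exp_add (-d) (2 * d)]; congr 2; ring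
        have e2 : rexp (2 * d) ≤ 1 + 4 * d := by
          have := Real.abs_exp_sub_one_le (x := 2 * d) (by rw [abs_of_pos (by positivity)]; linarith)
          rw [abs_of_pos (show 0 < 2 * d by positivity)] at this
          linarith [(abs_le.1 this).2]
        have e3 : 16 * κ * z / t = 4 * d * z := by rw [hd]; field_simp; ring
        rw [e3]
        have e4 : 0 < E * rexp (-d) := by positivity
        have := min_le_right z (E * rexp d)
        rw [e1] at this ⊢; nlinarith
      gcongr
    · rw [filter_false_of_mem]
      · simp only [card_empty, Nat.cast_zero]; positivity
      · rintro p _ ⟨h2, h3⟩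
        exact hcase (h2.trans h3)
  have hnum : ((Icc a b).card : ℝ) ≤ 51 * t := by
    rw [Int.card_Icc]
    have hbl : (b : ℝ) ≤ t * log z / (2 * π) + 2 := by
      have := (Int.ceil_lt_add_one (t * log z / (2 * π) + 1)).le
      rw [← hb] at this; linarith
    have hal : t * log (z / 8) / (2 * π) - 2 ≤ a := by
      have := (Int.sub_one_lt_floor (t * log (z / 8) / (2 * π) - 1)).le
      rw [← ha] at this; linarith
    have h8 : log (z / 8) = log z - 3 * log 2 := by
      rw [log_div hz.ne' (by norm_num), show (8 : ℝ) = 2 ^ 3 by norm_num, log_pow]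
      norm_num
    have hl2 := log_two_lt_d9
    have hdiff : t * log z / (2 * π) - t * log (z / 8) / (2 * π) ≤ t := by
      rw [h8, ← sub_div, div_le_iff₀ (by positivity)]
      nlinarith
    have h5 : ((b + 1 - a : ℤ) : ℝ) ≤ 51 * t := by push_cast; linarith
    have h6 : (((b + 1 - a).toNat : ℤ) : ℝ) ≤ 51 * t := by
      rw [Int.toNat_eq_max]; push_cast; exact max_le (by push_cast at h5; linarith) (by positivity)
    exact_mod_cast h6
  have hbadle : (bad.card : ℝ) ≤ 51 * t *
      ((16 * κ * z / t + 1) * (400 / log z) + z ^ (0.06 : ℝ)) := by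
    have c1 : (bad.card : ℝ) ≤ ∑ j ∈ Icc a b, (((blk z).filter (fun p : ℕ =>
      rexp (2 * π * j / t) * rexp (-(4 * κ / t)) ≤ (p : ℝ) ∧
      (p : ℝ) ≤ min z (rexp (2 * π * j / t) * rexp (4 * κ / t)))).card : ℝ) := by
      exact_mod_cast (card_le_card hsub).trans card_biUnion_le
    refine c1.trans ((sum_le_card_nsmul _ _ _ hbound).trans ?_); rw [nsmul_eq_mul]; gcongr
  have hz66 : t * z ^ (0.06 : ℝ) ≤ z ^ (0.66 : ℝ) := by
    calc t * z ^ (0.06 : ℝ) ≤ z ^ (0.6 : ℝ) * z ^ (0.06 : ℝ) := by gcongr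
      _ = z ^ (0.66 : ℝ) := by rw [← rpow_add hz]; norm_num
  have hz96 : z ^ (0.66 : ℝ) * log z ≤ z / 10 ^ 6 := by
    calc z ^ (0.66 : ℝ) * log z ≤ z ^ (0.66 : ℝ) * (1 / 10 ^ 6 * z ^ (0.3 : ℝ)) := by gcongr
      _ = z ^ (0.96 : ℝ) / 10 ^ 6 := by rw [mul_left_comm, ← rpow_add hz]; norm_num; ring
      _ ≤ z ^ (1 : ℝ) / 10 ^ 6 := by
        gcongr
        · linarith
        · norm_num
      _ = z / 10 ^ 6 := by rw [rpow_one]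
  have htz : t ≤ z / 10 ^ 6 := by
    have h2 : t ≤ z ^ (0.66 : ℝ) := ht2.trans
      (rpow_le_rpow_of_exponent_le (by linarith) (by norm_num))
    have h3 : 1 ≤ log z := by rw [le_log_iff_exp_le hz]; linarith [exp_one_lt_d9]
    nlinarith
  have hfin : (bad.card : ℝ) ≤ (1 / 5) * z / log z := by
    refine hbadle.trans ?_; rw [le_div_iff₀ hlog]
    have e : 51 * t * ((16 * κ * z / t + 1) * (400 / log z) + z ^ (0.06 : ℝ)) * log z =
        326400 * κ * z + 20400 * t + 51 * (t * z ^ (0.06 : ℝ)) * log z := by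
      field_simp; ring
    rw [e]
    have h5 : (t * z ^ (0.06 : ℝ)) * log z ≤ z ^ (0.66 : ℝ) * log z := by gcongr
    rw [hκ]; nlinarith
  have hsplit' : (good.card : ℝ) + bad.card = (blk z).card := mod_cast hsplit
  have : (2 / 5) * z / log z = (1 / 5) * z / log z + (1 / 5) * z / log z := by ring
  linarith

/-! ### Sums over primes attached to the saddle point -/

lemma mem_primesLe (hy : 0 ≤ y) {p : ℕ} :
    p ∈ primesLe y ↔ p.Prime ∧ (p : ℝ) ≤ y := by
  unfold primesLe; rw [mem_filter, mem_Iic, Nat.le_floor_iff hy]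
  tauto

lemma two_le_of_mem_primesLe {p : ℕ} (hp : p ∈ primesLe y) : (2 : ℝ) ≤ p := by
  have := (mem_filter.1 hp).2.two_le
  exact_mod_cast this

lemma log_pos_of_mem_primesLe {p : ℕ} (hp : p ∈ primesLe y) : 0 < log p :=
  log_pos (by linarith [two_le_of_mem_primesLe hp])

lemma theta_eq_sum_primesLe (y : ℝ) : theta y = ∑ p ∈ primesLe y, log p := by
  unfold theta primesLe; refine sum_congr ?_ fun _ _ => rfl
  ext p; simp only [mem_filter, mem_Ioc, mem_Iic]
  exact ⟨fun h => ⟨h.1.2, h.2⟩, fun h => ⟨⟨h.2.pos, h.1⟩, h.2⟩⟩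

lemma primesLe_eq_union (hz : 0 ≤ z) : primesLe z = blk z ∪ primesLe (z / 8) := by
  ext p; rw [mem_union, mem_primesLe hz, mem_blk hz, mem_primesLe (by positivity)]
  constructor
  · rintro ⟨h1, h2⟩
    by_cases h : z / 8 < p
    · exact Or.inl ⟨h1, h, h2⟩
    · exact Or.inr ⟨h1, not_lt.1 h⟩
  · rintro (⟨h1, _, h3⟩ | ⟨h1, h2⟩)
    · exact ⟨h1, h3⟩
    · exact ⟨h1, by linarith⟩

lemma sum_primesLe_blocks (hy : 0 ≤ y) (f : ℕ → ℝ) (n : ℕ) :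
    ∑ p ∈ primesLe y, f p =
      ∑ i ∈ range n, ∑ p ∈ blk (y / 8 ^ i), f p + ∑ p ∈ primesLe (y / 8 ^ n), f p := by
  induction n with
  | zero => simp
  | succ n ih =>
    rw [ih, sum_range_succ, add_assoc]; congr 1
    have hz : 0 ≤ y / 8 ^ n := by positivity
    rw [primesLe_eq_union hz, sum_union, pow_succ, ← div_div]; rw [disjoint_left]; intro p hp hp'
    rw [mem_blk hz] at hp; rw [mem_primesLe (by positivity)] at hp'
    linarith [hp.2.1, hp'.2]

lemma sum_range_mul_le (g : ℕ → ℝ) (hg : Antitone g) (K m : ℕ) :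
    ∑ i ∈ range (m * K), g i ≤ m * ∑ i ∈ range K, g i := by
  induction m with
  | zero => simp
  | succ m ih =>
    rw [Nat.succ_mul, sum_range_add]; push_cast; rw [add_mul, one_mul]; gcongr with i _
    · exact hg (by omega)

/-- The number of blocks used. -/
def Kb (y : ℝ) : ℕ := ⌊log y / 40⌋₊

/-- The size of the contribution of a block. -/
def om (y α : ℝ) (i : ℕ) : ℝ := (y / 8 ^ i) ^ (1 - α) / log y

/-- The total size of the top blocks. -/
def Wb (y α : ℝ) : ℝ := ∑ i ∈ range (Kb y), om y α i

lemma om_pos (hy : 2 ≤ y) (i : ℕ) : 0 < om y α i := by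
  have : 0 < log y := log_pos (by linarith)
  have : 0 < y := by linarith
  unfold om; positivity

lemma pow_anti (hy : 2 ≤ y) (hα : α ≤ 1) :
    Antitone fun i : ℕ => (y / 8 ^ i) ^ (1 - α) := by
  intro i j hij; apply Real.rpow_le_rpow (by positivity) _ (by linarith)
  gcongr; norm_num

lemma om_anti (hy : 2 ≤ y) (hα : α ≤ 1) : Antitone (om y α) := by
  intro i j hij
  have : 0 < log y := log_pos (by linarith)
  exact div_le_div_of_nonneg_right (pow_anti hy hα hij) this.le

lemma log_eight : log 8 = 3 * log 2 := by
  rw [show (8 : ℝ) = 2 ^ 3 by norm_num, log_pow]; norm_num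

lemma log_block (hy : 2 ≤ y) (i : ℕ) :
    log (y / 8 ^ i) = log y - i * (3 * log 2) := by
  rw [log_div (by linarith) (by positivity), log_pow, log_eight]

lemma om_eq (hy : 2 ≤ y) (i : ℕ) :
    om y α i = rexp ((1 - α) * (log y - i * (3 * log 2))) / log y := by
  unfold om; rw [Real.rpow_def_of_pos (by positivity), log_block hy, mul_comm]

lemma eventually_Kb : ∀ᶠ y : ℝ in atTop,
    log y / 80 ≤ Kb y ∧ (Kb y : ℝ) ≤ log y / 40 ∧ 100 ≤ Kb y := by
  filter_upwards [Real.tendsto_log_atTop.eventually_ge_atTop 8000] with y hy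
  unfold Kb
  have h1 := Nat.floor_le (show 0 ≤ log y / 40 by linarith)
  have h2 := Nat.sub_one_lt_floor (log y / 40)
  refine ⟨by linarith, h1, Nat.le_floor ?_⟩
  push_cast; linarith

lemma block_ge (hy : 2 ≤ y) {i : ℕ} (hi : (i : ℝ) ≤ log y / 40) :
    y ^ (0.9 : ℝ) ≤ y / 8 ^ i := by
  have hy0 : 0 < y := by linarith
  have hl : 0 < log y := log_pos (by linarith)
  rw [← Real.log_le_log_iff (by positivity) (by positivity), log_rpow hy0, log_block hy]
  nlinarith [log_two_lt_d9, log_two_gt_d9]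

/-- Chebyshev upper bound for `∑ log p / p^α`. -/
lemma eventually_sum_log_le : ∀ᶠ y : ℝ in atTop, ∀ α : ℝ, 0 ≤ α → α ≤ 1 →
    ∑ p ∈ primesLe y, log p * (p : ℝ) ^ (-α) ≤ 960 * (log y * Wb y α) := by
  filter_upwards [eventually_Kb, eventually_ge_atTop 2] with y hK hy α hα0 hα1
  have hy0 : 0 < y := by linarith
  have hl : 0 < log y := log_pos (by linarith)
  rw [sum_primesLe_blocks hy0.le _ (80 * Kb y)]
  have hempty : primesLe (y / 8 ^ (80 * Kb y)) = ∅ := by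
    apply eq_empty_of_forall_notMem; intro p hp
    have h2 := two_le_of_mem_primesLe hp
    have h3 := ((mem_primesLe (by positivity)).1 hp).2
    have h4 : log 1 ≤ log (y / 8 ^ (80 * Kb y)) :=
      log_le_log one_pos (by linarith)
    rw [log_block hy, Real.log_one] at h4; push_cast at h4; nlinarith [log_two_gt_d9, hK.1]
  rw [hempty, sum_empty, add_zero]
  have hblock : ∀ i : ℕ, ∑ p ∈ blk (y / 8 ^ i), log p * (p : ℝ) ^ (-α) ≤
      12 * (y / 8 ^ i) ^ (1 - α) := by
    intro i; set z := y / 8 ^ i with hz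
    have hz0 : 0 < z := by positivity
    have h1 : ∀ p ∈ blk z, log p * (p : ℝ) ^ (-α) ≤ log p * (8 * z ^ (-α)) := by
      intro p hp; rw [mem_blk hz0.le] at hp; gcongr
      calc (p : ℝ) ^ (-α) ≤ (z / 8) ^ (-α) :=
            Real.rpow_le_rpow_of_nonpos (by positivity) hp.2.1.le (by linarith)
        _ = 8 ^ α * z ^ (-α) := by
            rw [Real.div_rpow hz0.le (by norm_num), rpow_neg (by norm_num : (0:ℝ) ≤ 8)]
            field_simp
        _ ≤ 8 * z ^ (-α) := by
            gcongr
            calc (8 : ℝ) ^ α ≤ 8 ^ (1 : ℝ) := rpow_le_rpow_of_exponent_le (by norm_num) hα1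
              _ = 8 := rpow_one 8
    refine (sum_le_sum h1).trans ?_; rw [← sum_mul, theta_blk hz0.le]
    have t1 := theta_le_log4_mul_x hz0.le
    have t2 := Chebyshev.theta_nonneg (z / 8)
    have l4 : log 4 = 2 * log 2 := by rw [show (4 : ℝ) = 2 ^ 2 by norm_num, log_pow]; norm_num
    have l2 := log_two_lt_d9
    have e : z ^ (1 - α) = z * z ^ (-α) := by rw [sub_eq_add_neg, rpow_add hz0, rpow_one]
    rw [e]
    have : 0 < z ^ (-α) := by positivity
    have h3 : theta z - theta (z / 8) ≤ 1.4 * z := by nlinarith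
    calc _ ≤ 1.4 * z * (8 * z ^ (-α)) := by gcongr
      _ ≤ _ := by nlinarith [mul_pos hz0 this]
  refine (sum_le_sum fun i _ => hblock i).trans ?_
  rw [← mul_sum]
  have h5 := sum_range_mul_le _ (pow_anti (α := α) hy hα1) (Kb y) 80
  have h6 : log y * Wb y α = ∑ i ∈ range (Kb y), (y / 8 ^ i) ^ (1 - α) := by
    unfold Wb om; rw [← sum_div]; field_simp
  rw [h6]; push_cast at h5; linarith

lemma sum_rpow_le (hy : 2 ≤ y) (hα : 0 ≤ α) :
    ∑ p ∈ primesLe y, (p : ℝ) ^ (-α) ≤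
      √y + 2 / log y * ∑ p ∈ primesLe y, log p * (p : ℝ) ^ (-α) := by
  have hy0 : 0 < y := by linarith
  have hl : 0 < log y := log_pos (by linarith)
  rw [mul_sum]
  have h1 : ∀ p ∈ primesLe y, (p : ℝ) ^ (-α) ≤ (if (p : ℝ) ≤ √y then 1 else 0) +
      2 / log y * (log p * (p : ℝ) ^ (-α)) := by
    intro p hp
    have hp2 := two_le_of_mem_primesLe hp
    have hlp := log_pos_of_mem_primesLe hp
    split_ifs with h
    · have : (p : ℝ) ^ (-α) ≤ 1 := Real.rpow_le_one_of_one_le_of_nonpos (by linarith) (by linarith)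
      have : 0 ≤ 2 / log y * (log p * (p : ℝ) ^ (-α)) := by positivity
      linarith
    · push Not at h
      have h3 : log (√y) ≤ log p := log_le_log (by positivity) h.le
      rw [Real.log_sqrt hy0.le] at h3
      have h4 : 1 ≤ 2 / log y * log p := by rw [div_mul_eq_mul_div, le_div_iff₀ hl]; linarith
      have h5 : 0 ≤ (p : ℝ) ^ (-α) := by positivity
      rw [← mul_assoc, zero_add]; nlinarith
  refine (sum_le_sum h1).trans ?_; rw [sum_add_distrib]; gcongr; rw [sum_boole]
  have : (primesLe y).filter (fun p : ℕ => (p : ℝ) ≤ √y) ⊆ Icc 1 ⌊√y⌋₊ := by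
    intro p hp; rw [mem_filter] at hp
    have hp2 := two_le_of_mem_primesLe hp.1
    rw [mem_Icc]; exact ⟨mod_cast (by linarith : (1 : ℝ) ≤ p), Nat.le_floor hp.2⟩
  calc _ ≤ ((Icc 1 ⌊√y⌋₊).card : ℝ) := mod_cast card_le_card this
    _ = (⌊√y⌋₊ : ℝ) := by simp
    _ ≤ √y := Nat.floor_le (by positivity)

lemma inv_one_sub_exp_le {s : ℝ} (hs : 0 < s) : 1 / (1 - rexp (-s)) ≤ 1 + 1 / s := by
  have h1 : rexp (-s) ≤ 1 / (1 + s) := by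
    rw [Real.exp_neg, ← one_div]
    exact one_div_le_one_div_of_le (by linarith) (by linarith [add_one_le_exp s])
  have h2 : s / (1 + s) ≤ 1 - rexp (-s) := by
    have : s / (1 + s) = 1 - 1 / (1 + s) := by field_simp; ring
    linarith
  calc 1 / (1 - rexp (-s)) ≤ 1 / (s / (1 + s)) := by gcongr
    _ = 1 + 1 / s := by field_simp; ring

lemma rpow_neg_eq_exp {p : ℝ} (hp : 0 < p) : p ^ (-α) = rexp (-(α * log p)) := by
  rw [Real.rpow_def_of_pos hp]; congr 1; ring

lemma saddle_term_eq {p : ℝ} (hp : 1 < p) (hα : 0 < α) :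
    log p / (p ^ α - 1) = log p * p ^ (-α) * (1 / (1 - p ^ (-α))) := by
  have h1 : 1 < p ^ α := one_lt_rpow hp hα
  rw [rpow_neg (by linarith)]
  have : p ^ α - 1 ≠ 0 := by linarith
  field_simp

lemma saddle_term_le {p : ℝ} (hp : 1 < p) (hα : 0 < α) :
    log p / (p ^ α - 1) ≤ log p * p ^ (-α) + 1 / α * p ^ (-α) := by
  have hl : 0 < log p := log_pos hp
  have hp0 : 0 < p := by linarith
  rw [saddle_term_eq hp hα]
  have h := inv_one_sub_exp_le (s := α * log p) (by positivity)
  rw [← rpow_neg_eq_exp hp0] at h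
  calc _ ≤ log p * p ^ (-α) * (1 + 1 / (α * log p)) := by gcongr
    _ = _ := by field_simp

/-- Data of the problem: `N = ū`. -/
lemma ubar_le_pi (x y : ℝ) : ubar x y ≤ (primesLe y).card := min_le_right _ _

lemma card_primesLe_le (hy : 0 ≤ y) : ((primesLe y).card : ℝ) ≤ y := by
  have : primesLe y ⊆ Icc 1 ⌊y⌋₊ := by
    intro p hp; rw [mem_primesLe hy] at hp; exact mem_Icc.2 ⟨hp.1.pos, Nat.le_floor hp.2⟩
  calc _ ≤ ((Icc 1 ⌊y⌋₊).card : ℝ) := mod_cast card_le_card this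
    _ = (⌊y⌋₊ : ℝ) := by simp
    _ ≤ y := Nat.floor_le hy

lemma ubar_le_self (hy : 0 ≤ y) : ubar x y ≤ y :=
  (ubar_le_pi x y).trans (card_primesLe_le hy)

/-- If `α ≥ 1` then `ū` is bounded. -/
lemma eventually_ubar_le_of_one_le : ∀ᶠ y : ℝ in atTop, ∀ x α : ℝ, 1 ≤ α →
    saddleEq x y α → ubar x y ≤ 48 := by
  filter_upwards [eventually_sum_log_le, eventually_Kb, eventually_ge_atTop 2]
    with y hS hK hy x α hα hsad
  have hl : 0 < log y := log_pos (by linarith)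
  refine (min_le_left _ _).trans ?_; rw [div_le_iff₀ hl, ← hsad]
  have h1 : ∀ p ∈ primesLe y, log p / ((p : ℝ) ^ α - 1) ≤ 2 * (log p * (p : ℝ) ^ (-1 : ℝ)) := by
    intro p hp
    have hp2 := two_le_of_mem_primesLe hp
    have hlp := log_pos_of_mem_primesLe hp
    have h3 : (p : ℝ) ≤ (p : ℝ) ^ α := by
      calc (p : ℝ) = (p : ℝ) ^ (1 : ℝ) := (rpow_one _).symm
        _ ≤ _ := rpow_le_rpow_of_exponent_le (by linarith) hα
    rw [Real.rpow_neg_one]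
    calc log p / ((p : ℝ) ^ α - 1) ≤ log p / (p / 2) := by
          gcongr; linarith
      _ = _ := by field_simp
  refine (sum_le_sum h1).trans ?_; rw [← mul_sum]
  have h2 := hS 1 zero_le_one le_rfl
  have h3 : log y * Wb y 1 = Kb y := by unfold Wb om; simp [hl.ne']; field_simp
  rw [h3] at h2; linarith [hK.2.1]

/-- `ū` is controlled by the top blocks. -/
lemma eventually_ubar_le_Wb : ∀ᶠ y : ℝ in atTop, ∀ x α : ℝ, 0 < α → α ≤ 1 →
    saddleEq x y α → ubar x y ≤ 7000 * Wb y α := by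
  filter_upwards [eventually_sum_log_le, eventually_Kb, eventually_ge_atTop 3,
    eventually_log_le_rpow (1 / 12) (1 / 4) (by norm_num) (by norm_num)]
    with y hS hK hy hlog x α hα0 hα1 hsad
  have hy0 : 0 < y := by linarith
  have hl : 0 < log y := log_pos (by linarith)
  have hW0 : om y α 0 ≤ Wb y α := by
    unfold Wb
    exact single_le_sum (f := om y α) (fun i _ => (om_pos (by linarith) i).le)
      (mem_range.2 (by omega))
  have hom0 : om y α 0 = y ^ (1 - α) / log y := by simp [om]
  have hsqrt : √y ≤ y ^ ((3 : ℝ) / 4) / log y / 12 := by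
    rw [div_div, le_div_iff₀ (by positivity)]
    calc √y * (log y * 12) ≤ √y * (1 / 12 * y ^ ((1 : ℝ) / 4) * 12) := by gcongr
      _ = y ^ ((3 : ℝ) / 4) := by
        rw [sqrt_eq_rpow]
        rw [show (1 : ℝ) / 12 * y ^ ((1 : ℝ) / 4) * 12 = y ^ ((1 : ℝ) / 4) by ring,
          ← rpow_add hy0]; norm_num
  set S1 := ∑ p ∈ primesLe y, log p * (p : ℝ) ^ (-α) with hS1
  have hS1le := hS α hα0.le hα1
  rw [← hS1] at hS1le
  have hWpos : 0 < Wb y α := lt_of_lt_of_le (om_pos (by linarith) 0) hW0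
  by_cases hcase : α * log y ≤ 1
  · refine (ubar_le_pi x y).trans ?_
    have h1 := sum_rpow_le (y := y) (α := 0) (by linarith) le_rfl
    simp only [neg_zero, Real.rpow_zero, mul_one, sum_const, nsmul_eq_mul] at h1
    rw [← theta_eq_sum_primesLe] at h1
    have t1 := theta_le_log4_mul_x hy0.le
    have l4 : log 4 = 2 * log 2 := by rw [show (4 : ℝ) = 2 ^ 2 by norm_num, log_pow]; norm_num
    have l2 := log_two_lt_d9
    have h2 : y / 3 / log y ≤ om y α 0 := by
      rw [hom0]; gcongr
      rw [sub_eq_add_neg, rpow_add hy0, rpow_one, rpow_neg_eq_exp hy0, div_eq_mul_inv]; gcongr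
      rw [Real.exp_neg]; gcongr
      calc rexp (α * log y) ≤ rexp 1 := exp_le_exp.2 hcase
        _ ≤ 3 := by linarith [exp_one_lt_d9]
    have h3 : √y ≤ y / log y := by
      refine hsqrt.trans ?_
      have : y ^ ((3 : ℝ) / 4) ≤ y := by
        calc _ ≤ y ^ (1 : ℝ) := rpow_le_rpow_of_exponent_le (by linarith) (by norm_num)
          _ = y := rpow_one y
      calc _ ≤ y / log y / 12 := by gcongr
        _ ≤ _ := div_le_self (by positivity) (by norm_num)
    have h4 : 2 / log y * theta y ≤ 4 * (y / log y) := by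
      have : theta y ≤ 2 * y := by nlinarith
      calc 2 / log y * theta y ≤ 2 / log y * (2 * y) := by gcongr
        _ = _ := by ring
    have h5 : y / 3 / log y = (y / log y) / 3 := by ring
    linarith
  · push Not at hcase
    refine (min_le_left _ _).trans ?_; rw [div_le_iff₀ hl, ← hsad]
    set S2 := ∑ p ∈ primesLe y, (p : ℝ) ^ (-α) with hS2
    have h1 : ∑ p ∈ primesLe y, log p / ((p : ℝ) ^ α - 1) ≤ S1 + 1 / α * S2 := by
      rw [hS1, hS2, mul_sum, ← sum_add_distrib]
      exact sum_le_sum fun p hp =>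
        saddle_term_le (by linarith [two_le_of_mem_primesLe hp]) hα0
    have hS20 : 0 ≤ S2 := sum_nonneg fun p _ => by positivity
    refine h1.trans ?_
    by_cases h4 : 1 / 4 ≤ α
    · have h5 : 1 / α ≤ 4 := by rw [div_le_iff₀ hα0]; linarith
      have h6 : S2 ≤ 3 / 2 * S1 := by
        rw [hS1, hS2, mul_sum]; refine sum_le_sum fun p hp => ?_
        have hp2 := two_le_of_mem_primesLe hp
        have : log 2 ≤ log p := log_le_log (by norm_num) hp2
        have h7 : 0 ≤ (p : ℝ) ^ (-α) := by positivity
        have : 1 ≤ 3 / 2 * log p := by linarith [log_two_gt_d9]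
        nlinarith
      nlinarith
    · push Not at h4
      have h5 : 1 / α ≤ log y := by rw [div_le_iff₀ hα0]; linarith
      have h6 := sum_rpow_le (y := y) (α := α) (by linarith) hα0.le
      rw [← hS1, ← hS2] at h6
      have h7 : y ^ ((3 : ℝ) / 4) / log y ≤ Wb y α := by
        refine le_trans ?_ hW0; rw [hom0]; gcongr
        · linarith
        · linarith
      have h8 : 2 / log y * S1 ≤ 1920 * Wb y α := by
        rw [div_mul_eq_mul_div, div_le_iff₀ hl]; linarith
      have h9 : S2 ≤ 2000 * Wb y α := by linarith
      have h10 : 1 / α * S2 ≤ log y * (2000 * Wb y α) := by gcongr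
      nlinarith [mul_pos hl hWpos]

/-! ### Lower bounds for sums over the top blocks -/

lemma eventually_block {P : ℝ → Prop} (h : ∀ᶠ z in atTop, P z) :
    ∀ᶠ y : ℝ in atTop, ∀ i < Kb y, P (y / 8 ^ i) := by
  obtain ⟨z₀, hz₀⟩ := eventually_atTop.1 h
  filter_upwards [eventually_Kb, eventually_ge_atTop 2,
    eventually_const_le_rpow z₀ 0.9 (by norm_num)] with y hK hy hz i hi
  refine hz₀ _ (hz.trans (block_ge hy ?_))
  have : (i : ℝ) ≤ Kb y := mod_cast hi.le
  linarith [hK.2.1]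

lemma block_sum_ge (hy : 2 ≤ y) (hα : 0 ≤ α) {i : ℕ} (hz : 2 ≤ y / 8 ^ i)
    {s : Finset ℕ} (hs : s ⊆ blk (y / 8 ^ i)) (hc : 0 ≤ c)
    (hcard : c * (y / 8 ^ i) / log (y / 8 ^ i) ≤ s.card) :
    c * om y α i ≤ ∑ p ∈ s, (p : ℝ) ^ (-α) := by
  set z := y / 8 ^ i with hzdef
  have hz0 : 0 < z := by linarith
  have hlz : 0 < log z := log_pos (by linarith)
  have hzy : z ≤ y := div_le_self (by linarith) (one_le_pow₀ (by norm_num))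
  have h1 : ∀ p ∈ s, z ^ (-α) ≤ (p : ℝ) ^ (-α) := by
    intro p hp
    have hp' := (mem_blk hz0.le).1 (hs hp)
    refine Real.rpow_le_rpow_of_nonpos (mod_cast hp'.1.pos) hp'.2.2 (by linarith)
  calc c * om y α i = c * (z ^ (1 - α) / log y) := rfl
    _ ≤ c * (z ^ (1 - α) / log z) := by gcongr
    _ = (c * z / log z) * z ^ (-α) := by rw [sub_eq_add_neg, rpow_add hz0, rpow_one]; ring
    _ ≤ s.card * z ^ (-α) := by gcongr
    _ = ∑ p ∈ s, z ^ (-α) := by rw [sum_const, nsmul_eq_mul]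
    _ ≤ _ := sum_le_sum h1

lemma sum_blocks_le (hy : 0 ≤ y) (f : ℕ → ℝ) (hf : ∀ p ∈ primesLe y, 0 ≤ f p) (n : ℕ) :
    ∑ i ∈ range n, ∑ p ∈ blk (y / 8 ^ i), f p ≤ ∑ p ∈ primesLe y, f p := by
  rw [sum_primesLe_blocks hy f n]; refine le_add_of_nonneg_right (sum_nonneg fun p hp => hf p ?_)
  rw [mem_primesLe (by positivity)] at hp
  rw [mem_primesLe hy]; exact ⟨hp.1, hp.2.trans (div_le_self hy (one_le_pow₀ (by norm_num)))⟩

lemma blk_subset_primesLe (hy : 0 ≤ y) (i : ℕ) : blk (y / 8 ^ i) ⊆ primesLe y := by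
  intro p hp; rw [mem_blk (by positivity)] at hp
  rw [mem_primesLe hy]; exact ⟨hp.1, hp.2.2.trans (div_le_self hy (one_le_pow₀ (by norm_num)))⟩

lemma eventually_log_blk_ge : ∀ᶠ y : ℝ in atTop, ∀ i < Kb y, ∀ p ∈ blk (y / 8 ^ i),
    4 / 5 * log y ≤ log p := by
  filter_upwards [eventually_Kb, eventually_ge_atTop 2,
    Real.tendsto_log_atTop.eventually_ge_atTop 8000] with y hK hy hl i hi p hp
  rw [mem_blk (by positivity)] at hp
  have h1 := log_le_log (by positivity) hp.2.1.le
  have h2 : log (y / 8 ^ i / 8) = log (y / 8 ^ i) - 3 * log 2 := by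
    rw [log_div (by positivity) (by norm_num), log_eight]
  rw [h2, log_block hy] at h1
  have : (i : ℝ) ≤ Kb y := mod_cast hi.le
  nlinarith [log_two_lt_d9, log_two_gt_d9, hK.2.1]

/-- Lower bound for `∑ p^{-α}` over the top blocks. -/
lemma eventually_blocks_ge : ∀ᶠ y : ℝ in atTop, ∀ α : ℝ, 0 ≤ α →
    2 / 5 * Wb y α ≤ ∑ i ∈ range (Kb y), ∑ p ∈ blk (y / 8 ^ i), (p : ℝ) ^ (-α) := by
  filter_upwards [eventually_block eventually_blk_card,
    eventually_block (eventually_ge_atTop 2), eventually_ge_atTop 2]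
    with y hc hz hy α hα
  unfold Wb; rw [mul_sum]; refine sum_le_sum fun i hi => ?_
  rw [mem_range] at hi; exact block_sum_ge hy hα (hz i hi) (subset_refl _) (by norm_num) (hc i hi)

lemma eventually_Wb_le : ∀ᶠ y : ℝ in atTop, ∀ x α : ℝ, 0 < α → α ≤ 1 →
    saddleEq x y α → 3 / 10 * Wb y α ≤ ubar x y := by
  filter_upwards [eventually_blocks_ge, eventually_log_blk_ge, eventually_ge_atTop 2]
    with y hB hL hy x α hα hα1 hsad
  have hy0 : 0 < y := by linarith
  have hl : 0 < log y := log_pos (by linarith)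
  have hB' := hB α hα.le
  have hW : 0 ≤ Wb y α := sum_nonneg fun i _ => (om_pos hy i).le
  refine le_min ?_ ?_
  · rw [le_div_iff₀ hl, ← hsad]
    have h1 : ∀ p ∈ primesLe y, log p * (p : ℝ) ^ (-α) ≤ log p / ((p : ℝ) ^ α - 1) := by
      intro p hp
      have hp2 := two_le_of_mem_primesLe hp
      have h3 : 1 < (p : ℝ) ^ α := one_lt_rpow (by linarith) hα
      have := log_pos_of_mem_primesLe hp
      rw [rpow_neg (by linarith), ← div_eq_mul_inv]
      gcongr
      · linarith
    refine le_trans ?_ (sum_le_sum h1)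
    refine le_trans ?_ (sum_blocks_le hy0.le _ (fun p hp => ?_) (Kb y))
    · calc 3 / 10 * Wb y α * log y ≤ 4 / 5 * log y * (2 / 5 * Wb y α) := by
            nlinarith [mul_nonneg hW hl.le]
        _ ≤ 4 / 5 * log y * ∑ i ∈ range (Kb y), ∑ p ∈ blk (y / 8 ^ i), (p : ℝ) ^ (-α) := by gcongr
        _ ≤ _ := by
            rw [mul_sum]; refine sum_le_sum fun i hi => ?_
            rw [mul_sum]; refine sum_le_sum fun p hp => ?_
            have := hL i (mem_range.1 hi) p hp
            gcongr
    · have := log_pos_of_mem_primesLe hp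
      positivity
  · have h2 : ∑ p ∈ primesLe y, (p : ℝ) ^ (-α) ≤ (primesLe y).card := by
      rw [← nsmul_one, ← sum_const]; refine sum_le_sum fun p hp => ?_
      exact Real.rpow_le_one_of_one_le_of_nonpos (by linarith [two_le_of_mem_primesLe hp])
        (by linarith)
    have h3 := sum_blocks_le hy0.le (fun p : ℕ => (p : ℝ) ^ (-α))
      (fun p _ => by positivity) (Kb y)
    linarith

lemma eventually_exp_le_Wb : ∀ᶠ y : ℝ in atTop, ∀ α : ℝ, α ≤ 1 →
    rexp ((1 - α) * log y / 2) / 80 ≤ Wb y α := by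
  filter_upwards [eventually_Kb, eventually_ge_atTop 2] with y hK hy α hα1
  have hl : 0 < log y := log_pos (by linarith)
  have h1 : ∀ i ∈ range (Kb y), rexp ((1 - α) * log y / 2) / log y ≤ om y α i := by
    intro i hi; rw [om_eq hy]
    have : (i : ℝ) ≤ Kb y := mod_cast (mem_range.1 hi).le
    gcongr
    have : log y / 2 ≤ log y - i * (3 * log 2) := by
      nlinarith [log_two_lt_d9, log_two_gt_d9, hK.2.1]
    nlinarith
  have h2 := sum_le_sum h1
  rw [sum_const, nsmul_eq_mul, card_range] at h2; refine le_trans ?_ h2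
  have : rexp ((1 - α) * log y / 2) / 80 =
    log y / 80 * (rexp ((1 - α) * log y / 2) / log y) := by field_simp
  rw [this]; gcongr; exact hK.1

/-- `1 - α` is at most of order `log ū / log y`. -/
lemma eventually_one_sub_mul_log_le : ∀ᶠ y : ℝ in atTop, ∀ x α : ℝ, 0 < α → α ≤ 1 →
    saddleEq x y α → 100000 ≤ ubar x y → (1 - α) * log y ≤ 3 * log (ubar x y) := by
  filter_upwards [eventually_Wb_le, eventually_exp_le_Wb] with y h1 h2 x α hα hα1 hsad hN
  have h3 := h1 x α hα hα1 hsad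
  have h4 := h2 α hα1
  set N := ubar x y
  have hN0 : 0 < N := by linarith
  set h := (1 - α) * log y
  have h5 : rexp (h / 2) ≤ 267 * N := by linarith
  have h6 : h / 2 ≤ log (267 * N) := by rwa [le_log_iff_exp_le (by positivity)]
  have h7 : log (267 * N) ≤ 3 / 2 * log N := by
    rw [← log_rpow hN0]; apply log_le_log (by positivity)
    rw [show (3 : ℝ) / 2 = 1 / 2 + 1 by norm_num, rpow_add hN0, rpow_one, ← sqrt_eq_rpow]
    have : 267 ≤ √N := Real.le_sqrt_of_sq_le (by linarith)
    gcongr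
  linarith

lemma sin_ge_third {u : ℝ} (h0 : 0 ≤ u) (h1 : u ≤ 3 / 2) : u / 2 ≤ sin u := by
  have h := Real.mul_le_sin h0 (by linarith [pi_gt_three])
  have : u / 2 ≤ 2 / π * u := by
    rw [div_mul_eq_mul_div, div_le_div_iff₀ (by norm_num) pi_pos]
    nlinarith [Real.pi_lt_four]
  linarith

lemma abs_sin_ge_of_sub {a : ℝ} (hδ : 0 < δ) (h1 : 4 * δ ≤ a - b) (h2 : a - b ≤ 3 / 2)
    (ha : |sin a| < δ) : δ ≤ |sin b| := by
  have c3 := sin_ge_third (by linarith) h2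
  have c4 : |sin (a - b)| ≤ |sin a| + |sin b| := by
    rw [Real.sin_sub]; refine (abs_sub _ _).trans ?_; rw [abs_mul, abs_mul]
    have := Real.abs_cos_le_one a
    have := Real.abs_cos_le_one b
    have := abs_nonneg (sin a)
    have := abs_nonneg (sin b)
    nlinarith
  have c5 := le_abs_self (sin (a - b))
  linarith

lemma sin_block_pair {d j u u' : ℝ} (ht : 0 < t) (hd : 0 < d) (hj1 : d ≤ j - 1)
    (hj2 : t * (j + 1) ≤ 1 / 320 + 3 / 10) (b1 : (j - 1) * (3 * log 2) ≤ u - u')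
    (b2 : u - u' ≤ (j + 1) * (3 * log 2)) (h : |sin (t * u / 2)| < t * d / 4) :
    t * d / 4 ≤ |sin (t * u' / 2)| := by
  have hl2 := log_two_lt_d9
  have hl2' := log_two_gt_d9
  have h0 : 2 * d ≤ u - u' := by nlinarith
  have h1 : t * (2 * d) ≤ t * (u - u') := by gcongr
  refine abs_sin_ge_of_sub (by positivity) (by linarith) ?_ h
  have d2 : t * (u - u') ≤ t * ((j + 1) * (3 * log 2)) := by gcongr
  have d3 : t * (j + 1) * (3 * log 2) ≤ (1 / 320 + 3 / 10) * 3 := by gcongr; linarith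
  nlinarith

set_option maxHeartbeats 800000 in
lemma eventually_sin_sum_mid : ∀ᶠ y : ℝ in atTop, ∀ x α t : ℝ, 0 < α → α ≤ 1 →
    saddleEq x y α → 100000 ≤ ubar x y → 1 / log y ≤ t → t < 1 / 10 →
    1 / 10 ^ 12 * (ubar x y / log (ubar x y) ^ 2) ≤
      ∑ p ∈ primesLe y, (p : ℝ) ^ (-α) * sin (t * log p / 2) ^ 2 := by
  filter_upwards [eventually_one_sub_mul_log_le, eventually_ubar_le_Wb, eventually_Kb,
    eventually_block eventually_blk_card, eventually_ge_atTop 2,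
    eventually_block (eventually_ge_atTop 2)]
    with y hh hW hK hcard hy hz2 x α t hα hα1 hsad hN ht ht1
  have hy0 : 0 < y := by linarith
  have hl : 0 < log y := log_pos (by linarith)
  have h1 := hh x α hα hα1 hsad hN
  have h2 := hW x α hα hα1 hsad
  set N := ubar x y with hNdef
  have hN0 : 0 < N := by linarith
  have hlN : 11 ≤ log N := by
    rw [le_log_iff_exp_le hN0]
    have : rexp 11 = rexp 1 ^ 11 := by rw [← Real.exp_nat_mul]; norm_num
    rw [this]
    have : rexp 1 ^ 11 ≤ 2.7182818286 ^ 11 :=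
      pow_le_pow_left₀ (exp_pos _).le exp_one_lt_d9.le 11
    refine this.trans (le_trans ?_ hN); norm_num
  have ht0 : 0 < t := lt_of_lt_of_le (by positivity) ht
  set D : ℝ := 320 * t + 3 * (1 - α) with hD
  have hD0 : 0 < D := by nlinarith
  set j : ℕ := ⌊1 / D⌋₊ + 2 with hj
  have hf1 := Nat.floor_le (show 0 ≤ 1 / D by positivity)
  have hf2 := Nat.lt_floor_add_one (1 / D)
  have hjc : (j : ℝ) = ⌊1 / D⌋₊ + 2 := by rw [hj]; push_cast; ring
  have hDt : 1 / D * t ≤ 1 / 320 := by rw [div_mul_eq_mul_div, div_le_iff₀ hD0]; nlinarith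
  have hDa : 1 / D * (1 - α) ≤ 1 / 3 := by rw [div_mul_eq_mul_div, div_le_iff₀ hD0]; nlinarith
  have hjK : 2 * j ≤ Kb y := by
    have : 1 / D ≤ Kb y / 4 := by
      have h3 : 1 / D ≤ 1 / (320 * t) := by
        apply one_div_le_one_div_of_le (by positivity); nlinarith
      have h4 : 1 / (320 * t) ≤ log y / 320 := by
        rw [div_le_div_iff₀ (by positivity) (by norm_num)]
        rw [div_le_iff₀ hl] at ht; nlinarith
      linarith [hK.1]
    have h100 : (100 : ℝ) ≤ Kb y := mod_cast hK.2.2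
    have : (2 * j : ℝ) ≤ Kb y := by linarith
    exact_mod_cast this
  have hl2 := log_two_lt_d9
  have hl2' := log_two_gt_d9
  have hom : ∀ i, rexp (-5) * om y α i ≤ om y α (i + j) := by
    intro i; rw [om_eq hy, om_eq hy, ← mul_div_assoc, ← Real.exp_add]; gcongr; push_cast
    have h3 : (1 - α) * j ≤ 7 / 3 := by rw [hjc]; nlinarith
    have : (1 - α) * j * (3 * log 2) ≤ 5 := by nlinarith
    linarith
  -- the smallness parameter
  set δ : ℝ := t * (1 / D) / 4 with hδ
  have hδ0 : 0 < δ := by positivity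
  have hδlow : 1 / (200 * log N) ≤ δ := by
    have h3 : t * (1 / D) = 1 / (320 + 3 * ((1 - α) / t)) := by rw [hD]; field_simp
    have h4 : (1 - α) / t ≤ 3 * log N := by
      refine le_trans ?_ h1; rw [div_le_iff₀ ht0]; rw [div_le_iff₀ hl] at ht; nlinarith
    rw [hδ, h3, div_div]
    have h5 : 0 ≤ (1 - α) / t := div_nonneg (by linarith) ht0.le
    apply one_div_le_one_div_of_le (by linarith)
    linarith
  set f : ℕ → ℝ := fun p => (p : ℝ) ^ (-α) * sin (t * log p / 2) ^ 2 with hf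
  set F : ℕ → ℝ := fun i => ∑ p ∈ blk (y / 8 ^ i), f p with hF
  have hF0 : ∀ i, 0 ≤ F i := fun i => sum_nonneg fun p _ => by positivity
  have hpair : ∀ i ∈ range (Kb y - j),
      δ ^ 2 * (2 / 5 * rexp (-5)) * om y α i ≤ F i + F (i + j) := by
    intro i hi; rw [mem_range] at hi
    have hallF : ∀ k < Kb y, (∀ p ∈ blk (y / 8 ^ k), δ ≤ |sin (t * log p / 2)|) →
        δ ^ 2 * (2 / 5 * om y α k) ≤ F k := by
      intro k hk hall
      have h3 := block_sum_ge hy hα.le (hz2 k hk) (subset_refl _) (by norm_num) (hcard k hk)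
      calc _ ≤ δ ^ 2 * ∑ p ∈ blk (y / 8 ^ k), (p : ℝ) ^ (-α) := by gcongr
        _ ≤ F k := by
          rw [hF, mul_sum]; refine sum_le_sum fun p hp => ?_
          have h4 : δ ^ 2 ≤ sin (t * log p / 2) ^ 2 := by
            rw [← sq_abs (sin _)]; exact pow_le_pow_left₀ hδ0.le (hall p hp) 2
          have h5 : 0 ≤ (p : ℝ) ^ (-α) := by positivity
          calc δ ^ 2 * (p : ℝ) ^ (-α) = (p : ℝ) ^ (-α) * δ ^ 2 := mul_comm _ _
            _ ≤ _ := mul_le_mul_of_nonneg_left h4 h5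
    have home := om_pos (α := α) hy i
    have hexp1 : rexp (-5) ≤ 1 := exp_le_one_iff.2 (by norm_num)
    by_cases hall : ∀ p ∈ blk (y / 8 ^ i), δ ≤ |sin (t * log p / 2)|
    · have := hallF i (by omega) hall
      have h6 : δ ^ 2 * (2 / 5 * rexp (-5)) * om y α i ≤ δ ^ 2 * (2 / 5 * om y α i) := by
        calc _ ≤ δ ^ 2 * (2 / 5 * 1) * om y α i := by gcongr
          _ = _ := by ring
      linarith [hF0 (i + j)]
    · push Not at hall
      obtain ⟨p, hp, hps⟩ := hall
      have hall' : ∀ p' ∈ blk (y / 8 ^ (i + j)), δ ≤ |sin (t * log p' / 2)| := by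
        intro p' hp'; rw [mem_blk (by positivity)] at hp hp'
        have hp0 : (0 : ℝ) < p := mod_cast hp.1.pos
        have hp'0 : (0 : ℝ) < p' := mod_cast hp'.1.pos
        have e1 : ∀ k : ℕ, log (y / 8 ^ k / 8) = log y - (k + 1) * (3 * log 2) := by
          intro k; rw [log_div (by positivity) (by norm_num), log_eight, log_block hy]; ring
        have a1 := log_le_log (by positivity) hp.2.1.le
        have a2 := log_le_log hp0 hp.2.2
        have a3 := log_le_log (by positivity) hp'.2.1.le
        have a4 := log_le_log hp'0 hp'.2.2
        rw [e1] at a1 a3; rw [log_block hy] at a2 a4; push_cast at a3 a4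
        have b1 : (j - 1) * (3 * log 2) ≤ log p - log p' := by linarith only [a1, a4]
        have b2 : log p - log p' ≤ (j + 1) * (3 * log 2) := by linarith only [a2, a3]
        have hj1 : 1 / D ≤ j - 1 := by rw [hjc]; linarith only [hf2]
        have hj2 : t * (j + 1) ≤ 1 / 320 + 3 / 10 := by
          rw [hjc]
          have := mul_le_mul_of_nonneg_left hf1 ht0.le
          linarith only [this, hDt, ht1]
        have hD1 : 0 < 1 / D := one_div_pos.2 hD0
        exact sin_block_pair ht0 hD1 hj1 hj2 b1 b2 hps
      have := hallF (i + j) (by omega) hall'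
      have h6 : δ ^ 2 * (2 / 5 * rexp (-5)) * om y α i ≤ δ ^ 2 * (2 / 5 * om y α (i + j)) := by
        calc _ = δ ^ 2 * (2 / 5 * (rexp (-5) * om y α i)) := by ring
          _ ≤ _ := by gcongr; exact hom i
      linarith [hF0 i]
  have hsum := sum_le_sum hpair
  rw [← mul_sum, sum_add_distrib] at hsum
  have hs1 : ∑ i ∈ range (Kb y - j), F i ≤ ∑ i ∈ range (Kb y), F i :=
    sum_le_sum_of_subset_of_nonneg (range_mono (by omega)) fun i _ _ => hF0 i
  have hs2 : ∑ i ∈ range (Kb y - j), F (i + j) ≤ ∑ i ∈ range (Kb y), F i := by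
    have : ∑ i ∈ range (Kb y), F i = ∑ i ∈ range j, F i + ∑ i ∈ range (Kb y - j), F (i + j) := by
      rw [show range (Kb y) = range (j + (Kb y - j)) by congr 1; omega, sum_range_add]
      simp [add_comm]
    rw [this]; exact le_add_of_nonneg_left (sum_nonneg fun i _ => hF0 i)
  have hs3 := sum_blocks_le hy0.le f (fun p _ => by positivity) (Kb y)
  have hs4 : Wb y α ≤ 2 * ∑ i ∈ range (Kb y - j), om y α i := by
    refine le_trans ?_ (mod_cast sum_range_mul_le _ (om_anti (α := α) hy hα1) (Kb y - j) 2)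
    exact sum_le_sum_of_subset_of_nonneg (range_mono (by omega))
      fun i _ _ => (om_pos hy i).le
  have hexp : 1 / 250 ≤ rexp (-5) := by
    rw [Real.exp_neg, ← one_div]; apply one_div_le_one_div_of_le (exp_pos _)
    have : rexp 5 = rexp 1 ^ 5 := by rw [← Real.exp_nat_mul]; norm_num
    rw [this]; refine (pow_le_pow_left₀ (exp_pos _).le exp_one_lt_d9.le 5).trans (by norm_num)
  have hδ2 : (1 / (200 * log N)) ^ 2 ≤ δ ^ 2 := by apply pow_le_pow_left₀ (by positivity) hδlow
  have hfin : (1 / (200 * log N)) ^ 2 * (2 / 5 * (1 / 250)) * (N / 14000) ≤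
      δ ^ 2 * (2 / 5 * rexp (-5)) * ∑ i ∈ range (Kb y - j), om y α i := by
    gcongr; linarith
  have hfin2 : 1 / 10 ^ 12 * (N / log N ^ 2) * 2 ≤
      (1 / (200 * log N)) ^ 2 * (2 / 5 * (1 / 250)) * (N / 14000) := by
    have : (1 / (200 * log N)) ^ 2 * (2 / 5 * (1 / 250)) * (N / 14000) =
      (1 / 40000 * (2 / 5 * (1 / 250)) / 14000) * (N / log N ^ 2) := by
      field_simp; norm_num
    rw [this]
    have : 0 ≤ N / log N ^ 2 := by positivity
    nlinarith
  linarith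

lemma eventually_sin_sum_large : ∀ᶠ y : ℝ in atTop, ∀ x α t : ℝ, 0 < α → α ≤ 1 →
    saddleEq x y α → 1 / 10 ≤ t → t ≤ y ^ (0.54 : ℝ) → 1 / 10 ^ 24 * ubar x y ≤
      ∑ p ∈ primesLe y, (p : ℝ) ^ (-α) * sin (t * log p / 2) ^ 2 := by
  filter_upwards [eventually_ubar_le_Wb, eventually_block eventually_blk_sin,
    eventually_ge_atTop 2, eventually_Kb,
    eventually_block (eventually_ge_atTop 2)] with y hW hB hy hK hz2 x α t hα hα1 hsad ht ht1
  have hy0 : 0 < y := by linarith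
  have h2 := hW x α hα hα1 hsad
  refine le_trans ?_ (sum_blocks_le hy0.le _ (fun p _ => by positivity) (Kb y))
  have h3 : 1 / 10 ^ 18 * (1 / 5) * Wb y α ≤ ∑ i ∈ range (Kb y), ∑ p ∈ blk (y / 8 ^ i),
      (p : ℝ) ^ (-α) * sin (t * log p / 2) ^ 2 := by
    unfold Wb; rw [mul_sum]; refine sum_le_sum fun i hi => ?_
    rw [mem_range] at hi
    have hi' : (i : ℝ) ≤ Kb y := mod_cast hi.le
    have ht2 : t ≤ (y / 8 ^ i) ^ (0.6 : ℝ) := by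
      calc t ≤ y ^ (0.54 : ℝ) := ht1
        _ = (y ^ (0.9 : ℝ)) ^ (0.6 : ℝ) := by rw [← rpow_mul hy0.le]; norm_num
        _ ≤ _ := by
          apply Real.rpow_le_rpow (by positivity) (block_ge hy (by linarith [hK.2.1])) (by norm_num)
    have h4 := block_sum_ge hy hα.le (hz2 i hi) (filter_subset _ _) (by norm_num) (hB i hi t ht ht2)
    rw [mul_assoc]; refine (mul_le_mul_of_nonneg_left h4 (by norm_num)).trans ?_
    rw [mul_sum]
    refine le_trans (sum_le_sum fun p hp => ?_)
      (sum_le_sum_of_subset_of_nonneg (filter_subset _ _) fun p _ _ =>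
        mul_nonneg (Real.rpow_nonneg (Nat.cast_nonneg p) (-α)) (sq_nonneg (sin (t * log p / 2))))
    rw [mem_filter] at hp; rw [mul_comm]; gcongr 1
    rw [← sq_abs (sin _), show (1 : ℝ) / 10 ^ 18 = (1 / 10 ^ 9) ^ 2 by norm_num]
    exact pow_le_pow_left₀ (by norm_num) hp.2 2
  have hW0 : 0 ≤ Wb y α := sum_nonneg fun i _ => (om_pos hy i).le
  linarith

/-! ### The normalised system attached to the saddle point -/

/-- `q_p = e^{-A l_p}`. -/
def qq (A l : ℝ) : ℝ := rexp (-(A * l))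

/-- The variance of a local factor. -/
def mm (A l : ℝ) : ℝ := l ^ 2 * qq A l / (1 - qq A l) ^ 2

/-- The properties of the normalised family `l_p = log p / L` used in the analysis. -/
structure SysHyp (s : Finset ℕ) (l : ℕ → ℝ) (A N Y c κ : ℝ) : Prop where
  hl : ∀ p ∈ s, 0 < l p ∧ l p ≤ 1
  hA : 1 ≤ A
  hlow : c * N ≤ ∑ p ∈ s, mm A (l p)
  hupp : ∑ p ∈ s, mm A (l p) ≤ 2 * N
  hmean : ∑ p ∈ s, l p * qq A (l p) / (1 - qq A (l p)) ≤ N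
  hAexp : A ≤ rexp (N ^ κ)
  hY : A * √N * (A * N) ^ (1 / 100 : ℝ) ≤ Y
  hdich : ∀ t : ℝ, 0 < t → t ≤ Y → (c * min 1 (t ^ 2) * (N / log N ^ 2) ≤
      ∑ p ∈ s, qq A (l p) * sin (t * l p / 2) ^ 2) ∨ (A = 1 ∧ (∀ p ∈ s, t * l p ≤ 1) ∧ N ≤ s.card)

lemma qq_pos (A l : ℝ) : 0 < qq A l := exp_pos _

lemma qq_lt_one (hA : 0 < A) (hl : 0 < l) : qq A l < 1 := by
  unfold qq; rw [Real.exp_lt_one_iff]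
  have := mul_pos hA hl
  linarith

/-- `l / (1 - q) ≤ l + 1 / A`. -/
lemma div_one_sub_qq_le (hA : 0 < A) (hl : 0 < l) : l / (1 - qq A l) ≤ l + 1 / A := by
  have h := inv_one_sub_exp_le (mul_pos hA hl)
  calc l / (1 - qq A l) = l * (1 / (1 - rexp (-(A * l)))) := by unfold qq; ring
    _ ≤ l * (1 + 1 / (A * l)) := by gcongr
    _ = _ := by field_simp

lemma mean_le (hA : 0 < A) (hl : 0 < l) : l * qq A l / (1 - qq A l) ≤ 1 / A := by
  have h1 := qq_lt_one hA hl
  have h2 : 1 + A * l ≤ rexp (A * l) := by linarith [add_one_le_exp (A * l)]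
  have h3 : qq A l * rexp (A * l) = 1 := by unfold qq; rw [← Real.exp_add]; simp
  have h4 := qq_pos A l
  rw [div_le_div_iff₀ (by linarith) hA]
  have : qq A l * (1 + A * l) ≤ 1 := by
    have := mul_le_mul_of_nonneg_left h2 h4.le
    linarith
  linarith

lemma mm_le (hA : 1 ≤ A) (hl : 0 < l) (hl1 : l ≤ 1) :
    mm A l ≤ 2 * (l * qq A l / (1 - qq A l)) := by
  have hA0 : 0 < A := by linarith
  have h1 := qq_lt_one hA0 hl
  have h2 := div_one_sub_qq_le hA0 hl
  have h3 : 1 / A ≤ 1 := by rw [div_le_one hA0]; exact hA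
  have h4 := qq_pos A l
  have : mm A l = l / (1 - qq A l) * (l * qq A l / (1 - qq A l)) := by
    have : 1 - qq A l ≠ 0 := by linarith
    unfold mm; field_simp
  rw [this]; gcongr; linarith

lemma qq_mul_sq_le_mm (hA : 0 < A) (hl : 0 < l) : qq A l * l ^ 2 ≤ mm A l := by
  have h1 := qq_lt_one hA hl
  have h2 := qq_pos A l
  unfold mm; rw [le_div_iff₀ (by nlinarith)]
  have : (1 - qq A l) ^ 2 ≤ 1 := by nlinarith
  have h3 : 0 ≤ qq A l * l ^ 2 := by positivity
  nlinarith

lemma exp_neg_le_mm (hl : 0 < l) (hl1 : l ≤ 1) : 1 / 3 ≤ mm 1 l := by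
  have h1 := qq_lt_one one_pos hl
  have h2 : 1 - qq 1 l ≤ l := by unfold qq; linarith [add_one_le_exp (-(1 * l))]
  have h3 : 1 / 3 ≤ qq 1 l := by
    unfold qq; rw [Real.exp_neg, ← one_div]; apply one_div_le_one_div_of_le (exp_pos _)
    calc _ ≤ rexp 1 := exp_le_exp.2 (by linarith)
      _ ≤ 3 := by linarith [exp_one_lt_d9]
  unfold mm; rw [le_div_iff₀ (by nlinarith)]
  have : (1 - qq 1 l) ^ 2 ≤ l ^ 2 := by nlinarith
  nlinarith [sq_nonneg l]

/-- The normalising scale. -/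
def Lsc (y α : ℝ) : ℝ := max (1 / α) (log y)

set_option maxHeartbeats 1000000 in
lemma eventually_sys {ε : ℝ} (hε : 0 < ε) : ∀ᶠ y : ℝ in atTop, ∀ x α : ℝ, 3 ≤ x →
    y ≤ rexp (log x / log (log x) ^ (1 + ε)) → 0 < α → saddleEq x y α →
    100000 ≤ ubar x y → SysHyp (primesLe y) (fun p => log p / Lsc y α) (α * Lsc y α) (ubar x y)
      (Lsc y α * y ^ (0.54 : ℝ)) (1 / 10 ^ 24) (1 / (1 + ε)) := by
  filter_upwards [eventually_sin_sum_large, eventually_sin_sum_mid, eventually_ubar_le_of_one_le,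
    eventually_ubar_le_Wb, eventually_blocks_ge, eventually_log_blk_ge, eventually_blk_card,
    eventually_ge_atTop 3, eventually_log_le_rpow (2 / 5) (1 / 2) (by norm_num) (by norm_num),
    eventually_log_le_rpow 1 (1 / (2 * (1 + ε))) (by norm_num) (by positivity)]
    with y hlarge hmid hα1 hW hB hLb hcard hy hlog hloglog x α hx hyx hα hsad hN
  have hy0 : 0 < y := by linarith
  have hl1 : 1 ≤ log y := by rw [le_log_iff_exp_le hy0]; linarith [exp_one_lt_d9]
  have hl : 0 < log y := by linarith
  have hαle : α ≤ 1 := by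
    by_contra h
    push Not at h
    have := hα1 x α h.le hsad
    linarith
  set L := Lsc y α with hL
  have hL1 : 1 / α ≤ L := le_max_left _ _
  have hL2 : log y ≤ L := le_max_right _ _
  have hL0 : 0 < L := by linarith
  set N := ubar x y with hNdef
  have hN0 : 0 < N := by linarith
  have hA : 1 ≤ α * L := by rw [div_le_iff₀ hα] at hL1; linarith
  have hA0 : 0 < α * L := by linarith
  have hlogp : ∀ p ∈ primesLe y, log p ≤ log y := fun p hp =>
    log_le_log (by linarith [two_le_of_mem_primesLe hp]) ((mem_primesLe hy0.le).1 hp).2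
  have hq : ∀ p ∈ primesLe y, qq (α * L) (log p / L) = (p : ℝ) ^ (-α) := by
    intro p hp; rw [rpow_neg_eq_exp (by linarith [two_le_of_mem_primesLe hp])]
    unfold qq; congr 2; field_simp
  have hlen : ∀ p ∈ primesLe y, 0 < log p / L ∧ log p / L ≤ 1 := by
    intro p hp
    have := log_pos_of_mem_primesLe hp
    refine ⟨by positivity, ?_⟩
    rw [div_le_one hL0]; linarith [hlogp p hp]
  have hmean : ∑ p ∈ primesLe y, log p / L * qq (α * L) (log p / L) /
      (1 - qq (α * L) (log p / L)) ≤ N := by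
    refine le_min ?_ ?_
    · have : ∑ p ∈ primesLe y, log p / L * qq (α * L) (log p / L) /
          (1 - qq (α * L) (log p / L)) = log x / L := by
        rw [← hsad, sum_div]; refine sum_congr rfl fun p hp => ?_
        rw [hq p hp, saddle_term_eq (by linarith [two_le_of_mem_primesLe hp]) hα]
        ring
      rw [this]
      have : 0 ≤ log x := log_nonneg (by linarith)
      gcongr
    · rw [← nsmul_one, ← sum_const]
      refine sum_le_sum fun p hp => ?_
      refine (mean_le hA0 (hlen p hp).1).trans ?_; rw [div_le_one hA0]; exact hA
  have hNW := hW x α hα hαle hsad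
  have hcases : (α * L = 1) ∨ (L = log y) := by
    rcases max_choice (1 / α) (log y) with h | h
    · left
      rw [hL, Lsc, h]; field_simp
    · right; rw [hL, Lsc, h]
  have hqsum : L = log y → 1 / 28000 * N ≤ ∑ p ∈ primesLe y,
      qq (α * L) (log p / L) * (log p / L) ^ 2 := by
    intro hLy
    have h1 := hB α hα.le
    have h2 := sum_blocks_le hy0.le
      (fun p : ℕ => qq (α * L) (log p / L) * (log p / L) ^ 2)
      (fun p _ => by have := qq_pos (α * L) (log p / L); positivity) (Kb y)
    refine le_trans ?_ h2
    have h3 : 16 / 25 * (2 / 5 * Wb y α) ≤ ∑ i ∈ range (Kb y), ∑ p ∈ blk (y / 8 ^ i),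
        qq (α * L) (log p / L) * (log p / L) ^ 2 := by
      refine (mul_le_mul_of_nonneg_left h1 (by norm_num)).trans ?_
      rw [mul_sum]; refine sum_le_sum fun i hi => ?_
      rw [mul_sum]; refine sum_le_sum fun p hp => ?_
      have hp' := blk_subset_primesLe hy0.le i hp
      rw [hq p hp', mul_comm]
      have h4 := hLb i (mem_range.1 hi) p hp
      have h5 : 4 / 5 ≤ log p / L := by rw [hLy, le_div_iff₀ hl]; exact h4
      gcongr; nlinarith
    linarith
  have hYA : α * L * √N * (α * L * N) ^ (1 / 100 : ℝ) ≤ L * y ^ (0.54 : ℝ) := by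
    have hNy : N ≤ y := ubar_le_self hy0.le
    have hAy : α * L ≤ y := by
      rcases hcases with h | h
      · linarith
      · rw [h]
        have := Real.log_le_sub_one_of_pos hy0
        nlinarith
    have h1 : √N ≤ y ^ (1 / 2 : ℝ) := by rw [← sqrt_eq_rpow]; exact Real.sqrt_le_sqrt hNy
    have h2 : (α * L * N) ^ (1 / 100 : ℝ) ≤ y ^ (0.02 : ℝ) := by
      calc _ ≤ (y * y) ^ (1 / 100 : ℝ) := by gcongr
        _ = y ^ (0.02 : ℝ) := by rw [Real.mul_rpow hy0.le hy0.le, ← rpow_add hy0]; norm_num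
    calc α * L * √N * (α * L * N) ^ (1 / 100 : ℝ) ≤ 1 * L * y ^ (1 / 2 : ℝ) * y ^ (0.02 : ℝ) := by
          gcongr
      _ = L * y ^ (0.52 : ℝ) := by rw [mul_assoc, ← rpow_add hy0, one_mul]; norm_num
      _ ≤ _ := by
          gcongr
          · linarith
          · norm_num
  have hAexp : α * L ≤ rexp (N ^ (1 / (1 + ε))) := by
    rcases hcases with h | h
    · rw [h]
      exact one_le_exp (by positivity)
    · have hAl : α * L ≤ log y := by rw [h]; nlinarith
      refine hAl.trans ?_; rw [← Real.log_le_iff_le_exp hl]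
      rcases min_choice (log x / log y) ((primesLe y).card : ℝ) with hm | hm
      · have hNu : N = log x / log y := hm
        have hlx1 : 1 < log x := by
          rw [Real.lt_log_iff_exp_lt (by linarith)]; linarith [exp_one_lt_d9]
        have hllx : 0 < log (log x) := log_pos hlx1
        have h1 : log y ≤ log x / log (log x) ^ (1 + ε) := by rwa [Real.log_le_iff_le_exp hy0]
        have h2 : log (log x) ^ (1 + ε) ≤ N := by
          rw [hNu, le_div_iff₀ hl]; rw [le_div_iff₀ (by positivity)] at h1
          linarith
        have h3 : log (log x) ≤ N ^ (1 / (1 + ε)) := by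
          calc log (log x) = (log (log x) ^ (1 + ε)) ^ (1 / (1 + ε)) := by
                rw [← rpow_mul hllx.le, mul_one_div_cancel (by positivity), rpow_one]
            _ ≤ _ := by gcongr
        refine le_trans ?_ h3; apply log_le_log hl
        have : log x = N * log y := by rw [hNu]; field_simp
        rw [this]; nlinarith
      · have hNp : N = (primesLe y).card := hm
        have h1 : y ^ (1 / 2 : ℝ) ≤ N := by
          have h2 : ((blk y).card : ℝ) ≤ (primesLe y).card := by
            have := blk_subset_primesLe hy0.le 0
            rw [pow_zero, div_one] at this
            exact_mod_cast card_le_card this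
          rw [hNp]; refine le_trans ?_ (hcard.trans h2); rw [le_div_iff₀ hl]
          calc y ^ (1 / 2 : ℝ) * log y ≤ y ^ (1 / 2 : ℝ) * (2 / 5 * y ^ (1 / 2 : ℝ)) := by gcongr
            _ = 2 / 5 * (y ^ (1 / 2 : ℝ) * y ^ (1 / 2 : ℝ)) := by ring
            _ = 2 / 5 * y := by rw [← rpow_add hy0]; norm_num
        calc log (log y) ≤ log y := by linarith [Real.log_le_sub_one_of_pos hl]
          _ ≤ 1 * y ^ (1 / (2 * (1 + ε))) := hloglog
          _ = (y ^ (1 / 2 : ℝ)) ^ (1 / (1 + ε)) := by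
            rw [one_mul, ← rpow_mul hy0.le]; congr 1; field_simp
          _ ≤ _ := by gcongr
  have hlN : 1 ≤ log N := by rw [le_log_iff_exp_le hN0]; linarith [exp_one_lt_d9]
  refine ⟨hlen, hA, ?_, ?_, hmean, hAexp, hYA, ?_⟩
  · rcases hcases with h | h
    · rw [h]
      have h1 : N ≤ (primesLe y).card := ubar_le_pi x y
      calc 1 / 10 ^ 24 * N ≤ (primesLe y).card * (1 / 3) := by linarith
        _ = ∑ p ∈ primesLe y, (1 / 3 : ℝ) := by rw [sum_const, nsmul_eq_mul]
        _ ≤ _ := sum_le_sum fun p hp => exp_neg_le_mm (hlen p hp).1 (hlen p hp).2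
    · refine le_trans ?_ ((hqsum h).trans (sum_le_sum fun p hp => qq_mul_sq_le_mm hA0 (hlen p hp).1))
      linarith
  · refine (sum_le_sum fun p hp => mm_le hA (hlen p hp).1 (hlen p hp).2).trans ?_
    rw [← mul_sum]; linarith
  · intro t ht htY
    have htL : t / L ≤ y ^ (0.54 : ℝ) := by rw [div_le_iff₀ hL0]; linarith
    have hNl : N / log N ^ 2 ≤ N := by apply div_le_self hN0.le; nlinarith
    have hNl0 : 0 ≤ N / log N ^ 2 := by positivity
    have hm1 : min 1 (t ^ 2) ≤ 1 := min_le_left _ _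
    have hm2 : min 1 (t ^ 2) ≤ t ^ 2 := min_le_right _ _
    have hconv : ∑ p ∈ primesLe y, qq (α * L) (log p / L) * sin (t * (log p / L) / 2) ^ 2 =
        ∑ p ∈ primesLe y, (p : ℝ) ^ (-α) * sin (t / L * log p / 2) ^ 2 := by
      refine sum_congr rfl fun p hp => ?_
      rw [hq p hp]; congr 3; ring
    have hmul : min 1 (t ^ 2) * (N / log N ^ 2) ≤ N / log N ^ 2 := by
      have := mul_le_mul_of_nonneg_right hm1 hNl0
      linarith
    by_cases h1 : 1 / log y ≤ t / L
    · left
      rw [hconv]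
      by_cases h2 : 1 / 10 ≤ t / L
      · have := hlarge x α (t / L) hα hαle hsad h2 htL
        nlinarith
      · push Not at h2
        have := hmid x α (t / L) hα hαle hsad hN h1 h2
        nlinarith
    · push Not at h1
      rw [div_lt_div_iff₀ hL0 hl] at h1
      have hsmall : ∀ p ∈ primesLe y, t * (log p / L) ≤ 1 := by
        intro p hp
        have := hlogp p hp
        rw [← mul_div_assoc, div_le_one hL0]; nlinarith
      rcases hcases with h | h
      · right
        exact ⟨h, hsmall, ubar_le_pi x y⟩
      · left
        have h3 : t ^ 2 / 16 * (1 / 28000 * N) ≤ ∑ p ∈ primesLe y, qq (α * L) (log p / L) *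
            sin (t * (log p / L) / 2) ^ 2 := by
          refine (mul_le_mul_of_nonneg_left (hqsum h) (by positivity)).trans ?_
          rw [mul_sum]; refine sum_le_sum fun p hp => ?_
          have hlp := (hlen p hp).1
          have h4 := sin_ge_third (u := t * (log p / L) / 2) (by positivity)
            (by linarith [hsmall p hp])
          have h5 : (t * (log p / L) / 2 / 2) ^ 2 ≤ sin (t * (log p / L) / 2) ^ 2 :=
            pow_le_pow_left₀ (by positivity) h4 2
          have h6 := qq_pos (α * L) (log p / L)
          calc t ^ 2 / 16 * (qq (α * L) (log p / L) * (log p / L) ^ 2)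
              = qq (α * L) (log p / L) * (t * (log p / L) / 2 / 2) ^ 2 := by ring
            _ ≤ _ := by gcongr
        have h7 : min 1 (t ^ 2) * (N / log N ^ 2) ≤ t ^ 2 * N := by gcongr
        have : 0 ≤ t ^ 2 * N := by positivity
        linarith

/-! ### Geometric laws -/

/-- The geometric law on `ℕ` with parameter `q = e^{-Al}`. -/
def geo (A l : ℝ) : Measure ℕ :=
  Measure.count.withDensity fun k => ((toNNReal ((1 - qq A l) * qq A l ^ k) : NNReal) : ENNReal)

instance (A l : ℝ) : SigmaFinite (geo A l) := by
  unfold geo; exact SigmaFinite.withDensity fun k => toNNReal ((1 - qq A l) * qq A l ^ k)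

lemma geo_weight_nonneg (hA : 0 < A) (hl : 0 < l) (k : ℕ) :
    0 ≤ (1 - qq A l) * qq A l ^ k :=
  mul_nonneg (by linarith [qq_lt_one hA hl]) (pow_nonneg (qq_pos _ _).le _)

section Bochner

variable {E : Type*} [NormedAddCommGroup E] [NormedSpace ℝ E]

lemma geo_integrable_iff (hA : 0 < A) (hl : 0 < l) (f : ℕ → E) :
    Integrable f (geo A l) ↔ Summable fun k => (1 - qq A l) * qq A l ^ k * ‖f k‖ := by
  unfold geo
  rw [integrable_withDensity_iff_integrable_smul (measurable_of_countable _), integrable_count_iff]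
  refine summable_congr fun k => ?_
  rw [NNReal.smul_def, norm_smul, Real.coe_toNNReal _ (geo_weight_nonneg hA hl k),
    norm_of_nonneg (geo_weight_nonneg hA hl k)]

lemma geo_singleton (hA : 0 < A) (hl : 0 < l) (k : ℕ) :
    (geo A l).real {k} = (1 - qq A l) * qq A l ^ k := by
  unfold geo; rw [Measure.real, withDensity_apply _ (measurableSet_singleton k)]
  simp [geo_weight_nonneg hA hl k]

lemma geo_integral [CompleteSpace E] (hA : 0 < A) (hl : 0 < l) {f : ℕ → E} (hf : Integrable f (geo A l)) :
    ∫ k, f k ∂(geo A l) = ∑' k, ((1 - qq A l) * qq A l ^ k) • f k := by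
  rw [integral_countable hf]
  simp_rw [geo_singleton hA hl]

lemma geo_integral_complex (hA : 0 < A) (hl : 0 < l) {f : ℕ → ℂ} {a : ℂ}
    (hf : HasSum (fun k => ((1 - qq A l : ℝ) : ℂ) * (qq A l : ℂ) ^ k * f k) a) :
    Integrable f (geo A l) ∧ ∫ k, f k ∂(geo A l) = a := by
  have hi : Integrable f (geo A l) := by
    rw [geo_integrable_iff hA hl]; refine hf.summable.norm.congr fun k => ?_
    rw [norm_mul, norm_mul, norm_pow, norm_real, norm_real, norm_of_nonneg (qq_pos _ _).le,
      norm_of_nonneg (by linarith [qq_lt_one hA hl])]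
  refine ⟨hi, ?_⟩; rw [geo_integral hA hl hi, ← hf.tsum_eq]; refine tsum_congr fun k => ?_
  rw [real_smul]; push_cast; ring

lemma geo_integral_real (hA : 0 < A) (hl : 0 < l) {f : ℕ → ℝ} {a : ℝ}
    (hf0 : ∀ k, 0 ≤ f k)
    (hf : HasSum (fun k => (1 - qq A l) * qq A l ^ k * f k) a) :
    Integrable f (geo A l) ∧ ∫ k, f k ∂(geo A l) = a := by
  have hi : Integrable f (geo A l) := by
    rw [geo_integrable_iff hA hl]; refine hf.summable.congr fun k => ?_
    rw [norm_of_nonneg (hf0 k)]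
  refine ⟨hi, ?_⟩; rw [geo_integral hA hl hi, ← hf.tsum_eq]
  rfl

lemma qq_norm_lt (hA : 0 < A) (hl : 0 < l) : ‖qq A l‖ < 1 := by
  rw [norm_of_nonneg (qq_pos _ _).le]; exact qq_lt_one hA hl

lemma isProb_geo (hA : 0 < A) (hl : 0 < l) :
    IsProbabilityMeasure (geo A l) := by
  have hq := qq_lt_one hA hl
  have h := geo_integral_real hA hl (f := fun _ => 1) (a := 1) (fun _ => zero_le_one) (by
    have := (hasSum_geometric_of_norm_lt_one (qq_norm_lt hA hl)).mul_left (1 - qq A l)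
    rw [mul_inv_cancel₀ (by linarith)] at this
    simpa using this)
  rw [isProbabilityMeasure_iff_real]
  simpa using h.2

/-- Second moment of a geometric progression. -/
lemma hasSum_sq_mul_geometric (h0 : 0 ≤ r) (hr : r < 1) :
    HasSum (fun n : ℕ => (n : ℝ) ^ 2 * r ^ n) (r * (1 + r) / (1 - r) ^ 3) := by
  have hn : ‖r‖ < 1 := by rwa [norm_of_nonneg h0]
  have h1 := hasSum_choose_mul_geometric_of_norm_lt_one 2 hn
  have h2 := hasSum_coe_mul_geometric_of_norm_lt_one hn
  have h3 := hasSum_geometric_of_norm_lt_one hn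
  have h := ((h1.mul_left 2).sub (h2.mul_left 3)).sub (h3.mul_left 2)
  have hne : (1 - r) ≠ 0 := by linarith
  convert! h using 1
  · funext n
    have : ((n + 2).choose 2 : ℝ) = (n + 2) * (n + 1) / 2 := by
      rw [Nat.cast_choose_two]; push_cast; ring
    rw [this]; ring
  · field_simp
    ring

lemma geo_mean (hA : 0 < A) (hl : 0 < l) :
    Integrable (fun k : ℕ => l * k) (geo A l) ∧
      ∫ k : ℕ, l * k ∂(geo A l) = l * qq A l / (1 - qq A l) := by
  have hq := qq_lt_one hA hl
  refine geo_integral_real hA hl (fun k => by positivity) ?_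
  have := (hasSum_coe_mul_geometric_of_norm_lt_one (qq_norm_lt hA hl)).mul_left
    (l * (1 - qq A l))
  convert! this using 1
  · funext k; ring
  · have : 1 - qq A l ≠ 0 := by linarith
    field_simp

lemma geo_sq (hA : 0 < A) (hl : 0 < l) :
    Integrable (fun k : ℕ => (l * k) ^ 2) (geo A l) ∧
      ∫ k : ℕ, (l * k) ^ 2 ∂(geo A l) = l ^ 2 * (qq A l * (1 + qq A l)) / (1 - qq A l) ^ 2 := by
  have hq := qq_lt_one hA hl
  refine geo_integral_real hA hl (fun k => by positivity) ?_
  have := (hasSum_sq_mul_geometric (qq_pos A l).le hq).mul_left (l ^ 2 * (1 - qq A l))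
  convert! this using 1
  · funext k; ring
  · have : 1 - qq A l ≠ 0 := by linarith
    field_simp

lemma mm_pos (hA : 0 < A) (hl : 0 < l) : 0 < mm A l := by
  have := qq_lt_one hA hl
  have := qq_pos A l
  unfold mm
  have : 0 < 1 - qq A l := by linarith
  positivity

lemma mm_le_two (hA : 1 ≤ A) (hl : 0 < l) (hl1 : l ≤ 1) : mm A l ≤ 2 := by
  have h1 := mm_le hA hl hl1
  have h2 := mean_le (by linarith : 0 < A) hl
  have h3 : 1 / A ≤ 1 := by rw [div_le_one (by linarith)]; exact hA
  linarith

/-- The tilted second moment is bounded by the variance. -/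
lemma geo_sq_exp (hA : 1 ≤ A) (hl : 0 < l) (hl1 : l ≤ 1) :
    Integrable (fun k : ℕ => (l * k) ^ 2 * rexp (l * k / 2)) (geo A l) ∧
      ∫ k : ℕ, (l * k) ^ 2 * rexp (l * k / 2) ∂(geo A l) ≤ 27 * mm A l := by
  have hA0 : 0 < A := by linarith
  have hq := qq_lt_one hA0 hl
  have hq0 := qq_pos A l
  set q := qq A l with hqd
  set r := q * rexp (l / 2) with hr
  have hr0 : 0 < r := by positivity
  have hrsq : r ≤ rexp (-(A * l / 2)) := by
    rw [hr, hqd, qq, ← Real.exp_add]; apply exp_le_exp.2; nlinarith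
  have hsq : rexp (-(A * l / 2)) ^ 2 = q := by
    rw [hqd, qq, ← Real.exp_nat_mul]; congr 1; push_cast; ring
  have h1r : (1 - q) / 2 ≤ 1 - r := by nlinarith
  have hr1 : r < 1 := by linarith
  have hs := (hasSum_sq_mul_geometric hr0.le hr1).mul_left (l ^ 2 * (1 - q))
  have hk := geo_integral_real hA0 hl (f := fun k : ℕ => (l * k) ^ 2 * rexp (l * k / 2))
    (a := l ^ 2 * (1 - q) * (r * (1 + r) / (1 - r) ^ 3)) (fun k => by positivity) (by
      convert! hs using 1
      funext k; rw [hr, mul_pow q, ← Real.exp_nat_mul]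
      rw [show (k : ℝ) * (l / 2) = l * k / 2 by ring]
      ring)
  refine ⟨hk.1, ?_⟩; rw [hk.2]
  have h1q : 0 < 1 - q := by linarith
  have hexp : rexp (l / 2) ≤ 27 / 16 := by
    calc rexp (l / 2) ≤ rexp (1 / 2) := exp_le_exp.2 (by linarith)
      _ ≤ 27 / 16 := by
        have h2 : rexp (1 / 2) ^ 2 = rexp 1 := by rw [← Real.exp_nat_mul]; norm_num
        have h3 := exp_one_lt_d9
        by_contra h
        push Not at h
        nlinarith
  calc l ^ 2 * (1 - q) * (r * (1 + r) / (1 - r) ^ 3)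
      ≤ l ^ 2 * (1 - q) * (r * 2 / ((1 - q) / 2) ^ 3) := by gcongr; linarith
    _ = l ^ 2 * q / (1 - q) ^ 2 * (16 * rexp (l / 2)) := by rw [hr]; field_simp; ring
    _ ≤ l ^ 2 * q / (1 - q) ^ 2 * 27 := by gcongr; linarith
    _ = 27 * mm A l := by rw [mm]; ring

/-- Functions of quadratic size have expectation bounded by the variance. -/
lemma geo_bound (hA : 1 ≤ A) (hl : 0 < l) (hl1 : l ≤ 1) {g : ℕ → E} {D : ℝ}
    (hD : 0 ≤ D)
    (hg : ∀ k : ℕ, ‖g k‖ ≤ D * (((l * k) ^ 2 + mm A l) * rexp (l * k / 2))) :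
    Integrable g (geo A l) ∧ ∫ k, ‖g k‖ ∂(geo A l) ≤ 100 * D * mm A l ∧
      ‖∫ k, g k ∂(geo A l)‖ ≤ 100 * D * mm A l := by
  have hA0 : 0 < A := by linarith
  have := isProb_geo hA0 hl
  obtain ⟨h1, h2⟩ := geo_sq_exp hA hl hl1
  have hm := mm_pos hA0 hl
  have hm2 := mm_le_two hA hl hl1
  set m := mm A l
  have hpt : ∀ k : ℕ, ‖g k‖ ≤ D * ((1 + m) * ((l * k) ^ 2 * rexp (l * k / 2)) + 2 * m) := by
    intro k; refine (hg k).trans ?_; gcongr; set w := l * (k : ℝ) with hw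
    have key : rexp (w / 2) ≤ w ^ 2 * rexp (w / 2) + 2 := by
      have he := exp_pos (w / 2)
      rcases le_total w 1 with h | h
      · have : rexp (w / 2) ≤ 2 := by
          calc rexp (w / 2) ≤ rexp (1 / 2) := exp_le_exp.2 (by linarith)
            _ ≤ 2 := by
              have h2 : rexp (1 / 2) ^ 2 = rexp 1 := by rw [← Real.exp_nat_mul]; norm_num
              have h3 := exp_one_lt_d9
              nlinarith [exp_pos (1 / 2)]
        nlinarith [mul_nonneg (sq_nonneg w) he.le]
      · nlinarith [mul_le_mul_of_nonneg_right (one_le_pow₀ h : 1 ≤ w ^ 2) he.le]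
    nlinarith
  have hitg : Integrable (fun k : ℕ => D * ((1 + m) * ((l * k) ^ 2 * rexp (l * k / 2)) + 2 * m))
      (geo A l) := ((h1.const_mul _).add (integrable_const _)).const_mul _
  have hgi : Integrable g (geo A l) := by
    rw [geo_integrable_iff hA0 hl]
    have h3 := (geo_integrable_iff hA0 hl _).1 hitg
    refine Summable.of_nonneg_of_le (fun k => mul_nonneg (geo_weight_nonneg hA0 hl k) (norm_nonneg _))
      (fun k => ?_) h3
    refine mul_le_mul_of_nonneg_left ((hpt k).trans (le_abs_self _)) (geo_weight_nonneg hA0 hl k)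
  have hle : ∫ k, ‖g k‖ ∂(geo A l) ≤ 100 * D * m := by
    calc ∫ k, ‖g k‖ ∂(geo A l)
        ≤ ∫ k : ℕ, D * ((1 + m) * ((l * k) ^ 2 * rexp (l * k / 2)) + 2 * m) ∂(geo A l) :=
          integral_mono hgi.norm hitg hpt
      _ = D * ((1 + m) * (∫ k : ℕ, (l * k) ^ 2 * rexp (l * k / 2) ∂(geo A l)) + 2 * m) := by
          rw [integral_const_mul, integral_add (h1.const_mul _) (integrable_const _),
            integral_const_mul]
          simp
      _ ≤ D * ((1 + m) * (27 * m) + 2 * m) := by gcongr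
      _ ≤ D * (100 * m) := by gcongr; nlinarith
      _ = 100 * D * m := by ring
  exact ⟨hgi, hle, (norm_integral_le_integral_norm _).trans hle⟩

end Bochner

/-! ### Local factors -/

/-- The centred local variable. -/
def xk (A l : ℝ) (k : ℕ) : ℝ := l * k - l * qq A l / (1 - qq A l)

/-- `e^{itx}`. -/
def eg (A l t : ℝ) (k : ℕ) : ℂ := cexp ((t * xk A l k : ℝ) * I)

/-- Twisted expectation of a local factor. -/
def twE (A l t : ℝ) (f : ℕ → ℂ) : ℂ := ∫ k, eg A l t k * f k ∂(geo A l)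

/-- Covariance of a local factor with the centred variable. -/
def kaL (A l : ℝ) (f : ℕ → ℂ) : ℂ := ∫ k, (xk A l k : ℂ) * (f k - 1) ∂(geo A l)

/-- The local factor `f` is close to `1`. -/
def LF (l r δ : ℝ) (f : ℕ → ℂ) : Prop :=
  ∀ k : ℕ, ‖f k - 1‖ ≤ δ * ((l * k) ^ 2 * rexp (r * (l * k)))

lemma norm_eg (A l t : ℝ) (k : ℕ) : ‖eg A l t k‖ = 1 := norm_exp_ofReal_mul_I _

lemma mean_nonneg (hA : 1 ≤ A) (hl : 0 < l) : 0 ≤ l * qq A l / (1 - qq A l) := by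
  have := qq_lt_one (by linarith : 0 < A) hl
  exact div_nonneg (mul_nonneg hl.le (qq_pos _ _).le) (by linarith)

lemma mean_le_one (hA : 1 ≤ A) (hl : 0 < l) : l * qq A l / (1 - qq A l) ≤ 1 := by
  have h2 := mean_le (by linarith : 0 < A) hl
  have h3 : 1 / A ≤ 1 := by rw [div_le_one (by linarith)]; exact hA
  linarith

lemma mean_sq_le (hA : 1 ≤ A) (hl : 0 < l) :
    (l * qq A l / (1 - qq A l)) ^ 2 ≤ mm A l := by
  have h := qq_lt_one (by linarith : 0 < A) hl
  have h0 := qq_pos A l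
  rw [mm, div_pow]; gcongr; rw [mul_pow]; gcongr; nlinarith

lemma abs_xk_le (hA : 1 ≤ A) (hl : 0 < l) (k : ℕ) : |xk A l k| ≤ l * k + 1 := by
  have h1 := mean_nonneg hA hl
  have h2 := mean_le_one hA hl
  have h3 : 0 ≤ l * k := by positivity
  unfold xk; rw [abs_le]
  constructor <;> linarith

lemma xk_sq_le (hA : 1 ≤ A) (hl : 0 < l) (k : ℕ) :
    xk A l k ^ 2 ≤ 2 * ((l * k) ^ 2 + mm A l) := by
  have h1 := mean_sq_le hA hl
  unfold xk; nlinarith [sq_nonneg (l * k + l * qq A l / (1 - qq A l))]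

lemma one_add_le_exp_div {u n : ℝ} (hn : 1 ≤ n) : 1 + u ≤ n * rexp (u / n) := by
  have := add_one_le_exp (u / n)
  have hn0 : 0 < n := by linarith
  calc 1 + u ≤ n * (u / n + 1) := by rw [mul_add, mul_div_cancel₀ _ hn0.ne']; linarith
    _ ≤ _ := by gcongr

lemma norm_exp_I_sub_le (y : ℝ) : ‖cexp (y * I) - 1 - y * I‖ ≤ y ^ 2 * rexp |y| := by
  have h := norm_exp_sub_sum_le_norm_mul_exp (y * I) 2
  simp [sum_range_succ] at h; rw [sub_sub]
  simpa using h

lemma norm_exp_I_sub_le' (y : ℝ) :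
    ‖cexp (y * I) - 1 - y * I + y ^ 2 / 2‖ ≤ |y| ^ 3 * rexp |y| := by
  have h := norm_exp_sub_sum_le_norm_mul_exp (y * I) 3
  simp [sum_range_succ, mul_pow] at h
  convert h using 2
  ring

/-- Size of the exponential weight for `|t| ≤ 1/8`. -/
lemma exp_abs_tx_le (hA : 1 ≤ A) (hl : 0 < l) (ht : |t| ≤ 1 / 8) (k : ℕ) :
    rexp |t * xk A l k| ≤ 2 * rexp (l * k / 8) := by
  have h := abs_xk_le hA hl k
  calc rexp |t * xk A l k| ≤ rexp (1 / 8 + l * k / 8) := by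
        apply exp_le_exp.2; rw [abs_mul]; nlinarith [abs_nonneg t, abs_nonneg (xk A l k)]
    _ = rexp (1 / 8) * rexp (l * k / 8) := Real.exp_add _ _
    _ ≤ 2 * rexp (l * k / 8) := by
        gcongr
        have h1 : rexp (1 / 8) ≤ rexp (1 / 2) := exp_le_exp.2 (by norm_num)
        have h2 : rexp (1 / 2) ^ 2 = rexp 1 := by rw [← Real.exp_nat_mul]; norm_num
        have h3 := exp_one_lt_d9
        nlinarith [exp_pos (1 / 2)]

lemma integral_xk (hA : 1 ≤ A) (hl : 0 < l) :
    Integrable (xk A l) (geo A l) ∧ ∫ k, xk A l k ∂(geo A l) = 0 := by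
  have hA0 : 0 < A := by linarith
  have := isProb_geo hA0 hl
  obtain ⟨h1, h2⟩ := geo_mean hA0 hl
  refine ⟨h1.sub (integrable_const _), ?_⟩; unfold xk; rw [integral_sub h1 (integrable_const _), h2]
  simp

lemma integral_xk_sq (hA : 1 ≤ A) (hl : 0 < l) :
    Integrable (fun k => xk A l k ^ 2) (geo A l) ∧ ∫ k, xk A l k ^ 2 ∂(geo A l) = mm A l := by
  have hA0 : 0 < A := by linarith
  have := isProb_geo hA0 hl
  obtain ⟨h1, h2⟩ := geo_mean hA0 hl
  obtain ⟨h3, h4⟩ := geo_sq hA0 hl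
  have hq := qq_lt_one hA0 hl
  have e : (fun k => xk A l k ^ 2) = fun k : ℕ => ((l * k) ^ 2 -
      2 * (l * qq A l / (1 - qq A l)) * (l * k)) + (l * qq A l / (1 - qq A l)) ^ 2 := by
    funext k; unfold xk; ring
  have h5 : Integrable (fun k : ℕ => (l * k) ^ 2 -
      2 * (l * qq A l / (1 - qq A l)) * (l * k)) (geo A l) := h3.sub (h1.const_mul _)
  rw [e]; refine ⟨h5.add (integrable_const _), ?_⟩
  rw [integral_add h5 (integrable_const _), integral_sub h3 (h1.const_mul _), integral_const_mul,
    h2, h4]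
  have : 1 - qq A l ≠ 0 := by linarith
  simp only [integral_const, probReal_univ, smul_eq_mul, one_mul]; unfold mm; field_simp; ring

/-- The local characteristic function. -/
def phiL (A l t : ℝ) : ℂ := ∫ k, eg A l t k ∂(geo A l)

lemma integrable_eg (hA : 1 ≤ A) (hl : 0 < l) (t : ℝ) :
    Integrable (eg A l t) (geo A l) := by
  have := isProb_geo (by linarith : 0 < A) hl
  refine Integrable.of_bound (C := 1) (measurable_of_countable _).aestronglyMeasurable ?_
  exact .of_forall fun k => (norm_eg A l t k).le

lemma phiL_sub_one (hA : 1 ≤ A) (hl : 0 < l) (hl1 : l ≤ 1) (ht : |t| ≤ 1 / 8) :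
    ‖phiL A l t - 1‖ ≤ 400 * t ^ 2 * mm A l := by
  have hA0 : 0 < A := by linarith
  have := isProb_geo hA0 hl
  obtain ⟨hx, hx0⟩ := integral_xk hA hl
  have hb := geo_bound hA hl hl1 (g := fun k => eg A l t k - 1 - (t * xk A l k : ℝ) * I)
    (D := 4 * t ^ 2) (by positivity) (fun k => by
      refine (norm_exp_I_sub_le _).trans ?_
      have h1 := xk_sq_le hA hl k
      have h2 := exp_abs_tx_le hA hl ht k
      have h3 : rexp (l * k / 8) ≤ rexp (l * k / 2) := by
        apply exp_le_exp.2
        have : 0 ≤ l * k := by positivity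
        linarith
      calc (t * xk A l k) ^ 2 * rexp |t * xk A l k|
          ≤ (t ^ 2 * (2 * ((l * k) ^ 2 + mm A l))) * (2 * rexp (l * k / 2)) := by
            have := mm_pos hA0 hl
            rw [mul_pow]; gcongr; linarith
        _ = _ := by ring)
  have e : ∫ k, (eg A l t k - 1 - (t * xk A l k : ℝ) * I) ∂(geo A l) = phiL A l t - 1 := by
    have hi : Integrable (fun k => ((t * xk A l k : ℝ) : ℂ) * I) (geo A l) :=
      ((hx.const_mul t).ofReal).mul_const I
    have h0 : ∫ k, ((t * xk A l k : ℝ) : ℂ) * I ∂(geo A l) = 0 := by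
      rw [integral_mul_const, integral_complex_ofReal, integral_const_mul, hx0]; simp
    have he1 : Integrable (fun k => eg A l t k - 1) (geo A l) :=
      (integrable_eg hA hl t).sub (integrable_const _)
    rw [integral_sub he1 hi, integral_sub (integrable_eg hA hl t) (integrable_const _), h0]
    simp [phiL]
  rw [e] at hb
  calc _ ≤ _ := hb.2.2
    _ = _ := by ring

lemma phiL_expand (hA : 1 ≤ A) (hl : 0 < l) (hl1 : l ≤ 1) (ht : |t| ≤ 1 / 8) :
    ‖phiL A l t - 1 + t ^ 2 * mm A l / 2‖ ≤ 3200 * |t| ^ 3 * mm A l := by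
  have hA0 : 0 < A := by linarith
  have := isProb_geo hA0 hl
  obtain ⟨hx, hx0⟩ := integral_xk hA hl
  obtain ⟨hx2, hx20⟩ := integral_xk_sq hA hl
  have hb := geo_bound hA hl hl1 (g := fun k => eg A l t k - 1 - (t * xk A l k : ℝ) * I +
      ((t * xk A l k : ℝ) : ℂ) ^ 2 / 2)
    (D := 32 * |t| ^ 3) (by positivity) (fun k => by
      refine (norm_exp_I_sub_le' _).trans ?_
      have h1 := xk_sq_le hA hl k
      have h2 := exp_abs_tx_le hA hl ht k
      have h4 := abs_xk_le hA hl k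
      have hu : 0 ≤ l * k := by positivity
      have h5 := one_add_le_exp_div (u := l * (k : ℝ)) (by norm_num : (1 : ℝ) ≤ 8)
      have h3 : rexp (l * k / 8) * rexp (l * k / 8) ≤ rexp (l * k / 2) := by
        rw [← Real.exp_add]; apply exp_le_exp.2; linarith
      calc |t * xk A l k| ^ 3 * rexp |t * xk A l k|
          = |t| ^ 3 * (xk A l k ^ 2 * |xk A l k|) * rexp |t * xk A l k| := by
            rw [abs_mul, ← sq_abs (xk A l k)]; ring
        _ ≤ |t| ^ 3 * ((2 * ((l * k) ^ 2 + mm A l)) * (8 * rexp (l * k / 8))) *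
            (2 * rexp (l * k / 8)) := by
            have := mm_pos hA0 hl
            gcongr; linarith
        _ = 32 * |t| ^ 3 * (((l * k) ^ 2 + mm A l) *
            (rexp (l * k / 8) * rexp (l * k / 8))) := by ring
        _ ≤ _ := by
            have := mm_pos hA0 hl
            gcongr)
  have e : ∫ k, (eg A l t k - 1 - (t * xk A l k : ℝ) * I + ((t * xk A l k : ℝ) : ℂ) ^ 2 / 2)
      ∂(geo A l) = phiL A l t - 1 + t ^ 2 * mm A l / 2 := by
    have hi : Integrable (fun k => ((t * xk A l k : ℝ) : ℂ) * I) (geo A l) :=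
      ((hx.const_mul t).ofReal).mul_const I
    have h0 : ∫ k, ((t * xk A l k : ℝ) : ℂ) * I ∂(geo A l) = 0 := by
      rw [integral_mul_const, integral_complex_ofReal, integral_const_mul, hx0]; simp
    have e2 : (fun k => ((t * xk A l k : ℝ) : ℂ) ^ 2 / 2) =
        fun k => ((t ^ 2 / 2 * xk A l k ^ 2 : ℝ) : ℂ) := by
      funext k; push_cast; ring
    have hi2 : Integrable (fun k => ((t * xk A l k : ℝ) : ℂ) ^ 2 / 2) (geo A l) := by
      rw [e2]; exact (hx2.const_mul _).ofReal
    have h02 : ∫ k, (((t * xk A l k : ℝ) : ℂ) ^ 2 / 2 : ℂ) ∂(geo A l) = (t : ℂ) ^ 2 * (mm A l : ℂ) / 2 := by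
      rw [e2, integral_complex_ofReal, integral_const_mul, hx20]; push_cast; ring
    have he1 : Integrable (fun k => eg A l t k - 1) (geo A l) :=
      (integrable_eg hA hl t).sub (integrable_const _)
    have he2 : Integrable (fun k => eg A l t k - 1 - (t * xk A l k : ℝ) * I) (geo A l) :=
      he1.sub hi
    rw [integral_add he2 hi2, integral_sub he1 hi,
      integral_sub (integrable_eg hA hl t) (integrable_const _), h0, h02]
    simp [phiL]
  rw [e] at hb
  calc _ ≤ _ := hb.2.2
    _ = _ := by ring

lemma LF.bound {f : ℕ → ℂ} (hf : LF l (1 / 4) δ f) (hA : 1 ≤ A) (hl : 0 < l)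
    (hl1 : l ≤ 1) (hδ : 0 ≤ δ) :
    Integrable (fun k => f k - 1) (geo A l) ∧ ∫ k, ‖f k - 1‖ ∂(geo A l) ≤ 100 * δ * mm A l ∧
      ‖∫ k, (f k - 1) ∂(geo A l)‖ ≤ 100 * δ * mm A l := by
  refine geo_bound hA hl hl1 hδ fun k => (hf k).trans ?_
  have hu : 0 ≤ l * k := by positivity
  have := mm_pos (by linarith : 0 < A) hl
  gcongr
  · linarith
  · linarith

lemma LF.integrable {f : ℕ → ℂ} (hf : LF l (1 / 4) δ f) (hA : 1 ≤ A) (hl : 0 < l)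
    (hl1 : l ≤ 1) (hδ : 0 ≤ δ) : Integrable f (geo A l) := by
  have := isProb_geo (by linarith : 0 < A) hl
  have h := (hf.bound hA hl hl1 hδ).1.add (integrable_const (1 : ℂ))
  refine h.congr (.of_forall fun k => ?_)
  simp

lemma LF.integral_sub_one {f : ℕ → ℂ} (hf : LF l (1 / 4) δ f) (hA : 1 ≤ A)
    (hl : 0 < l) (hl1 : l ≤ 1) (hδ : 0 ≤ δ) :
    ∫ k, (f k - 1) ∂(geo A l) = ∫ k, f k ∂(geo A l) - 1 := by
  have := isProb_geo (by linarith : 0 < A) hl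
  rw [integral_sub (hf.integrable hA hl hl1 hδ) (integrable_const _)]; simp

lemma LF.kaL {f : ℕ → ℂ} (hf : LF l (1 / 4) δ f) (hA : 1 ≤ A) (hl : 0 < l)
    (hl1 : l ≤ 1) (hδ : 0 ≤ δ) :
    Integrable (fun k => (xk A l k : ℂ) * (f k - 1)) (geo A l) ∧
      ‖kaL A l f‖ ≤ 800 * δ * mm A l := by
  have h := geo_bound hA hl hl1 (g := fun k => (xk A l k : ℂ) * (f k - 1)) (D := 8 * δ)
    (by positivity) (fun k => by
      have hu : 0 ≤ l * k := by positivity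
      have h5 := one_add_le_exp_div (u := l * (k : ℝ)) (by norm_num : (1 : ℝ) ≤ 8)
      have h4 := abs_xk_le hA hl k
      rw [norm_mul, norm_real, norm_eq_abs]
      calc |xk A l k| * ‖f k - 1‖
          ≤ (8 * rexp (l * k / 8)) * (δ * ((l * k) ^ 2 * rexp (1 / 4 * (l * k)))) := by
            gcongr
            · linarith
            · exact hf k
        _ = 8 * δ * ((l * k) ^ 2 * (rexp (l * k / 8) * rexp (1 / 4 * (l * k)))) := by ring
        _ ≤ _ := by
            have := mm_pos (by linarith : 0 < A) hl
            gcongr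
            · linarith
            · rw [← Real.exp_add]
              apply exp_le_exp.2
              linarith)
  refine ⟨h.1, ?_⟩
  calc _ ≤ _ := h.2.2
    _ = _ := by ring

/-- Expansion of the twisted expectation. -/
lemma LF.twE_expand {f : ℕ → ℂ} (hf : LF l (1 / 4) δ f) (hA : 1 ≤ A) (hl : 0 < l)
    (hl1 : l ≤ 1) (hδ : 0 ≤ δ) (ht : |t| ≤ 1 / 8) :
    ‖twE A l t f - (phiL A l t + (∫ k, f k ∂(geo A l) - 1) + t * I * _root_.kaL A l f)‖ ≤
      51200 * (t ^ 2 * δ) * mm A l := by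
  have hA0 : 0 < A := by linarith
  have := isProb_geo hA0 hl
  obtain ⟨hk, -⟩ := hf.kaL hA hl hl1 hδ
  have hfi := hf.integrable hA hl hl1 hδ
  have hb := geo_bound hA hl hl1
    (g := fun k => (eg A l t k - 1 - (t * xk A l k : ℝ) * I) * (f k - 1))
    (D := 512 * (t ^ 2 * δ)) (by positivity) (fun k => by
      have h2 := exp_abs_tx_le hA hl ht k
      have h5 := one_add_le_exp_div (u := l * (k : ℝ)) (by norm_num : (1 : ℝ) ≤ 16)
      have h4 := abs_xk_le hA hl k
      have h6 : xk A l k ^ 2 ≤ (16 * rexp (l * k / 16)) ^ 2 := by rw [← sq_abs]; gcongr; linarith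
      rw [norm_mul]
      calc _ ≤ ((t * xk A l k) ^ 2 * rexp |t * xk A l k|) *
            (δ * ((l * k) ^ 2 * rexp (1 / 4 * (l * k)))) := by
            gcongr
            · exact norm_exp_I_sub_le _
            · exact hf k
        _ ≤ ((t ^ 2 * (16 * rexp (l * k / 16)) ^ 2) * (2 * rexp (l * k / 8))) *
            (δ * ((l * k) ^ 2 * rexp (1 / 4 * (l * k)))) := by
            rw [mul_pow]; gcongr
        _ = 512 * (t ^ 2 * δ) * ((l * k) ^ 2 * (rexp (l * k / 16) ^ 2 * rexp (l * k / 8) *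
            rexp (1 / 4 * (l * k)))) := by ring
        _ ≤ _ := by
            have := mm_pos hA0 hl
            gcongr
            · linarith
            · rw [← Real.exp_nat_mul, ← Real.exp_add, ← Real.exp_add]
              apply exp_le_exp.2; push_cast
              linarith)
  have e : ∫ k, (eg A l t k - 1 - (t * xk A l k : ℝ) * I) * (f k - 1) ∂(geo A l) =
      twE A l t f - (phiL A l t + (∫ k, f k ∂(geo A l) - 1) + t * I * _root_.kaL A l f) := by
    have hef : Integrable (fun k => eg A l t k * f k) (geo A l) :=
      hfi.bdd_mul (c := 1) (measurable_of_countable _).aestronglyMeasurable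
        (.of_forall fun k => (norm_eg A l t k).le)
    have e1 : (fun k => (eg A l t k - 1 - (t * xk A l k : ℝ) * I) * (f k - 1)) =
        fun k => (eg A l t k * f k - eg A l t k - (f k - 1)) -
          (t * I) * ((xk A l k : ℂ) * (f k - 1)) := by
      funext k; push_cast; ring
    have h1 : Integrable (fun k => f k - 1) (geo A l) := hfi.sub (integrable_const _)
    have h2 : Integrable (fun k => eg A l t k * f k - eg A l t k) (geo A l) :=
      hef.sub (integrable_eg hA hl t)
    have h3 : Integrable (fun k => eg A l t k * f k - eg A l t k - (f k - 1)) (geo A l) :=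
      h2.sub h1
    rw [e1, integral_sub h3 (hk.const_mul _), integral_sub h2 h1,
      integral_sub hef (integrable_eg hA hl t),
      integral_const_mul, hf.integral_sub_one hA hl hl1 hδ]
    unfold twE phiL _root_.kaL; ring
  rw [e] at hb
  calc _ ≤ _ := hb.2.2
    _ = _ := by ring

/-! ### Logarithms of local factors -/

lemma exists_exp_eq_one_add {a : ℂ} (ha : ‖a‖ ≤ 1 / 2) :
    ∃ e : ℂ, 1 + a = cexp (a + e) ∧ ‖e‖ ≤ ‖a‖ ^ 2 := by
  refine ⟨Complex.log (1 + a) - a, ?_, ?_⟩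
  · rw [add_sub_cancel, Complex.exp_log]
    intro h
    have : ‖a‖ = 1 := by rw [show a = -1 by linear_combination h]; simp
    linarith
  · have h := norm_log_one_add_sub_self_le (z := a) (by linarith)
    refine h.trans ?_
    have h2 : (1 - ‖a‖)⁻¹ ≤ 2 := by rw [inv_le_comm₀ (by linarith) (by norm_num)]; linarith
    nlinarith [sq_nonneg ‖a‖]

lemma phiL_exp (hA : 1 ≤ A) (hl : 0 < l) (hl1 : l ≤ 1) (ht : |t| ≤ 1 / 10 ^ 4) :
    ∃ e : ℂ, phiL A l t = cexp (-(t ^ 2 * mm A l / 2) + e) ∧ ‖e‖ ≤ 400000 * |t| ^ 3 * mm A l := by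
  have h1 := phiL_sub_one hA hl hl1 (t := t) (by linarith)
  have h2 := phiL_expand hA hl hl1 (t := t) (by linarith)
  have hm := mm_pos (by linarith : 0 < A) hl
  have hm2 := mm_le_two hA hl hl1
  set m := mm A l
  have ht0 := abs_nonneg t
  have ht2 : t ^ 2 = |t| ^ 2 := (sq_abs t).symm
  obtain ⟨e, he1, he2⟩ := exists_exp_eq_one_add (a := phiL A l t - 1) (by
    refine h1.trans ?_; rw [ht2]
    nlinarith [mul_nonneg ht0 ht0])
  refine ⟨(phiL A l t - 1 + t ^ 2 * m / 2) + e, ?_, ?_⟩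
  · rw [add_sub_cancel] at he1
    rw [he1]; congr 1; rw [← he1]; ring
  · have h3 : ‖phiL A l t - 1‖ ^ 2 ≤ (400 * t ^ 2 * m) ^ 2 := by gcongr
    have h4 : (400 * t ^ 2 * m) ^ 2 ≤ 320000 * |t| ^ 3 * m := by
      rw [ht2]
      have h5 : m ^ 2 ≤ 2 * m := by nlinarith
      have h6 : |t| ^ 4 ≤ |t| ^ 3 := pow_le_pow_of_le_one ht0 (by linarith) (by norm_num)
      calc (400 * |t| ^ 2 * m) ^ 2 = 160000 * (|t| ^ 4 * m ^ 2) := by ring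
        _ ≤ 160000 * (|t| ^ 3 * (2 * m)) := by gcongr
        _ = _ := by ring
    calc _ ≤ _ := norm_add_le _ _
      _ ≤ 3200 * |t| ^ 3 * m + 320000 * |t| ^ 3 * m := by linarith
      _ ≤ _ := by nlinarith [mul_nonneg (pow_nonneg ht0 3) hm.le]

lemma LF.b_exp {f : ℕ → ℂ} (hf : LF l (1 / 4) δ f) (hA : 1 ≤ A) (hl : 0 < l)
    (hl1 : l ≤ 1) (hδ : 0 ≤ δ) (hδ1 : δ ≤ 1 / 10 ^ 4) :
    ∃ e : ℂ, ∫ k, f k ∂(geo A l) = cexp e ∧ ‖e‖ ≤ 200 * δ * mm A l := by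
  have h1 := (hf.bound hA hl hl1 hδ).2.2
  rw [hf.integral_sub_one hA hl hl1 hδ] at h1
  have hm2 := mm_le_two hA hl hl1
  set m := mm A l
  set b := ∫ k, f k ∂(geo A l)
  have h2 : ‖b - 1‖ ≤ 1 / 2 := h1.trans (by nlinarith)
  obtain ⟨e, he1, he2⟩ := exists_exp_eq_one_add h2
  refine ⟨b - 1 + e, by rw [← he1]; ring, ?_⟩
  calc _ ≤ _ := norm_add_le _ _
    _ ≤ ‖b - 1‖ + ‖b - 1‖ ^ 2 := by gcongr
    _ ≤ 2 * ‖b - 1‖ := by nlinarith [norm_nonneg (b - 1)]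
    _ ≤ _ := by linarith

set_option maxHeartbeats 800000 in
lemma LF.twE_exp {f : ℕ → ℂ} (hf : LF l (1 / 4) δ f) (hA : 1 ≤ A) (hl : 0 < l)
    (hl1 : l ≤ 1) (hδ : 0 ≤ δ) (hδ1 : δ ≤ 1 / 10 ^ 4) (ht : |t| ≤ 1 / 10 ^ 4) :
    ∃ e : ℂ, twE A l t f = phiL A l t * (∫ k, f k ∂(geo A l)) *
      cexp (t * I * _root_.kaL A l f + e) ∧ ‖e‖ ≤ 10 ^ 7 * (t ^ 2 * δ + |t| * δ ^ 2) * mm A l := by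
  have h1 := (hf.bound hA hl hl1 hδ).2.2
  rw [hf.integral_sub_one hA hl hl1 hδ] at h1
  have h2 := phiL_sub_one hA hl hl1 (t := t) (by linarith)
  have h3 := (hf.kaL hA hl hl1 hδ).2
  have h4 := hf.twE_expand hA hl hl1 hδ (t := t) (by linarith)
  have hm := mm_pos (by linarith : 0 < A) hl
  have hm2 := mm_le_two hA hl hl1
  set m := mm A l
  set b := ∫ k, f k ∂(geo A l)
  set φ := phiL A l t
  set κ := _root_.kaL A l f
  set G := twE A l t f
  have ht0 := abs_nonneg t
  have ht2 : t ^ 2 = |t| ^ 2 := (sq_abs t).symm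
  have hφ1 : ‖φ - 1‖ ≤ 1 / 4 := h2.trans (by rw [ht2]; nlinarith [mul_nonneg ht0 ht0])
  have hφb : ‖φ * b - 1‖ ≤ 150 * δ * m + 400 * t ^ 2 * m := by
    have : φ * b - 1 = φ * (b - 1) + (φ - 1) := by ring
    rw [this]
    have hφ : ‖φ‖ ≤ 3 / 2 := by
      calc ‖φ‖ = ‖1 + (φ - 1)‖ := by congr 1; ring
        _ ≤ ‖(1 : ℂ)‖ + ‖φ - 1‖ := norm_add_le _ _
        _ ≤ 3 / 2 := by rw [norm_one]; linarith
    calc _ ≤ _ := norm_add_le _ _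
      _ ≤ 3 / 2 * (100 * δ * m) + 400 * t ^ 2 * m := by rw [norm_mul]; gcongr
      _ = _ := by ring
  have hφb2 : ‖φ * b - 1‖ ≤ 1 / 2 := hφb.trans (by rw [ht2]; nlinarith [mul_nonneg ht0 ht0])
  have hφbn : 1 / 2 ≤ ‖φ * b‖ := by
    have : ‖(1 : ℂ)‖ ≤ ‖φ * b‖ + ‖φ * b - 1‖ := by
      calc ‖(1 : ℂ)‖ = ‖φ * b - (φ * b - 1)‖ := by congr 1; ring
        _ ≤ _ := norm_sub_le _ _
    rw [norm_one] at this; linarith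
  have hne : φ * b ≠ 0 := by intro h; rw [h, norm_zero] at hφbn; linarith
  obtain ⟨hneφ, hneb⟩ := mul_ne_zero_iff.1 hne
  have hinv : ‖(φ * b)⁻¹‖ ≤ 2 := by
    rw [norm_inv, inv_le_comm₀ (by linarith) (by norm_num)]; linarith
  set r := G - (φ + (b - 1) + t * I * κ) with hr
  set a := G / (φ * b) - 1 with ha
  have hG : G = φ * b * (1 + a) := by rw [ha]; field_simp; ring
  have haeq : a - t * I * κ = (φ * b)⁻¹ * (t * I * κ * (1 - φ * b) + r - (φ - 1) * (b - 1)) := by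
    rw [ha, hr]; field_simp; ring
  have hm2' : m ^ 2 ≤ 2 * m := by nlinarith
  have hbd : ‖a - t * I * κ‖ ≤ 4 * 10 ^ 6 * (t ^ 2 * δ + |t| * δ ^ 2) * m := by
    rw [haeq, norm_mul]
    have e1 : ‖t * I * κ * (1 - φ * b)‖ ≤ |t| * (800 * δ * m) * (150 * δ * m + 400 * t ^ 2 * m) := by
      rw [norm_mul, norm_mul, norm_mul, norm_I, mul_one, norm_real, norm_eq_abs, norm_sub_rev 1]
      gcongr
    have e2 : ‖(φ - 1) * (b - 1)‖ ≤ (400 * t ^ 2 * m) * (100 * δ * m) := by rw [norm_mul]; gcongr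
    have e3 : ‖t * I * κ * (1 - φ * b) + r - (φ - 1) * (b - 1)‖ ≤
        |t| * (800 * δ * m) * (150 * δ * m + 400 * t ^ 2 * m) + 51200 * (t ^ 2 * δ) * m +
        (400 * t ^ 2 * m) * (100 * δ * m) :=
      (norm_sub_le _ _).trans (add_le_add ((norm_add_le _ _).trans (add_le_add e1 h4)) e2)
    have e4 : |t| * (800 * δ * m) * (150 * δ * m + 400 * t ^ 2 * m) ≤
        240000 * (|t| * δ ^ 2) * m + 640000 * (t ^ 2 * δ) * m := by
      have : |t| * t ^ 2 ≤ t ^ 2 := by nlinarith [sq_nonneg t]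
      calc _ = 120000 * (|t| * δ ^ 2) * m ^ 2 + 320000 * (|t| * t ^ 2 * δ) * m ^ 2 := by ring
        _ ≤ 120000 * (|t| * δ ^ 2) * (2 * m) + 320000 * (t ^ 2 * δ) * (2 * m) := by gcongr
        _ = _ := by ring
    have e5 : (400 * t ^ 2 * m) * (100 * δ * m) ≤ 80000 * (t ^ 2 * δ) * m := by
      calc _ = 40000 * (t ^ 2 * δ) * m ^ 2 := by ring
        _ ≤ 40000 * (t ^ 2 * δ) * (2 * m) := by gcongr
        _ = _ := by ring
    have p1 : 0 ≤ (t ^ 2 * δ) * m := by positivity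
    have p2 : 0 ≤ (|t| * δ ^ 2) * m := by positivity
    calc _ ≤ 2 * (240000 * (|t| * δ ^ 2) * m + 640000 * (t ^ 2 * δ) * m +
          51200 * (t ^ 2 * δ) * m + 80000 * (t ^ 2 * δ) * m) := by
          gcongr; linarith
      _ ≤ _ := by linarith
  have hat : ‖a‖ ≤ 1600 * |t| * δ * m := by
    have e1 : ‖t * I * κ‖ ≤ |t| * (800 * δ * m) := by
      rw [norm_mul, norm_mul, norm_I, mul_one, norm_real, norm_eq_abs]; gcongr
    have e2 : ‖a‖ ≤ ‖a - t * I * κ‖ + ‖t * I * κ‖ := by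
      calc ‖a‖ = ‖(a - t * I * κ) + t * I * κ‖ := by congr 1; ring
        _ ≤ _ := norm_add_le _ _
    have e3 : 4 * 10 ^ 6 * (t ^ 2 * δ + |t| * δ ^ 2) * m ≤ 800 * (|t| * δ * m) := by
      rw [ht2]
      have p : 0 ≤ |t| * δ * m := by positivity
      calc _ = 4 * 10 ^ 6 * (|t| + δ) * (|t| * δ * m) := by ring
        _ ≤ 800 * (|t| * δ * m) := by gcongr; linarith
    linarith
  have hahalf : ‖a‖ ≤ 1 / 2 := by
    refine hat.trans ?_
    have : |t| * δ ≤ 1 / 10 ^ 4 * (1 / 10 ^ 4) := by gcongr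
    nlinarith
  obtain ⟨e, he1, he2⟩ := exists_exp_eq_one_add hahalf
  refine ⟨(a - t * I * κ) + e, ?_, ?_⟩
  · rw [hG, he1]; congr 2; ring
  · have e1 : ‖a‖ ^ 2 ≤ (1600 * |t| * δ * m) ^ 2 := by gcongr
    have e2 : (1600 * |t| * δ * m) ^ 2 ≤ 10 ^ 6 * (t ^ 2 * δ) * m := by
      have p : 0 ≤ t ^ 2 * δ := by positivity
      calc _ = 2560000 * (t ^ 2 * δ) * (δ * m ^ 2) := by rw [ht2]; ring
        _ ≤ 2560000 * (t ^ 2 * δ) * (1 / 10 ^ 4 * (2 * m)) := by gcongr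
        _ ≤ _ := by nlinarith [mul_nonneg p hm.le]
    have p1 : 0 ≤ (t ^ 2 * δ) * m := by positivity
    have p2 : 0 ≤ (|t| * δ ^ 2) * m := by positivity
    calc _ ≤ _ := norm_add_le _ _
      _ ≤ 4 * 10 ^ 6 * (t ^ 2 * δ + |t| * δ ^ 2) * m + 10 ^ 6 * (t ^ 2 * δ) * m := by linarith
      _ ≤ _ := by linarith

lemma LF.mono {r' : ℝ} {f : ℕ → ℂ} (hf : LF l r δ f) (hl : 0 < l) (hδ : 0 ≤ δ) (hr : r ≤ r') :
    LF l r' δ f := by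
  intro k; refine (hf k).trans ?_; gcongr

lemma LF.conj {f : ℕ → ℂ} (hf : LF l r δ f) :
    LF l r δ (fun k => conj (f k)) := by
  intro k
  have : conj (f k) - 1 = conj (f k - 1) := by simp
  rw [this, RCLike.norm_conj]; exact hf k

lemma LF.sq_bound {f : ℕ → ℂ} (hf : LF l (1 / 16) δ f) (hl : 0 < l) (k : ℕ) :
    ‖f k - 1‖ ^ 2 ≤ 256 * δ ^ 2 * ((l * k) ^ 2 * rexp (1 / 4 * (l * k))) := by
  have h5 := one_add_le_exp_div (u := l * (k : ℝ)) (by norm_num : (1 : ℝ) ≤ 16)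
  have h6 : l * k ≤ 16 * rexp (l * k / 16) := by linarith
  calc ‖f k - 1‖ ^ 2 ≤ (δ * ((l * k) ^ 2 * rexp (1 / 16 * (l * k)))) ^ 2 := by
        have := hf k
        gcongr
    _ = δ ^ 2 * (l * k) ^ 2 * (rexp (1 / 16 * (l * k)) ^ 2 * (l * k) ^ 2) := by ring
    _ ≤ δ ^ 2 * (l * k) ^ 2 * (rexp (1 / 16 * (l * k)) ^ 2 *
        (16 * rexp (l * k / 16)) ^ 2) := by gcongr
    _ = 256 * δ ^ 2 * ((l * k) ^ 2 * (rexp (1 / 16 * (l * k)) ^ 2 *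
        rexp (l * k / 16) ^ 2)) := by ring
    _ = _ := by
        rw [← Real.exp_nat_mul, ← Real.exp_nat_mul, ← Real.exp_add]; congr 3; push_cast; ring_nf

lemma LF.normSq {f : ℕ → ℂ} (hf : LF l (1 / 16) δ f) (hl : 0 < l) (hδ : 0 ≤ δ)
    (hδ1 : δ ≤ 1) : LF l (1 / 4) (258 * δ) (fun k => f k * conj (f k)) := by
  intro k
  have e : f k * conj (f k) - 1 = (f k - 1) + conj (f k - 1) + (f k - 1) * conj (f k - 1) := by
    rw [map_sub, map_one]; ring
  have h1 := (hf.mono hl hδ (by norm_num : (1 / 16 : ℝ) ≤ 1 / 4)) k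
  have h2 := hf.sq_bound hl k
  set W := (l * k) ^ 2 * rexp (1 / 4 * (l * k)) with hW
  have hW0 : 0 ≤ W := by positivity
  rw [e]
  calc _ ≤ ‖f k - 1‖ + ‖f k - 1‖ + ‖f k - 1‖ * ‖f k - 1‖ := by
        refine (norm_add_le _ _).trans (add_le_add ((norm_add_le _ _).trans ?_) ?_)
        · rw [RCLike.norm_conj]
        · rw [norm_mul, RCLike.norm_conj]
    _ ≤ 2 * (δ * W) + 256 * δ ^ 2 * W := by nlinarith
    _ ≤ 258 * δ * W := by nlinarith [mul_nonneg hδ hW0]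

lemma LF.sq_moments {f : ℕ → ℂ} (hf : LF l (1 / 16) δ f) (hA : 1 ≤ A) (hl : 0 < l)
    (hl1 : l ≤ 1) :
    (Integrable (fun k => (f k - 1) * conj (f k - 1)) (geo A l) ∧
    ‖∫ k, (f k - 1) * conj (f k - 1) ∂(geo A l)‖ ≤ 25600 * δ ^ 2 * mm A l) ∧
    Integrable (fun k => (xk A l k : ℂ) * ((f k - 1) * conj (f k - 1))) (geo A l) ∧
    ‖∫ k, (xk A l k : ℂ) * ((f k - 1) * conj (f k - 1)) ∂(geo A l)‖ ≤ 204800 * δ ^ 2 * mm A l := by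
  have hm := mm_pos (by linarith : 0 < A) hl
  constructor
  · have h := geo_bound hA hl hl1 (g := fun k => (f k - 1) * conj (f k - 1))
      (D := 256 * δ ^ 2) (by positivity) (fun k => by
        have h2 := hf.sq_bound hl k
        have hu : 0 ≤ l * k := by positivity
        rw [norm_mul, RCLike.norm_conj, ← sq]; refine h2.trans ?_; gcongr
        · linarith
        · linarith)
    refine ⟨h.1, h.2.2.trans (le_of_eq (by ring))⟩
  · have h := geo_bound hA hl hl1
      (g := fun k => (xk A l k : ℂ) * ((f k - 1) * conj (f k - 1)))
      (D := 2048 * δ ^ 2) (by positivity) (fun k => by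
        have h2 := hf.sq_bound hl k
        have hu : 0 ≤ l * k := by positivity
        have h5 := one_add_le_exp_div (u := l * (k : ℝ)) (by norm_num : (1 : ℝ) ≤ 8)
        have h4 := abs_xk_le hA hl k
        rw [norm_mul, norm_mul, RCLike.norm_conj, ← sq, norm_real, norm_eq_abs]
        calc _ ≤ (8 * rexp (l * k / 8)) *
              (256 * δ ^ 2 * ((l * k) ^ 2 * rexp (1 / 4 * (l * k)))) := by
              gcongr; linarith
          _ = 2048 * δ ^ 2 * ((l * k) ^ 2 * (rexp (l * k / 8) * rexp (1 / 4 * (l * k)))) := by ring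
          _ ≤ _ := by
              gcongr
              · linarith
              · rw [← Real.exp_add]
                apply exp_le_exp.2
                linarith)
    refine ⟨h.1, h.2.2.trans (le_of_eq (by ring))⟩

lemma LF.kaL_normSq {f : ℕ → ℂ} (hf : LF l (1 / 16) δ f) (hA : 1 ≤ A) (hl : 0 < l)
    (hl1 : l ≤ 1) (hδ : 0 ≤ δ) :
    ‖_root_.kaL A l (fun k => f k * conj (f k)) - (_root_.kaL A l f +
      _root_.kaL A l (fun k => conj (f k)))‖ ≤ 204800 * δ ^ 2 * mm A l := by
  obtain ⟨-, h3, h4⟩ := hf.sq_moments hA hl hl1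
  have hf4 := hf.mono hl hδ (by norm_num : (1 / 16 : ℝ) ≤ 1 / 4)
  have k1 := (hf4.kaL hA hl hl1 hδ).1
  have k2 := (hf4.conj.kaL hA hl hl1 hδ).1
  have e : _root_.kaL A l (fun k => f k * conj (f k)) - (_root_.kaL A l f +
      _root_.kaL A l (fun k => conj (f k))) =
      ∫ k, (xk A l k : ℂ) * ((f k - 1) * conj (f k - 1)) ∂(geo A l) := by
    unfold _root_.kaL
    have e1 : (fun k => (xk A l k : ℂ) * (f k * conj (f k) - 1)) =
        fun k => ((xk A l k : ℂ) * (f k - 1) + (xk A l k : ℂ) * (conj (f k) - 1)) +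
          (xk A l k : ℂ) * ((f k - 1) * conj (f k - 1)) := by
      funext k; rw [map_sub, map_one]; ring
    have k3 : Integrable (fun k => (xk A l k : ℂ) * (f k - 1) +
      (xk A l k : ℂ) * (conj (f k) - 1)) (geo A l) := k1.add k2
    rw [e1, integral_add k3 h3, integral_add k1 k2]; ring
  rw [e]; exact h4

/-- Second moment against the square of the first. -/
lemma LF.b_normSq {f : ℕ → ℂ} (hf : LF l (1 / 16) δ f) (hA : 1 ≤ A) (hl : 0 < l)
    (hl1 : l ≤ 1) (hδ : 0 ≤ δ) (hδ1 : δ ≤ 1 / 10 ^ 4) :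
    ∃ e : ℂ, ∫ k, f k * conj (f k) ∂(geo A l) =
      (∫ k, f k ∂(geo A l)) * (∫ k, conj (f k) ∂(geo A l)) * cexp e ∧
      ‖e‖ ≤ 10 ^ 6 * δ ^ 2 * mm A l := by
  have := isProb_geo (by linarith : 0 < A) hl
  obtain ⟨⟨h3, h4⟩, -⟩ := hf.sq_moments hA hl hl1
  have hf4 := hf.mono hl hδ (by norm_num : (1 / 16 : ℝ) ≤ 1 / 4)
  have i1 := hf4.integrable hA hl hl1 hδ
  have i2 := hf4.conj.integrable hA hl hl1 hδ
  have b1 := (hf4.bound hA hl hl1 hδ).2.2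
  have b2 := (hf4.conj.bound hA hl hl1 hδ).2.2
  rw [hf4.integral_sub_one hA hl hl1 hδ] at b1; rw [hf4.conj.integral_sub_one hA hl hl1 hδ] at b2
  have hm := mm_pos (by linarith : 0 < A) hl
  have hm2 := mm_le_two hA hl hl1
  have e1 : ∫ k, f k * conj (f k) ∂(geo A l) = (∫ k, f k ∂(geo A l)) +
      (∫ k, conj (f k) ∂(geo A l)) - 1 + ∫ k, (f k - 1) * conj (f k - 1) ∂(geo A l) := by
    have e1 : (fun k => f k * conj (f k)) =
        fun k => (f k + conj (f k) - 1) + (f k - 1) * conj (f k - 1) := by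
      funext k; rw [map_sub, map_one]; ring
    have k2 : Integrable (fun k => f k + conj (f k)) (geo A l) := i1.add i2
    have k3 : Integrable (fun k => f k + conj (f k) - 1) (geo A l) :=
      k2.sub (integrable_const _)
    rw [e1, integral_add k3 h3, integral_sub k2 (integrable_const _), integral_add i1 i2]; simp
  rw [e1]; set m := mm A l
  set b := ∫ k, f k ∂(geo A l)
  set b' := ∫ k, conj (f k) ∂(geo A l)
  set W := ∫ k, (f k - 1) * conj (f k - 1) ∂(geo A l)
  have hm2' : m ^ 2 ≤ 2 * m := by nlinarith
  have lower : ∀ c : ℂ, ‖c - 1‖ ≤ 100 * δ * m → 3 / 4 ≤ ‖c‖ := by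
    intro c hc
    have h : ‖(1 : ℂ)‖ ≤ ‖c‖ + ‖c - 1‖ := by
      calc ‖(1 : ℂ)‖ = ‖c - (c - 1)‖ := by congr 1; ring
        _ ≤ _ := norm_sub_le _ _
    rw [norm_one] at h; nlinarith
  have hbb : 1 / 2 ≤ ‖b * b'‖ := by rw [norm_mul]; nlinarith [lower b b1, lower b' b2]
  have hne : b * b' ≠ 0 := by intro h; rw [h, norm_zero] at hbb; linarith
  obtain ⟨hneb, hneb'⟩ := mul_ne_zero_iff.1 hne
  set a := (W - (b - 1) * (b' - 1)) / (b * b') with ha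
  have haeq : b + b' - 1 + W = b * b' * (1 + a) := by rw [ha]; field_simp; ring
  have hna : ‖a‖ ≤ 91200 * δ ^ 2 * m := by
    rw [ha, norm_div, div_le_iff₀ (by linarith)]
    have h5 : ‖W - (b - 1) * (b' - 1)‖ ≤ 25600 * δ ^ 2 * m + (100 * δ * m) * (100 * δ * m) := by
      refine (norm_sub_le _ _).trans (add_le_add h4 ?_); rw [norm_mul]; gcongr
    nlinarith
  have hδ2 : δ ^ 2 ≤ 1 / 10 ^ 8 := by
    calc δ ^ 2 ≤ (1 / 10 ^ 4) ^ 2 := by gcongr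
      _ = _ := by norm_num
  obtain ⟨e, he1, he2⟩ := exists_exp_eq_one_add (a := a) (hna.trans (by nlinarith))
  refine ⟨a + e, by rw [haeq, he1], ?_⟩
  have : ‖a‖ ≤ 1 := hna.trans (by nlinarith)
  calc _ ≤ _ := norm_add_le _ _
    _ ≤ ‖a‖ + ‖a‖ ^ 2 := by gcongr
    _ ≤ 2 * ‖a‖ := by nlinarith [norm_nonneg a]
    _ ≤ _ := by nlinarith [mul_nonneg (sq_nonneg δ) hm.le]

/-! ### The divisor transform at a prime -/

/-- The average of `(d/√n)^ζ` over the divisors `d` of `n = p^k`. -/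
def Tk (l : ℝ) (ζ : ℂ) (k : ℕ) : ℂ :=
  ((k : ℂ) + 1)⁻¹ * ∑ j ∈ range (k + 1), cexp (ζ * ((l * (j - k / 2) : ℝ) : ℂ))

/-- The local contribution to `ϱ²`. -/
def rl2 (A l : ℝ) : ℝ := l ^ 2 * (qq A l - qq A l ^ 2 / 3) / (4 * (1 - qq A l) ^ 2)

lemma sum_range_sub (c : ℂ) (n : ℕ) :
    ∑ j ∈ range n, ((j : ℂ) - c) = n * (n - 1) / 2 - n * c := by
  induction n with
  | zero => simp
  | succ n ih => rw [sum_range_succ, ih]; push_cast; ring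

lemma sum_range_sub_sq (c : ℂ) (n : ℕ) :
    ∑ j ∈ range n, ((j : ℂ) - c) ^ 2 =
      n * (n - 1) * (2 * n - 1) / 6 - c * (n * (n - 1)) + n * c ^ 2 := by
  induction n with
  | zero => simp
  | succ n ih => rw [sum_range_succ, ih]; push_cast; ring

lemma sum_range_sub_cube (c : ℂ) (n : ℕ) :
    ∑ j ∈ range n, ((j : ℂ) - c) ^ 3 =
      (n * (n - 1) / 2) ^ 2 - 3 * c * (n * (n - 1) * (2 * n - 1) / 6) +
        3 * c ^ 2 * (n * (n - 1) / 2) - n * c ^ 3 := by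
  induction n with
  | zero => simp
  | succ n ih => rw [sum_range_succ, ih]; push_cast; ring

lemma abs_node_le (hl : 0 < l) {j k : ℕ} (hj : j ∈ range (k + 1)) :
    |l * ((j : ℝ) - k / 2)| ≤ l * k / 2 := by
  have h : (j : ℝ) ≤ k := by
    have := mem_range.1 hj
    exact_mod_cast Nat.lt_succ_iff.1 this
  rw [abs_mul, abs_of_pos hl, mul_div_assoc]; gcongr; rw [abs_le]
  constructor <;> linarith

lemma norm_avg_le {k : ℕ} {g : ℕ → ℂ} {B : ℝ} (hg : ∀ j ∈ range (k + 1), ‖g j‖ ≤ B) :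
    ‖((k : ℂ) + 1)⁻¹ * ∑ j ∈ range (k + 1), g j‖ ≤ B := by
  have hk : ‖((k : ℂ) + 1)‖ = k + 1 := by
    rw [show ((k : ℂ) + 1) = ((k + 1 : ℕ) : ℂ) by push_cast; ring, Complex.norm_natCast]
    push_cast; ring
  rw [norm_mul, norm_inv, hk, inv_mul_le_iff₀ (by positivity)]
  refine (norm_sum_le_of_le _ hg).trans ?_; simp

lemma Tk_sub_one (l : ℝ) (ζ : ℂ) (k : ℕ) : Tk l ζ k - 1 = ((k : ℂ) + 1)⁻¹ *
    ∑ j ∈ range (k + 1), (cexp (ζ * ((l * (j - k / 2) : ℝ) : ℂ)) -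
      ∑ i ∈ range 2, (ζ * ((l * (j - k / 2) : ℝ) : ℂ)) ^ i / (i.factorial : ℂ)) := by
  have hk : ((k : ℂ) + 1) ≠ 0 := Nat.cast_add_one_ne_zero k
  have e : ∑ j ∈ range (k + 1),
      ∑ i ∈ range 2, (ζ * ((l * (j - k / 2) : ℝ) : ℂ)) ^ i / (i.factorial : ℂ) = k + 1 := by
    have : ∀ j ∈ range (k + 1), ∑ i ∈ range 2,
        (ζ * ((l * (j - k / 2) : ℝ) : ℂ)) ^ i / (i.factorial : ℂ) =
        1 + ζ * l * ((j : ℂ) - k / 2) := by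
      intro j _; simp [sum_range_succ]; ring
    rw [sum_congr rfl this, sum_add_distrib, ← mul_sum, sum_range_sub]; simp
    right; ring
  rw [sum_sub_distrib, e, mul_sub, inv_mul_cancel₀ hk, Tk]

lemma Tk_sub_quadratic (l : ℝ) (ζ : ℂ) (k : ℕ) :
    Tk l ζ k - 1 - ζ ^ 2 / 2 * ((l ^ 2 * (k * (k + 2)) / 12 : ℝ) : ℂ) = ((k : ℂ) + 1)⁻¹ *
    ∑ j ∈ range (k + 1), (cexp (ζ * ((l * (j - k / 2) : ℝ) : ℂ)) -
      ∑ i ∈ range 4, (ζ * ((l * (j - k / 2) : ℝ) : ℂ)) ^ i / (i.factorial : ℂ)) := by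
  have hk : ((k : ℂ) + 1) ≠ 0 := Nat.cast_add_one_ne_zero k
  have e : ∑ j ∈ range (k + 1),
      ∑ i ∈ range 4, (ζ * ((l * (j - k / 2) : ℝ) : ℂ)) ^ i / (i.factorial : ℂ) =
      (k + 1) * (1 + ζ ^ 2 / 2 * ((l ^ 2 * (k * (k + 2)) / 12 : ℝ) : ℂ)) := by
    have : ∀ j ∈ range (k + 1), ∑ i ∈ range 4,
        (ζ * ((l * (j - k / 2) : ℝ) : ℂ)) ^ i / (i.factorial : ℂ) =
        1 + ζ * l * ((j : ℂ) - k / 2) + ζ ^ 2 * l ^ 2 / 2 * ((j : ℂ) - k / 2) ^ 2 +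
          ζ ^ 3 * l ^ 3 / 6 * ((j : ℂ) - k / 2) ^ 3 := by
      intro j _; simp [sum_range_succ, Nat.factorial]; ring
    rw [sum_congr rfl this, sum_add_distrib, sum_add_distrib,
      sum_add_distrib, ← mul_sum, ← mul_sum, ← mul_sum,
      sum_range_sub, sum_range_sub_sq, sum_range_sub_cube]
    simp; ring
  rw [sum_sub_distrib, e, mul_sub, ← mul_assoc _ ((k : ℂ) + 1), inv_mul_cancel₀ hk, Tk]; ring

lemma norm_node_le (hl : 0 < l) (ζ : ℂ) {j k : ℕ} (hj : j ∈ range (k + 1)) :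
    ‖ζ * ((l * (j - k / 2) : ℝ) : ℂ)‖ ≤ ‖ζ‖ * (l * k / 2) := by
  rw [norm_mul, norm_real, norm_eq_abs]; gcongr; exact abs_node_le hl hj

lemma Tk_LF (hl : 0 < l) {ζ : ℂ} (hζ : ‖ζ‖ ≤ 1 / 8) : LF l (1 / 16) (‖ζ‖ ^ 2) (Tk l ζ) := by
  intro k; rw [Tk_sub_one]; refine norm_avg_le fun j hj => ?_
  have hn := norm_node_le hl ζ hj
  have hu : 0 ≤ l * k := by positivity
  refine (norm_exp_sub_sum_le_norm_mul_exp _ 2).trans ?_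
  calc _ ≤ (‖ζ‖ * (l * k / 2)) ^ 2 * rexp (1 / 16 * (l * k)) := by
        gcongr; refine hn.trans ?_; nlinarith [norm_nonneg ζ]
    _ = ‖ζ‖ ^ 2 * ((l * k) ^ 2 * rexp (1 / 16 * (l * k))) / 4 := by ring
    _ ≤ _ := by
      have : 0 ≤ ‖ζ‖ ^ 2 * ((l * k) ^ 2 * rexp (1 / 16 * (l * k))) := by positivity
      linarith

lemma integral_V (hA : 1 ≤ A) (hl : 0 < l) :
    Integrable (fun k : ℕ => l ^ 2 * (k * (k + 2)) / 12) (geo A l) ∧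
      ∫ k : ℕ, l ^ 2 * (k * (k + 2)) / 12 ∂(geo A l) = rl2 A l := by
  have hA0 : 0 < A := by linarith
  obtain ⟨h1, h2⟩ := geo_mean hA0 hl
  obtain ⟨h3, h4⟩ := geo_sq hA0 hl
  have hq := qq_lt_one hA0 hl
  have e : (fun k : ℕ => l ^ 2 * ((k : ℝ) * (k + 2)) / 12) =
      fun k : ℕ => (1 / 12) * (l * k) ^ 2 + (l / 6) * (l * k) := by
    funext k; ring
  rw [e]; refine ⟨(h3.const_mul _).add (h1.const_mul _), ?_⟩
  rw [integral_add (h3.const_mul _) (h1.const_mul _), integral_const_mul, integral_const_mul,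
    h2, h4, rl2]
  have : 1 - qq A l ≠ 0 := by linarith
  field_simp; ring

lemma Tk_mean (hA : 1 ≤ A) (hl : 0 < l) (hl1 : l ≤ 1) {ζ : ℂ} (hζ : ‖ζ‖ ≤ 1 / 8) :
    ‖∫ k, Tk l ζ k ∂(geo A l) - 1 - ζ ^ 2 / 2 * (rl2 A l : ℂ)‖ ≤ 1600 * ‖ζ‖ ^ 4 * mm A l := by
  have hA0 : 0 < A := by linarith
  have := isProb_geo hA0 hl
  have hm := mm_pos hA0 hl
  obtain ⟨v1, v2⟩ := integral_V hA hl
  have hLF := (Tk_LF hl hζ).mono hl (sq_nonneg _) (by norm_num : (1 / 16 : ℝ) ≤ 1 / 4)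
  have hT := hLF.integrable hA hl hl1 (sq_nonneg _)
  have h := geo_bound hA hl hl1 (g := fun k : ℕ =>
    Tk l ζ k - 1 - ζ ^ 2 / 2 * ((l ^ 2 * (k * (k + 2)) / 12 : ℝ) : ℂ)) (D := 16 * ‖ζ‖ ^ 4)
    (by positivity) (fun k => by
      rw [Tk_sub_quadratic]; refine norm_avg_le fun j hj => ?_
      have hn := norm_node_le hl ζ hj
      have hu : 0 ≤ l * k := by positivity
      have h5 := one_add_le_exp_div (u := l * (k : ℝ)) (by norm_num : (1 : ℝ) ≤ 16)
      have h6 : l * k ≤ 16 * rexp (l * k / 16) := by linarith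
      refine (norm_exp_sub_sum_le_norm_mul_exp _ 4).trans ?_
      calc _ ≤ (‖ζ‖ * (l * k / 2)) ^ 4 * rexp (1 / 16 * (l * k)) := by
            gcongr; refine hn.trans ?_; nlinarith [norm_nonneg ζ]
        _ = ‖ζ‖ ^ 4 / 16 * ((l * k) ^ 2 * ((l * k) ^ 2 * rexp (1 / 16 * (l * k)))) := by ring
        _ ≤ ‖ζ‖ ^ 4 / 16 * ((l * k) ^ 2 * ((16 * rexp (l * k / 16)) ^ 2 *
            rexp (1 / 16 * (l * k)))) := by gcongr
        _ = 16 * ‖ζ‖ ^ 4 * ((l * k) ^ 2 * (rexp (l * k / 16) ^ 2 *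
            rexp (1 / 16 * (l * k)))) := by ring
        _ ≤ _ := by
            gcongr
            · linarith
            · rw [← Real.exp_nat_mul, ← Real.exp_add]
              apply exp_le_exp.2; push_cast
              linarith)
  have e : ∫ k : ℕ, (Tk l ζ k - 1 - ζ ^ 2 / 2 * ((l ^ 2 * (k * (k + 2)) / 12 : ℝ) : ℂ)) ∂(geo A l) =
      ∫ k, Tk l ζ k ∂(geo A l) - 1 - ζ ^ 2 / 2 * (rl2 A l : ℂ) := by
    have h1 : Integrable (fun k => Tk l ζ k - 1) (geo A l) := hT.sub (integrable_const _)
    have hV : Integrable (fun k : ℕ => ((l ^ 2 * (k * (k + 2)) / 12 : ℝ) : ℂ)) (geo A l) :=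
      v1.ofReal
    rw [integral_sub h1 (hV.const_mul _), integral_sub hT (integrable_const _),
      integral_const_mul, integral_complex_ofReal, v2]
    simp
  rw [e] at h; refine h.2.2.trans (le_of_eq (by ring))

lemma Tk_mean_exp (hA : 1 ≤ A) (hl : 0 < l) (hl1 : l ≤ 1) {ζ : ℂ}
    (hζ : ‖ζ‖ ≤ 1 / 100) :
    ∃ e : ℂ, ∫ k, Tk l ζ k ∂(geo A l) = cexp (ζ ^ 2 / 2 * (rl2 A l : ℂ) + e) ∧
      ‖e‖ ≤ 30000 * ‖ζ‖ ^ 4 * mm A l := by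
  have hm := mm_pos (by linarith : 0 < A) hl
  have hm2 := mm_le_two hA hl hl1
  have h1 := Tk_mean hA hl hl1 (ζ := ζ) (by linarith)
  have hLF := (Tk_LF hl (ζ := ζ) (by linarith)).mono hl (sq_nonneg _)
    (by norm_num : (1 / 16 : ℝ) ≤ 1 / 4)
  have h2 := (hLF.bound hA hl hl1 (sq_nonneg _)).2.2
  rw [hLF.integral_sub_one hA hl hl1 (sq_nonneg _)] at h2; set b := ∫ k, Tk l ζ k ∂(geo A l)
  set m := mm A l
  have hz : ‖ζ‖ ^ 2 ≤ 1 / 10000 := by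
    calc ‖ζ‖ ^ 2 ≤ (1 / 100) ^ 2 := by gcongr
      _ = _ := by norm_num
  obtain ⟨e, he1, he2⟩ := exists_exp_eq_one_add (a := b - 1) (h2.trans (by nlinarith))
  refine ⟨(b - 1 - ζ ^ 2 / 2 * (rl2 A l : ℂ)) + e, ?_, ?_⟩
  · rw [add_sub_cancel] at he1
    rw [he1]; congr 1; rw [← he1]; ring
  · have h3 : ‖b - 1‖ ^ 2 ≤ (100 * ‖ζ‖ ^ 2 * m) ^ 2 := by gcongr
    have h4 : (100 * ‖ζ‖ ^ 2 * m) ^ 2 ≤ 20000 * ‖ζ‖ ^ 4 * m := by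
      calc _ = 10000 * ‖ζ‖ ^ 4 * (m * m) := by ring
        _ ≤ 10000 * ‖ζ‖ ^ 4 * (2 * m) := by gcongr
        _ = _ := by ring
    have p : 0 ≤ ‖ζ‖ ^ 4 * m := by positivity
    calc _ ≤ _ := norm_add_le _ _
      _ ≤ 1600 * ‖ζ‖ ^ 4 * m + 20000 * ‖ζ‖ ^ 4 * m := by linarith
      _ ≤ _ := by linarith

/-- Mean modulus of the transform for small `ζ`. -/
lemma Tk_mean_norm (hA : 1 ≤ A) (hl : 0 < l) (hl1 : l ≤ 1) {ζ : ℂ}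
    (hζ : ‖ζ‖ ≤ 1 / 8) :
    ∫ k, ‖Tk l ζ k‖ ∂(geo A l) ≤ 1 + (ζ ^ 2).re / 2 * rl2 A l + 20000 * ‖ζ‖ ^ 4 * mm A l := by
  have hA0 : 0 < A := by linarith
  have := isProb_geo hA0 hl
  have hm := mm_pos hA0 hl
  have hLF16 := Tk_LF hl hζ
  have hLF := hLF16.mono hl (sq_nonneg _) (by norm_num : (1 / 16 : ℝ) ≤ 1 / 4)
  have hT := hLF.integrable hA hl hl1 (sq_nonneg _)
  have h1 := Tk_mean hA hl hl1 hζ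
  have hb2 := geo_bound hA hl hl1 (g := fun k => ‖Tk l ζ k - 1‖ ^ 2)
      (D := 256 * (‖ζ‖ ^ 2) ^ 2) (by positivity) (fun k => by
        have h2 := hLF16.sq_bound hl k
        have hu : 0 ≤ l * k := by positivity
        rw [norm_of_nonneg (by positivity)]
        refine h2.trans ?_; gcongr
        · linarith
        · linarith)
  have hpt : ∀ k, ‖Tk l ζ k‖ ≤ (Tk l ζ k).re + ‖Tk l ζ k - 1‖ ^ 2 / 2 := by
    intro k; set w := Tk l ζ k
    have e1 : ‖w - 1‖ ^ 2 = ‖w‖ ^ 2 - 2 * w.re + 1 := by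
      rw [← normSq_eq_norm_sq, ← normSq_eq_norm_sq, normSq_apply, normSq_apply]; simp; ring
    nlinarith [sq_nonneg (‖w‖ - 1)]
  have hre : ∫ k, (Tk l ζ k).re ∂(geo A l) = (∫ k, Tk l ζ k ∂(geo A l)).re :=
    reCLM.integral_comp_comm hT
  have hre2 : Integrable (fun k => (Tk l ζ k).re) (geo A l) := reCLM.integrable_comp hT
  have hN : Integrable (fun k => ‖Tk l ζ k‖) (geo A l) := hT.norm
  have hb1 := hb2.1.div_const 2
  have hb3 := hb2.2.2
  have hsum : Integrable (fun k => (Tk l ζ k).re + ‖Tk l ζ k - 1‖ ^ 2 / 2) (geo A l) :=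
    hre2.add hb1
  have hmono : ∫ k, ‖Tk l ζ k‖ ∂(geo A l) ≤
      ∫ k, ((Tk l ζ k).re + ‖Tk l ζ k - 1‖ ^ 2 / 2) ∂(geo A l) :=
    integral_mono hN hsum fun k => hpt k
  generalize hb : ∫ k, Tk l ζ k ∂(geo A l) = b at h1 hre
  have h3 : b.re ≤ 1 + (ζ ^ 2).re / 2 * rl2 A l + 1600 * ‖ζ‖ ^ 4 * mm A l := by
    have h4 := (re_le_norm (b - 1 - ζ ^ 2 / 2 * (rl2 A l : ℂ))).trans h1
    have h5 : (b - 1 - ζ ^ 2 / 2 * (rl2 A l : ℂ)).re = b.re - 1 - (ζ ^ 2).re / 2 * rl2 A l := by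
      rw [sub_re, sub_re, re_mul_ofReal]; simp
    linarith
  have h6 : ∫ k, ‖Tk l ζ k - 1‖ ^ 2 ∂(geo A l) ≤ 25600 * ‖ζ‖ ^ 4 * mm A l := by
    refine ((le_abs_self _).trans hb3).trans (le_of_eq (by ring))
  calc ∫ k, ‖Tk l ζ k‖ ∂(geo A l)
      ≤ ∫ k, ((Tk l ζ k).re + ‖Tk l ζ k - 1‖ ^ 2 / 2) ∂(geo A l) := hmono
    _ = b.re + (∫ k, ‖Tk l ζ k - 1‖ ^ 2 ∂(geo A l)) / 2 := by
        rw [integral_add hre2 hb1, hre, integral_div]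
    _ ≤ _ := by
        have p : 0 ≤ ‖ζ‖ ^ 4 * mm A l := by positivity
        linarith

/-! ### Gaps away from the origin -/

lemma geo_tail (hA : 0 < A) (hl : 0 < l) (n : ℕ) :
    Integrable (fun k : ℕ => if n ≤ k then (1 : ℝ) else 0) (geo A l) ∧
      ∫ k : ℕ, (if n ≤ k then (1 : ℝ) else 0) ∂(geo A l) = qq A l ^ n := by
  have hq := qq_lt_one hA hl
  refine geo_integral_real hA hl (fun k => by split_ifs <;> norm_num) ?_
  rw [← hasSum_nat_add_iff' n]
  have e : ∑ i ∈ range n, (1 - qq A l) * qq A l ^ i * (if n ≤ i then (1 : ℝ) else 0) = 0 := by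
    refine sum_eq_zero fun i hi => ?_
    rw [if_neg (by simpa using hi), mul_zero]
  rw [e, sub_zero]
  have := (hasSum_geometric_of_norm_lt_one (qq_norm_lt hA hl)).mul_left
    ((1 - qq A l) * qq A l ^ n)
  convert! this using 1
  · funext k
    rw [if_pos (by omega), pow_add]; ring
  · have : 1 - qq A l ≠ 0 := by linarith
    field_simp

lemma integral_norm_le_of_tail {γ : ℝ} (hA : 1 ≤ A) (hl : 0 < l) {T : ℕ → ℂ} {n : ℕ}
    (h1 : ∀ k, ‖T k‖ ≤ 1) (h2 : ∀ k, n ≤ k → ‖T k‖ ≤ 1 - γ) :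
    ∫ k, ‖T k‖ ∂(geo A l) ≤ 1 - γ * qq A l ^ n := by
  have hA0 : 0 < A := by linarith
  have := isProb_geo hA0 hl
  obtain ⟨h3, h4⟩ := geo_tail hA0 hl n
  have hT : Integrable (fun k => ‖T k‖) (geo A l) := by
    refine Integrable.of_bound (C := 1) (measurable_of_countable _).aestronglyMeasurable ?_
    refine .of_forall fun k => ?_
    rw [norm_norm]; exact h1 k
  have h5 : Integrable (fun k : ℕ => 1 - γ * (if n ≤ k then (1 : ℝ) else 0)) (geo A l) :=
    (integrable_const (1 : ℝ)).sub (h3.const_mul γ)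
  calc _ ≤ ∫ k : ℕ, (1 - γ * (if n ≤ k then (1 : ℝ) else 0)) ∂(geo A l) := by
        refine integral_mono hT h5 fun k => ?_
        by_cases hk : n ≤ k
        · simpa [hk] using h2 k hk
        · simpa [hk] using h1 k
    _ = _ := by
      rw [integral_sub (integrable_const _) (h3.const_mul γ), integral_const_mul, h4]; simp

lemma norm_sum_le_of_pairs {g : ℕ → ℂ} (h1 : ∀ j, ‖g j‖ ≤ 1)
    (h2 : ∀ j, ‖g j + g (j + 1)‖ ≤ 2 * c) (n : ℕ) :
    ‖∑ j ∈ range (2 * n), g j‖ ≤ 2 * n * c ∧ ‖∑ j ∈ range (2 * n + 1), g j‖ ≤ 2 * n * c + 1 := by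
  have h : ‖∑ j ∈ range (2 * n), g j‖ ≤ 2 * n * c := by
    induction n with
    | zero => simp
    | succ n ih =>
      rw [show 2 * (n + 1) = 2 * n + 1 + 1 by ring, sum_range_succ, sum_range_succ, add_assoc]
      refine (norm_add_le _ _).trans ?_
      have := h2 (2 * n)
      push_cast; linarith
  refine ⟨h, ?_⟩; rw [sum_range_succ]; exact (norm_add_le _ _).trans (add_le_add h (h1 _))

lemma norm_one_add_exp (β : ℝ) : ‖1 + cexp (β * I)‖ = 2 * |cos (β / 2)| := by
  have e : 1 + cexp (β * I) = ((2 * cos (β / 2) : ℝ) : ℂ) * cexp ((β / 2 : ℝ) * I) := by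
    have h1 : cexp (β * I) = cexp ((β / 2 : ℝ) * I) * cexp ((β / 2 : ℝ) * I) := by
      rw [← Complex.exp_add]; congr 1; push_cast; ring
    have h2 : cexp (-(β / 2 : ℝ) * I) * cexp ((β / 2 : ℝ) * I) = 1 := by
      rw [← Complex.exp_add]; simp
    rw [h1]; push_cast; rw [two_cos]; push_cast at h2; rw [add_mul, h2]; ring
  rw [e, norm_mul, norm_exp_ofReal_mul_I, norm_real, norm_eq_abs, abs_mul]; simp

lemma norm_one_sub_exp (β : ℝ) : ‖1 - cexp (β * I)‖ = 2 * |sin (β / 2)| := by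
  have h := norm_one_add_exp (β + π)
  have e : cexp ((β + π : ℝ) * I) = -cexp (β * I) := by
    push_cast; rw [add_mul, Complex.exp_add, exp_pi_mul_I]; ring
  rw [e, ← sub_eq_add_neg] at h
  rw [h, show (β + π) / 2 = β / 2 + π / 2 by ring, Real.cos_add_pi_div_two, abs_neg]

lemma norm_Tk_I (l θ : ℝ) (k : ℕ) : ‖Tk l (θ * I) k‖ =
    (k + 1 : ℝ)⁻¹ * ‖∑ j ∈ range (k + 1), cexp (((θ * l * j : ℝ) : ℂ) * I)‖ := by
  have e : ∑ j ∈ range (k + 1), cexp (θ * I * ((l * (j - k / 2) : ℝ) : ℂ)) =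
      cexp (((-(θ * l * k / 2) : ℝ) : ℂ) * I) *
        ∑ j ∈ range (k + 1), cexp (((θ * l * j : ℝ) : ℂ) * I) := by
    rw [mul_sum]; refine sum_congr rfl fun j _ => ?_
    rw [← Complex.exp_add]; congr 1; push_cast; ring
  have hk : ‖((k : ℂ) + 1)‖ = k + 1 := by
    rw [show ((k : ℂ) + 1) = ((k + 1 : ℕ) : ℂ) by push_cast; ring, Complex.norm_natCast]
    push_cast; ring
  rw [Tk, e, norm_mul, norm_mul, norm_inv, hk, norm_exp_ofReal_mul_I, one_mul]

lemma norm_Tk_I_le_one (l θ : ℝ) (k : ℕ) : ‖Tk l (θ * I) k‖ ≤ 1 := by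
  refine norm_avg_le fun j _ => ?_
  rw [show θ * I * ((l * (j - k / 2) : ℝ) : ℂ) = ((θ * (l * (j - k / 2)) : ℝ) : ℂ) * I by
    push_cast; ring, norm_exp_ofReal_mul_I]

lemma norm_Tk_I_le_gap (l θ : ℝ) {k : ℕ} (hk : 1 ≤ k) :
    ‖Tk l (θ * I) k‖ ≤ 1 - 1 / 3 * sin (θ * l / 2) ^ 2 := by
  set c := |cos (θ * l / 2)| with hc
  have hc0 : 0 ≤ c := abs_nonneg _
  have hc1 : c ≤ 1 := Real.abs_cos_le_one _
  have hs : sin (θ * l / 2) ^ 2 = 1 - c ^ 2 := by rw [hc, sq_abs, Real.sin_sq]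
  have hp := norm_sum_le_of_pairs (g := fun j : ℕ => cexp (((θ * l * j : ℝ) : ℂ) * I)) (c := c)
    (fun j => (norm_exp_ofReal_mul_I _).le) (fun j => by
      have : cexp (((θ * l * j : ℝ) : ℂ) * I) + cexp (((θ * l * ((j + 1 : ℕ) : ℝ) : ℝ) : ℂ) * I) =
          cexp (((θ * l * j : ℝ) : ℂ) * I) * (1 + cexp ((θ * l : ℝ) * I)) := by
        rw [mul_add, ← Complex.exp_add, mul_one]; congr 2; push_cast; ring
      rw [this, norm_mul, norm_exp_ofReal_mul_I, norm_one_add_exp, one_mul])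
  rw [norm_Tk_I, inv_mul_le_iff₀ (by positivity), hs]
  rcases Nat.even_or_odd' (k + 1) with ⟨m, hm | hm⟩
  · have h := (hp m).1
    rw [← hm] at h
    have hkm : (k : ℝ) + 1 = 2 * m := mod_cast hm
    rw [hkm]; refine h.trans ?_
    have : (0 : ℝ) ≤ m := Nat.cast_nonneg m
    nlinarith [mul_nonneg this (sub_nonneg.2 hc1), mul_nonneg (mul_nonneg this (sub_nonneg.2 hc1)) hc0]
  · have h := (hp m).2
    rw [← hm] at h
    have hkm : (k : ℝ) + 1 = 2 * m + 1 := mod_cast hm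
    rw [hkm]; refine h.trans ?_
    have : (1 : ℝ) ≤ m := by
      have : 1 ≤ m := by omega
      exact_mod_cast this
    have h3 : 0 ≤ (m - 1) * (1 - c) := mul_nonneg (by linarith) (by linarith)
    have h4 : 0 ≤ (m - 1) * (1 - c) * (1 - c) := mul_nonneg h3 (by linarith)
    nlinarith [mul_nonneg (sub_nonneg.2 hc1) hc0]

lemma Tk_I_gap (hA : 1 ≤ A) (hl : 0 < l) (θ : ℝ) :
    ∫ k, ‖Tk l (θ * I) k‖ ∂(geo A l) ≤ 1 - 1 / 3 * (qq A l * sin (θ * l / 2) ^ 2) := by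
  have h := integral_norm_le_of_tail hA hl (norm_Tk_I_le_one l θ)
    (n := 1) (fun k hk => norm_Tk_I_le_gap l θ hk)
  linarith

lemma norm_geom_exp_le {β : ℝ} (h0 : 0 < β) (h1 : β ≤ 1) (n : ℕ) :
    ‖∑ j ∈ range n, cexp (((β * j : ℝ) : ℂ) * I)‖ ≤ 4 / β := by
  have e : ∑ j ∈ range n, cexp (((β * j : ℝ) : ℂ) * I) = ∑ j ∈ range n, cexp (β * I) ^ j := by
    refine sum_congr rfl fun j _ => ?_
    rw [← Complex.exp_nat_mul]; congr 1; push_cast; ring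
  have hs := sin_ge_third (u := β / 2) (by linarith) (by linarith)
  have hn := norm_one_sub_exp β
  rw [abs_of_pos (by linarith : 0 < sin (β / 2))] at hn
  have h2 := mul_neg_geom_sum (cexp (β * I)) n
  have h3 := congrArg norm h2
  rw [norm_mul, hn] at h3
  have h4 : ‖1 - cexp (β * I) ^ n‖ ≤ 2 := by
    refine (norm_sub_le _ _).trans ?_; rw [norm_pow, norm_exp_ofReal_mul_I]; norm_num
  rw [e, le_div_iff₀ h0]; nlinarith [norm_nonneg (∑ j ∈ range n, cexp (β * I) ^ j)]

lemma Tk_I_gap' {θ : ℝ} (hl : 0 < l) (hl1 : l ≤ 1) (hη : 0 < η) (hθ : η ≤ θ)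
    (h1 : θ * l ≤ 1) :
    ∫ k, ‖Tk l (θ * I) k‖ ∂(geo 1 l) ≤ 1 - 1 / 2 * rexp (-(8 / η + 1)) := by
  have hb : 0 < θ * l := mul_pos (by linarith) hl
  set n := ⌈8 / (θ * l)⌉₊ with hn
  have h := integral_norm_le_of_tail (A := 1) le_rfl hl (norm_Tk_I_le_one l θ)
    (n := n) (γ := 1 / 2) (fun k hk => by
      rw [norm_Tk_I, inv_mul_le_iff₀ (by positivity)]
      refine (norm_geom_exp_le hb h1 _).trans ?_
      have h3 : 8 / (θ * l) ≤ k := (Nat.le_ceil _).trans (mod_cast hk)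
      have h4 : 4 / (θ * l) = (8 / (θ * l)) / 2 := by ring
      rw [h4]; linarith)
  refine h.trans ?_
  have h5 : rexp (-(8 / η + 1)) ≤ qq 1 l ^ n := by
    rw [qq, ← Real.exp_nat_mul]; apply exp_le_exp.2
    have h6 : (n : ℝ) ≤ 8 / (θ * l) + 1 := (Nat.ceil_lt_add_one (by positivity)).le
    have h7 : n * l ≤ 8 / η + 1 := by
      calc n * l ≤ (8 / (θ * l) + 1) * l := by gcongr
        _ = 8 / θ + l := by
          have : θ ≠ 0 := by linarith
          field_simp
        _ ≤ _ := by gcongr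
    linarith
  linarith

lemma norm_Tk_add_le {s : ℝ} (hl : 0 < l) (hs : 0 ≤ s) (θ : ℝ) (k : ℕ) :
    ‖Tk l (s + θ * I) k‖ ≤ ‖Tk l (θ * I) k‖ + (rexp (s * (l * k) / 2) - 1) := by
  have e : Tk l (s + θ * I) k = Tk l (θ * I) k + ((k : ℂ) + 1)⁻¹ *
      ∑ j ∈ range (k + 1), (cexp ((s + θ * I) * ((l * (j - k / 2) : ℝ) : ℂ)) -
        cexp ((θ * I) * ((l * (j - k / 2) : ℝ) : ℂ))) := by
    rw [sum_sub_distrib, mul_sub, Tk, Tk]; ring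
  rw [e]; refine (norm_add_le _ _).trans ?_; gcongr; refine norm_avg_le fun j hj => ?_
  have hn := abs_node_le hl hj
  set u := l * ((j : ℝ) - k / 2)
  have e2 : cexp ((s + θ * I) * (u : ℂ)) - cexp ((θ * I) * (u : ℂ)) =
      ((rexp (s * u) - 1 : ℝ) : ℂ) * cexp ((θ * u : ℝ) * I) := by
    push_cast; rw [sub_mul, ← Complex.exp_add, one_mul]; congr 2 <;> ring
  rw [e2, norm_mul, norm_exp_ofReal_mul_I, mul_one, norm_real, norm_eq_abs]
  have hsu : |s * u| ≤ s * (l * k) / 2 := by rw [abs_mul, abs_of_nonneg hs]; nlinarith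
  have h1 := (abs_le.1 hsu)
  have h2 := exp_le_exp.2 h1.2
  have h3 := exp_le_exp.2 h1.1
  have h4 : 2 ≤ rexp (s * (l * k) / 2) + rexp (-(s * (l * k) / 2)) := by
    have := add_one_le_exp (s * (l * k) / 2)
    have := Real.one_le_cosh (s * (l * k) / 2)
    rw [Real.cosh_eq] at this; linarith
  rw [abs_le]
  constructor <;> linarith

lemma integral_exp_sub_one_le {s : ℝ} (hA : 1 ≤ A) (hl : 0 < l) (hl1 : l ≤ 1) (hs : 0 ≤ s)
    (hs1 : s ≤ 1 / 8) :
    Integrable (fun k : ℕ => rexp (s * (l * k) / 2) - 1) (geo A l) ∧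
      ∫ k : ℕ, (rexp (s * (l * k) / 2) - 1) ∂(geo A l) ≤ 28 * s * (l * qq A l / (1 - qq A l)) := by
  have hA0 : 0 < A := by linarith
  obtain ⟨h1, h2⟩ := geo_mean hA0 hl
  obtain ⟨h3, h4⟩ := geo_sq_exp hA hl hl1
  have h5 := mm_le hA hl hl1
  have hpt : ∀ k : ℕ, rexp (s * (l * k) / 2) - 1 ≤
      s / 2 * (l * k + (l * k) ^ 2 * rexp (l * k / 2)) := by
    intro k
    have hu : 0 ≤ l * k := by positivity
    set u := l * (k : ℝ)
    have key : ∀ w : ℝ, rexp w - 1 ≤ w * rexp w := by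
      intro w
      have := add_one_le_exp (-w)
      have : rexp w * (-w + 1) ≤ rexp w * rexp (-w) := by gcongr
      rw [← Real.exp_add, add_neg_cancel, Real.exp_zero] at this; linarith
    have k1 := key (s * u / 2)
    have k2 := key (u / 2)
    have k3 : rexp (s * u / 2) ≤ rexp (u / 2) := by apply exp_le_exp.2; nlinarith
    have k4 : u * rexp (u / 2) ≤ u + u ^ 2 * rexp (u / 2) := by
      have : u * (rexp (u / 2) - 1) ≤ u * (u / 2 * rexp (u / 2)) := by gcongr
      have : 0 ≤ u ^ 2 * rexp (u / 2) := by positivity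
      nlinarith
    calc _ ≤ s * u / 2 * rexp (s * u / 2) := k1
      _ ≤ s * u / 2 * rexp (u / 2) := by gcongr
      _ = s / 2 * (u * rexp (u / 2)) := by ring
      _ ≤ _ := by gcongr
  have hsum : Integrable (fun k : ℕ => s / 2 * (l * k + (l * k) ^ 2 * rexp (l * k / 2)))
      (geo A l) := (h1.add h3).const_mul _
  have hitg : Integrable (fun k : ℕ => rexp (s * (l * k) / 2) - 1) (geo A l) := by
    refine hsum.mono' (measurable_of_countable _).aestronglyMeasurable ?_
    refine .of_forall fun k => ?_
    rw [norm_of_nonneg]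
    · exact hpt k
    · have := one_le_exp (x := s * (l * k) / 2) (by positivity)
      linarith
  refine ⟨hitg, (integral_mono hitg hsum fun k => hpt k).trans ?_⟩
  rw [integral_const_mul, integral_add h1 h3, h2]
  have h6 := mean_nonneg hA hl
  nlinarith

lemma Tk_integrable {s : ℝ} (hA : 1 ≤ A) (hl : 0 < l) (hl1 : l ≤ 1) (hs : 0 ≤ s)
    (hs1 : s ≤ 1 / 8) (θ : ℝ) : Integrable (Tk l (s + θ * I)) (geo A l) := by
  have := isProb_geo (by linarith : 0 < A) hl
  refine ((integrable_const (1 : ℝ)).add (integral_exp_sub_one_le hA hl hl1 hs hs1).1).mono'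
    (measurable_of_countable _).aestronglyMeasurable (.of_forall fun k => ?_)
  have h1 := norm_Tk_add_le hl hs θ k
  have h2 := norm_Tk_I_le_one l θ k
  simp only [Pi.add_apply]; linarith

lemma integral_norm_Tk_le {s : ℝ} (hA : 1 ≤ A) (hl : 0 < l) (hl1 : l ≤ 1) (hs : 0 ≤ s)
    (hs1 : s ≤ 1 / 8) (θ : ℝ) :
    ∫ k, ‖Tk l (s + θ * I) k‖ ∂(geo A l) ≤
      ∫ k, ‖Tk l (θ * I) k‖ ∂(geo A l) + 28 * s * (l * qq A l / (1 - qq A l)) := by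
  obtain ⟨h1, h2⟩ := integral_exp_sub_one_le hA hl hl1 hs hs1
  have hT := (Tk_integrable hA hl hl1 hs hs1 θ).norm
  have hT0 : Integrable (fun k => ‖Tk l (θ * I) k‖) (geo A l) := by
    have := (Tk_integrable hA hl hl1 le_rfl (by norm_num) θ).norm
    simpa using this
  calc _ ≤ ∫ k : ℕ, (‖Tk l (θ * I) k‖ + (rexp (s * (l * k) / 2) - 1)) ∂(geo A l) := by
        refine integral_mono hT ?_ fun k => norm_Tk_add_le hl hs θ k
        exact hT0.add h1
    _ = ∫ k, ‖Tk l (θ * I) k‖ ∂(geo A l) +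
        ∫ k : ℕ, (rexp (s * (l * k) / 2) - 1) ∂(geo A l) := integral_add hT0 h1
    _ ≤ _ := by gcongr

lemma norm_phiL (hA : 1 ≤ A) (hl : 0 < l) (t : ℝ) :
    ‖phiL A l t‖ * ‖1 - (qq A l : ℂ) * cexp ((t * l : ℝ) * I)‖ = 1 - qq A l := by
  have hA0 : 0 < A := by linarith
  have hq := qq_lt_one hA0 hl
  have hq0 := qq_pos A l
  set r : ℂ := (qq A l : ℂ) * cexp ((t * l : ℝ) * I) with hr
  set μ0 := l * qq A l / (1 - qq A l) with hμ0
  have hrn : ‖r‖ < 1 := by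
    rw [hr, norm_mul, norm_exp_ofReal_mul_I, norm_real, norm_of_nonneg hq0.le, mul_one]; exact hq
  have h := (geo_integral_complex hA0 hl (f := eg A l t) (a := ((1 - qq A l : ℝ) : ℂ) *
    cexp ((-(t * μ0) : ℝ) * I) * (1 - r)⁻¹) (by
      have := (hasSum_geometric_of_norm_lt_one hrn).mul_left (((1 - qq A l : ℝ) : ℂ) *
        cexp ((-(t * μ0) : ℝ) * I))
      convert! this using 1
      funext k; rw [hr, mul_pow, ← Complex.exp_nat_mul, eg, xk, ← hμ0]
      have : ((t * (l * k - μ0) : ℝ) : ℂ) * I =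
        ((-(t * μ0) : ℝ) : ℂ) * I + (k : ℂ) * (((t * l : ℝ) : ℂ) * I) := by push_cast; ring
      rw [this, Complex.exp_add]; ring)).2
  have hne : (1 - r) ≠ 0 := by
    intro h0
    have : r = 1 := by linear_combination -h0
    rw [this] at hrn; simp at hrn
  rw [phiL, h, norm_mul, norm_mul, norm_exp_ofReal_mul_I, norm_inv, mul_one,
    mul_assoc, inv_mul_cancel₀ (norm_ne_zero_iff.2 hne), norm_real,
    norm_of_nonneg (by linarith), mul_one]

lemma norm_sq_one_sub (q β : ℝ) :
    ‖1 - (q : ℂ) * cexp (β * I)‖ ^ 2 = (1 - q) ^ 2 + 4 * q * sin (β / 2) ^ 2 := by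
  have e : cexp (β * I) = ⟨cos β, sin β⟩ := by
    apply Complex.ext
    · simp [exp_ofReal_mul_I_re]
    · simp [exp_ofReal_mul_I_im]
  have h1 : cos β = 1 - 2 * sin (β / 2) ^ 2 := by
    have := Real.cos_two_mul (β / 2)
    rw [show 2 * (β / 2) = β by ring, Real.cos_sq'] at this
    linarith
  rw [← normSq_eq_norm_sq, e, normSq_apply]; simp
  linear_combination q ^ 2 * Real.sin_sq_add_cos_sq β - 2 * q * h1

lemma phiL_gap_of_le {w : ℝ} (hA : 1 ≤ A) (hl : 0 < l) (t : ℝ) (hw0 : 0 ≤ w) (hw4 : w ≤ 4)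
    (hw : w * (1 - qq A l) ^ 2 ≤ 4 * qq A l * sin (t * l / 2) ^ 2) :
    ‖phiL A l t‖ ≤ 1 - w / 10 := by
  have hq := qq_lt_one (by linarith : 0 < A) hl
  have h1 := norm_phiL hA hl t
  have h2 := norm_sq_one_sub (qq A l) (t * l)
  set a := ‖phiL A l t‖
  set b := ‖1 - (qq A l : ℂ) * cexp ((t * l : ℝ) * I)‖
  set d := 1 - qq A l
  have h3 : a ^ 2 * (1 + w) ≤ 1 := by
    have h4 : a ^ 2 * ((1 + w) * d ^ 2) ≤ a ^ 2 * b ^ 2 := by gcongr; linarith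
    rw [← mul_pow, h1] at h4
    have h5 : 0 < d ^ 2 := by positivity
    nlinarith
  have h6 : 1 ≤ (1 - w / 10) ^ 2 * (1 + w) := by
    have : 0 ≤ w * (4 / 5 - 19 / 100 * w + w ^ 2 / 100) := by apply mul_nonneg hw0; nlinarith
    nlinarith
  have h7 : a ^ 2 ≤ (1 - w / 10) ^ 2 := by nlinarith
  exact abs_le_of_sq_le_sq' h7 (by linarith) |>.2

lemma phiL_gap (hA : 1 ≤ A) (hl : 0 < l) (t : ℝ) :
    ‖phiL A l t‖ ≤ 1 - 1 / 3 * (qq A l * sin (t * l / 2) ^ 2) := by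
  have hq := qq_lt_one (by linarith : 0 < A) hl
  have hq0 := qq_pos A l
  have hs := Real.sin_sq_le_one (t * l / 2)
  have h0 : 0 ≤ qq A l * sin (t * l / 2) ^ 2 := by positivity
  have h := phiL_gap_of_le hA hl t (w := 4 * qq A l * sin (t * l / 2) ^ 2) (by positivity)
    (by nlinarith) (by
      have : (1 - qq A l) ^ 2 ≤ 1 := by nlinarith
      nlinarith)
  linarith

lemma phiL_gap' (hl : 0 < l) (hη : 0 < η) (hη1 : η ≤ 1) (ht : η ≤ t)
    (h1 : t * l ≤ 1) (hm : 1 / 3 ≤ mm 1 l) : ‖phiL 1 l t‖ ≤ 1 - η ^ 2 / 120 := by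
  have hq := qq_lt_one one_pos hl
  have hb : 0 < t * l := mul_pos (by linarith) hl
  have hs := sin_ge_third (u := t * l / 2) (by linarith) (by linarith)
  have hq0 := qq_pos 1 l
  have h := phiL_gap_of_le le_rfl hl t (w := η ^ 2 / 12) (by positivity) (by nlinarith) (by
    have h2 : (1 - qq 1 l) ^ 2 / 3 ≤ l ^ 2 * qq 1 l := by
      rw [mm, le_div_iff₀ (by have : 0 < 1 - qq 1 l := by linarith
                              positivity)] at hm
      linarith
    have h3 : (η * l / 4) ^ 2 ≤ sin (t * l / 2) ^ 2 := by gcongr; nlinarith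
    calc η ^ 2 / 12 * (1 - qq 1 l) ^ 2 = η ^ 2 / 4 * ((1 - qq 1 l) ^ 2 / 3) := by ring
      _ ≤ η ^ 2 / 4 * (l ^ 2 * qq 1 l) := by gcongr
      _ = 4 * qq 1 l * (η * l / 4) ^ 2 := by ring
      _ ≤ _ := by gcongr)
  linarith

lemma norm_twE_le {f : ℕ → ℂ} (hf : LF l (1 / 4) δ f) (hA : 1 ≤ A) (hl : 0 < l)
    (hl1 : l ≤ 1) (hδ : 0 ≤ δ) (t : ℝ) :
    ‖twE A l t f‖ ≤ ‖phiL A l t‖ + 100 * δ * mm A l := by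
  obtain ⟨h1, h2, -⟩ := hf.bound hA hl hl1 hδ
  have h3 : Integrable (fun k => eg A l t k * (f k - 1)) (geo A l) :=
    h1.bdd_mul (measurable_of_countable _).aestronglyMeasurable
      (.of_forall fun k => (norm_eg A l t k).le)
  have e : twE A l t f = phiL A l t + ∫ k, eg A l t k * (f k - 1) ∂(geo A l) := by
    rw [twE, phiL, ← integral_add (integrable_eg hA hl t) h3]; congr 1; funext k; ring
  rw [e]; refine (norm_add_le _ _).trans ?_; gcongr
  refine (norm_integral_le_integral_norm _).trans (le_trans (le_of_eq ?_) h2); congr 1; funext k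
  rw [norm_mul, norm_eg, one_mul]

/-- The oscillating factor `e^{itx}`. -/
def osc (t x : ℝ) : ℂ := cexp (((t * x : ℝ) : ℂ) * I)

lemma norm_osc (t x : ℝ) : ‖osc t x‖ = 1 := by
  unfold osc; exact norm_exp_ofReal_mul_I _

lemma continuous_osc : Continuous (fun p : ℝ × ℝ => osc p.1 p.2) := by
  unfold osc; fun_prop

lemma integral_osc_swap {Ω : Type*} [MeasurableSpace Ω] (μ : Measure Ω) [SFinite μ] {X : Ω → ℝ}
    (hX : Measurable X) {m : ℝ → ℂ} (hm : Integrable m) {g : Ω → ℂ} (hg : Integrable g μ) :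
    ∫ ω, (∫ t, osc t (X ω) * m t) * g ω ∂μ = ∫ t, m t * ∫ ω, osc t (X ω) * g ω ∂μ := by
  have h1 : Integrable (fun p : Ω × ℝ => g p.1 * m p.2) (μ.prod volume) := hg.mul_prod hm
  have h2 : Integrable (fun p : Ω × ℝ => osc p.2 (X p.1) * (g p.1 * m p.2)) (μ.prod volume) := by
    refine h1.bdd_mul (c := 1) ?_ (.of_forall fun p => (norm_osc _ _).le)
    exact (continuous_osc.measurable.comp
      (measurable_snd.prodMk (hX.comp measurable_fst))).aestronglyMeasurable
  have h3 := integral_integral_swap (f := fun ω t => osc t (X ω) * (g ω * m t)) h2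
  calc _ = ∫ ω, (∫ t, osc t (X ω) * (g ω * m t)) ∂μ := by
        congr 1; funext ω; rw [← integral_mul_const]; congr 1; funext t; ring
    _ = _ := by rw [h3]; congr 1; funext t; rw [← integral_const_mul]; congr 1; funext ω; ring

lemma osc_exp_Ioi (x : ℝ) (ht : t ∈ Set.Ioi (0 : ℝ)) :
    osc t x * ((rexp (-(|t| / b)) : ℝ) : ℂ) = cexp ((-(1 / b : ℝ) + x * I) * t) := by
  have ht' : |t| = t := abs_of_pos ht
  rw [osc, ht', ofReal_exp, ← Complex.exp_add]; congr 1; push_cast; ring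

lemma osc_exp_Iic (x : ℝ) (ht : t ∈ Set.Iic (0 : ℝ)) :
    osc t x * ((rexp (-(|t| / b)) : ℝ) : ℂ) = cexp (((1 / b : ℝ) + x * I) * t) := by
  have ht' : |t| = -t := abs_of_nonpos ht
  rw [osc, ht', ofReal_exp, ← Complex.exp_add]; congr 1; push_cast; ring

lemma integrable_osc_exp (hb : 0 < b) (x : ℝ) :
    IntegrableOn (fun t : ℝ => osc t x * ((rexp (-(|t| / b)) : ℝ) : ℂ)) (Set.Ioi 0) ∧
    IntegrableOn (fun t : ℝ => osc t x * ((rexp (-(|t| / b)) : ℝ) : ℂ)) (Set.Iic 0) := by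
  constructor
  · refine IntegrableOn.congr_fun (integrableOn_exp_mul_complex_Ioi
      (a := -(1 / b : ℝ) + x * I) (by simpa using hb) 0) (fun t ht => ?_) measurableSet_Ioi
    exact (osc_exp_Ioi x ht).symm
  · refine IntegrableOn.congr_fun (integrableOn_exp_mul_complex_Iic
      (a := (1 / b : ℝ) + x * I) (by simpa using hb) 0) (fun t ht => ?_) measurableSet_Iic
    exact (osc_exp_Iic x ht).symm

lemma integral_osc_exp (hb : 0 < b) (x : ℝ) :
    ∫ t : ℝ, osc t x * ((rexp (-(|t| / b)) : ℝ) : ℂ) = ((2 * b / (1 + (b * x) ^ 2) : ℝ) : ℂ) := by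
  obtain ⟨h1, h2⟩ := integrable_osc_exp hb x
  rw [← intervalIntegral.integral_Iic_add_Ioi h2 h1,
    setIntegral_congr_fun measurableSet_Ioi (fun t ht => osc_exp_Ioi x ht),
    setIntegral_congr_fun measurableSet_Iic (fun t ht => osc_exp_Iic x ht),
    integral_exp_mul_complex_Ioi (by simpa using hb), integral_exp_mul_complex_Iic (by simpa using hb)]
  have e1 : (1 + (b : ℂ) * x * I) ≠ 0 := by intro h; have := congrArg re h; simp at this
  have e2 : (-1 + (b : ℂ) * x * I) ≠ 0 := by intro h; have := congrArg re h; simp at this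
  have e3 : (1 + ((b : ℂ) * x) ^ 2) ≠ 0 := by
    have h : (1 + ((b : ℂ) * x) ^ 2) = ((1 + (b * x) ^ 2 : ℝ) : ℂ) := by push_cast; ring
    rw [h]; exact_mod_cast (by positivity : (1 + (b * x) ^ 2 : ℝ) ≠ 0)
  have hbc : (b : ℂ) ≠ 0 := mod_cast hb.ne'
  have f1 : ((1 / b : ℝ) : ℂ) + x * I = (1 + (b : ℂ) * x * I) / b := by push_cast; field_simp
  have f2 : -((1 / b : ℝ) : ℂ) + x * I = (-1 + (b : ℂ) * x * I) / b := by push_cast; field_simp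
  rw [f1, f2]
  have f3 : ((2 * b / (1 + (b * x) ^ 2) : ℝ) : ℂ) = 2 * b / (1 + ((b : ℂ) * x) ^ 2) := by
    push_cast; ring
  rw [f3]; simp only [ofReal_zero, mul_zero, Complex.exp_zero]
  rw [div_div_eq_mul_div, div_div_eq_mul_div, div_add_div _ _ e1 e2, div_eq_div_iff
    (mul_ne_zero e1 e2) e3]
  linear_combination (2 * b * (1 + (b:ℂ)^2*x^2) - 2 * b * (1 + (b:ℂ)^2*x^2) -2*(b:ℂ)^3*x^2)  * I_sq

lemma integrable_exp_neg_abs (hb : 0 < b) :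
    Integrable (fun t : ℝ => rexp (-(|t| / b))) := by
  obtain ⟨h1, h2⟩ := integrable_osc_exp hb 0
  have h := integrableOn_univ.1 ((Set.Iic_union_Ioi (a := (0 : ℝ))) ▸ h2.union h1)
  refine h.norm.congr (.of_forall fun t => ?_)
  simp only [norm_mul, norm_osc, one_mul, norm_real, norm_eq_abs, abs_of_pos (exp_pos _)]

lemma integral_exp_neg_abs (hb : 0 < b) :
    ∫ t : ℝ, rexp (-(|t| / b)) = 2 * b := by
  have h := integral_osc_exp hb 0
  have e : ∀ t : ℝ, osc t 0 = 1 := fun t => by simp [osc]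
  simp only [e, one_mul] at h; rw [integral_complex_ofReal] at h
  have := ofReal_injective h
  simpa using this

/-- Smooth-truncated transform of the one-sided exponential. -/
def ker (A T t : ℝ) : ℂ := ((rexp (-(t ^ 2 / (2 * T ^ 2))) : ℝ) : ℂ) / (A - t * I)

/-- One-sided exponential weight. -/
def wc (A x : ℝ) : ℝ := if x ≤ 0 then rexp (A * x) else 0

/-- Error weight attached to the truncation at height `T`. -/
def wo (A T x : ℝ) : ℝ := 1 / (1 + (T * x) ^ 2) + A / T / (1 + (A * x) ^ 2)

lemma wc_nonneg (A x : ℝ) : 0 ≤ wc A x := by unfold wc; split_ifs <;> positivity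

lemma wc_le_one (hA : 0 ≤ A) (x : ℝ) : wc A x ≤ 1 := by
  unfold wc; split_ifs with h
  · exact exp_le_one_iff.2 (mul_nonpos_of_nonneg_of_nonpos hA h)
  · norm_num

lemma wo_nonneg (hA : 0 < A) (hT : A ≤ T) (x : ℝ) : 0 ≤ wo A T x := by
  have : 0 < T := by linarith
  unfold wo; positivity

lemma wo_le_two (hA : 0 < A) (hT : A ≤ T) (x : ℝ) : wo A T x ≤ 2 := by
  have h0 : 0 < T := by linarith
  have h1 : 1 / (1 + (T * x) ^ 2) ≤ 1 := by
    rw [div_le_one (by positivity)]; nlinarith [sq_nonneg (T * x)]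
  have h2 : A / T / (1 + (A * x) ^ 2) ≤ 1 := by
    rw [div_le_one (by positivity)]
    have : A / T ≤ 1 := (div_le_one h0).2 hT
    nlinarith [sq_nonneg (A * x)]
  unfold wo; linarith

lemma measurable_wc (A : ℝ) : Measurable (wc A) := by
  unfold wc; exact Measurable.ite measurableSet_Iic (by fun_prop) measurable_const

lemma measurable_wo (A T : ℝ) : Measurable (wo A T) := by
  unfold wo; fun_prop

lemma sub_mul_I_ne_zero (hA : 0 < A) (t : ℝ) : (A - t * I : ℂ) ≠ 0 := by
  intro h; have := congrArg re h; simp at this; linarith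

lemma le_norm_sub_mul_I (A t : ℝ) : A ≤ ‖(A - t * I : ℂ)‖ := by
  have h := re_le_norm (A - t * I : ℂ)
  simpa using h

lemma norm_ker_le (hA : 0 < A) (hT : 0 < T) (t : ℝ) :
    ‖ker A T t‖ ≤ 2 * rexp (-(|t| / T)) / A := by
  rw [ker, norm_div, norm_real, norm_eq_abs, abs_of_pos (exp_pos _)]
  have h1 : rexp (-(t ^ 2 / (2 * T ^ 2))) ≤ 2 * rexp (-(|t| / T)) := by
    have h2 : rexp (-(t ^ 2 / (2 * T ^ 2))) ≤ rexp (1 / 2 + -(|t| / T)) := by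
      apply exp_le_exp.2
      have e : t ^ 2 / (2 * T ^ 2) = (|t| / T) ^ 2 / 2 := by rw [div_pow, sq_abs]; field_simp
      rw [e]; nlinarith [sq_nonneg (|t| / T - 1)]
    rw [Real.exp_add] at h2
    have h3 : rexp (1 / 2) ≤ 2 := by
      have := exp_one_lt_d9
      have h4 : rexp (1 / 2) ^ 2 = rexp 1 := by rw [← Real.exp_nat_mul]; norm_num
      nlinarith [exp_pos (1 / 2)]
    exact h2.trans (by gcongr)
  exact div_le_div₀ (by positivity) h1 hA (le_norm_sub_mul_I A t)

lemma continuous_ker (hA : 0 < A) (T : ℝ) : Continuous (ker A T) := by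
  unfold ker; exact Continuous.div (by fun_prop) (by fun_prop) (sub_mul_I_ne_zero hA)

lemma integrable_ker (hA : 0 < A) (hT : 0 < T) : Integrable (ker A T) := by
  refine ((integrable_exp_neg_abs hT).const_mul (2 / A)).mono'
    (continuous_ker hA T).aestronglyMeasurable (.of_forall fun t => ?_)
  refine (norm_ker_le hA hT t).trans (le_of_eq (by ring))

/-- Variance parameter `1 / T²` of the smoothing Gaussian. -/
def gvar (T : ℝ) : NNReal := toNNReal (1 / T ^ 2)

lemma gvar_coe (T : ℝ) : (gvar T : ℝ) = 1 / T ^ 2 := by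
  rw [gvar, Real.coe_toNNReal _ (by positivity)]

lemma gvar_ne_zero (hT : 0 < T) : gvar T ≠ 0 := by
  intro h
  have h1 := gvar_coe T
  rw [h] at h1
  have : 0 < 1 / T ^ 2 := by positivity
  simp only [NNReal.coe_zero] at h1; linarith

lemma integral_osc_gauss (hT : 0 < T) (u : ℝ) :
    ∫ t : ℝ, osc t u * ((rexp (-(t ^ 2 / (2 * T ^ 2))) : ℝ) : ℂ) =
      ((2 * π * gaussianPDFReal 0 (gvar T) u : ℝ) : ℂ) := by
  have hb : 0 < ((1 / (2 * T ^ 2) : ℝ) : ℂ).re := by rw [ofReal_re]; positivity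
  have h := fourierIntegral_gaussian hb (u : ℂ)
  have e : ∀ t : ℝ, osc t u * ((rexp (-(t ^ 2 / (2 * T ^ 2))) : ℝ) : ℂ) =
      cexp (I * u * t) * cexp (-((1 / (2 * T ^ 2) : ℝ) : ℂ) * t ^ 2) := by
    intro t; rw [osc, ofReal_exp]; congr 2
    · push_cast; ring
    · push_cast; ring
  simp only [e]; rw [h, ProbabilityTheory.gaussianPDFReal_def, gvar_coe]
  have h1 : (π / ((1 / (2 * T ^ 2) : ℝ) : ℂ)) ^ (1 / 2 : ℂ) = ((√(2 * π * T ^ 2) : ℝ) : ℂ) := by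
    rw [sqrt_eq_rpow, ofReal_cpow (by positivity)]
    have hT' : (T : ℂ) ≠ 0 := mod_cast hT.ne'
    congr 1
    · push_cast; field_simp
    · push_cast; ring
  have h2 : √(2 * π * T ^ 2) = 2 * π * (√(2 * π * (1 / T ^ 2)))⁻¹ := by
    rw [Real.sqrt_mul (by positivity), Real.sqrt_mul (by positivity) (1 / T ^ 2), Real.sqrt_sq hT.le,
      Real.sqrt_div zero_le_one, Real.sqrt_one, Real.sqrt_sq hT.le]
    have h4 : √(2 * π) * √(2 * π) = 2 * π := Real.mul_self_sqrt (by positivity)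
    field_simp; linarith
  rw [h1, h2]
  have h5 : cexp (-(u : ℂ) ^ 2 / (4 * ((1 / (2 * T ^ 2) : ℝ) : ℂ))) =
      ((rexp (-(u - 0) ^ 2 / (2 * (1 / T ^ 2))) : ℝ) : ℂ) := by
    rw [ofReal_exp]; congr 1
    have hT' : (T : ℂ) ≠ 0 := mod_cast hT.ne'
    push_cast; field_simp; ring
  rw [h5]; push_cast; ring

/-- The function `u ↦ 1_{u > x} e^{-A (u - x)}`. -/
def shiftExp (A x u : ℝ) : ℝ := Set.indicator (Set.Ioi x) (fun u => rexp (-(A * (u - x)))) u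

lemma integral_osc_ker (hA : 0 < A) (hT : 0 < T) (x : ℝ) :
    ∫ t : ℝ, osc t x * ker A T t =
      ((2 * π * ∫ u, shiftExp A x u ∂(gaussianReal 0 (gvar T)) : ℝ) : ℂ) := by
  have hg : Integrable (fun r : ℝ => cexp (-(A : ℂ) * r)) (volume.restrict (Set.Ioi 0)) :=
    integrableOn_exp_mul_complex_Ioi (by simpa using hA) 0
  have hm : Integrable (fun t : ℝ => ((rexp (-(t ^ 2 / (2 * T ^ 2))) : ℝ) : ℂ)) := by
    have := integrable_exp_neg_mul_sq (b := 1 / (2 * T ^ 2)) (by positivity)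
    refine Integrable.ofReal (this.congr (.of_forall fun t => ?_))
    simp only []; congr 1; ring
  have hX : Measurable (fun r : ℝ => x + r) := by fun_prop
  have h := integral_osc_swap (volume.restrict (Set.Ioi 0)) hX hm hg
  have e1 : ∀ t : ℝ, osc t x * ker A T t = ((rexp (-(t ^ 2 / (2 * T ^ 2))) : ℝ) : ℂ) *
      ∫ r in Set.Ioi 0, osc t (x + r) * cexp (-(A : ℂ) * r) := by
    intro t
    have e2 : ∀ r : ℝ, osc t (x + r) * cexp (-(A : ℂ) * r) =
        osc t x * cexp ((-(A : ℂ) + t * I) * r) := by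
      intro r; rw [osc, osc, ← Complex.exp_add, ← Complex.exp_add]; congr 1; push_cast; ring
    simp only [e2]; rw [integral_const_mul, integral_exp_mul_complex_Ioi (by simpa using hA)]
    have h4 : (-(A : ℂ) + t * I) = -(A - t * I) := by ring
    rw [h4, ker, ofReal_zero, mul_zero, Complex.exp_zero, neg_div_neg_eq]; ring
  simp only [e1]; rw [← h]; simp only [integral_osc_gauss hT]
  rw [ProbabilityTheory.integral_gaussianReal_eq_integral_smul (gvar_ne_zero hT),
    ← integral_indicator measurableSet_Ioi]
  rw [← integral_const_mul, ← integral_complex_ofReal,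
    ← integral_add_left_eq_self (fun u : ℝ => ((2 * π *
      (gaussianPDFReal 0 (gvar T) u • shiftExp A x u) : ℝ) : ℂ)) x]
  congr 1; funext r
  by_cases hr : r ∈ Set.Ioi (0 : ℝ)
  · have hr' : x + r ∈ Set.Ioi x := by simpa using hr
    rw [Set.indicator_of_mem hr, shiftExp, Set.indicator_of_mem hr']
    rw [show x + r - x = r by ring]
    push_cast; rw [smul_eq_mul]; push_cast; rw [show -((A : ℂ) * r) = -A * r by ring]; ring
  · have hr' : x + r ∉ Set.Ioi x := by simpa using hr
    rw [Set.indicator_of_notMem hr, shiftExp, Set.indicator_of_notMem hr']; simp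

lemma one_add_sq_le_two_cosh (s : ℝ) : 1 + s ^ 2 ≤ rexp (2 * s) + rexp (-(2 * s)) := by
  rcases le_total 0 s with h | h
  · have := Real.quadratic_le_exp_of_nonneg (x := 2 * s) (by linarith)
    have := exp_pos (-(2 * s))
    nlinarith
  · have := Real.quadratic_le_exp_of_nonneg (x := -(2 * s)) (by linarith)
    have := exp_pos (2 * s)
    nlinarith [add_one_le_exp (2 * s)]

lemma abs_one_sub_exp_le (s : ℝ) : |1 - rexp (-s)| ≤ |s| * rexp |s| := by
  rcases le_total 0 s with h | h
  · rw [abs_of_nonneg h, abs_of_nonneg (by simpa using h)]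
    have := add_one_le_exp (-s)
    have := one_le_exp h
    nlinarith
  · rw [abs_of_nonpos h, abs_of_nonpos (by simpa using h)]
    have := add_one_le_exp s
    have h2 : rexp s * rexp (-s) = 1 := by rw [← Real.exp_add]; simp
    nlinarith [exp_pos (-s)]

lemma exp_neg_abs_le (s : ℝ) : rexp (-|s|) ≤ 2 / (1 + s ^ 2) := by
  rw [le_div_iff₀ (by positivity), Real.exp_neg, inv_mul_le_iff₀ (exp_pos _)]
  have := Real.quadratic_le_exp_of_nonneg (abs_nonneg s)
  rw [sq_abs] at this; nlinarith [abs_nonneg s]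

lemma abs_wc_sub_shiftExp_le (hA : 0 < A) (hT : A ≤ T) (x u : ℝ) :
    |wc A x - shiftExp A x u| ≤ (2 * wo A T x) * (rexp ((2 * T) * u) + rexp ((-(2 * T)) * u)) := by
  have hT0 : 0 < T := by linarith
  set Cc := rexp ((2 * T) * u) + rexp ((-(2 * T)) * u) with hC
  have hC1 : 1 + (T * u) ^ 2 ≤ Cc := by
    have := one_add_sq_le_two_cosh (T * u)
    rw [hC]; convert this using 3 <;> ring
  have hCpos : 0 < Cc := by positivity
  have far : |x| ≤ |u| → |wc A x - shiftExp A x u| ≤ 1 → |wc A x - shiftExp A x u| ≤ 2 * wo A T x * Cc := by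
    intro h1 h2
    have h3 : (1 : ℝ) ≤ 1 / (1 + (T * x) ^ 2) * Cc := by
      rw [one_div, inv_mul_eq_div, le_div_iff₀ (by positivity), one_mul]
      have h4 : (T * x) ^ 2 ≤ (T * u) ^ 2 := by
        rw [mul_pow, mul_pow]
        have := sq_le_sq.2 h1
        gcongr
      linarith
    have h5 : 0 ≤ A / T / (1 + (A * x) ^ 2) * Cc := by positivity
    have h6 : 0 ≤ wo A T x * Cc := mul_nonneg (wo_nonneg hA hT x) hCpos.le
    have h7 : wo A T x * Cc = 1 / (1 + (T * x) ^ 2) * Cc + A / T / (1 + (A * x) ^ 2) * Cc := by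
      rw [wo]; ring
    nlinarith
  rcases le_or_gt x 0 with hx | hx
  · have hw : wc A x = rexp (A * x) := if_pos hx
    by_cases hu : u ∈ Set.Ioi x
    · rw [hw, shiftExp, Set.indicator_of_mem hu]
      have e : rexp (A * x) - rexp (-(A * (u - x))) = rexp (-|A * x|) * (1 - rexp (-(A * u))) := by
        rw [abs_of_nonpos (mul_nonpos_of_nonneg_of_nonpos hA.le hx), mul_sub (rexp _), ← Real.exp_add]
        congr 1
        · simp
        · congr 1; ring
      rw [e, abs_mul, abs_of_pos (exp_pos _)]
      have h1 := exp_neg_abs_le (A * x)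
      have h2 := abs_one_sub_exp_le (A * u)
      have h3 : |A * u| * rexp |A * u| ≤ A / T * Cc := by
        have h4 : |A * u| = A / T * |T * u| := by
          rw [abs_mul, abs_mul, abs_of_pos hA, abs_of_pos hT0]; field_simp
        have h5 : |A * u| ≤ |T * u| := by
          rw [abs_mul, abs_mul, abs_of_pos hA, abs_of_pos hT0]; gcongr
        have h6 : |T * u| * rexp |A * u| ≤ rexp (2 * |T * u|) := by
          have := add_one_le_exp |T * u|
          calc |T * u| * rexp |A * u| ≤ rexp |T * u| * rexp |T * u| := by
                gcongr; linarith
            _ = _ := by rw [← Real.exp_add]; congr 1; ring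
        have h7 : rexp (2 * |T * u|) ≤ Cc := by
          rw [hC]
          rcases le_total 0 (T * u) with h | h
          · rw [abs_of_nonneg h, ← mul_assoc]; have := exp_pos (-(2 * T) * u); linarith
          · rw [abs_of_nonpos h, show 2 * -(T * u) = -(2 * T) * u by ring]
            have := exp_pos (2 * T * u); linarith
        calc |A * u| * rexp |A * u| = A / T * (|T * u| * rexp |A * u|) := by
              nth_rewrite 1 [h4]; ring
          _ ≤ _ := by gcongr; exact h6.trans h7
      calc _ ≤ 2 / (1 + (A * x) ^ 2) * (A / T * Cc) := by
            gcongr; exact h2.trans h3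
        _ = 2 * (A / T / (1 + (A * x) ^ 2)) * Cc := by ring
        _ ≤ _ := by
          gcongr; rw [wo]
          have : 0 ≤ 1 / (1 + (T * x) ^ 2) := by positivity
          linarith
    · have hu' : u ≤ x := not_lt.1 hu
      refine far ?_ ?_
      · rw [abs_of_nonpos hx, abs_of_nonpos (hu'.trans hx)]; linarith
      · rw [shiftExp, Set.indicator_of_notMem hu, sub_zero, abs_of_nonneg (wc_nonneg _ _)]
        exact wc_le_one hA.le x
  · have hw : wc A x = 0 := if_neg (not_le.2 hx)
    by_cases hu : u ∈ Set.Ioi x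
    · have hu' : x < u := hu
      refine far ?_ ?_
      · rw [abs_of_pos hx, abs_of_pos (hx.trans hu')]; exact hu'.le
      · rw [hw, shiftExp, Set.indicator_of_mem hu, zero_sub, abs_neg, abs_of_pos (exp_pos _)]
        apply exp_le_one_iff.2
        have : 0 ≤ A * (u - x) := mul_nonneg hA.le (by linarith)
        linarith
    · rw [hw, shiftExp, Set.indicator_of_notMem hu]
      simp only [sub_zero, abs_zero]
      exact mul_nonneg (mul_nonneg zero_le_two (wo_nonneg hA hT x)) hCpos.le

lemma measurable_shiftExp (A x : ℝ) : Measurable (shiftExp A x) := by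
  unfold shiftExp; exact Measurable.indicator (by fun_prop) measurableSet_Ioi

lemma shiftExp_mem (hA : 0 < A) (x u : ℝ) : ‖shiftExp A x u‖ ≤ 1 := by
  unfold shiftExp
  by_cases hu : u ∈ Set.Ioi x
  · rw [Set.indicator_of_mem hu, norm_eq_abs, abs_of_pos (exp_pos _)]
    apply exp_le_one_iff.2
    have hu' : x < u := hu
    have : 0 ≤ A * (u - x) := mul_nonneg hA.le (by linarith)
    linarith
  · rw [Set.indicator_of_notMem hu]; simp

lemma integral_exp_gauss (hT : 0 < T) (hc : c ^ 2 = (2 * T) ^ 2) :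
    ∫ u, rexp (c * u) ∂(gaussianReal 0 (gvar T)) = rexp 2 := by
  have h := congrFun (ProbabilityTheory.mgf_fun_id_gaussianReal (μ := 0) (v := gvar T)) c
  rw [mgf] at h; rw [h, gvar_coe, hc]; congr 1; field_simp; ring

lemma abs_wc_sub_smooth_le (hA : 0 < A) (hT : A ≤ T) (x : ℝ) :
    ‖((wc A x : ℝ) : ℂ) - 1 / (2 * π) * ∫ t : ℝ, osc t x * ker A T t‖ ≤ 40 * wo A T x := by
  have hT0 : 0 < T := by linarith
  set P := gaussianReal 0 (gvar T)
  have e : ((wc A x : ℝ) : ℂ) - 1 / (2 * π) * ∫ t : ℝ, osc t x * ker A T t =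
      ((∫ u, (wc A x - shiftExp A x u) ∂P : ℝ) : ℂ) := by
    have hs : Integrable (fun u => shiftExp A x u) P :=
      Integrable.of_bound (measurable_shiftExp A x).aestronglyMeasurable 1
        (.of_forall (shiftExp_mem hA x))
    rw [integral_osc_ker hA hT0, integral_sub (integrable_const _) hs, integral_const]
    have : (π : ℂ) ≠ 0 := mod_cast Real.pi_ne_zero
    simp only [probReal_univ, one_smul]; push_cast; field_simp; simp [P]
  rw [e, norm_real]
  have i1 : Integrable (fun u => rexp ((2 * T) * u)) P :=
    integrable_exp_mul_gaussianReal _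
  have i2 : Integrable (fun u => rexp ((-(2 * T)) * u)) P :=
    integrable_exp_mul_gaussianReal _
  have i3 : Integrable (fun u => (2 * wo A T x) *
      (rexp ((2 * T) * u) + rexp ((-(2 * T)) * u))) P := (i1.add i2).const_mul _
  refine (norm_integral_le_of_norm_le i3 (.of_forall fun u =>
    abs_wc_sub_shiftExp_le hA hT x u)).trans ?_
  rw [integral_const_mul, integral_add i1 i2, integral_exp_gauss hT0 rfl,
    integral_exp_gauss hT0 (by ring)]
  have h1 : rexp 2 ≤ 10 := by
    have := exp_one_lt_d9
    have h4 : rexp 2 = rexp 1 ^ 2 := by rw [← Real.exp_nat_mul]; norm_num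
    nlinarith [exp_pos 1]
  nlinarith [wo_nonneg hA hT x]

section Transfer

variable {Ω : Type*} [MeasurableSpace Ω] (μ : Measure Ω) {X : Ω → ℝ}

lemma measurable_osc_comp (hX : Measurable X) (t : ℝ) : Measurable (fun ω => osc t (X ω)) := by
  unfold osc; fun_prop

lemma integrable_osc_mul (hX : Measurable X) {g : Ω → ℂ} (hg : Integrable g μ) (t : ℝ) :
    Integrable (fun ω => osc t (X ω) * g ω) μ :=
  hg.bdd_mul (measurable_osc_comp hX t).aestronglyMeasurable
    (.of_forall fun ω => (norm_osc t (X ω)).le)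

lemma norm_integral_osc_le (g : Ω → ℂ) (t : ℝ) :
    ‖∫ ω, osc t (X ω) * g ω ∂μ‖ ≤ ∫ ω, ‖g ω‖ ∂μ := by
  refine (norm_integral_le_integral_norm _).trans (le_of_eq ?_)
  congr 1; funext ω; rw [norm_mul, norm_osc, one_mul]

lemma integrable_wc_mul (hX : Measurable X) (hA : 0 < A) {g : Ω → ℂ}
    (hg : Integrable g μ) : Integrable (fun ω => ((wc A (X ω) : ℝ) : ℂ) * g ω) μ := by
  refine hg.bdd_mul (c := 1) ?_ (.of_forall fun ω => ?_)
  · exact (measurable_ofReal.comp ((measurable_wc A).comp hX)).aestronglyMeasurable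
  · rw [norm_real, norm_eq_abs, abs_of_nonneg (wc_nonneg _ _)]
    exact wc_le_one hA.le _

lemma integrable_wo_mul (hX : Measurable X) (hA : 0 < A) (hT : A ≤ T) {h : Ω → ℝ}
    (hh : Integrable h μ) : Integrable (fun ω => wo A T (X ω) * h ω) μ := by
  refine hh.bdd_mul (c := 2) ((measurable_wo A T).comp hX).aestronglyMeasurable
    (.of_forall fun ω => ?_)
  rw [norm_eq_abs, abs_of_nonneg (wo_nonneg hA hT _)]; exact wo_le_two hA hT _

variable [SFinite μ]

/-- Smoothed inversion for the one-sided exponential weight. -/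
theorem wc_transfer (hX : Measurable X) (hA : 0 < A) (hT : A ≤ T) {g : Ω → ℂ}
    (hg : Integrable g μ) :
    ‖(∫ ω, ((wc A (X ω) : ℝ) : ℂ) * g ω ∂μ) -
      1 / (2 * π) * ∫ t, ker A T t * ∫ ω, osc t (X ω) * g ω ∂μ‖ ≤
      40 * ∫ ω, wo A T (X ω) * ‖g ω‖ ∂μ := by
  have hT0 : 0 < T := by linarith
  have hk := integrable_ker hA hT0
  rw [← integral_osc_swap μ hX hk hg, ← integral_const_mul]
  have hP : Integrable (fun ω => (∫ t, osc t (X ω) * ker A T t) * g ω) μ := by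
    have hm : Measurable (fun x : ℝ => ∫ t, osc t x * ker A T t) := by
      have : StronglyMeasurable (fun p : ℝ × ℝ => osc p.2 p.1 * ker A T p.2) := by
        refine (Continuous.mul ?_ ((continuous_ker hA T).comp continuous_snd)).stronglyMeasurable
        exact continuous_osc.comp (continuous_snd.prodMk continuous_fst)
      exact this.integral_prod_right.measurable
    refine hg.bdd_mul (c := ∫ t, ‖ker A T t‖) (hm.comp hX).aestronglyMeasurable
      (.of_forall fun ω => ?_)
    refine (norm_integral_le_integral_norm _).trans (le_of_eq ?_)
    congr 1; funext t; rw [norm_mul, norm_osc, one_mul]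
  have hP' : Integrable (fun ω => 1 / (2 * π : ℂ) * ((∫ t, osc t (X ω) * ker A T t) * g ω)) μ :=
    hP.const_mul _
  rw [← integral_sub (integrable_wc_mul μ hX hA hg) hP', ← integral_const_mul]
  refine norm_integral_le_of_norm_le ((integrable_wo_mul μ hX hA hT hg.norm).const_mul 40)
    (.of_forall fun ω => ?_)
  have e : ((wc A (X ω) : ℝ) : ℂ) * g ω - 1 / (2 * π : ℂ) * ((∫ t, osc t (X ω) * ker A T t) * g ω) =
      (((wc A (X ω) : ℝ) : ℂ) - 1 / (2 * π : ℂ) * ∫ t, osc t (X ω) * ker A T t) * g ω := by ring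
  rw [e, norm_mul, ← mul_assoc]; gcongr; exact abs_wc_sub_smooth_le hA hT (X ω)

lemma integral_poisson_le (hX : Measurable X) (hb : 0 < b) {h : Ω → ℝ}
    (hh : Integrable h μ) :
    ∫ ω, 1 / (1 + (b * X ω) ^ 2) * h ω ∂μ ≤
      1 / (2 * b) * ∫ t, rexp (-(|t| / b)) * ‖∫ ω, osc t (X ω) * ((h ω : ℝ) : ℂ) ∂μ‖ := by
  have hm : Integrable (fun t : ℝ => ((rexp (-(|t| / b)) : ℝ) : ℂ)) :=
    (integrable_exp_neg_abs hb).ofReal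
  have hg : Integrable (fun ω => ((h ω : ℝ) : ℂ)) μ := hh.ofReal
  have hs := integral_osc_swap μ hX hm hg
  simp only [integral_osc_exp hb] at hs
  have e : ((∫ ω, 1 / (1 + (b * X ω) ^ 2) * h ω ∂μ : ℝ) : ℂ) = ((1 / (2 * b) : ℝ) : ℂ) *
      ∫ ω, ((2 * b / (1 + (b * X ω) ^ 2) : ℝ) : ℂ) * ((h ω : ℝ) : ℂ) ∂μ := by
    rw [← integral_complex_ofReal, ← integral_const_mul]; congr 1; funext ω
    rw [← ofReal_mul, ← ofReal_mul]; congr 1; field_simp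
  have h1 : |∫ ω, 1 / (1 + (b * X ω) ^ 2) * h ω ∂μ| ≤
      1 / (2 * b) * ∫ t, rexp (-(|t| / b)) * ‖∫ ω, osc t (X ω) * ((h ω : ℝ) : ℂ) ∂μ‖ := by
    rw [← norm_eq_abs, ← norm_real, e, hs, norm_mul, norm_real,
      norm_eq_abs, abs_of_pos (by positivity)]
    gcongr; refine (norm_integral_le_integral_norm _).trans (le_of_eq ?_); congr 1; funext t
    rw [norm_mul, norm_real, norm_eq_abs, abs_of_pos (exp_pos _)]
  exact (le_abs_self _).trans h1

lemma stronglyMeasurable_integral_osc (hX : Measurable X) {g : Ω → ℂ} (hg : Integrable g μ) :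
    AEStronglyMeasurable (fun t : ℝ => ∫ ω, osc t (X ω) * g ω ∂μ) volume := by
  have h0 : AEStronglyMeasurable (fun p : ℝ × Ω => osc p.1 (X p.2) * g p.2)
      ((volume : Measure ℝ).prod μ) := by
    refine AEStronglyMeasurable.mul ?_ ?_
    · exact (continuous_osc.measurable.comp
        (measurable_fst.prodMk (hX.comp measurable_snd))).aestronglyMeasurable
    · exact hg.aestronglyMeasurable.comp_snd
  exact h0.integral_prod_right'

lemma integrable_mul_integral_osc (hX : Measurable X) {g : Ω → ℂ} (hg : Integrable g μ) {m : ℝ → ℂ}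
    (hm : Integrable m) : Integrable (fun t => m t * ∫ ω, osc t (X ω) * g ω ∂μ) := by
  refine hm.mul_bdd (c := ∫ ω, ‖g ω‖ ∂μ) (stronglyMeasurable_integral_osc μ hX hg)
    (.of_forall fun t => norm_integral_osc_le μ g t)

lemma integrable_exp_mul_norm_integral_osc (hX : Measurable X) {g : Ω → ℂ} (hg : Integrable g μ)
 (hb : 0 < b) :
    Integrable (fun t => rexp (-(|t| / b)) * ‖∫ ω, osc t (X ω) * g ω ∂μ‖) := by
  refine (integrable_exp_neg_abs hb).mul_bdd (c := ∫ ω, ‖g ω‖ ∂μ)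
    (stronglyMeasurable_integral_osc μ hX hg).norm
    (.of_forall fun t => ?_)
  rw [norm_norm]; exact norm_integral_osc_le μ g t

/-- The error weight is controlled by the transform. -/
theorem wo_transfer (hX : Measurable X) (hA : 0 < A) (hT : A ≤ T) {h : Ω → ℝ}
    (hh : Integrable h μ) :
    ∫ ω, wo A T (X ω) * h ω ∂μ ≤
      1 / T * ∫ t, rexp (-(|t| / T)) * ‖∫ ω, osc t (X ω) * ((h ω : ℝ) : ℂ) ∂μ‖ := by
  have hT0 : 0 < T := by linarith
  have hg : Integrable (fun ω => ((h ω : ℝ) : ℂ)) μ := hh.ofReal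
  have b1 : ∀ c : ℝ, Integrable (fun ω => 1 / (1 + (c * X ω) ^ 2) * h ω) μ := by
    intro c
    refine hh.bdd_mul (c := 1) (Measurable.aestronglyMeasurable (by fun_prop))
      (.of_forall fun ω => ?_)
    rw [norm_eq_abs, abs_of_nonneg (by positivity), div_le_one (by positivity)]
    nlinarith [sq_nonneg (c * X ω)]
  have e : ∫ ω, wo A T (X ω) * h ω ∂μ = (∫ ω, 1 / (1 + (T * X ω) ^ 2) * h ω ∂μ) +
      A / T * ∫ ω, 1 / (1 + (A * X ω) ^ 2) * h ω ∂μ := by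
    have b2 : Integrable (fun ω => A / T * (1 / (1 + (A * X ω) ^ 2) * h ω)) μ :=
      (b1 A).const_mul _
    rw [← integral_const_mul, ← integral_add (b1 T) b2]; congr 1; funext ω; rw [wo]; ring
  have h1 := integral_poisson_le μ hX hT0 hh
  have h2 := integral_poisson_le μ hX hA hh
  have h3 : ∫ t, rexp (-(|t| / A)) * ‖∫ ω, osc t (X ω) * ((h ω : ℝ) : ℂ) ∂μ‖ ≤
      ∫ t, rexp (-(|t| / T)) * ‖∫ ω, osc t (X ω) * ((h ω : ℝ) : ℂ) ∂μ‖ := by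
    refine integral_mono (integrable_exp_mul_norm_integral_osc μ hX hg hA)
      (integrable_exp_mul_norm_integral_osc μ hX hg hT0) fun t => ?_
    simp only []; gcongr
  have h4 : A / T * ∫ ω, 1 / (1 + (A * X ω) ^ 2) * h ω ∂μ ≤ A / T * (1 / (2 * A) *
        ∫ t, rexp (-(|t| / T)) * ‖∫ ω, osc t (X ω) * ((h ω : ℝ) : ℂ) ∂μ‖) := by
    gcongr; exact h2.trans (by gcongr)
  rw [e]; refine (add_le_add h1 h4).trans (le_of_eq ?_); field_simp; ring

end Transfer

lemma one_add_sq_mul_exp_le {u : ℝ} (hc : 0 < c) (hu : 0 ≤ u) :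
    (1 + u) ^ 2 * rexp (-(c * u)) ≤ (1 + 4 / c) ^ 2 * rexp (-(c / 2 * u)) := by
  have h1 : 1 + u ≤ (1 + 4 / c) * rexp (c / 4 * u) := by
    have h2 := add_one_le_exp (c / 4 * u)
    have h3 : u = 4 / c * (c / 4 * u) := by field_simp
    have h4 : 1 ≤ rexp (c / 4 * u) := one_le_exp (by positivity)
    have h5 : u ≤ 4 / c * rexp (c / 4 * u) := by
      calc u = 4 / c * (c / 4 * u) := h3
        _ ≤ _ := by gcongr; linarith
    linarith
  calc (1 + u) ^ 2 * rexp (-(c * u))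
      ≤ ((1 + 4 / c) * rexp (c / 4 * u)) ^ 2 * rexp (-(c * u)) := by gcongr
    _ = (1 + 4 / c) ^ 2 * (rexp (c / 4 * u) * rexp (c / 4 * u) * rexp (-(c * u))) := by ring
    _ = _ := by rw [← Real.exp_add, ← Real.exp_add]; congr 2; ring

lemma integrable_gauss_tail {a τ : ℝ} (hb : 0 < b) (hT : 0 < T) :
    Integrable (fun t : ℝ => a * rexp (-(b * t ^ 2)) + τ * rexp (-(|t| / (2 * T)))) := by
  have h1 := (integrable_exp_neg_mul_sq hb).const_mul a
  have h2 := (integrable_exp_neg_abs (b := 2 * T) (by positivity)).const_mul τ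
  simp only [neg_mul] at h1; exact h1.add h2

lemma integral_gauss_tail {a τ : ℝ} (hb : 0 < b) (hT : 0 < T) :
    ∫ t : ℝ, (a * rexp (-(b * t ^ 2)) + τ * rexp (-(|t| / (2 * T)))) =
      a * √(π / b) + τ * (4 * T) := by
  have h1 := (integrable_exp_neg_mul_sq hb).const_mul a
  have h2 := (integrable_exp_neg_abs (b := 2 * T) (by positivity)).const_mul τ
  have h3 := integral_gaussian b
  simp only [neg_mul] at h1 h3
  rw [integral_add h1 h2, integral_const_mul, integral_const_mul, h3,
    integral_exp_neg_abs (by positivity)]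
  ring

lemma norm_integral_le_gauss_tail {E : Type*} [NormedAddCommGroup E] [NormedSpace ℝ E]
    {g : ℝ → E} {a τ : ℝ} (hb : 0 < b) (hT : 0 < T)
    (h : ∀ t, ‖g t‖ ≤ a * rexp (-(b * t ^ 2)) + τ * rexp (-(|t| / (2 * T)))) :
    ‖∫ t, g t‖ ≤ a * √(π / b) + τ * (4 * T) := by
  rw [← integral_gauss_tail hb hT]
  exact norm_integral_le_of_norm_le (integrable_gauss_tail hb hT) (.of_forall h)

lemma ker_sub_le (hA : 1 ≤ A) (hT : 1 ≤ T) :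
    ‖ker A T t - 1 / A‖ ≤ (t ^ 2 + |t|) / A := by
  have hA0 : 0 < A := by linarith
  have hne := sub_mul_I_ne_zero hA0 t
  have hAc : (A : ℂ) ≠ 0 := mod_cast hA0.ne'
  set g := rexp (-(t ^ 2 / (2 * T ^ 2))) with hg
  have e : ker A T t - 1 / A = (((g - 1 : ℝ) : ℂ) * A + t * I) / ((A - t * I) * A) := by
    rw [ker, ← hg]; field_simp; push_cast; ring
  have hg1 : |g - 1| ≤ t ^ 2 := by
    have h1 : g ≤ 1 := exp_le_one_iff.2 (by
      have : 0 ≤ t ^ 2 / (2 * T ^ 2) := by positivity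
      linarith)
    have h2 := add_one_le_exp (-(t ^ 2 / (2 * T ^ 2)))
    have h3 : t ^ 2 / (2 * T ^ 2) ≤ t ^ 2 := by apply div_le_self (by positivity); nlinarith
    rw [abs_of_nonpos (by linarith)]; linarith
  have hn := le_norm_sub_mul_I A t
  rw [e, norm_div, norm_mul, norm_real, norm_eq_abs, abs_of_pos hA0,
    div_le_div_iff₀ (by positivity) hA0]
  have h4 : ‖((g - 1 : ℝ) : ℂ) * A + t * I‖ ≤ t ^ 2 * A + |t| * A := by
    refine (norm_add_le _ _).trans ?_
    rw [norm_mul, norm_mul, norm_real, norm_real, norm_real, norm_I,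
      norm_eq_abs, norm_eq_abs, norm_eq_abs, abs_of_pos hA0]
    have : |t| * 1 ≤ |t| * A := by gcongr
    have : |g - 1| * A ≤ t ^ 2 * A := by gcongr
    linarith
  have h5 : (t ^ 2 * A + |t| * A) * A ≤ (t ^ 2 + |t|) * (‖(A - t * I : ℂ)‖ * A) := by
    have : (t ^ 2 + |t|) * A * A ≤ (t ^ 2 + |t|) * ‖(A - t * I : ℂ)‖ * A := by gcongr
    linarith
  calc _ ≤ (t ^ 2 * A + |t| * A) * A := by gcongr
    _ ≤ _ := h5

lemma re_ker_ge (hA : 1 ≤ A) (hT : 1 ≤ T) (hN : 1 ≤ N) :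
    1 / A * rexp (-(2 * N * t ^ 2)) ≤ (ker A T t).re := by
  have hA0 : 0 < A := by linarith
  set g := rexp (-(t ^ 2 / (2 * T ^ 2))) with hg
  have e : (ker A T t).re = g * (A / (A ^ 2 + t ^ 2)) := by
    rw [ker, ← hg, div_re]; simp [normSq_apply]; ring
  have h1 : rexp (-(N * t ^ 2)) ≤ g := by
    apply exp_le_exp.2
    have h3 : t ^ 2 / (2 * T ^ 2) ≤ t ^ 2 := by apply div_le_self (by positivity); nlinarith
    nlinarith [sq_nonneg t]
  have h2 : 1 / A * rexp (-(N * t ^ 2)) ≤ A / (A ^ 2 + t ^ 2) := by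
    rw [Real.exp_neg, one_div, ← mul_inv, inv_le_comm₀ (by positivity) (by positivity), inv_div,
      div_le_iff₀ hA0]
    have := add_one_le_exp (N * t ^ 2)
    have h4 : t ^ 2 ≤ A ^ 2 * (N * t ^ 2) := by
      have : 1 ≤ A ^ 2 * N := by nlinarith
      nlinarith [sq_nonneg t]
    nlinarith
  rw [e]
  calc 1 / A * rexp (-(2 * N * t ^ 2)) = rexp (-(N * t ^ 2)) * (1 / A * rexp (-(N * t ^ 2))) := by
        rw [show -(2 * N * t ^ 2) = -(N * t ^ 2) + -(N * t ^ 2) by ring, Real.exp_add]; ring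
    _ ≤ _ := by gcongr

/-- Hypotheses on the transform of `X` under `μ`: Gaussian main arc of width `η`, negligible
complement. -/
structure ArcHyp {Ω : Type*} [MeasurableSpace Ω] (μ : Measure Ω) (X : Ω → ℝ)
    (η c₀ C₀ A N σ : ℝ) : Prop where
  hX : Measurable X
  hA : 1 ≤ A
  hσ : 2 * c₀ * N ≤ σ
  hσ' : σ ≤ 2 * N
  main : ∀ t, |t| ≤ η → ‖∫ ω, osc t (X ω) ∂μ‖ ≤ rexp (-(c₀ * (N * t ^ 2)))
  main' : ∀ t, |t| ≤ η → ‖(∫ ω, osc t (X ω) ∂μ) - ((rexp (-(σ * t ^ 2 / 2)) : ℝ) : ℂ)‖ ≤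
    C₀ * (N * |t| ^ 3) * rexp (-(c₀ * (N * t ^ 2)))
  off : ∀ t, η < |t| → rexp (-(|t| / (A * √N))) * ‖∫ ω, osc t (X ω) ∂μ‖ ≤
    1 / (A * N ^ 2) * rexp (-(|t| / (2 * (A * √N))))

lemma exp_mul_sq_eq (c N t : ℝ) : rexp (-(c * (N * t ^ 2))) = rexp (-(c * N * t ^ 2)) := by
  rw [mul_assoc]

lemma cube_le (hN : 0 < N) : N * |t| ^ 3 ≤ 1 / √N * (1 + N * t ^ 2) ^ 2 := by
  have h1 : √N ^ 2 = N := sq_sqrt hN.le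
  set x := √N * |t| with hx
  have hx0 : 0 ≤ x := by positivity
  have h2 : N * t ^ 2 = x ^ 2 := by rw [hx, mul_pow, h1, sq_abs]
  have h3 : N * |t| ^ 3 = 1 / √N * x ^ 3 := by rw [hx]; field_simp; rw [h1]; ring
  rw [h2, h3]; gcongr
  nlinarith [sq_nonneg (x - 1), sq_nonneg (x ^ 2), sq_nonneg x, mul_nonneg hx0 (sq_nonneg (x - 1))]

lemma sqrt_pi_div (hb : 0 < b) : √(π / (b * N)) = √(π / b) / √N := by
  rw [← div_div, Real.sqrt_div (by positivity)]

lemma norm_ker_le' (hA : 0 < A) (hT : 0 < T) (t : ℝ) : ‖ker A T t‖ ≤ 2 / A := by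
  refine (norm_ker_le hA hT t).trans ?_
  have : rexp (-(|t| / T)) ≤ 1 := exp_le_one_iff.2 (by
    have : 0 ≤ |t| / T := by positivity
    linarith)
  gcongr; linarith

lemma ArcHyp.exp_mul_norm_le {Ω : Type*} [MeasurableSpace Ω] {μ : Measure Ω} {X : Ω → ℝ}
    {c₀ C₀ : ℝ} (h : ArcHyp μ X η c₀ C₀ A N σ) (hN : 1 ≤ N) (t : ℝ) :
    rexp (-(|t| / (A * √N))) * ‖∫ ω, osc t (X ω) ∂μ‖ ≤ 1 * rexp (-(c₀ * N * t ^ 2)) +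
        1 / (A * N ^ 2) * rexp (-(|t| / (2 * (A * √N)))) := by
  have hA := h.hA
  rcases le_or_gt |t| η with ht | ht
  · have h1 := h.main t ht
    rw [exp_mul_sq_eq] at h1
    have h2 : rexp (-(|t| / (A * √N))) ≤ 1 := exp_le_one_iff.2 (by
      have : 0 ≤ |t| / (A * √N) := by positivity
      linarith)
    have h3 : 0 ≤ 1 / (A * N ^ 2) * rexp (-(|t| / (2 * (A * √N)))) := by positivity
    have : rexp (-(|t| / (A * √N))) * ‖∫ ω, osc t (X ω) ∂μ‖ ≤
        1 * rexp (-(c₀ * N * t ^ 2)) := by gcongr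
    linarith
  · have := h.off t ht
    have h3 : 0 ≤ 1 * rexp (-(c₀ * N * t ^ 2)) := by positivity
    linarith

lemma ArcHyp.integral_le {Ω : Type*} [MeasurableSpace Ω] {μ : Measure Ω} {X : Ω → ℝ}
    {c₀ C₀ : ℝ} (h : ArcHyp μ X η c₀ C₀ A N σ) (hc : 0 < c₀) (hN : 1 ≤ N) :
    ∫ t, rexp (-(|t| / (A * √N))) * ‖∫ ω, osc t (X ω) ∂μ‖ ≤ (√(π / c₀) + 4) / √N := by
  have hA := h.hA
  have h1 := norm_integral_le_gauss_tail (g := fun t => rexp (-(|t| / (A * √N))) *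
    ‖∫ ω, osc t (X ω) ∂μ‖) (b := c₀ * N) (T := A * √N) (by positivity) (by positivity) (fun t => by
      rw [norm_eq_abs, abs_of_nonneg (by positivity)]; exact h.exp_mul_norm_le hN t)
  refine (le_norm_self _).trans (h1.trans ?_); rw [sqrt_pi_div hc, add_div, one_mul]; gcongr
  have h2 : √N ^ 2 = N := sq_sqrt (by linarith)
  rw [div_mul_eq_mul_div, one_mul, div_le_div_iff₀ (by positivity) (by positivity)]
  have : A * N * 1 ≤ A * N * N := by gcongr
  nlinarith

set_option maxHeartbeats 800000 in
theorem ArcHyp.lower {c₀ C₀ : ℝ} (hη : 0 < η) (hc : 0 < c₀) (hC : 0 < C₀) :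
    ∃ N₀ c₁ : ℝ, 0 < c₁ ∧ ∀ {Ω : Type} [MeasurableSpace Ω] (μ : Measure Ω) [IsProbabilityMeasure μ]
      (X : Ω → ℝ) (A N σ : ℝ), ArcHyp μ X η c₀ C₀ A N σ → N₀ ≤ N →
      c₁ / (A * √N) ≤ ∫ ω, wc A (X ω) ∂μ := by
  set C₂ := (C₀ + 1 / η ^ 3) * (1 + 4 / c₀) ^ 2 with hC₂
  set k₁ := √(π / 3) / (2 * π) with hk₁
  set k₂ := (2 * C₂ * √(π / (c₀ / 2)) + 8) / (2 * π) + 40 * (√(π / c₀) + 4) with hk₂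
  have hC₂0 : 0 < C₂ := by positivity
  have hk₁0 : 0 < k₁ := by positivity
  refine ⟨max 1 ((2 * k₂ / k₁) ^ 2), k₁ / 2, by positivity, ?_⟩
  intro Ω _ μ _ X A N σ h hN0
  have hN : 1 ≤ N := (le_max_left _ _).trans hN0
  have hA := h.hA
  have hA0 : 0 < A := by linarith
  have hS : 1 ≤ √N := one_le_sqrt.2 hN
  have hSk : 2 * k₂ / k₁ ≤ √N := Real.le_sqrt_of_sq_le ((le_max_right _ _).trans hN0)
  have hS2 : √N ^ 2 = N := sq_sqrt (by linarith)
  have hT : A ≤ A * √N := by nlinarith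
  have hT1 : 1 ≤ A * √N := by linarith
  have hT0 : 0 < A * √N := by linarith
  have hσ := h.hσ
  have hσ' := h.hσ'
  set T := A * √N with hTdef
  set S := √N with hSdef
  clear_value S
  set Phi : ℝ → ℂ := fun t => ∫ ω, osc t (X ω) ∂μ with hPhi
  set J := ∫ ω, wc A (X ω) ∂μ with hJ
  -- transfer
  have i1 : Integrable (fun _ : Ω => (1 : ℂ)) μ := integrable_const _
  have i1' : Integrable (fun _ : Ω => (1 : ℝ)) μ := integrable_const _
  have t1 := wc_transfer μ h.hX hA0 hT i1
  have t2 := wo_transfer μ h.hX hA0 hT i1'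
  simp only [mul_one, norm_one, ofReal_one] at t1 t2; rw [integral_complex_ofReal] at t1
  have t3 := h.integral_le hc hN
  have t4 : ∫ ω, wo A T (X ω) ∂μ ≤ 1 / T * ((√(π / c₀) + 4) / S) := by
    refine t2.trans ?_; rw [← hSdef, ← hTdef] at t3; gcongr
  -- comparison with the Gaussian transform
  set G₀ : ℝ → ℂ := fun t => ((rexp (-(σ * t ^ 2 / 2)) : ℝ) : ℂ) with hG₀
  have hG₀le : ∀ t, ‖G₀ t‖ ≤ rexp (-(c₀ * (N * t ^ 2))) := by
    intro t; rw [hG₀]; simp only []; rw [norm_real, norm_eq_abs, abs_of_pos (exp_pos _)]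
    apply exp_le_exp.2; nlinarith [sq_nonneg t]
  have ik := integrable_ker hA0 hT0
  have iG : Integrable (fun t => ker A T t * G₀ t) := by
    refine ik.mul_bdd (c := 1) (by rw [hG₀]; fun_prop) (.of_forall fun t => ?_)
    exact (hG₀le t).trans (exp_le_one_iff.2 (by
      have : 0 ≤ c₀ * (N * t ^ 2) := by positivity
      linarith))
  have iP : Integrable (fun t => ker A T t * Phi t) := by
    have := integrable_mul_integral_osc μ h.hX i1 ik
    simpa using this
  have cub : ∀ t, N * |t| ^ 3 * rexp (-(c₀ * (N * t ^ 2))) ≤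
      1 / S * ((1 + 4 / c₀) ^ 2 * rexp (-(c₀ / 2 * N * t ^ 2))) := by
    intro t
    have := cube_le (N := N) (t := t) (by linarith)
    rw [← hSdef] at this
    have h2 := one_add_sq_mul_exp_le (u := N * t ^ 2) hc (by positivity)
    rw [exp_mul_sq_eq (c₀ / 2)] at h2
    calc _ ≤ 1 / S * (1 + N * t ^ 2) ^ 2 * rexp (-(c₀ * (N * t ^ 2))) := by gcongr
      _ = 1 / S * ((1 + N * t ^ 2) ^ 2 * rexp (-(c₀ * (N * t ^ 2)))) := by ring
      _ ≤ _ := by gcongr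
  have pw : ∀ t, ‖ker A T t * Phi t - ker A T t * G₀ t‖ ≤
      2 / A * C₂ * (1 / S) * rexp (-(c₀ / 2 * N * t ^ 2)) +
        2 / A * (1 / (A * N ^ 2)) * rexp (-(|t| / (2 * T))) := by
    intro t
    have hc3 : C₂ * (1 / S) * rexp (-(c₀ / 2 * N * t ^ 2)) = (C₀ + 1 / η ^ 3) *
        (1 / S * ((1 + 4 / c₀) ^ 2 * rexp (-(c₀ / 2 * N * t ^ 2)))) := by rw [hC₂]; ring
    have hc4 : (C₀ + 1 / η ^ 3) * (N * |t| ^ 3 * rexp (-(c₀ * (N * t ^ 2)))) ≤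
        C₂ * (1 / S) * rexp (-(c₀ / 2 * N * t ^ 2)) := by
      rw [hc3]; exact mul_le_mul_of_nonneg_left (cub t) (by positivity)
    have hp3 : 0 ≤ 2 / A * (1 / (A * N ^ 2)) * rexp (-(|t| / (2 * T))) := by positivity
    rcases le_or_gt |t| η with ht | ht
    · rw [← mul_sub, norm_mul]
      have h1 := h.main' t ht
      have h2 : ‖Phi t - G₀ t‖ ≤ C₂ * (1 / S) * rexp (-(c₀ / 2 * N * t ^ 2)) := by
        refine h1.trans (le_trans ?_ hc4)
        have : 0 ≤ 1 / η ^ 3 * (N * |t| ^ 3 * rexp (-(c₀ * (N * t ^ 2)))) := by positivity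
        linarith
      have h3 : ‖ker A T t‖ * ‖Phi t - G₀ t‖ ≤
          2 / A * (C₂ * (1 / S) * rexp (-(c₀ / 2 * N * t ^ 2))) := by
        gcongr; exact norm_ker_le' hA0 hT0 t
      linarith
    · have h1 := h.off t ht
      have h2 : ‖ker A T t * Phi t‖ ≤ 2 / A * (1 / (A * N ^ 2) * rexp (-(|t| / (2 * T)))) := by
        rw [norm_mul]
        calc _ ≤ 2 * rexp (-(|t| / T)) / A * ‖Phi t‖ := by gcongr; exact norm_ker_le hA0 hT0 t
          _ = 2 / A * (rexp (-(|t| / T)) * ‖Phi t‖) := by ring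
          _ ≤ _ := by rw [← hSdef, ← hTdef] at h1; gcongr
      have h3 : ‖ker A T t * G₀ t‖ ≤ 2 / A * (C₂ * (1 / S) * rexp (-(c₀ / 2 * N * t ^ 2))) := by
        rw [norm_mul]
        refine mul_le_mul (norm_ker_le' hA0 hT0 t) (le_trans ?_ hc4) (norm_nonneg _) (by positivity)
        refine (hG₀le t).trans ?_
        have h4 : 1 ≤ 1 / η ^ 3 * (N * |t| ^ 3) := by
          rw [one_div, inv_mul_eq_div, le_div_iff₀ (by positivity), one_mul]
          have : η ^ 3 ≤ |t| ^ 3 := by gcongr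
          nlinarith [pow_pos hη 3]
        have h5 : 1 * rexp (-(c₀ * (N * t ^ 2))) ≤
            1 / η ^ 3 * (N * |t| ^ 3) * rexp (-(c₀ * (N * t ^ 2))) := by gcongr
        have : 0 ≤ C₀ * (N * |t| ^ 3 * rexp (-(c₀ * (N * t ^ 2)))) := by positivity
        linarith
      refine (norm_sub_le _ _).trans ?_; linarith
  have n1 := norm_integral_le_gauss_tail (g := fun t => ker A T t * Phi t - ker A T t * G₀ t)
    (b := c₀ / 2 * N) (T := T) (by positivity) hT0 pw
  rw [integral_sub iP iG, sqrt_pi_div (by positivity), ← hSdef] at n1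
  -- the Gaussian main term
  have n2 : 1 / A * (√(π / 3) / S) ≤ (∫ t, ker A T t * G₀ t).re := by
    have e := reCLM.integral_comp_comm iG
    simp only [reCLM_apply] at e; rw [← e]
    have g1 := integral_gaussian (3 * N)
    have g2 := integrable_exp_neg_mul_sq (b := 3 * N) (by positivity)
    rw [sqrt_pi_div (by norm_num), ← hSdef] at g1
    rw [← g1, ← integral_const_mul]
    have g3 : Integrable (fun t => 1 / A * rexp (-(3 * N) * t ^ 2)) := g2.const_mul _
    have g4 : Integrable (fun t => (ker A T t * G₀ t).re) := reCLM.integrable_comp iG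
    refine integral_mono g3 g4 fun t => ?_
    have h1 := re_ker_ge (t := t) hA hT1 hN
    have h2 : (ker A T t * G₀ t).re = (ker A T t).re * rexp (-(σ * t ^ 2 / 2)) := by
      rw [hG₀]; simp only [re_mul_ofReal]
    have h3 : rexp (-(N * t ^ 2)) ≤ rexp (-(σ * t ^ 2 / 2)) := by
      apply exp_le_exp.2; nlinarith [sq_nonneg t]
    simp only [h2]
    calc 1 / A * rexp (-(3 * N) * t ^ 2) =
        1 / A * rexp (-(2 * N * t ^ 2)) * rexp (-(N * t ^ 2)) := by
          rw [mul_assoc, ← Real.exp_add]; congr 2; ring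
      _ ≤ _ := by gcongr; exact le_trans (by positivity) h1
  -- assembling
  have r1 : (1 / (2 * π)) * (∫ t, ker A T t * Phi t).re - J ≤ 40 * ∫ ω, wo A T (X ω) ∂μ := by
    have := (abs_re_le_norm _).trans t1
    have h2 := (neg_le_abs _).trans this
    have e : ((1 / (2 * π) : ℂ) * ∫ t, ker A T t * Phi t).re =
        (1 / (2 * π)) * (∫ t, ker A T t * Phi t).re := by
      rw [show (1 / (2 * π) : ℂ) = ((1 / (2 * π) : ℝ) : ℂ) by push_cast; ring, re_ofReal_mul]
    rw [sub_re, e, ofReal_re] at h2; linarith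
  have r2 : (∫ t, ker A T t * G₀ t).re - (∫ t, ker A T t * Phi t).re ≤
      2 / A * C₂ * (1 / S) * (√(π / (c₀ / 2)) / S) + 2 / A * (1 / (A * N ^ 2)) * (4 * T) := by
    have := (neg_le_abs _).trans ((abs_re_le_norm _).trans n1)
    rw [sub_re] at this; linarith
  have r3 : 2 / A * (1 / (A * N ^ 2)) * (4 * T) ≤ 8 / (A * S ^ 2) := by
    rw [hTdef, ← hS2, show 2 / A * (1 / (A * (S ^ 2) ^ 2)) * (4 * (A * S)) = 8 / (A * S ^ 3) by
      field_simp; ring]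
    apply div_le_div_of_nonneg_left (by norm_num) (by positivity)
    gcongr <;> norm_num
  have r4 : k₁ / (A * S) - k₂ / (A * S ^ 2) ≤ J := by
    have e1 : 1 / (2 * π) * (1 / A * (√(π / 3) / S)) = k₁ / (A * S) := by rw [hk₁]; field_simp
    have e2 : k₂ / (A * S ^ 2) = 1 / (2 * π) * (2 / A * C₂ * (1 / S) * (√(π / (c₀ / 2)) / S) +
        8 / (A * S ^ 2)) + 40 * (1 / T * ((√(π / c₀) + 4) / S)) := by
      rw [hk₂, hTdef]; field_simp
    have e3 : 1 / (2 * π) * (1 / A * (√(π / 3) / S)) ≤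
        1 / (2 * π) * ((∫ t, ker A T t * Phi t).re + (2 / A * C₂ * (1 / S) * (√(π / (c₀ / 2)) / S) +
        8 / (A * S ^ 2))) := by
      gcongr; linarith
    rw [← e1, e2]; linarith
  rw [hTdef]; refine le_trans ?_ r4
  have r5 : k₂ / (A * S ^ 2) ≤ k₁ / 2 / (A * S) := by
    rw [div_le_iff₀ hk₁0] at hSk; rw [div_le_div_iff₀ (by positivity) (by positivity)]
    have : A * S * (2 * k₂) ≤ A * S * (S * k₁) := by gcongr
    nlinarith
  have r6 : k₁ / (A * S) = k₁ / 2 / (A * S) + k₁ / 2 / (A * S) := by ring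
  linarith

lemma ArcHyp.integral_wo_le {Ω : Type*} [MeasurableSpace Ω] {μ : Measure Ω} [IsProbabilityMeasure μ]
    {X : Ω → ℝ} {c₀ C₀ : ℝ} (h : ArcHyp μ X η c₀ C₀ A N σ) (hc : 0 < c₀) (hN : 1 ≤ N) :
    ∫ ω, wo A (A * √N) (X ω) ∂μ ≤ 1 / (A * √N) * ((√(π / c₀) + 4) / √N) := by
  have hA := h.hA
  have hS : 1 ≤ √N := one_le_sqrt.2 hN
  have hT : A ≤ A * √N := by nlinarith
  have i1' : Integrable (fun _ : Ω => (1 : ℝ)) μ := integrable_const _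
  have t2 := wo_transfer μ h.hX (by linarith) hT i1'
  simp only [mul_one, ofReal_one] at t2; refine t2.trans ?_
  have := h.integral_le hc hN
  gcongr

lemma integral_odd_zero {g : ℝ → ℂ} (hg : ∀ t, g (-t) = -g t) : ∫ t, g t = 0 := by
  have h1 := integral_neg_eq_self g volume
  simp only [hg] at h1; rw [integral_neg] at h1; exact self_eq_neg.1 h1.symm

set_option maxHeartbeats 800000 in
theorem ArcHyp.compare {c₀ C₀ : ℝ} (hη : 0 < η) (hc : 0 < c₀) (hC : 0 < C₀) :
    ∃ C : ℝ, 0 < C ∧ ∀ {Ω : Type} [MeasurableSpace Ω] (μ : Measure Ω) [IsProbabilityMeasure μ]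
      (X : Ω → ℝ) (A N σ : ℝ), ArcHyp μ X η c₀ C₀ A N σ → 1 ≤ N →
      ∀ (g : Ω → ℂ) (K : ℂ) (E₀ : ℝ), 1 / N ≤ E₀ → Integrable g μ →
      Integrable (fun ω => ‖g ω‖ ^ 2) μ → ‖K‖ ≤ C₀ * N * E₀ →
      (∀ t, |t| ≤ η → ‖(∫ ω, osc t (X ω) * g ω ∂μ) -
        t * I * K * ((rexp (-(σ * t ^ 2 / 2)) : ℝ) : ℂ)‖ ≤ C₀ * E₀ * rexp (-(c₀ * (N * t ^ 2)))) →
      (∀ t, |t| ≤ η → ‖∫ ω, osc t (X ω) * ((‖g ω‖ ^ 2 : ℝ) : ℂ) ∂μ‖ ≤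
          C₀ * E₀ * rexp (-(c₀ * (N * t ^ 2)))) →
      (∀ t, η < |t| → rexp (-(|t| / (A * √N))) * ‖∫ ω, osc t (X ω) * g ω ∂μ‖ ≤
        E₀ / (A * N) * rexp (-(|t| / (2 * (A * √N))))) → (∀ t, η < |t| → rexp (-(|t| / (A * √N))) *
        ‖∫ ω, osc t (X ω) * ((‖g ω‖ ^ 2 : ℝ) : ℂ) ∂μ‖ ≤
        E₀ / (A * N) * rexp (-(|t| / (2 * (A * √N))))) →
      ‖∫ ω, ((wc A (X ω) : ℝ) : ℂ) * g ω ∂μ‖ ≤ C * E₀ / (A * √N) := by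
  set k := √(π / c₀) with hk
  set B := C₀ * (3 + η + 1 / η) * (1 + 4 / c₀) ^ 2 with hB
  refine ⟨(B * √(π / (c₀ / 2)) + 8) / (2 * π) + 40 * ((k + 4) / 2 + (C₀ * k / 2 + 2)),
    by positivity, ?_⟩
  intro Ω _ μ _ X A N σ h hN g K E₀ hE hg hg2 hK hG hH hGo hHo
  have hA := h.hA
  have hA0 : 0 < A := by linarith
  have hS : 1 ≤ √N := one_le_sqrt.2 hN
  have hS2 : √N ^ 2 = N := sq_sqrt (by linarith)
  have hT : A ≤ A * √N := by nlinarith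
  have hT1 : 1 ≤ A * √N := by linarith
  have hT0 : 0 < A * √N := by linarith
  have hσ := h.hσ
  have hw := h.integral_wo_le hc hN
  have hE0 : 0 < E₀ := lt_of_lt_of_le (by positivity) hE
  obtain ⟨S, hSdef⟩ := @exists_eq _ (√N)
  obtain ⟨T, hTdef⟩ := @exists_eq _ (A * √N)
  rw [← hTdef] at hT hT1 hT0 hw; simp only [← hTdef] at hGo hHo; rw [← hSdef] at hS hS2 hw
  have hTS : T = A * S := by rw [hTdef, hSdef]
  -- error weight
  have hH' : ∫ ω, wo A T (X ω) * ‖g ω‖ ^ 2 ∂μ ≤ 1 / T * (C₀ * E₀ * (k / S) + E₀ / (A * N) * (4 * T)) := by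
    refine (wo_transfer μ h.hX hA0 hT hg2).trans ?_; gcongr
    have n := norm_integral_le_gauss_tail (g := fun t => rexp (-(|t| / T)) *
      ‖∫ ω, osc t (X ω) * ((‖g ω‖ ^ 2 : ℝ) : ℂ) ∂μ‖) (b := c₀ * N) (T := T) (a := C₀ * E₀)
      (τ := E₀ / (A * N)) (by positivity) hT0 (fun t => by
        rw [norm_eq_abs, abs_of_nonneg (by positivity)]
        rcases le_or_gt |t| η with ht | ht
        · have h1 := hH t ht
          rw [exp_mul_sq_eq] at h1
          have h2 : rexp (-(|t| / T)) ≤ 1 := exp_le_one_iff.2 (by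
            have : 0 ≤ |t| / T := by positivity
            linarith)
          have h3 : 0 ≤ E₀ / (A * N) * rexp (-(|t| / (2 * T))) := by positivity
          have := mul_le_mul h2 h1 (norm_nonneg _) zero_le_one
          linarith
        · have h1 := hHo t ht
          have h3 : 0 ≤ C₀ * E₀ * rexp (-(c₀ * N * t ^ 2)) := by positivity
          linarith)
    rw [sqrt_pi_div hc, ← hSdef] at n; exact (le_norm_self _).trans n
  have hW : ∫ ω, wo A T (X ω) * ‖g ω‖ ∂μ ≤ ((k + 4) / 2 + (C₀ * k / 2 + 2)) * E₀ / (A * S) := by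
    have j1 : Integrable (fun ω => wo A T (X ω)) μ := by
      simpa using integrable_wo_mul μ h.hX hA0 hT (integrable_const (1 : ℝ))
    have j2 := integrable_wo_mul μ h.hX hA0 hT hg2
    have j3 := integrable_wo_mul μ h.hX hA0 hT hg.norm
    have j4 : Integrable (fun ω => 1 / (2 * S) * wo A T (X ω)) μ := j1.const_mul _
    have j5 : Integrable (fun ω => S / 2 * (wo A T (X ω) * ‖g ω‖ ^ 2)) μ := j2.const_mul _
    have j6 : Integrable (fun ω => 1 / (2 * S) * wo A T (X ω) +
      S / 2 * (wo A T (X ω) * ‖g ω‖ ^ 2)) μ := j4.add j5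
    have j7 : ∫ ω, wo A T (X ω) * ‖g ω‖ ∂μ ≤ 1 / (2 * S) * ∫ ω, wo A T (X ω) ∂μ +
        S / 2 * ∫ ω, wo A T (X ω) * ‖g ω‖ ^ 2 ∂μ := by
      rw [← integral_const_mul, ← integral_const_mul, ← integral_add j4 j5]
      refine integral_mono j3 j6 fun ω => ?_
      have h0 := wo_nonneg hA0 hT (X ω)
      have h1 : ‖g ω‖ ≤ 1 / (2 * S) + S / 2 * ‖g ω‖ ^ 2 := by
        have e : 1 / (2 * S) + S / 2 * ‖g ω‖ ^ 2 - ‖g ω‖ = (S * ‖g ω‖ - 1) ^ 2 / (2 * S) := by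
          field_simp; ring
        have : 0 ≤ (S * ‖g ω‖ - 1) ^ 2 / (2 * S) := by positivity
        linarith
      have := mul_le_mul_of_nonneg_left h1 h0
      simp only []; linarith
    refine j7.trans ?_
    have f1 : 1 / (2 * S) * ∫ ω, wo A T (X ω) ∂μ ≤ (k + 4) / 2 * E₀ / (A * S) := by
      calc _ ≤ 1 / (2 * S) * (1 / T * ((k + 4) / S)) := by gcongr
        _ = (k + 4) / 2 * (1 / N) / (A * S) := by rw [hTS, ← hS2]; field_simp
        _ ≤ _ := by gcongr
    have f2 : S / 2 * ∫ ω, wo A T (X ω) * ‖g ω‖ ^ 2 ∂μ ≤ (C₀ * k / 2 + 2) * E₀ / (A * S) := by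
      calc _ ≤ S / 2 * (1 / T * (C₀ * E₀ * (k / S) + E₀ / (A * N) * (4 * T))) := by gcongr
        _ = _ := by rw [hTS, ← hS2]; field_simp; ring
    calc _ ≤ _ := add_le_add f1 f2
      _ = _ := by ring
  -- main term
  have t1 := wc_transfer μ h.hX hA0 hT hg
  set G : ℝ → ℂ := fun t => ∫ ω, osc t (X ω) * g ω ∂μ with hGdef
  set e : ℝ → ℝ := fun t => rexp (-(σ * t ^ 2 / 2)) with he
  set q : ℝ → ℂ := fun t => t * I * K * ((e t : ℝ) : ℂ) / A with hq
  have hele : ∀ t, e t ≤ rexp (-(c₀ * (N * t ^ 2))) := by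
    intro t; apply exp_le_exp.2; nlinarith [sq_nonneg t]
  have he0 : ∀ t, 0 < e t := fun t => exp_pos _
  have hq0 : ∫ t, q t = 0 := by
    apply integral_odd_zero; intro t; simp only [hq, he]; rw [neg_sq]; push_cast; ring
  have hqi : Integrable q := by
    have h1 := integrable_mul_exp_neg_mul_sq (b := σ / 2)
      (by have : 0 < 2 * c₀ * N := by positivity
          linarith)
    have h2 := (h1.ofReal (𝕜 := ℂ)).const_mul (I * K / A)
    refine h2.congr (.of_forall fun t => ?_)
    simp only [hq, he]; rw [show -(σ / 2) * t ^ 2 = -(σ * t ^ 2 / 2) by ring]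
    push_cast; simp; ring
  have hki := integrable_mul_integral_osc μ h.hX hg (integrable_ker hA0 hT0)
  have habs : ∀ t : ℝ, (1 + N * t ^ 2) ^ 2 * rexp (-(c₀ * (N * t ^ 2))) ≤
      (1 + 4 / c₀) ^ 2 * rexp (-(c₀ / 2 * N * t ^ 2)) := by
    intro t
    have h2 := one_add_sq_mul_exp_le (u := N * t ^ 2) hc (by positivity)
    rwa [exp_mul_sq_eq (c₀ / 2)] at h2
  have hKt : ∀ t : ℝ, ‖(t * I * K * ((e t : ℝ) : ℂ))‖ ≤
      |t| * (C₀ * N * E₀) * rexp (-(c₀ * (N * t ^ 2))) := by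
    intro t
    rw [norm_mul, norm_mul, norm_mul, norm_I, norm_real, norm_real,
      norm_eq_abs, norm_eq_abs, abs_of_pos (he0 t), mul_one]
    gcongr; exact hele t
  have pw : ∀ t, ‖ker A T t * G t - q t‖ ≤ B * E₀ / A * rexp (-(c₀ / 2 * N * t ^ 2)) +
      2 / A * (E₀ / (A * N)) * rexp (-(|t| / (2 * T))) := by
    intro t
    have hx := hKt t
    set w : ℂ := t * I * K * ((e t : ℝ) : ℂ) with hw
    have hqw : q t = w / A := rfl
    have hAn : ‖(A : ℂ)‖ = A := by rw [norm_real, norm_eq_abs, abs_of_pos hA0]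
    set Ex := rexp (-(c₀ * (N * t ^ 2))) with hEx
    set u := N * t ^ 2 with hu
    have hu0 : 0 ≤ u := by positivity
    have hBe : ∀ y : ℝ, y ≤ (3 + η + 1 / η) * (1 + u) ^ 2 → C₀ * E₀ / A * y * Ex ≤
        B * E₀ / A * rexp (-(c₀ / 2 * N * t ^ 2)) := by
      intro y hy
      calc C₀ * E₀ / A * y * Ex ≤ C₀ * E₀ / A * ((3 + η + 1 / η) * (1 + u) ^ 2) * Ex := by gcongr
        _ = C₀ * E₀ / A * (3 + η + 1 / η) * ((1 + u) ^ 2 * Ex) := by ring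
        _ ≤ C₀ * E₀ / A * (3 + η + 1 / η) * ((1 + 4 / c₀) ^ 2 * rexp (-(c₀ / 2 * N * t ^ 2))) := by
          exact mul_le_mul_of_nonneg_left (habs t) (by positivity)
        _ = _ := by rw [hB]; ring
    have hηi : 0 < 1 / η := by positivity
    have hu1 : 0 ≤ u ^ 2 := by positivity
    rcases le_or_gt |t| η with ht | ht
    · have h1 : ‖G t - w‖ ≤ C₀ * E₀ * Ex := hG t ht
      have e1 : ker A T t * G t - q t = ker A T t * (G t - w) + (ker A T t - 1 / A) * w := by
        rw [hqw]; ring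
      have h2 : ‖ker A T t * (G t - w)‖ ≤ 2 / A * (C₀ * E₀ * Ex) := by
        rw [norm_mul]; gcongr; exact norm_ker_le' hA0 hT0 t
      have h3 : ‖(ker A T t - 1 / A) * w‖ ≤ (t ^ 2 + |t|) / A * (|t| * (C₀ * N * E₀) * Ex) := by
        rw [norm_mul]; gcongr; exact ker_sub_le hA hT1
      have h4 : (t ^ 2 + |t|) * |t| * N ≤ (1 + η) * u := by
        have : |t| * |t| = t ^ 2 := by rw [← sq, sq_abs]
        have h5 : (t ^ 2 + |t|) * |t| * N = (|t| + 1) * u := by rw [hu, ← this]; ring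
        rw [h5]; exact mul_le_mul_of_nonneg_right (by linarith) hu0
      have h5 : 2 / A * (C₀ * E₀ * Ex) + (t ^ 2 + |t|) / A * (|t| * (C₀ * N * E₀) * Ex) =
          C₀ * E₀ / A * (2 + (t ^ 2 + |t|) * |t| * N) * Ex := by ring
      have h6 := hBe (2 + (t ^ 2 + |t|) * |t| * N) (by nlinarith [mul_nonneg hη.le hu0, mul_nonneg hηi.le hu0, mul_nonneg hη.le hu1, mul_nonneg hηi.le hu1])
      have h7 : 0 ≤ 2 / A * (E₀ / (A * N)) * rexp (-(|t| / (2 * T))) := by positivity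
      rw [e1]; refine (norm_add_le _ _).trans ?_; linarith
    · have h1 := hGo t ht
      have h2 : ‖ker A T t * G t‖ ≤ 2 / A * (E₀ / (A * N) * rexp (-(|t| / (2 * T)))) := by
        rw [norm_mul]
        calc _ ≤ 2 * rexp (-(|t| / T)) / A * ‖G t‖ := by gcongr; exact norm_ker_le hA0 hT0 t
          _ = 2 / A * (rexp (-(|t| / T)) * ‖G t‖) := by ring
          _ ≤ _ := by gcongr
      have h3 : ‖q t‖ ≤ C₀ * E₀ / A * (|t| * N) * Ex := by
        rw [hqw, norm_div, hAn]
        calc ‖w‖ / A ≤ |t| * (C₀ * N * E₀) * Ex / A := by gcongr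
          _ = _ := by ring
      have h4 : |t| * N ≤ (3 + η + 1 / η) * (1 + u) ^ 2 := by
        have : |t| * N ≤ 1 / η * u := by
          rw [one_div, inv_mul_eq_div, le_div_iff₀ hη]
          have h8 : u = |t| * N * |t| := by rw [hu, ← sq_abs]; ring
          rw [h8]; gcongr
        nlinarith [mul_nonneg hη.le hu0, mul_nonneg hηi.le hu0, mul_nonneg hη.le hu1, mul_nonneg hηi.le hu1]
      have h5 := hBe _ h4
      refine (norm_sub_le _ _).trans ?_; linarith
  have n1 := norm_integral_le_gauss_tail (g := fun t => ker A T t * G t - q t)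
    (b := c₀ / 2 * N) (T := T) (by positivity) hT0 pw
  rw [integral_sub hki hqi, hq0, sub_zero, sqrt_pi_div (by positivity), ← hSdef] at n1
  have n2 : ‖(1 / (2 * π : ℂ)) * ∫ t, ker A T t * G t‖ ≤
      (B * √(π / (c₀ / 2)) + 8) / (2 * π) * E₀ / (A * S) := by
    rw [norm_mul, show (1 / (2 * π) : ℂ) = ((1 / (2 * π) : ℝ) : ℂ) by push_cast; ring,
      norm_real, norm_eq_abs, abs_of_pos (by positivity)]
    calc _ ≤ 1 / (2 * π) * (B * E₀ / A * (√(π / (c₀ / 2)) / S) + 2 / A * (E₀ / (A * N)) * (4 * T)) := by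
          gcongr
      _ = _ := by rw [hTS, ← hS2]; field_simp; ring
  have fin := (norm_le_norm_add_norm_sub' _ _).trans (add_le_add n2 (t1.trans
    (mul_le_mul_of_nonneg_left hW (by norm_num : (0 : ℝ) ≤ 40))))
  refine fin.trans (le_of_eq ?_); rw [← hSdef]; ring

lemma twist_absorb {B : ℝ} (hc : 0 < c) (hB : 0 < B) (hN : 0 ≤ N)
    (hδ1 : δ ≤ c / (16 * B)) :
    2 * (B * (|t| * (N * δ))) + B * (t ^ 2 * (N * δ) + N * δ ^ 2) ≤
      c / 8 * (N * t ^ 2) + (16 * B ^ 2 / c + B) * (N * δ ^ 2) := by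
  have h1 : B * δ ≤ c / 16 := by rw [le_div_iff₀ (by positivity)] at hδ1; linarith
  have h2 : B * (t ^ 2 * (N * δ)) ≤ c / 16 * (N * t ^ 2) := by
    have := mul_le_mul_of_nonneg_right h1 (by positivity : 0 ≤ N * t ^ 2)
    linarith
  have h3 : 2 * (B * (|t| * (N * δ))) ≤ c / 16 * (N * t ^ 2) + 16 * B ^ 2 / c * (N * δ ^ 2) := by
    have h4 : 0 ≤ N / c * (c / 4 * |t| - 4 * B * δ) ^ 2 := by positivity
    have h5 : N / c * (c / 4 * |t| - 4 * B * δ) ^ 2 =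
        c / 16 * (N * t ^ 2) + 16 * B ^ 2 / c * (N * δ ^ 2) - 2 * (B * (|t| * (N * δ))) := by
      rw [← sq_abs t]; field_simp; ring
    linarith
  linarith

lemma twist_poly {B : ℝ} (hB : 1 ≤ B) (hN : 0 < N) (hδ : 0 ≤ δ) :
    (B * (|t| * (N * δ))) ^ 2 + B * (t ^ 2 * (N * δ) + N * δ ^ 2) + B ^ 2 * (δ * (N * t ^ 2) ^ 2) ≤
      3 * B ^ 2 * ((1 + N * t ^ 2) ^ 2 * (1 / N + N * δ ^ 2)) := by
  have hu : 0 ≤ N * t ^ 2 := by positivity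
  have hv : 0 ≤ N * δ ^ 2 := by positivity
  have hNi : 0 ≤ 1 / N := by positivity
  have hδF : δ ≤ 1 / N + N * δ ^ 2 := by
    have h4 : 0 ≤ 1 / N * (1 - N * δ) ^ 2 := by positivity
    have h5 : 1 / N * (1 - N * δ) ^ 2 = 1 / N + N * δ ^ 2 - 2 * δ := by field_simp; ring
    linarith
  have e1 : (B * (|t| * (N * δ))) ^ 2 = B ^ 2 * ((N * t ^ 2) * (N * δ ^ 2)) := by
    rw [← sq_abs t]; ring
  have e2 : t ^ 2 * (N * δ) = (N * t ^ 2) * δ := by ring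
  rw [e1, e2]
  generalize N * t ^ 2 = u at *
  generalize N * δ ^ 2 = v at *
  obtain ⟨F, hF⟩ := @exists_eq _ (1 / N + v)
  rw [← hF] at hδF ⊢
  have hvF : v ≤ F := by linarith
  have hF0 : 0 ≤ F := by linarith
  have hBB : B ≤ B ^ 2 := by nlinarith
  have h1 : u * v ≤ (1 + u) ^ 2 * F := by apply mul_le_mul (by nlinarith) hvF hv (by positivity)
  have h2 : u * δ + v ≤ (1 + u) ^ 2 * F := by
    nlinarith [mul_le_mul_of_nonneg_left hδF hu, mul_nonneg hu hF0, mul_nonneg (mul_nonneg hu hu) hF0]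
  have h3 : δ * u ^ 2 ≤ (1 + u) ^ 2 * F := by
    nlinarith [mul_le_mul_of_nonneg_right hδF (sq_nonneg u), mul_nonneg hu hF0]
  have h2' : B * (u * δ + v) ≤ B ^ 2 * ((1 + u) ^ 2 * F) :=
    mul_le_mul hBB h2 (by positivity) (by positivity)
  nlinarith [mul_le_mul_of_nonneg_left h1 (sq_nonneg B), mul_le_mul_of_nonneg_left h3 (sq_nonneg B)]

lemma norm_exp_sub_one_le_mul (z : ℂ) : ‖cexp z - 1‖ ≤ ‖z‖ * rexp ‖z‖ := by
  have := norm_exp_sub_sum_le_norm_mul_exp z 1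
  simpa using this

lemma norm_exp_sub_one_sub_le (z : ℂ) : ‖cexp z - 1 - z‖ ≤ ‖z‖ ^ 2 * rexp ‖z‖ := by
  have := norm_exp_sub_sum_le_norm_mul_exp z 2
  simpa [sum_range_succ, sub_sub] using this

lemma gauss_factor {e : ℂ} (hσ : c * N ≤ σ) (he : ‖e‖ ≤ σ * t ^ 2 / 8) :
    ‖cexp (((-(σ * t ^ 2 / 2) : ℝ) : ℂ) + e)‖ ≤ rexp (-(3 / 8 * c * (N * t ^ 2))) ∧
    ‖cexp (((-(σ * t ^ 2 / 2) : ℝ) : ℂ) + e) - ((rexp (-(σ * t ^ 2 / 2)) : ℝ) : ℂ)‖ ≤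
      ‖e‖ * rexp (-(3 / 8 * c * (N * t ^ 2))) := by
  have h0 : c * N * t ^ 2 ≤ σ * t ^ 2 := mul_le_mul_of_nonneg_right hσ (sq_nonneg t)
  have hre : e.re ≤ ‖e‖ := re_le_norm e
  constructor
  · rw [norm_exp, exp_le_exp]
    simp only [add_re, ofReal_re]; nlinarith
  · have : cexp (((-(σ * t ^ 2 / 2) : ℝ) : ℂ) + e) - ((rexp (-(σ * t ^ 2 / 2)) : ℝ) : ℂ) =
        ((rexp (-(σ * t ^ 2 / 2)) : ℝ) : ℂ) * (cexp e - 1) := by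
      rw [Complex.exp_add, ofReal_exp]; ring
    rw [this, norm_mul, norm_real, norm_of_nonneg (exp_nonneg _)]
    calc _ ≤ rexp (-(σ * t ^ 2 / 2)) * (‖e‖ * rexp ‖e‖) := by
            gcongr; exact norm_exp_sub_one_le_mul e
      _ = ‖e‖ * rexp (-(σ * t ^ 2 / 2) + ‖e‖) := by rw [Real.exp_add]; ring
      _ ≤ _ := by gcongr; nlinarith

/-- First order expansion of a twisted near-Gaussian characteristic function. -/
lemma gauss_twist_first {B : ℝ} (hc : 0 < c) (hB : 1 ≤ B) :
    ∃ C : ℝ, 0 < C ∧ ∀ (N σ t δ : ℝ) (e w E : ℂ), 0 < N → c * N ≤ σ → 0 ≤ δ →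
      δ ≤ c / (16 * B) → ‖e‖ ≤ B * (|t| ^ 3 * N) → ‖e‖ ≤ σ * t ^ 2 / 8 →
      ‖w‖ ≤ B * (|t| * (N * δ)) → ‖E‖ ≤ B * (t ^ 2 * (N * δ) + N * δ ^ 2) →
      ‖cexp (((-(σ * t ^ 2 / 2) : ℝ) : ℂ) + e) * (cexp (w + E) - 1) -
        w * ((rexp (-(σ * t ^ 2 / 2)) : ℝ) : ℂ)‖ ≤
      C * ((1 / N + N * δ ^ 2) * rexp ((16 * B ^ 2 / c + B) * (N * δ ^ 2))) *
        rexp (-(c / 8 * (N * t ^ 2))) := by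
  refine ⟨6 * B ^ 2 * (1 + 4 / (c / 4)) ^ 2, by positivity, ?_⟩
  intro N σ t δ e w E hN hσ hδ hδ1 he he' hw hE; obtain ⟨hP, hP'⟩ := gauss_factor hσ he'
  have habs := twist_absorb (t := t) hc (by linarith) hN.le hδ1
  have hpoly := twist_poly (t := t) hB hN hδ
  have hu : 0 ≤ N * t ^ 2 := by positivity
  have hsq := one_add_sq_mul_exp_le (c := c / 4) (by positivity) hu
  set P := cexp (((-(σ * t ^ 2 / 2) : ℝ) : ℂ) + e)
  set G := ((rexp (-(σ * t ^ 2 / 2)) : ℝ) : ℂ)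
  have hwE : ‖w‖ + ‖E‖ ≤ c / 8 * (N * t ^ 2) + (16 * B ^ 2 / c + B) * (N * δ ^ 2) := by
    have : 0 ≤ ‖w‖ := norm_nonneg w
    linarith
  have h1 : ‖cexp (w + E) - 1 - w‖ ≤ (‖w‖ ^ 2 + ‖E‖) * rexp (‖w‖ + ‖E‖) := by
    have e1 : cexp (w + E) - 1 - w = cexp w * (cexp E - 1) + (cexp w - 1 - w) := by
      rw [Complex.exp_add]; ring
    rw [e1]; refine (norm_add_le _ _).trans ?_; rw [norm_mul]
    have a1 : ‖cexp w‖ ≤ rexp ‖w‖ := by rw [norm_exp]; exact exp_le_exp.2 (re_le_norm w)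
    have a2 := norm_exp_sub_one_le_mul E
    have a3 := norm_exp_sub_one_sub_le w
    have a4 : rexp ‖w‖ ≤ rexp (‖w‖ + ‖E‖) :=
      exp_le_exp.2 (by linarith [norm_nonneg E])
    calc _ ≤ rexp ‖w‖ * (‖E‖ * rexp ‖E‖) + ‖w‖ ^ 2 * rexp (‖w‖ + ‖E‖) := by
            refine add_le_add (mul_le_mul a1 a2 (norm_nonneg _) (exp_nonneg _)) (a3.trans ?_)
            gcongr
      _ = _ := by rw [Real.exp_add]; ring
  have e2 : P * (cexp (w + E) - 1) - w * G = P * (cexp (w + E) - 1 - w) + w * (P - G) := by ring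
  have hexp : rexp (-(3 / 8 * c * (N * t ^ 2))) * rexp (‖w‖ + ‖E‖) ≤
      rexp (-(c / 4 * (N * t ^ 2))) * rexp ((16 * B ^ 2 / c + B) * (N * δ ^ 2)) := by
    rw [← Real.exp_add, ← Real.exp_add, exp_le_exp]; linarith
  have hexp' : rexp (-(3 / 8 * c * (N * t ^ 2))) ≤
      rexp (-(c / 4 * (N * t ^ 2))) * rexp ((16 * B ^ 2 / c + B) * (N * δ ^ 2)) := by
    rw [← Real.exp_add, exp_le_exp]
    have : 0 ≤ (16 * B ^ 2 / c + B) * (N * δ ^ 2) := by positivity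
    have : 0 ≤ c * (N * t ^ 2) := by positivity
    linarith
  set Q := rexp (-(c / 4 * (N * t ^ 2))) * rexp ((16 * B ^ 2 / c + B) * (N * δ ^ 2)) with hQ
  have hp0 : 0 ≤ (B * (|t| * (N * δ))) ^ 2 + B * (t ^ 2 * (N * δ) + N * δ ^ 2) := by positivity
  have hp1 : 0 ≤ B ^ 2 * (δ * (N * t ^ 2) ^ 2) := by positivity
  set Q3 := 3 * B ^ 2 * ((1 + N * t ^ 2) ^ 2 * (1 / N + N * δ ^ 2)) with hQ3
  have t1 : ‖P * (cexp (w + E) - 1 - w)‖ ≤ Q3 * Q := by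
    rw [norm_mul]
    calc _ ≤ rexp (-(3 / 8 * c * (N * t ^ 2))) * ((‖w‖ ^ 2 + ‖E‖) * rexp (‖w‖ + ‖E‖)) := by gcongr
      _ = (‖w‖ ^ 2 + ‖E‖) * (rexp (-(3 / 8 * c * (N * t ^ 2))) * rexp (‖w‖ + ‖E‖)) := by ring
      _ ≤ Q3 * Q := by
            apply mul_le_mul _ hexp (by positivity) (by positivity)
            have : ‖w‖ ^ 2 ≤ (B * (|t| * (N * δ))) ^ 2 := by gcongr
            linarith
  have t2 : ‖w * (P - G)‖ ≤ Q3 * Q := by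
    rw [norm_mul]
    calc _ ≤ (B * (|t| * (N * δ))) * ((B * (|t| ^ 3 * N)) * rexp (-(3 / 8 * c * (N * t ^ 2)))) := by
            gcongr; exact hP'.trans (by gcongr)
      _ = B ^ 2 * (δ * (N * t ^ 2) ^ 2) * rexp (-(3 / 8 * c * (N * t ^ 2))) := by
            rw [← sq_abs t]; ring
      _ ≤ Q3 * Q := by
            apply mul_le_mul _ hexp' (by positivity) (by positivity)
            linarith
  rw [e2]; refine (norm_add_le _ _).trans ((add_le_add t1 t2).trans ?_)
  have : Q3 * Q + Q3 * Q = 6 * B ^ 2 * ((1 / N + N * δ ^ 2) *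
      rexp ((16 * B ^ 2 / c + B) * (N * δ ^ 2))) *
      ((1 + N * t ^ 2) ^ 2 * rexp (-(c / 4 * (N * t ^ 2)))) := by
    rw [hQ, hQ3]; ring
  rw [this]
  calc _ ≤ 6 * B ^ 2 * ((1 / N + N * δ ^ 2) * rexp ((16 * B ^ 2 / c + B) * (N * δ ^ 2))) *
      ((1 + 4 / (c / 4)) ^ 2 * rexp (-(c / 4 / 2 * (N * t ^ 2)))) :=
        mul_le_mul_of_nonneg_left hsq (by positivity)
    _ = _ := by
      have : c / 4 / 2 = c / 8 := by ring
      rw [this]; ring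

/-- Second order expansion of a twisted near-Gaussian characteristic function. -/
lemma gauss_twist_second {B : ℝ} (hc : 0 < c) (hB : 1 ≤ B) :
    ∃ C : ℝ, 0 < C ∧ ∀ (N σ t δ : ℝ) (e w w' E : ℂ), 0 < N → c * N ≤ σ → 0 ≤ δ →
      δ ≤ c / (16 * B) → ‖e‖ ≤ σ * t ^ 2 / 8 →
      ‖w‖ ≤ B * (|t| * (N * δ)) → ‖w'‖ ≤ B * (|t| * (N * δ)) →
      ‖E‖ ≤ B * (t ^ 2 * (N * δ) + N * δ ^ 2) → ‖cexp (((-(σ * t ^ 2 / 2) : ℝ) : ℂ) + e) *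
        (cexp (w + w' + E) - cexp w - cexp w' + 1)‖ ≤
      C * ((1 / N + N * δ ^ 2) * rexp ((16 * B ^ 2 / c + B) * (N * δ ^ 2))) *
        rexp (-(c / 8 * (N * t ^ 2))) := by
  refine ⟨3 * B ^ 2 * (1 + 4 / (c / 4)) ^ 2, by positivity, ?_⟩
  intro N σ t δ e w w' E hN hσ hδ hδ1 he' hw hw' hE; obtain ⟨hP, -⟩ := gauss_factor hσ he'
  have habs := twist_absorb (t := t) hc (by linarith) hN.le hδ1
  have hpoly := twist_poly (t := t) hB hN hδ
  have hu : 0 ≤ N * t ^ 2 := by positivity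
  have hsq := one_add_sq_mul_exp_le (c := c / 4) (by positivity) hu
  set P := cexp (((-(σ * t ^ 2 / 2) : ℝ) : ℂ) + e)
  have hp1 : 0 ≤ B ^ 2 * (δ * (N * t ^ 2) ^ 2) := by positivity
  have h1 : ‖cexp (w + w' + E) - cexp w - cexp w' + 1‖ ≤
      (‖w‖ * ‖w'‖ + ‖E‖) * rexp (‖w‖ + ‖w'‖ + ‖E‖) := by
    have e1 : cexp (w + w' + E) - cexp w - cexp w' + 1 = (cexp w - 1) * (cexp w' - 1) +
          cexp (w + w') * (cexp E - 1) := by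
      rw [Complex.exp_add, Complex.exp_add]; ring
    rw [e1]; refine (norm_add_le _ _).trans ?_; rw [norm_mul, norm_mul]
    have a1 : ‖cexp (w + w')‖ ≤ rexp (‖w‖ + ‖w'‖) := by
      rw [norm_exp]; exact exp_le_exp.2 ((re_le_norm _).trans (norm_add_le _ _))
    have a2 := norm_exp_sub_one_le_mul E
    have a3 := norm_exp_sub_one_le_mul w
    have a4 := norm_exp_sub_one_le_mul w'
    have a5 : rexp (‖w‖ + ‖w'‖) ≤ rexp (‖w‖ + ‖w'‖ + ‖E‖) :=
      exp_le_exp.2 (by linarith [norm_nonneg E])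
    calc _ ≤ (‖w‖ * rexp ‖w‖) * (‖w'‖ * rexp ‖w'‖) + rexp (‖w‖ + ‖w'‖) * (‖E‖ * rexp ‖E‖) := by
            gcongr
      _ = ‖w‖ * ‖w'‖ * rexp (‖w‖ + ‖w'‖) + ‖E‖ * rexp (‖w‖ + ‖w'‖ + ‖E‖) := by
            rw [Real.exp_add (‖w‖ + ‖w'‖) ‖E‖, Real.exp_add ‖w‖ ‖w'‖]; ring
      _ ≤ ‖w‖ * ‖w'‖ * rexp (‖w‖ + ‖w'‖ + ‖E‖) + ‖E‖ * rexp (‖w‖ + ‖w'‖ + ‖E‖) := by gcongr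
      _ = _ := by ring
  have hexp : rexp (-(3 / 8 * c * (N * t ^ 2))) * rexp (‖w‖ + ‖w'‖ + ‖E‖) ≤
      rexp (-(c / 4 * (N * t ^ 2))) * rexp ((16 * B ^ 2 / c + B) * (N * δ ^ 2)) := by
    rw [← Real.exp_add, ← Real.exp_add, exp_le_exp]; linarith
  rw [norm_mul]
  calc _ ≤ rexp (-(3 / 8 * c * (N * t ^ 2))) *
        ((‖w‖ * ‖w'‖ + ‖E‖) * rexp (‖w‖ + ‖w'‖ + ‖E‖)) := by gcongr
    _ = (‖w‖ * ‖w'‖ + ‖E‖) *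
        (rexp (-(3 / 8 * c * (N * t ^ 2))) * rexp (‖w‖ + ‖w'‖ + ‖E‖)) := by ring
    _ ≤ (3 * B ^ 2 * ((1 + N * t ^ 2) ^ 2 * (1 / N + N * δ ^ 2))) *
        (rexp (-(c / 4 * (N * t ^ 2))) * rexp ((16 * B ^ 2 / c + B) * (N * δ ^ 2))) := by
          apply mul_le_mul _ hexp (by positivity) (by positivity)
          have : ‖w‖ * ‖w'‖ ≤ (B * (|t| * (N * δ))) ^ 2 := by rw [sq]; gcongr
          linarith
    _ = 3 * B ^ 2 * ((1 / N + N * δ ^ 2) * rexp ((16 * B ^ 2 / c + B) * (N * δ ^ 2))) *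
        ((1 + N * t ^ 2) ^ 2 * rexp (-(c / 4 * (N * t ^ 2)))) := by ring
    _ ≤ 3 * B ^ 2 * ((1 / N + N * δ ^ 2) * rexp ((16 * B ^ 2 / c + B) * (N * δ ^ 2))) *
      ((1 + 4 / (c / 4)) ^ 2 * rexp (-(c / 4 / 2 * (N * t ^ 2)))) :=
        mul_le_mul_of_nonneg_left hsq (by positivity)
    _ = _ := by
      have : c / 4 / 2 = c / 8 := by ring
      rw [this]; ring

/-- Product of the geometric laws. -/
def gpi {ι : Type} [Fintype ι] (A : ℝ) (l : ι → ℝ) : Measure (ι → ℕ) :=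
  Measure.pi fun p => geo A (l p)

/-- The centred sum of the coordinates. -/
def Xs {ι : Type} [Fintype ι] (A : ℝ) (l : ι → ℝ) (k : ι → ℕ) : ℝ := ∑ p, xk A (l p) (k p)

section Product

variable {ι : Type} [Fintype ι] {A : ℝ} {l : ι → ℝ}

lemma isProb_gpi (hA : 1 ≤ A) (hl : ∀ p, 0 < l p ∧ l p ≤ 1) :
    IsProbabilityMeasure (gpi A l) := by
  have : ∀ p, IsProbabilityMeasure (geo A (l p)) := fun p =>
    isProb_geo (by linarith) (hl p).1
  unfold gpi; infer_instance

lemma measurable_Xs : Measurable (Xs A l) := by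
  unfold Xs; refine measurable_sum _ fun p _ => ?_
  exact (measurable_of_countable (xk A (l p))).comp (measurable_pi_apply p)

lemma osc_Xs (t : ℝ) (k : ι → ℕ) : osc t (Xs A l k) = ∏ p, eg A (l p) t (k p) := by
  unfold osc Xs eg; rw [← Complex.exp_sum]; congr 1; push_cast; rw [mul_sum, sum_mul]

lemma integral_osc_Xs_mul (t : ℝ) (f : ι → ℕ → ℂ) :
    ∫ k, osc t (Xs A l k) * ∏ p, f p (k p) ∂(gpi A l) = ∏ p, twE A (l p) t (f p) := by
  simp_rw [osc_Xs, ← prod_mul_distrib]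
  unfold gpi twE; exact integral_fintype_prod_eq_prod (fun p k => eg A (l p) t k * f p k)

lemma integral_osc_Xs (t : ℝ) :
    ∫ k, osc t (Xs A l k) ∂(gpi A l) = ∏ p, phiL A (l p) t := by
  simp_rw [osc_Xs]
  unfold gpi phiL; exact integral_fintype_prod_eq_prod (fun p k => eg A (l p) t k)

lemma integral_gpi_prod (f : ι → ℕ → ℂ) :
    ∫ k, ∏ p, f p (k p) ∂(gpi A l) = ∏ p, ∫ k, f p k ∂(geo A (l p)) :=
  integral_fintype_prod_eq_prod f

lemma integrable_gpi_prod {f : ι → ℕ → ℂ} (hf : ∀ p, Integrable (f p) (geo A (l p))) :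
    Integrable (fun k => ∏ p, f p (k p)) (gpi A l) :=
  Integrable.fintype_prod_dep hf

lemma prod_exp_form {a b u : ι → ℂ} {m : ι → ℝ} {B : ℝ}
    (h : ∀ p, ∃ e : ℂ, a p = b p * cexp (u p + e) ∧ ‖e‖ ≤ B * m p) :
    ∃ e : ℂ, ∏ p, a p = (∏ p, b p) * cexp ((∑ p, u p) + e) ∧ ‖e‖ ≤ B * ∑ p, m p := by
  choose e he he' using h
  refine ⟨∑ p, e p, ?_, ?_⟩
  · rw [← sum_add_distrib, Complex.exp_sum, ← prod_mul_distrib]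
    exact prod_congr rfl fun p _ => he p
  · rw [mul_sum]
    exact (norm_sum_le _ _).trans (sum_le_sum fun p _ => he' p)

lemma prod_phiL_exp (hA : 1 ≤ A) (hl : ∀ p, 0 < l p ∧ l p ≤ 1) (ht : |t| ≤ 1 / 10 ^ 4) :
    ∃ e : ℂ, ∏ p, phiL A (l p) t = cexp (((-((∑ p, mm A (l p)) * t ^ 2 / 2) : ℝ) : ℂ) + e) ∧
      ‖e‖ ≤ 400000 * |t| ^ 3 * ∑ p, mm A (l p) := by
  obtain ⟨e, h1, h2⟩ := prod_exp_form (a := fun p => phiL A (l p) t) (b := fun _ => 1)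
    (u := fun p => -(t ^ 2 * mm A (l p) / 2 : ℂ)) (m := fun p => mm A (l p))
    (B := 400000 * |t| ^ 3) (fun p => by
      obtain ⟨e, h, h'⟩ := phiL_exp hA (hl p).1 (hl p).2 ht
      exact ⟨e, by rw [one_mul]; exact h, h'⟩)
  refine ⟨e, ?_, h2⟩; rw [h1]; simp only [prod_const_one, one_mul]; congr 2; push_cast
  rw [sum_mul, sum_div, ← sum_neg_distrib]; exact sum_congr rfl fun p _ => by ring

lemma prod_twE_exp (hA : 1 ≤ A) (hl : ∀ p, 0 < l p ∧ l p ≤ 1) (ht : |t| ≤ 1 / 10 ^ 4)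
    (hδ : 0 ≤ δ) (hδ1 : δ ≤ 1 / 10 ^ 4) {f : ι → ℕ → ℂ} (hf : ∀ p, LF (l p) (1 / 4) δ (f p)) :
    ∃ E : ℂ, ∏ p, twE A (l p) t (f p) = (∏ p, phiL A (l p) t) * (∏ p, ∫ k, f p k ∂(geo A (l p))) *
      cexp (t * I * (∑ p, kaL A (l p) (f p)) + E) ∧
      ‖E‖ ≤ 10 ^ 7 * (t ^ 2 * δ + |t| * δ ^ 2) * ∑ p, mm A (l p) := by
  obtain ⟨e, h1, h2⟩ := prod_exp_form (a := fun p => twE A (l p) t (f p))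
    (b := fun p => phiL A (l p) t * (∫ k, f p k ∂(geo A (l p))))
    (u := fun p => t * I * kaL A (l p) (f p)) (m := fun p => mm A (l p))
    (B := 10 ^ 7 * (t ^ 2 * δ + |t| * δ ^ 2))
    (fun p => (hf p).twE_exp hA (hl p).1 (hl p).2 hδ hδ1 ht)
  refine ⟨e, ?_, h2⟩; rw [h1, prod_mul_distrib, mul_sum]

lemma prod_integral_normSq (hA : 1 ≤ A) (hl : ∀ p, 0 < l p ∧ l p ≤ 1)
    (hδ : 0 ≤ δ) (hδ1 : δ ≤ 1 / 10 ^ 4) {f : ι → ℕ → ℂ} (hf : ∀ p, LF (l p) (1 / 16) δ (f p)) :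
    ∃ e : ℂ, ∏ p, ∫ k, f p k * conj (f p k) ∂(geo A (l p)) = (∏ p, ∫ k, f p k ∂(geo A (l p))) *
      (∏ p, ∫ k, conj (f p k) ∂(geo A (l p))) * cexp e ∧
      ‖e‖ ≤ 10 ^ 6 * δ ^ 2 * ∑ p, mm A (l p) := by
  obtain ⟨e, h1, h2⟩ := prod_exp_form
    (a := fun p => ∫ k, f p k * conj (f p k) ∂(geo A (l p)))
    (b := fun p => (∫ k, f p k ∂(geo A (l p))) * (∫ k, conj (f p k) ∂(geo A (l p))))
    (u := fun _ => 0) (m := fun p => mm A (l p)) (B := 10 ^ 6 * δ ^ 2)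
    (fun p => by
      obtain ⟨e, h, h'⟩ := (hf p).b_normSq hA (hl p).1 (hl p).2 hδ hδ1
      exact ⟨e, by rw [zero_add]; exact h, h'⟩)
  refine ⟨e, ?_, h2⟩; rw [h1, prod_mul_distrib]; simp

lemma prod_integral_exp (hA : 1 ≤ A) (hl : ∀ p, 0 < l p ∧ l p ≤ 1)
    (hδ : 0 ≤ δ) (hδ1 : δ ≤ 1 / 10 ^ 4) {f : ι → ℕ → ℂ} (hf : ∀ p, LF (l p) (1 / 4) δ (f p)) :
    ∃ e : ℂ, ∏ p, ∫ k, f p k ∂(geo A (l p)) = cexp e ∧ ‖e‖ ≤ 200 * δ * ∑ p, mm A (l p) := by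
  obtain ⟨e, h1, h2⟩ := prod_exp_form
    (a := fun p => ∫ k, f p k ∂(geo A (l p))) (b := fun _ => 1)
    (u := fun _ => 0) (m := fun p => mm A (l p)) (B := 200 * δ)
    (fun p => by
      obtain ⟨e, h, h'⟩ := (hf p).b_exp hA (hl p).1 (hl p).2 hδ hδ1
      exact ⟨e, by rw [zero_add, one_mul]; exact h, h'⟩)
  refine ⟨e, ?_, h2⟩; rw [h1]; simp

lemma exp_neg_le_norm_exp (e : ℂ) : rexp (-‖e‖) ≤ ‖cexp e‖ := by
  rw [norm_exp, exp_le_exp]; exact (abs_le.1 (abs_re_le_norm e)).1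

lemma sum_kaL_le (hA : 1 ≤ A) (hl : ∀ p, 0 < l p ∧ l p ≤ 1)
    (hδ : 0 ≤ δ) {f : ι → ℕ → ℂ} (hf : ∀ p, LF (l p) (1 / 4) δ (f p)) :
    ‖∑ p, kaL A (l p) (f p)‖ ≤ 800 * δ * ∑ p, mm A (l p) := by
  rw [mul_sum]
  exact (norm_sum_le _ _).trans
    (sum_le_sum fun p _ => ((hf p).kaL hA (hl p).1 (hl p).2 hδ).2)

lemma sum_kaL_normSq (hA : 1 ≤ A) (hl : ∀ p, 0 < l p ∧ l p ≤ 1)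
    (hδ : 0 ≤ δ) {f : ι → ℕ → ℂ} (hf : ∀ p, LF (l p) (1 / 16) δ (f p)) :
    ‖∑ p, kaL A (l p) (fun k => f p k * conj (f p k)) -
      ((∑ p, kaL A (l p) (f p)) + ∑ p, kaL A (l p) (fun k => conj (f p k)))‖ ≤
      204800 * δ ^ 2 * ∑ p, mm A (l p) := by
  rw [mul_sum, ← sum_add_distrib, ← sum_sub_distrib]
  exact (norm_sum_le _ _).trans
    (sum_le_sum fun p _ => (hf p).kaL_normSq hA (hl p).1 (hl p).2 hδ)

lemma prod_le_exp_of_gap {a g m : ι → ℝ} {B : ℝ} (ha : ∀ p, 0 ≤ a p)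
    (h : ∀ p, a p ≤ 1 - g p + B * m p) :
    ∏ p, a p ≤ rexp (-(∑ p, g p) + B * ∑ p, m p) := by
  calc ∏ p, a p ≤ ∏ p, rexp (-g p + B * m p) := by
        refine Finset.prod_le_prod (fun p _ => ha p) fun p _ => (h p).trans ?_
        linarith [add_one_le_exp (-g p + B * m p)]
    _ = _ := by rw [← Real.exp_sum, sum_add_distrib, sum_neg_distrib, mul_sum]

lemma norm_prod_twE_le (hA : 1 ≤ A) (hl : ∀ p, 0 < l p ∧ l p ≤ 1)
    (hδ : 0 ≤ δ) {f : ι → ℕ → ℂ} (hf : ∀ p, LF (l p) (1 / 4) δ (f p)) {g : ι → ℝ}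
    (hg : ∀ p, ‖phiL A (l p) t‖ ≤ 1 - g p) :
    ‖∏ p, twE A (l p) t (f p)‖ ≤ rexp (-(∑ p, g p) + 100 * δ * ∑ p, mm A (l p)) := by
  rw [norm_prod]; refine prod_le_exp_of_gap (fun p => norm_nonneg _) fun p => ?_
  linarith [norm_twE_le (hf p) hA (hl p).1 (hl p).2 hδ t, hg p]

lemma norm_prod_phiL_le {g : ι → ℝ} (hg : ∀ p, ‖phiL A (l p) t‖ ≤ 1 - g p) :
    ‖∏ p, phiL A (l p) t‖ ≤ rexp (-(∑ p, g p)) := by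
  rw [norm_prod]
  have := prod_le_exp_of_gap (a := fun p => ‖phiL A (l p) t‖) (g := g) (m := fun _ => 0) (B := 0)
    (fun p => norm_nonneg _) fun p => by linarith [hg p]
  simpa using this

end Product

lemma norm_phiL_abs (A l t : ℝ) :
    ‖phiL A l |t|‖ = ‖phiL A l t‖ := by
  rcases abs_choice t with h | h
  · rw [h]
  · rw [h]
    have : phiL A l (-t) = conj (phiL A l t) := by
      unfold phiL; rw [← integral_conj]; congr 1; funext k; unfold eg; rw [← exp_conj]; congr 1
      simp
    rw [this, norm_conj]

lemma integral_sub_sub_add {Ω : Type*} [MeasurableSpace Ω] {μ : Measure Ω} {a b c d : Ω → ℂ}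
    (ha : Integrable a μ) (hb : Integrable b μ) (hc : Integrable c μ) (hd : Integrable d μ) :
    ∫ ω, (a ω - b ω - c ω + d ω) ∂μ =
      (∫ ω, a ω ∂μ) - (∫ ω, b ω ∂μ) - (∫ ω, c ω ∂μ) + ∫ ω, d ω ∂μ := by
  have h1 : Integrable (fun ω => a ω - b ω) μ := ha.sub hb
  have h2 : Integrable (fun ω => a ω - b ω - c ω) μ := h1.sub hc
  rw [integral_add h2 hd, integral_sub h1 hc, integral_sub ha hb]

section Twist

variable {ι : Type} [Fintype ι] {A : ℝ} {l : ι → ℝ}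

/-- The normalised multiplicative twist minus its mean. -/
def twg (A : ℝ) (l : ι → ℝ) (f : ι → ℕ → ℂ) (k : ι → ℕ) : ℂ :=
  (∏ p, f p (k p)) / (∏ p, ∫ j, f p j ∂(geo A (l p))) - 1

lemma prod_integral_conj (f : ι → ℕ → ℂ) :
    ∏ p, ∫ k, conj (f p k) ∂(geo A (l p)) = conj (∏ p, ∫ k, f p k ∂(geo A (l p))) := by
  rw [map_prod]; exact prod_congr rfl fun p _ => integral_conj

lemma normSq_twg (f : ι → ℕ → ℂ) (k : ι → ℕ) :
    ((‖twg A l f k‖ ^ 2 : ℝ) : ℂ) = (∏ p, f p (k p) * conj (f p (k p))) /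
        ((∏ p, ∫ j, f p j ∂(geo A (l p))) * ∏ p, ∫ j, conj (f p j) ∂(geo A (l p))) -
      (∏ p, f p (k p)) / (∏ p, ∫ j, f p j ∂(geo A (l p))) -
      (∏ p, conj (f p (k p))) / (∏ p, ∫ j, conj (f p j) ∂(geo A (l p))) + 1 := by
  rw [ofReal_pow, ← mul_conj', prod_mul_distrib, mul_div_mul_comm, prod_integral_conj, ← map_prod]
  unfold twg; rw [map_sub, map_div₀, map_one]; ring

lemma integrable_twist (hA : 1 ≤ A) (hl : ∀ p, 0 < l p ∧ l p ≤ 1) (hδ : 0 ≤ δ)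
    {f : ι → ℕ → ℂ} (hf : ∀ p, LF (l p) (1 / 16) δ (f p)) : Integrable (fun k => ∏ p, f p (k p)) (gpi A l) :=
  integrable_gpi_prod fun p =>
    ((hf p).mono (hl p).1 hδ (by norm_num)).integrable hA (hl p).1 (hl p).2 hδ

lemma integrable_twg (hA : 1 ≤ A) (hl : ∀ p, 0 < l p ∧ l p ≤ 1) (hδ : 0 ≤ δ)
    {f : ι → ℕ → ℂ} (hf : ∀ p, LF (l p) (1 / 16) δ (f p)) : Integrable (twg A l f) (gpi A l) := by
  have := isProb_gpi hA hl
  exact ((integrable_twist hA hl hδ hf).div_const _).sub (integrable_const 1)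

lemma integral_osc_twg (hA : 1 ≤ A) (hl : ∀ p, 0 < l p ∧ l p ≤ 1) (hδ : 0 ≤ δ)
    {f : ι → ℕ → ℂ} (hf : ∀ p, LF (l p) (1 / 16) δ (f p)) (t : ℝ) :
    ∫ k, osc t (Xs A l k) * twg A l f k ∂(gpi A l) =
      (∏ p, twE A (l p) t (f p)) / (∏ p, ∫ j, f p j ∂(geo A (l p))) - ∏ p, phiL A (l p) t := by
  have := isProb_gpi hA hl
  have h1 := integrable_osc_mul (gpi A l) (measurable_Xs (A := A) (l := l)) (integrable_twist hA hl hδ hf) t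
  have h2 := integrable_osc_mul (gpi A l) (measurable_Xs (A := A) (l := l))
    (integrable_const (1 : ℂ)) t
  simp only [mul_one] at h2
  rw [← integral_osc_Xs_mul, ← integral_osc_Xs, ← integral_div, ← integral_sub (h1.div_const _) h2]
  congr 1; funext k; unfold twg; ring

lemma integrable_twist_normSq (hA : 1 ≤ A) (hl : ∀ p, 0 < l p ∧ l p ≤ 1) (hδ : 0 ≤ δ) (hδ1 : δ ≤ 1)
    {f : ι → ℕ → ℂ} (hf : ∀ p, LF (l p) (1 / 16) δ (f p)) :
    Integrable (fun k => ∏ p, f p (k p) * conj (f p (k p))) (gpi A l) :=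
  integrable_gpi_prod (f := fun p k => f p k * conj (f p k)) fun p =>
    ((hf p).normSq (hl p).1 hδ hδ1).integrable hA (hl p).1 (hl p).2 (by positivity)

lemma integrable_normSq_twg' (hA : 1 ≤ A) (hl : ∀ p, 0 < l p ∧ l p ≤ 1) (hδ : 0 ≤ δ) (hδ1 : δ ≤ 1)
    {f : ι → ℕ → ℂ} (hf : ∀ p, LF (l p) (1 / 16) δ (f p)) :
    Integrable (fun k => ((‖twg A l f k‖ ^ 2 : ℝ) : ℂ)) (gpi A l) := by
  have := isProb_gpi hA hl
  simp_rw [normSq_twg]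
  exact ((((integrable_twist_normSq hA hl hδ hδ1 hf).div_const _).sub
    ((integrable_twist hA hl hδ hf).div_const _)).sub
    ((integrable_twist hA hl hδ fun p => (hf p).conj).div_const _)).add (integrable_const 1)

lemma integrable_normSq_twg (hA : 1 ≤ A) (hl : ∀ p, 0 < l p ∧ l p ≤ 1) (hδ : 0 ≤ δ) (hδ1 : δ ≤ 1)
    {f : ι → ℕ → ℂ} (hf : ∀ p, LF (l p) (1 / 16) δ (f p)) : Integrable (fun k => ‖twg A l f k‖ ^ 2) (gpi A l) := by
  have := (integrable_normSq_twg' hA hl hδ hδ1 hf).re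
  simpa only [RCLike.re_to_complex, ofReal_re] using this

lemma integral_osc_normSq_twg (hA : 1 ≤ A) (hl : ∀ p, 0 < l p ∧ l p ≤ 1) (hδ : 0 ≤ δ) (hδ1 : δ ≤ 1)
    {f : ι → ℕ → ℂ} (hf : ∀ p, LF (l p) (1 / 16) δ (f p)) (t : ℝ) :
    ∫ k, osc t (Xs A l k) * ((‖twg A l f k‖ ^ 2 : ℝ) : ℂ) ∂(gpi A l) =
      (∏ p, twE A (l p) t (fun k => f p k * conj (f p k))) /
        ((∏ p, ∫ j, f p j ∂(geo A (l p))) * ∏ p, ∫ j, conj (f p j) ∂(geo A (l p))) -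
      (∏ p, twE A (l p) t (f p)) / (∏ p, ∫ j, f p j ∂(geo A (l p))) -
      (∏ p, twE A (l p) t (fun k => conj (f p k))) /
        (∏ p, ∫ j, conj (f p j) ∂(geo A (l p))) + ∏ p, phiL A (l p) t := by
  have := isProb_gpi hA hl
  have h1 := integrable_osc_mul (gpi A l) (measurable_Xs (A := A) (l := l)) (integrable_twist hA hl hδ hf) t
  have h2 := integrable_osc_mul (gpi A l) (measurable_Xs (A := A) (l := l))
    (integrable_const (1 : ℂ)) t
  simp only [mul_one] at h2
  have h3 := integrable_osc_mul (gpi A l) (measurable_Xs (A := A) (l := l))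
    (integrable_twist hA hl hδ fun p => (hf p).conj) t
  have h4 := integrable_osc_mul (gpi A l) (measurable_Xs (A := A) (l := l))
    (integrable_twist_normSq hA hl hδ hδ1 hf) t
  rw [← integral_osc_Xs_mul, ← integral_osc_Xs_mul, ← integral_osc_Xs_mul, ← integral_osc_Xs,
    ← integral_div, ← integral_div, ← integral_div,
    ← integral_sub_sub_add (h4.div_const _) (h1.div_const _) (h3.div_const _) h2]
  congr 1; funext k; rw [normSq_twg]; ring

lemma integral_normSq_twg_le (hA : 1 ≤ A) (hl : ∀ p, 0 < l p ∧ l p ≤ 1) (hδ : 0 ≤ δ) (hδ1 : δ ≤ 1)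
    {f : ι → ℕ → ℂ} (hf : ∀ p, LF (l p) (1 / 16) δ (f p)) :
    ∫ k, ‖twg A l f k‖ ^ 2 ∂(gpi A l) ≤ 2 + 2 * (‖∏ p, ∫ k, f p k * conj (f p k) ∂(geo A (l p))‖ /
        ‖∏ p, ∫ j, f p j ∂(geo A (l p))‖ ^ 2) := by
  have := isProb_gpi hA hl
  set M := ∏ p, ∫ j, f p j ∂(geo A (l p)) with hM
  have e1 : ∀ k : ι → ℕ, ∏ p, f p (k p) * conj (f p (k p)) = ((‖∏ p, f p (k p)‖ ^ 2 : ℝ) : ℂ) := by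
    intro k; rw [prod_mul_distrib, ← map_prod, mul_conj', ofReal_pow]
  have h4 := integrable_twist_normSq hA hl hδ hδ1 hf
  simp_rw [e1] at h4
  have h5 : Integrable (fun k : ι → ℕ => ‖∏ p, f p (k p)‖ ^ 2) (gpi A l) := by
    simpa only [RCLike.re_to_complex, ofReal_re] using h4.re
  have h6 : ‖∏ p, ∫ k, f p k * conj (f p k) ∂(geo A (l p))‖ =
      ∫ k, ‖∏ p, f p (k p)‖ ^ 2 ∂(gpi A l) := by
    rw [← integral_gpi_prod (fun p k => f p k * conj (f p k))]
    simp_rw [e1]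
    rw [integral_complex_ofReal, norm_real, norm_of_nonneg]
    exact integral_nonneg fun k => by positivity
  rw [h6, ← integral_div, ← integral_const_mul]
  have h7 : ∀ k, ‖twg A l f k‖ ^ 2 ≤ 2 + 2 * (‖∏ p, f p (k p)‖ ^ 2 / ‖M‖ ^ 2) := by
    intro k
    have : ‖twg A l f k‖ ≤ ‖∏ p, f p (k p)‖ / ‖M‖ + 1 := by
      unfold twg; rw [← norm_div]; exact (norm_sub_le _ _).trans (by simp [hM])
    rw [← div_pow]; nlinarith [norm_nonneg (twg A l f k), sq_nonneg (‖∏ p, f p (k p)‖ / ‖M‖ - 1)]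
  have h8 : Integrable (fun k : ι → ℕ => 2 * (‖∏ p, f p (k p)‖ ^ 2 / ‖M‖ ^ 2)) (gpi A l) :=
    (h5.div_const _).const_mul 2
  calc _ ≤ ∫ k, (2 + 2 * (‖∏ p, f p (k p)‖ ^ 2 / ‖M‖ ^ 2)) ∂(gpi A l) :=
        integral_mono (integrable_normSq_twg hA hl hδ hδ1 hf) ((integrable_const 2).add h8) h7
    _ = _ := by rw [integral_add (integrable_const 2) h8]; simp

end Twist

lemma phi_err_le {e : ℝ} (hσ : 0 ≤ σ) (ht : |t| ≤ 1 / 10 ^ 7)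
    (he : e ≤ 400000 * |t| ^ 3 * σ) : e ≤ σ * t ^ 2 / 8 := by
  have h1 : |t| ^ 3 ≤ 1 / 10 ^ 7 * t ^ 2 := by
    rw [pow_succ', ← sq_abs t]; exact mul_le_mul_of_nonneg_right ht (by positivity)
  nlinarith [mul_le_mul_of_nonneg_right h1 hσ, mul_nonneg hσ (sq_nonneg t)]

set_option maxHeartbeats 1600000 in
lemma twist_main_arc (hc : 0 < c) :
    ∃ C C' δ₀ : ℝ, 0 < C ∧ 0 < C' ∧ 0 < δ₀ ∧ δ₀ ≤ 1 / 10 ^ 8 ∧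
      ∀ {ι : Type} [Fintype ι] {A N δ t : ℝ} {l : ι → ℝ} {f : ι → ℕ → ℂ}, 1 ≤ A →
      (∀ p, 0 < l p ∧ l p ≤ 1) → 1 ≤ N → c * N ≤ ∑ p, mm A (l p) → ∑ p, mm A (l p) ≤ 2 * N →
      0 ≤ δ → δ ≤ δ₀ → (∀ p, LF (l p) (1 / 16) δ (f p)) → |t| ≤ 1 / 10 ^ 7 →
      ‖(∫ k, osc t (Xs A l k) * twg A l f k ∂(gpi A l)) - t * I * (∑ p, kaL A (l p) (f p)) *
        ((rexp (-((∑ p, mm A (l p)) * t ^ 2 / 2)) : ℝ) : ℂ)‖ ≤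
        C * ((1 / N + N * δ ^ 2) * rexp (C' * (N * δ ^ 2))) * rexp (-(c / 8 * (N * t ^ 2))) ∧
      ‖∫ k, osc t (Xs A l k) * ((‖twg A l f k‖ ^ 2 : ℝ) : ℂ) ∂(gpi A l)‖ ≤
        C * ((1 / N + N * δ ^ 2) * rexp (C' * (N * δ ^ 2))) * rexp (-(c / 8 * (N * t ^ 2))) := by
  obtain ⟨B, hBdef⟩ : ∃ B : ℝ, B = 10 ^ 13 := ⟨_, rfl⟩
  have hB : 1 ≤ B := by rw [hBdef]; norm_num
  obtain ⟨C1, hC1, h1⟩ := gauss_twist_first hc hB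
  obtain ⟨C2, hC2, h2⟩ := gauss_twist_second hc hB
  refine ⟨max C1 C2, 16 * B ^ 2 / c + B, min (1 / 10 ^ 8) (c / (16 * B)), lt_max_of_lt_left hC1,
    by positivity, by positivity, min_le_left _ _, ?_⟩
  intro ι _ A N δ t l f hA hl hN hlow hupp hδ hδ0 hf ht
  have hδ8 : δ ≤ 1 / 10 ^ 8 := hδ0.trans (min_le_left _ _)
  have hδ' : δ ≤ c / (16 * B) := hδ0.trans (min_le_right _ _)
  have ht4 : |t| ≤ 1 / 10 ^ 4 := ht.trans (by norm_num)
  have ht1 : |t| ≤ 1 := ht.trans (by norm_num)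
  have hσ0 : 0 ≤ ∑ p, mm A (l p) := (by positivity : 0 ≤ c * N).trans hlow
  have hN0 : 0 < N := by linarith
  have hf4 : ∀ p, LF (l p) (1 / 4) δ (f p) := fun p => (hf p).mono (hl p).1 hδ (by norm_num)
  have hfc4 : ∀ p, LF (l p) (1 / 4) δ (fun k => conj (f p k)) := fun p => (hf4 p).conj
  have hfn : ∀ p, LF (l p) (1 / 4) (258 * δ) (fun k => f p k * conj (f p k)) := fun p =>
    (hf p).normSq (hl p).1 hδ (by linarith)
  obtain ⟨e, hPhi, he⟩ := prod_phiL_exp hA hl ht4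
  obtain ⟨E1, hE1, hE1'⟩ := prod_twE_exp hA hl ht4 hδ (by linarith) hf4
  obtain ⟨E2, hE2, hE2'⟩ := prod_twE_exp hA hl ht4 hδ (by linarith) hfc4
  obtain ⟨E3, hE3, hE3'⟩ := prod_twE_exp hA hl ht4 (by positivity : 0 ≤ 258 * δ) (by linarith) hfn
  obtain ⟨e4, he4, he4'⟩ := prod_integral_normSq hA hl hδ (by linarith) hf
  obtain ⟨m1, hm1, -⟩ := prod_integral_exp hA hl hδ (by linarith) hf4
  have hK1 := sum_kaL_le hA hl hδ hf4
  have hK2 := sum_kaL_le hA hl hδ hfc4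
  have hK3 := sum_kaL_normSq hA hl hδ hf
  have hee := phi_err_le hσ0 ht he
  rw [integral_osc_twg hA hl hδ hf, integral_osc_normSq_twg hA hl hδ (by linarith) hf]
  have hM0 : ∏ p, ∫ j, f p j ∂(geo A (l p)) ≠ 0 := by rw [hm1]; exact Complex.exp_ne_zero _
  have hMc0 : ∏ p, ∫ j, conj (f p j) ∂(geo A (l p)) ≠ 0 := by
    rw [prod_integral_conj]; exact (map_ne_zero _).2 hM0
  rw [hE1, hE2, hE3, he4]
  generalize ∏ p, ∫ j, f p j ∂(geo A (l p)) = M at *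
  generalize ∏ p, ∫ j, conj (f p j) ∂(geo A (l p)) = Mc at *
  generalize ∑ p, kaL A (l p) (f p) = K1 at *
  generalize ∑ p, kaL A (l p) (fun k => conj (f p k)) = K2 at *
  generalize ∑ p, kaL A (l p) (fun k => f p k * conj (f p k)) = K3 at *
  rw [hPhi]
  generalize ∑ p, mm A (l p) = σ at *
  clear hE1 hE2 hE3 he4 hPhi hf4 hfc4 hfn hf hl hm1
  have ht2 : t ^ 2 ≤ |t| := by rw [← sq_abs]; nlinarith [abs_nonneg t]
  have hta := abs_nonneg t
  have hδδ : δ ^ 2 ≤ δ := by nlinarith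
  have p1 : 0 ≤ t ^ 2 * (N * δ) := by positivity
  have p2 : 0 ≤ N * δ ^ 2 := by positivity
  have p3 : 0 ≤ |t| * (N * δ) := by positivity
  have bd : ∀ d : ℝ, 0 ≤ d → 10 ^ 7 * (t ^ 2 * d + |t| * d ^ 2) * σ ≤
      2 * 10 ^ 7 * (t ^ 2 * (N * d) + N * d ^ 2) := by
    intro d hd
    have q1 : |t| * d ^ 2 ≤ d ^ 2 := mul_le_of_le_one_left (sq_nonneg d) ht1
    calc _ ≤ 10 ^ 7 * (t ^ 2 * d + d ^ 2) * (2 * N) := by gcongr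
      _ = _ := by ring
  have bd' : ∀ E : ℂ, ‖E‖ ≤ 10 ^ 7 * (t ^ 2 * δ + |t| * δ ^ 2) * σ →
      ‖E‖ ≤ 2 * 10 ^ 7 * (t ^ 2 * (N * δ) + N * δ ^ 2) ∧ ‖E‖ ≤ 4 * 10 ^ 7 * (|t| * (N * δ)) := by
    intro E hE; refine ⟨hE.trans (bd δ hδ), hE.trans ?_⟩
    calc _ ≤ 10 ^ 7 * (|t| * δ + |t| * δ) * (2 * N) := by gcongr
      _ = _ := by ring
  obtain ⟨q1, q1'⟩ := bd' E1 hE1'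
  obtain ⟨q2, q2'⟩ := bd' E2 hE2'
  have q3 : ‖E3‖ ≤ 2 * 10 ^ 7 * (258 * (t ^ 2 * (N * δ)) + 66564 * (N * δ ^ 2)) := by
    refine (hE3'.trans (bd _ (by positivity))).trans (le_of_eq ?_); ring
  have q4 : ‖e4‖ ≤ 2 * 10 ^ 6 * (N * δ ^ 2) := by
    refine he4'.trans ?_
    calc _ ≤ 10 ^ 6 * δ ^ 2 * (2 * N) := by gcongr
      _ = _ := by ring
  have kb : ∀ K : ℂ, ‖K‖ ≤ 800 * δ * σ → ‖(t : ℂ) * I * K‖ ≤ 1600 * (|t| * (N * δ)) := by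
    intro K hK; rw [norm_mul, norm_mul, norm_I, norm_real, norm_eq_abs, mul_one]
    calc _ ≤ |t| * (800 * δ * (2 * N)) := by
          refine mul_le_mul_of_nonneg_left (hK.trans ?_) hta; gcongr
      _ = _ := by ring
  have k1 := kb K1 hK1
  have k2 := kb K2 hK2
  have k3 : ‖(t : ℂ) * I * (K3 - (K1 + K2))‖ ≤ 409600 * (N * δ ^ 2) := by
    rw [norm_mul, norm_mul, norm_I, norm_real, norm_eq_abs, mul_one]
    calc _ ≤ 1 * (204800 * δ ^ 2 * (2 * N)) := by
          refine mul_le_mul ht1 (hK3.trans ?_) (norm_nonneg _) (by norm_num)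
          gcongr
      _ = _ := by ring
  have he3 : ‖e‖ ≤ B * (|t| ^ 3 * N) := by
    refine he.trans ?_
    have : 0 ≤ |t| ^ 3 * N := by positivity
    calc _ ≤ 400000 * |t| ^ 3 * (2 * N) := by gcongr
      _ ≤ _ := by rw [hBdef]; linarith
  constructor
  · have hb : ‖(t : ℂ) * I * K1‖ ≤ B * (|t| * (N * δ)) := by rw [hBdef]; linarith
    have hb' : ‖E1‖ ≤ B * (t ^ 2 * (N * δ) + N * δ ^ 2) := by rw [hBdef]; linarith
    have := h1 N σ t δ e (t * I * K1) E1 hN0 hlow hδ hδ' he3 hee hb hb'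
    refine le_trans (le_of_eq ?_) (this.trans ?_)
    · congr 1
      rw [mul_assoc, mul_comm M, ← mul_assoc, mul_div_assoc, div_self hM0]; ring
    · gcongr
      exact le_max_left _ _
  · have n1 : ‖(t : ℂ) * I * K1 + E1‖ ≤ B * (|t| * (N * δ)) := by
      refine (norm_add_le _ _).trans ?_; rw [hBdef]; linarith
    have n2 : ‖(t : ℂ) * I * K2 + E2‖ ≤ B * (|t| * (N * δ)) := by
      refine (norm_add_le _ _).trans ?_; rw [hBdef]; linarith
    have n3 : ‖(t : ℂ) * I * (K3 - (K1 + K2)) + E3 + e4 - E1 - E2‖ ≤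
        B * (t ^ 2 * (N * δ) + N * δ ^ 2) := by
      have a1 := norm_sub_le ((t : ℂ) * I * (K3 - (K1 + K2)) + E3 + e4 - E1) E2
      have a2 := norm_sub_le ((t : ℂ) * I * (K3 - (K1 + K2)) + E3 + e4) E1
      have a3 := norm_add_le ((t : ℂ) * I * (K3 - (K1 + K2)) + E3) e4
      have a4 := norm_add_le ((t : ℂ) * I * (K3 - (K1 + K2))) E3
      rw [hBdef]; linarith
    have := h2 N σ t δ e _ _ _ hN0 hlow hδ hδ' hee n1 n2 n3
    refine le_trans (le_of_eq ?_) (this.trans ?_)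
    · congr 1
      have x1 : (t : ℂ) * I * K1 + E1 + (t * I * K2 + E2) +
          (t * I * (K3 - (K1 + K2)) + E3 + e4 - E1 - E2) = t * I * K3 + E3 + e4 := by ring
      rw [x1, Complex.exp_add (t * I * K3 + E3) e4]; field_simp
    · gcongr
      exact le_max_right _ _

lemma eventually_saving {D : ℝ} (hc : 0 < c) (hκ : 0 ≤ κ) (hκ1 : κ < 1) :
    ∀ᶠ N : ℝ in atTop, D * N ^ κ + D * log N + D ≤ c * (N / log N ^ 2) := by
  obtain ⟨B, hB⟩ := @exists_eq _ (|D| * 3 / c)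
  have hBD : D ≤ c / 3 * B := by rw [hB]; field_simp; exact le_abs_self D
  filter_upwards [eventually_log_le_rpow 1 ((1 - κ) / 4) one_pos (by linarith),
    eventually_const_le_rpow B ((1 - κ) / 2) (by linarith),
    eventually_const_le_rpow B (1 / 4) (by norm_num), eventually_ge_atTop 3] with N h1 h2 h3 h4
  rw [one_mul] at h1
  have hN0 : 0 < N := by linarith
  have hN1 : 1 ≤ N := by linarith
  have hlog : 0 < log N := log_pos (by linarith)
  have key : N ^ ((1 + κ) / 2) ≤ N / log N ^ 2 := by
    rw [le_div_iff₀ (by positivity)]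
    calc _ ≤ N ^ ((1 + κ) / 2) * (N ^ ((1 - κ) / 4)) ^ 2 := by gcongr
      _ = N ^ ((1 + κ) / 2 + (1 - κ) / 4 * 2) := by
          rw [← rpow_natCast, ← rpow_mul hN0.le, ← rpow_add hN0]; norm_num
      _ = N := by rw [show (1 + κ) / 2 + (1 - κ) / 4 * 2 = 1 by ring, rpow_one]
  have b1 : B * N ^ κ ≤ N ^ ((1 + κ) / 2) := by
    calc _ ≤ N ^ ((1 - κ) / 2) * N ^ κ := by gcongr
      _ = _ := by rw [← rpow_add hN0]; congr 1; ring
  have b2 : B * log N ≤ N ^ ((1 + κ) / 2) := by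
    calc _ ≤ N ^ (1 / 4 : ℝ) * N ^ ((1 - κ) / 4) := by gcongr
      _ = N ^ (1 / 4 + (1 - κ) / 4) := by rw [← rpow_add hN0]
      _ ≤ _ := rpow_le_rpow_of_exponent_le hN1 (by linarith)
  have b3 : B ≤ N ^ ((1 + κ) / 2) :=
    h3.trans (rpow_le_rpow_of_exponent_le hN1 (by linarith))
  have hr : 0 ≤ N ^ κ := by positivity
  have hc3 : 0 ≤ c / 3 := by positivity
  nlinarith [mul_le_mul_of_nonneg_left b1 hc3, mul_le_mul_of_nonneg_left b2 hc3,
    mul_le_mul_of_nonneg_left b3 hc3, mul_le_mul_of_nonneg_right hBD hr,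
    mul_le_mul_of_nonneg_right hBD hlog.le, mul_le_mul_of_nonneg_left key hc.le]

lemma eventually_tail (D : ℝ) : ∀ᶠ x : ℝ in atTop,
    D * rexp (-(x ^ (1 / 100 : ℝ) / 2)) ≤ 1 / x ^ 2 := by
  filter_upwards [eventually_log_le_rpow (1 / 8) (1 / 100) (by norm_num) (by norm_num),
    eventually_const_le_rpow (4 * D) (1 / 100) (by norm_num), eventually_ge_atTop 1]
    with x h1 h2 h3
  have hx : 0 < x := by linarith
  have e1 : 1 / x ^ 2 = rexp (-(2 * log x)) := by
    rw [Real.exp_neg, one_div, two_mul, Real.exp_add, Real.exp_log hx, sq]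
  have h4 : D ≤ rexp D := by linarith [add_one_le_exp D]
  calc _ ≤ rexp D * rexp (-(x ^ (1 / 100 : ℝ) / 2)) := by gcongr
    _ = rexp (D + -(x ^ (1 / 100 : ℝ) / 2)) := by rw [Real.exp_add]
    _ ≤ _ := by rw [e1]; apply exp_le_exp.2; linarith

lemma eventually_off_bound {D : ℝ} (hD : 1 ≤ D) (hc : 0 < c) (hκ : 0 ≤ κ) (hκ1 : κ < 1) :
    ∀ᶠ N : ℝ in atTop, ∀ A Y t Z e κ₁ : ℝ, 1 ≤ A → κ₁ ≤ κ → A ≤ rexp (N ^ κ₁) →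
      A * √N * (A * N) ^ (1 / 100 : ℝ) ≤ Y → 0 ≤ Z → 1 ≤ e →
      (|t| ≤ Y → Z ≤ D * rexp (-(c * (N / log N ^ 2)) + D * N ^ κ)) → (Y < |t| → Z ≤ D * e) →
      rexp (-(|t| / (A * √N))) * Z ≤ 1 / (A * N ^ 2) * e * rexp (-(|t| / (2 * (A * √N)))) := by
  obtain ⟨x₀, hx₀⟩ := eventually_atTop.1 (eventually_tail D)
  filter_upwards [eventually_saving (D := D + 2) hc hκ hκ1, eventually_ge_atTop x₀,
    eventually_ge_atTop 3] with N h1 h2 h3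
  intro A Y t Z e κ₁ hA hκ₁ hAe hY hZ he hmin htail
  have hN0 : 0 < N := by linarith
  have hA0 : 0 < A := by linarith
  have hlog : 0 ≤ log N := log_nonneg (by linarith)
  have e0 : rexp (-(|t| / (A * √N))) =
      rexp (-(|t| / (2 * (A * √N)))) * rexp (-(|t| / (2 * (A * √N)))) := by
    rw [← Real.exp_add]; congr 1; field_simp; ring
  have hq1 : rexp (-(|t| / (2 * (A * √N)))) ≤ 1 := by
    rw [exp_le_one_iff]
    have : 0 ≤ |t| / (2 * (A * √N)) := by positivity
    linarith
  suffices h : rexp (-(|t| / (2 * (A * √N)))) * Z ≤ 1 / (A * N ^ 2) * e by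
    rw [e0]; nlinarith [mul_le_mul_of_nonneg_left h (exp_nonneg (-(|t| / (2 * (A * √N)))))]
  have hAN : 0 < 1 / (A * N ^ 2) := by positivity
  by_cases ht : |t| ≤ Y
  · have hAle : A ≤ rexp (N ^ κ) :=
      hAe.trans (exp_le_exp.2 (rpow_le_rpow_of_exponent_le (by linarith) hκ₁))
    have h5 : Z ≤ 1 / (A * N ^ 2) := by
      refine (hmin ht).trans ?_; rw [le_div_iff₀ (by positivity)]
      have h6 : D ≤ rexp D := by linarith [add_one_le_exp D]
      have h7 : N ^ 2 = rexp (2 * log N) := by rw [two_mul, Real.exp_add, Real.exp_log hN0, sq]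
      calc _ ≤ rexp D * rexp (-(c * (N / log N ^ 2)) + D * N ^ κ) *
            (rexp (N ^ κ) * rexp (2 * log N)) := by
            rw [h7]; gcongr
        _ = rexp (D + (-(c * (N / log N ^ 2)) + D * N ^ κ) +
            (N ^ κ + 2 * log N)) := by simp only [Real.exp_add]
        _ ≤ 1 := by
            rw [exp_le_one_iff]
            have : 0 ≤ N ^ κ := by positivity
            have : 0 ≤ D * log N := by positivity
            nlinarith
    calc _ ≤ 1 * (1 / (A * N ^ 2)) := mul_le_mul hq1 h5 hZ (by norm_num)
      _ ≤ _ := by rw [one_mul]; exact le_mul_of_one_le_right hAN.le he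
  · push Not at ht
    have h5 := htail ht
    have hANx : x₀ ≤ A * N := by nlinarith
    have h6 := hx₀ (A * N) hANx
    have h7 : (A * N) ^ (1 / 100 : ℝ) / 2 ≤ |t| / (2 * (A * √N)) := by
      rw [div_le_div_iff₀ (by norm_num) (by positivity)]
      nlinarith
    calc _ ≤ rexp (-((A * N) ^ (1 / 100 : ℝ) / 2)) * (D * e) := by gcongr
      _ = (D * rexp (-((A * N) ^ (1 / 100 : ℝ) / 2))) * e := by ring
      _ ≤ 1 / (A * N) ^ 2 * e := by gcongr
      _ ≤ _ := by
        gcongr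
        nlinarith [sq_nonneg N, mul_le_mul_of_nonneg_right hA (mul_nonneg hA0.le (sq_nonneg N))]

lemma SysHyp.phiL_gap {s : Finset ℕ} {l : ℕ → ℝ} (h : SysHyp s l A N Y c κ)
    (hc : 0 < c) (hc1 : c ≤ 1) (hN : 3 ≤ N) (hη : 0 < η) (hη1 : η ≤ 1) (ht : η < |t|)
    (htY : |t| ≤ Y) : ∃ g : s → ℝ, (∀ p : s, ‖phiL A (l p) t‖ ≤ 1 - g p) ∧
      c * η ^ 2 / 120 * (N / log N ^ 2) ≤ ∑ p, g p := by
  have hlog : 1 ≤ log N := by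
    rw [le_log_iff_exp_le (by linarith)]
    linarith [exp_one_lt_d9]
  rcases h.hdich |t| (hη.trans ht) htY with h1 | ⟨hA1, h2, h3⟩
  · refine ⟨fun p => 1 / 3 * (qq A (l p) * sin (|t| * l p / 2) ^ 2), fun p => ?_, ?_⟩
    · rw [← norm_phiL_abs]
      exact _root_.phiL_gap h.hA (h.hl p p.2).1 |t|
    · rw [← mul_sum, sum_coe_sort s (fun p => qq A (l p) * sin (|t| * l p / 2) ^ 2)]
      have hm : η ^ 2 ≤ min 1 (|t| ^ 2) := le_min (by nlinarith) (by gcongr)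
      have : c * η ^ 2 * (N / log N ^ 2) ≤ c * min 1 (|t| ^ 2) * (N / log N ^ 2) := by gcongr
      have h0 : 0 ≤ c * η ^ 2 * (N / log N ^ 2) := by positivity
      linarith
  · subst hA1
    refine ⟨fun _ => η ^ 2 / 120, fun p => ?_, ?_⟩
    · rw [← norm_phiL_abs]
      exact phiL_gap' (h.hl p p.2).1 hη hη1 ht.le (h2 p p.2)
        (exp_neg_le_mm (h.hl p p.2).1 (h.hl p p.2).2)
    · simp only [sum_const, card_univ, Fintype.card_coe, nsmul_eq_mul]
      have hle : N / log N ^ 2 ≤ N := div_le_self (by linarith) (by nlinarith)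
      calc _ ≤ 1 * η ^ 2 / 120 * N := by gcongr
        _ ≤ 1 * η ^ 2 / 120 * s.card := by gcongr
        _ = _ := by ring

lemma SysHyp.hl' {s : Finset ℕ} {l : ℕ → ℝ} (h : SysHyp s l A N Y c κ) :
    ∀ p : s, 0 < l p ∧ l p ≤ 1 := fun p => h.hl p p.2

lemma SysHyp.sum_mm {s : Finset ℕ} {l : ℕ → ℝ} (h : SysHyp s l A N Y c κ) :
    c * N ≤ ∑ p : s, mm A (l p) ∧ ∑ p : s, mm A (l p) ≤ 2 * N := by
  rw [sum_coe_sort s (fun p => mm A (l p))]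
  exact ⟨h.hlow, h.hupp⟩

lemma norm_integral_osc_Xs_le_one {ι : Type} [Fintype ι] {l : ι → ℝ} (hA : 1 ≤ A)
    (hl : ∀ p, 0 < l p ∧ l p ≤ 1) (t : ℝ) : ‖∫ k, osc t (Xs A l k) ∂(gpi A l)‖ ≤ 1 := by
  have := isProb_gpi hA hl
  have := norm_integral_osc_le (gpi A l) (X := Xs A l) (fun _ => (1 : ℂ)) t
  simpa using this

lemma SysHyp.arc {C₀ : ℝ} (hc : 0 < c) (hc1 : c ≤ 1) (hκ : 0 ≤ κ) (hκ1 : κ < 1)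
    (hC₀ : 800000 ≤ C₀) :
    ∃ N₀ : ℝ, ∀ (s : Finset ℕ) (l : ℕ → ℝ) (A N Y : ℝ), SysHyp s l A N Y c κ → N₀ ≤ N →
      ArcHyp (gpi A l⇂s) (Xs A l⇂s) (1 / 10 ^ 7) (c / 8) C₀ A N
        (∑ p : s, mm A (l p)) := by
  obtain ⟨N₀, hN₀⟩ := eventually_atTop.1
    (eventually_off_bound (D := 1) (c := c * (1 / 10 ^ 7) ^ 2 / 120) (κ := κ) le_rfl
      (by positivity) hκ hκ1)
  refine ⟨max N₀ 3, fun s l A N Y h hN => ?_⟩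
  have hN3 : 3 ≤ N := (le_max_right _ _).trans hN
  obtain ⟨hlow, hupp⟩ := h.sum_mm
  have hσ0 : 0 ≤ ∑ p : s, mm A (l p) := (by positivity : 0 ≤ c * N).trans hlow
  refine ⟨measurable_Xs, h.hA, by linarith, hupp, ?_, ?_, ?_⟩
  · intro t ht
    obtain ⟨e, h1, h2⟩ := prod_phiL_exp h.hA h.hl' (ht.trans (by norm_num) : |t| ≤ 1 / 10 ^ 4)
    rw [integral_osc_Xs, h1]
    refine (gauss_factor hlow (phi_err_le hσ0 ht h2)).1.trans (exp_le_exp.2 ?_)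
    have : 0 ≤ c * (N * t ^ 2) := by positivity
    linarith
  · intro t ht
    obtain ⟨e, h1, h2⟩ := prod_phiL_exp h.hA h.hl' (ht.trans (by norm_num) : |t| ≤ 1 / 10 ^ 4)
    rw [integral_osc_Xs, h1]; refine (gauss_factor hlow (phi_err_le hσ0 ht h2)).2.trans ?_
    have h3 : ‖e‖ ≤ C₀ * (N * |t| ^ 3) := by
      refine h2.trans ?_
      have : 0 ≤ N * |t| ^ 3 := by positivity
      calc _ ≤ 400000 * |t| ^ 3 * (2 * N) := by gcongr
        _ = 800000 * (N * |t| ^ 3) := by ring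
        _ ≤ _ := by gcongr
    refine mul_le_mul h3 (exp_le_exp.2 ?_) (exp_nonneg _) (by positivity)
    have : 0 ≤ c * (N * t ^ 2) := by positivity
    linarith
  · intro t ht
    have := hN₀ N ((le_max_left _ _).trans hN) A Y t
      ‖∫ k, osc t (Xs A l⇂s k) ∂(gpi A l⇂s)‖ 1 κ h.hA le_rfl h.hAexp
      h.hY (norm_nonneg _) le_rfl ?_ ?_
    · rwa [mul_one] at this
    · intro htY
      obtain ⟨g, hg, hg'⟩ := h.phiL_gap hc hc1 hN3 (by norm_num) (by norm_num) ht htY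
      rw [integral_osc_Xs]; refine (norm_prod_phiL_le hg).trans ?_; rw [one_mul, one_mul]
      apply exp_le_exp.2
      have : 0 ≤ N ^ κ := by positivity
      linarith
    · intro _
      rw [one_mul]; exact norm_integral_osc_Xs_le_one h.hA h.hl' t

set_option maxHeartbeats 1600000 in
/-- Twisting the friable sum by a multiplicative function close to one. -/
theorem SysHyp.twist {κ₁ : ℝ} (hc : 0 < c) (hc1 : c ≤ 1) (hκ₁ : 0 ≤ κ₁) (hκ : κ₁ ≤ κ)
    (hκ1 : κ < 1) :
    ∃ C C' N₀ c₁ : ℝ, 0 < C ∧ 0 < C' ∧ 0 < c₁ ∧ ∀ (s : Finset ℕ) (l : ℕ → ℝ) (A N Y : ℝ),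
      SysHyp s l A N Y c κ₁ → N₀ ≤ N → c₁ / (A * √N) ≤ ∫ k, wc A (Xs A l⇂s k) ∂(gpi A l⇂s) ∧
      ∀ (δ : ℝ) (f : s → ℕ → ℂ), 0 ≤ δ → N * δ ≤ N ^ κ → (∀ p : s, LF (l p) (1 / 16) δ (f p)) →
      ‖(∫ k, ((wc A (Xs A l⇂s k) : ℝ) : ℂ) * ∏ p, f p (k p)
          ∂(gpi A l⇂s)) - (∏ p : s, ∫ j, f p j ∂(geo A (l p))) *
          ((∫ k, wc A (Xs A l⇂s k) ∂(gpi A l⇂s) : ℝ) : ℂ)‖ ≤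
        C * ‖∏ p : s, ∫ j, f p j ∂(geo A (l p))‖ * ((1 / N + N * δ ^ 2) * rexp (C' * (N * δ ^ 2))) *
          ∫ k, wc A (Xs A l⇂s k) ∂(gpi A l⇂s) := by
  obtain ⟨C1, C2, δ₀, hC1, hC2, hδ₀, hδ₀', harc⟩ := twist_main_arc hc
  obtain ⟨C₀, hC₀⟩ := @exists_eq _ (max C1 800000)
  have hC₀1 : C1 ≤ C₀ := hC₀ ▸ le_max_left _ _
  have hC₀2 : 800000 ≤ C₀ := hC₀ ▸ le_max_right _ _
  have hC₀0 : 0 < C₀ := by linarith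
  have hη : (0 : ℝ) < 1 / 10 ^ 7 := by norm_num
  have hc8 : 0 < c / 8 := by positivity
  obtain ⟨N1, hN1⟩ := SysHyp.arc hc hc1 hκ₁ (hκ.trans_lt hκ1) hC₀2
  obtain ⟨N2, c₁, hc₁, hlower⟩ := ArcHyp.lower hη hc8 hC₀0
  obtain ⟨C3, hC3, hcomp⟩ := ArcHyp.compare hη hc8 hC₀0
  obtain ⟨N3, hN3⟩ := eventually_atTop.1
    (eventually_off_bound (D := 10 ^ 6) (c := c * (1 / 10 ^ 7) ^ 2 / 120) (κ := κ) (by norm_num)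
      (by positivity) (hκ₁.trans hκ) hκ1)
  obtain ⟨N4, hN4⟩ := eventually_atTop.1
    (eventually_const_le_rpow (1 / δ₀) (1 - κ) (by linarith))
  obtain ⟨C', hC'⟩ := @exists_eq _ (max C2 (2 * 10 ^ 6))
  have hC'1 : C2 ≤ C' := hC' ▸ le_max_left _ _
  have hC'2 : 2 * 10 ^ 6 ≤ C' := hC' ▸ le_max_right _ _
  refine ⟨C3 / c₁, C', max (max N1 N2) (max N3 (max N4 3)), c₁, by positivity, by linarith, hc₁, ?_⟩
  intro s l A N Y h hN; simp only [max_le_iff] at hN; obtain ⟨⟨hNN1, hNN2⟩, hNN3, hNN4, hNN5⟩ := hN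
  have hN0 : 0 < N := by linarith
  have hA := h.hA
  have hl := h.hl'
  obtain ⟨hlow, hupp⟩ := h.sum_mm
  have hprob : IsProbabilityMeasure (gpi A l⇂s) := isProb_gpi hA hl
  have hArc := hN1 s l A N Y h hNN1
  have hJ := hlower _ _ A N _ hArc hNN2
  refine ⟨hJ, fun δ f hδ hw hf => ?_⟩
  have hδδ₀ : δ ≤ δ₀ := by
    have h1 := hN4 N hNN4
    have h2 : N ^ κ * N ^ (1 - κ) = N := by
      rw [← rpow_add hN0, show κ + (1 - κ) = 1 by ring, rpow_one]
    rw [div_le_iff₀ hδ₀] at h1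
    have h3 : 0 < N ^ κ := by positivity
    by_contra hcon
    push Not at hcon
    have h4 : N ^ (1 - κ) * δ ≤ 1 := by
      have : N ^ κ * (N ^ (1 - κ) * δ) ≤ N ^ κ * 1 := by rw [← mul_assoc, h2, mul_one]; exact hw
      exact le_of_mul_le_mul_left this h3
    have h5 : 0 < N ^ (1 - κ) := by positivity
    nlinarith
  have hδ1 : δ ≤ 1 := by linarith
  have hf4 : ∀ p : s, LF (l p) (1 / 4) δ (f p) := fun p => (hf p).mono (hl p).1 hδ (by norm_num)
  have hfc4 : ∀ p : s, LF (l p) (1 / 4) δ (fun k => conj (f p k)) :=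
    fun p => (hf4 p).conj
  have hfn : ∀ p : s, LF (l p) (1 / 4) (258 * δ) (fun k => f p k * conj (f p k)) :=
    fun p => (hf p).normSq (hl p).1 hδ hδ1
  obtain ⟨m1, hm1, hm1'⟩ := prod_integral_exp hA hl hδ (by linarith) hf4
  obtain ⟨e4, he4, he4'⟩ := prod_integral_normSq hA hl hδ (by linarith) hf
  obtain ⟨M, hM⟩ := @exists_eq _ (∏ p : s, ∫ j, f p j ∂(geo A (l p)))
  have hMc : ∏ p : s, ∫ j, conj (f p j) ∂(geo A (l p)) = conj M := by
    rw [hM]; exact prod_integral_conj f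
  have hM0 : M ≠ 0 := by rw [hM, hm1]; exact Complex.exp_ne_zero _
  have hMn : 0 < ‖M‖ := norm_pos_iff.2 hM0
  have hMlow : rexp (-(400 * (N * δ))) ≤ ‖M‖ := by
    rw [hM, hm1]; refine le_trans (exp_le_exp.2 ?_) (exp_neg_le_norm_exp m1)
    have : 200 * δ * ∑ p : s, mm A (l p) ≤ 200 * δ * (2 * N) := by gcongr
    linarith
  have hMinv : 1 / ‖M‖ ≤ rexp (400 * (N * δ)) := by
    rw [div_le_iff₀ hMn]
    calc (1 : ℝ) = rexp (400 * (N * δ)) * rexp (-(400 * (N * δ))) := by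
          rw [← Real.exp_add]; simp
      _ ≤ _ := by gcongr
  obtain ⟨v, hv⟩ := @exists_eq _ (N * δ ^ 2)
  have hv0 : 0 ≤ v := by rw [hv]; positivity
  have hsecond : ‖∏ p : s, ∫ k, f p k * conj (f p k) ∂(geo A (l p))‖ / ‖M‖ ^ 2 ≤ rexp (C' * v) := by
    rw [he4, hMc, ← hM, norm_mul, norm_mul, norm_conj, ← sq,
      mul_div_cancel_left₀ _ (by positivity), norm_exp]
    apply exp_le_exp.2; refine (re_le_norm _).trans (he4'.trans ?_)
    calc _ ≤ 10 ^ 6 * δ ^ 2 * (2 * N) := by gcongr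
      _ = 2 * 10 ^ 6 * v := by rw [hv]; ring
      _ ≤ _ := by gcongr
  obtain ⟨e, he⟩ := @exists_eq _ (rexp (C' * v))
  have he1 : 1 ≤ e := by rw [he]; exact one_le_exp (by positivity)
  obtain ⟨E₀, hE₀⟩ := @exists_eq _ ((1 / N + v) * e)
  have hE₀' : 1 / N * e ≤ E₀ := by
    rw [hE₀]; apply mul_le_mul_of_nonneg_right _ (by linarith); linarith
  have hNi : 0 < 1 / N := by positivity
  have hE₀1 : 1 / N ≤ E₀ := (le_mul_of_one_le_right hNi.le he1).trans hE₀'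
  have hE₀0 : 0 < E₀ := by linarith
  have hexpC : rexp (C2 * (N * δ ^ 2)) ≤ e := by rw [he, ← hv]; exact exp_le_exp.2 (by gcongr)
  have hE₀2 : C1 * ((1 / N + N * δ ^ 2) * rexp (C2 * (N * δ ^ 2))) ≤ C₀ * E₀ := by
    rw [hE₀, ← hv]; rw [← hv] at hexpC; exact mul_le_mul hC₀1 (by gcongr) (by positivity) hC₀0.le
  have hitg := integrable_twg hA hl hδ hf
  have hitg2 := integrable_normSq_twg hA hl hδ hδ1 hf
  have hmain := fun t ht => @harc _ _ A N δ t l⇂s f hA hl (by linarith) hlow hupp hδ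
    hδδ₀ hf ht
  have hK : ‖∑ p : s, kaL A (l p) (f p)‖ ≤ C₀ * N * E₀ := by
    refine (sum_kaL_le hA hl hδ hf4).trans ?_
    have h1 : δ ≤ E₀ := by
      have h4 : 0 ≤ 1 / N * (1 - N * δ) ^ 2 := by positivity
      have h5 : 1 / N * (1 - N * δ) ^ 2 = 1 / N + N * δ ^ 2 - 2 * δ := by field_simp; ring
      have h6 : 1 / N + v ≤ E₀ := by rw [hE₀]; exact le_mul_of_one_le_right (by positivity) he1
      rw [hv] at h6; linarith
    have hσ0 : 0 ≤ ∑ p : s, mm A (l p) := (by positivity : 0 ≤ c * N).trans hlow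
    calc _ ≤ 800 * E₀ * (2 * N) := mul_le_mul (by linarith) hupp hσ0 (by positivity)
      _ = 1600 * N * E₀ := by ring
      _ ≤ _ := by gcongr; linarith
  have hsq2 := integral_normSq_twg_le hA hl hδ hδ1 hf
  rw [← hM] at hsq2
  have hsq3 : ∫ k, ‖twg A l⇂s f k‖ ^ 2 ∂(gpi A l⇂s) ≤ 4 * e := by rw [← he] at hsecond; linarith
  have hn1 : ∫ k, ‖twg A l⇂s f k‖ ∂(gpi A l⇂s) ≤ 5 * e := by
    calc _ ≤ ∫ k, (1 + ‖twg A l⇂s f k‖ ^ 2) ∂(gpi A l⇂s) := by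
          refine integral_mono hitg.norm ((integrable_const 1).add hitg2) fun k => ?_
          change _ ≤ 1 + ‖twg A l⇂s f k‖ ^ 2
          nlinarith [sq_nonneg (‖twg A l⇂s f k‖ - 1)]
      _ = 1 + ∫ k, ‖twg A l⇂s f k‖ ^ 2 ∂(gpi A l⇂s) := by
          rw [integral_add (integrable_const 1) hitg2]; simp
      _ ≤ _ := by linarith
  have hoff : ∀ t Z : ℝ, 0 ≤ Z → (|t| ≤ Y → Z ≤ 10 ^ 6 * rexp
        (-(c * (1 / 10 ^ 7) ^ 2 / 120 * (N / log N ^ 2)) + 10 ^ 6 * N ^ κ)) →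
      (Y < |t| → Z ≤ 10 ^ 6 * e) →
      rexp (-(|t| / (A * √N))) * Z ≤ E₀ / (A * N) * rexp (-(|t| / (2 * (A * √N)))) := by
    intro t Z hZ h1 h2; refine (hN3 N hNN3 A Y t Z e κ₁ hA hκ h.hAexp h.hY hZ he1 h1 h2).trans ?_
    have h3 : 1 / (A * N ^ 2) * e = 1 / N * e / (A * N) := by field_simp
    rw [h3]; gcongr
  have hg := hcomp _ _ A N _ hArc (by linarith) (twg A l⇂s f)
    (∑ p : s, kaL A (l p) (f p)) E₀ hE₀1 hitg hitg2 hK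
    (fun t ht => ((hmain t ht).1.trans (by gcongr)))
    (fun t ht => ((hmain t ht).2.trans (by gcongr)))
    (fun t ht => hoff t _ (norm_nonneg _) (fun htY => ?_) (fun _ => ?_))
    (fun t ht => hoff t _ (norm_nonneg _) (fun htY => ?_) (fun _ => ?_))
  rotate_left
  · obtain ⟨g, hg, hg'⟩ := h.phiL_gap hc hc1 hNN5 (by norm_num) (by norm_num) ht htY
    rw [integral_osc_twg hA hl hδ hf, ← hM]
    have b1 := norm_prod_twE_le hA hl hδ hf4 hg
    have b2 := norm_prod_phiL_le hg
    obtain ⟨Λ, hΛ⟩ := @exists_eq _ (c * (1 / 10 ^ 7) ^ 2 / 120 * (N / log N ^ 2))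
    rw [← hΛ] at hg' ⊢
    have c0 : 100 * δ * ∑ p : s, mm A (l p) ≤ 200 * (N * δ) := by
      calc _ ≤ 100 * δ * (2 * N) := by gcongr
        _ = _ := by ring
    have c1 : ‖(∏ p : s, twE A (l p) t (f p)) / M‖ ≤ rexp (-Λ + 600 * (N * δ)) := by
      rw [div_eq_mul_one_div, norm_mul, norm_div, norm_one]
      calc _ ≤ rexp (-Λ + 200 * (N * δ)) * rexp (400 * (N * δ)) := by
            refine mul_le_mul (b1.trans (exp_le_exp.2 ?_)) hMinv (by positivity)
              (exp_nonneg _)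
            linarith
        _ = _ := by rw [← Real.exp_add]; congr 1; ring
    have hNδ : 0 ≤ N * δ := by positivity
    have c2 : rexp (-Λ + 600 * (N * δ)) ≤ rexp (-Λ + 10 ^ 6 * N ^ κ) :=
      exp_le_exp.2 (by linarith)
    have c3 : rexp (-(∑ p, g p)) ≤ rexp (-Λ + 10 ^ 6 * N ^ κ) :=
      exp_le_exp.2 (by linarith)
    have := norm_sub_le ((∏ p : s, twE A (l p) t (f p)) / M) (∏ p : s, phiL A (l p) t)
    obtain ⟨E, hE⟩ := @exists_eq _ (rexp (-Λ + 10 ^ 6 * N ^ κ))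
    have hE0 : 0 ≤ E := hE ▸ exp_nonneg _
    simp only [← hE] at *
    linarith
  · refine (norm_integral_osc_le _ _ t).trans ?_
    linarith
  · obtain ⟨g, hg, hg'⟩ := h.phiL_gap hc hc1 hNN5 (by norm_num) (by norm_num) ht htY
    rw [integral_osc_normSq_twg hA hl hδ hδ1 hf, hMc, ← hM]
    have b1 := norm_prod_twE_le hA hl hδ hf4 hg
    have b1' := norm_prod_twE_le hA hl hδ hfc4 hg
    have b1'' := norm_prod_twE_le hA hl (by positivity : 0 ≤ 258 * δ) hfn hg
    have b2 := norm_prod_phiL_le hg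
    obtain ⟨Λ, hΛ⟩ := @exists_eq _ (c * (1 / 10 ^ 7) ^ 2 / 120 * (N / log N ^ 2))
    rw [← hΛ] at hg' ⊢
    have hNδ : 0 ≤ N * δ := by positivity
    have c0 : 100 * δ * ∑ p : s, mm A (l p) ≤ 200 * (N * δ) := by
      calc _ ≤ 100 * δ * (2 * N) := by gcongr
        _ = _ := by ring
    have hMinv' : 1 / (‖M‖ * ‖M‖) ≤ rexp (800 * (N * δ)) := by
      rw [← one_div_mul_one_div]
      calc _ ≤ rexp (400 * (N * δ)) * rexp (400 * (N * δ)) := by gcongr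
        _ = _ := by rw [← Real.exp_add]; congr 1; ring
    have c1 : ‖(∏ p : s, twE A (l p) t (f p)) / M‖ ≤ rexp (-Λ + 10 ^ 6 * N ^ κ) := by
      rw [div_eq_mul_one_div, norm_mul, norm_div, norm_one]
      calc _ ≤ rexp (-Λ + 200 * (N * δ)) * rexp (400 * (N * δ)) := by
            refine mul_le_mul (b1.trans (exp_le_exp.2 ?_)) hMinv (by positivity)
              (exp_nonneg _)
            linarith
        _ ≤ _ := by rw [← Real.exp_add]; apply exp_le_exp.2; linarith
    have c1' : ‖(∏ p : s, twE A (l p) t (fun k => conj (f p k))) / conj M‖ ≤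
        rexp (-Λ + 10 ^ 6 * N ^ κ) := by
      rw [div_eq_mul_one_div, norm_mul, norm_div, norm_one, norm_conj]
      calc _ ≤ rexp (-Λ + 200 * (N * δ)) * rexp (400 * (N * δ)) := by
            refine mul_le_mul (b1'.trans (exp_le_exp.2 ?_)) hMinv (by positivity)
              (exp_nonneg _)
            linarith
        _ ≤ _ := by rw [← Real.exp_add]; apply exp_le_exp.2; linarith
    have c1'' : ‖(∏ p : s, twE A (l p) t (fun k => f p k * conj (f p k))) /
        (M * conj M)‖ ≤ rexp (-Λ + 10 ^ 6 * N ^ κ) := by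
      rw [div_eq_mul_one_div, norm_mul, norm_div, norm_one, norm_mul, norm_conj]
      calc _ ≤ rexp (-Λ + 51600 * (N * δ)) * rexp (800 * (N * δ)) := by
            refine mul_le_mul (b1''.trans (exp_le_exp.2 ?_)) hMinv' (by positivity)
              (exp_nonneg _)
            linarith
        _ ≤ _ := by rw [← Real.exp_add]; apply exp_le_exp.2; linarith
    have c3 : rexp (-(∑ p, g p)) ≤ rexp (-Λ + 10 ^ 6 * N ^ κ) :=
      exp_le_exp.2 (by linarith)
    refine (norm_add_le _ _).trans ?_; refine (add_le_add_left (norm_sub_le _ _) _).trans ?_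
    refine (add_le_add_left (add_le_add_left (norm_sub_le _ _) _) _).trans ?_
    obtain ⟨E, hE⟩ := @exists_eq _ (rexp (-Λ + 10 ^ 6 * N ^ κ))
    have hE0 : 0 ≤ E := hE ▸ exp_nonneg _
    simp only [← hE] at *
    linarith
  · refine (norm_integral_osc_le _ _ t).trans ?_
    refine le_trans (le_of_eq ?_) (hsq3.trans (by linarith))
    congr 1; funext k; rw [norm_real, norm_of_nonneg (by positivity)]
  · obtain ⟨J, hJd⟩ := @exists_eq _ (∫ k, wc A (Xs A l⇂s k) ∂(gpi A l⇂s))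
    have hwi := integrable_wc_mul (gpi A l⇂s) measurable_Xs (by linarith : 0 < A)
      (integrable_const (1 : ℂ)) (X := Xs A l⇂s)
    have hwg := integrable_wc_mul (gpi A l⇂s) measurable_Xs (by linarith : 0 < A)
      hitg (X := Xs A l⇂s)
    have key : (∫ k, ((wc A (Xs A l⇂s k) : ℝ) : ℂ) * ∏ p, f p (k p) ∂(gpi A l⇂s)) - M * (J : ℂ) =
        M * ∫ k, ((wc A (Xs A l⇂s k) : ℝ) : ℂ) * twg A l⇂s f k
          ∂(gpi A l⇂s) := by
      have e1 : (J : ℂ) = ∫ k, ((wc A (Xs A l⇂s k) : ℝ) : ℂ) * 1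
          ∂(gpi A l⇂s) := by
        simp only [mul_one]; rw [hJd, integral_complex_ofReal]
      rw [sub_eq_iff_eq_add, e1, ← mul_add, ← integral_add hwg hwi, ← integral_const_mul]
      congr 1; funext k; unfold twg; rw [← hM]; field_simp; ring
    rw [← hM, ← hJd, key, norm_mul, ← hv, ← he, ← hE₀]; rw [← hJd] at hJ
    calc _ ≤ ‖M‖ * (C3 * E₀ / (A * √N)) := by gcongr
      _ = C3 / c₁ * ‖M‖ * E₀ * (c₁ / (A * √N)) := by field_simp
      _ ≤ _ := by gcongr

/-- The exponents of `n` at the primes up to `y`. -/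
def vecN (y : ℝ) (n : ℕ) : primesLe y → ℕ := fun p => n.factorization p

lemma prod_vecN {n : ℕ} (hy : 0 ≤ y) (hn : n ∈ Sxy x y) {R : Type*} [CommMonoid R] (g : ℕ → ℕ → R)
    (hg : ∀ p, g p 0 = 1) : ∏ p : primesLe y, g p (vecN y n p) = n.factorization.prod g := by
  obtain ⟨h1, h2⟩ := mem_filter.1 hn
  rw [Finsupp.prod_of_support_subset (s := primesLe y) _ _ _ (fun p _ => hg p)]
  · exact prod_coe_sort (primesLe y) (fun p => g p (n.factorization p))
  · intro p hp
    rw [Nat.support_factorization] at hp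
    have hp1 := Nat.prime_of_mem_primeFactors hp
    rw [mem_primesLe hy]; exact ⟨hp1, h2 p hp1 (Nat.dvd_of_mem_primeFactors hp)⟩

lemma vecN_prod (hy : 0 ≤ y) (k : primesLe y → ℕ) : vecN y (∏ p : primesLe y, (p : ℕ) ^ k p) = k := by
  funext q; unfold vecN
  have hpr : ∀ p : primesLe y, (p : ℕ).Prime := fun p => ((mem_primesLe hy).1 p.2).1
  rw [Nat.factorization_prod fun p _ => pow_ne_zero _ (hpr p).ne_zero]
  simp only [Nat.factorization_pow, Finsupp.coe_finsetSum, Finset.sum_apply, Finsupp.smul_apply,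
    (hpr _).factorization, smul_eq_mul]
  rw [sum_eq_single q]
  · simp
  · intro p _ hp
    rw [Finsupp.single_eq_of_ne (by exact fun h => hp (Subtype.ext h.symm)), mul_zero]
  · simp

lemma prod_mem_Sxy (hy : 0 ≤ y) (k : primesLe y → ℕ) (h : ((∏ p : primesLe y, (p : ℕ) ^ k p : ℕ) : ℝ) ≤ x) :
    (∏ p : primesLe y, (p : ℕ) ^ k p) ∈ Sxy x y := by
  have hpr : ∀ p : primesLe y, (p : ℕ).Prime := fun p => ((mem_primesLe hy).1 p.2).1
  refine mem_filter.2 ⟨mem_Icc.2 ⟨?_, Nat.le_floor h⟩, fun q hq hd => ?_⟩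
  · exact Nat.one_le_iff_ne_zero.2 (prod_ne_zero_iff.2 fun p _ => pow_ne_zero _ (hpr p).ne_zero)
  · obtain ⟨p, _, hp⟩ := (hq.prime.dvd_finsetProd_iff _).1 hd
    rw [(Nat.prime_dvd_prime_iff_eq hq (hpr p)).1 (hq.dvd_of_dvd_pow hp)]
    exact ((mem_primesLe hy).1 p.2).2

lemma log_prod_pow (hy : 0 ≤ y) (k : primesLe y → ℕ) :
    log ((∏ p : primesLe y, (p : ℕ) ^ k p : ℕ) : ℝ) = ∑ p : primesLe y, k p * log p := by
  have hpr : ∀ p : primesLe y, (p : ℕ).Prime := fun p => ((mem_primesLe hy).1 p.2).1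
  push_cast; rw [Real.log_prod fun p _ => pow_ne_zero _ (Nat.cast_ne_zero.2 (hpr p).ne_zero)]
  simp

lemma sum_mean_eq (hα : 0 < α) (hL : 0 < L) (h : saddleEq x y α) :
    ∑ p : primesLe y, log p / L * qq (α * L) (log p / L) /
      (1 - qq (α * L) (log p / L)) = log x / L := by
  rw [← h, sum_div, ← sum_coe_sort (primesLe y)]; refine sum_congr rfl fun p _ => ?_
  have hp2 := two_le_of_mem_primesLe p.2
  have hp : (1 : ℝ) < (p : ℕ) := mod_cast hp2
  rw [saddle_term_eq hp hα, rpow_neg_eq_exp (by linarith)]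
  have : qq (α * L) (log p / L) = rexp (-(α * log p)) := by unfold qq; congr 2; field_simp
  rw [this]; ring

lemma Xs_eq (hy : 0 ≤ y) (hα : 0 < α) (hL : 0 < L) (h : saddleEq x y α) (k : primesLe y → ℕ) :
    Xs (α * L) (fun p : primesLe y => log p / L) k =
      (log ((∏ p : primesLe y, (p : ℕ) ^ k p : ℕ) : ℝ) - log x) / L := by
  unfold Xs xk; rw [sum_sub_distrib, sum_mean_eq hα hL h, log_prod_pow hy, sub_div, sum_div]
  congr 1; exact sum_congr rfl fun p _ => by ring

/-- Sums over friable integers as expectations over the product of geometric laws. -/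
lemma integral_wc_eq_sum (hy : 0 ≤ y) (hx : 0 < x) (hα : 0 < α) (hL : 0 < L)
    (h : saddleEq x y α) : ∃ c₀ : ℝ, 0 < c₀ ∧ ∀ G : (primesLe y → ℕ) → ℂ,
        ∫ k, ((wc (α * L) (Xs (α * L) (fun p : primesLe y => log p / L) k) : ℝ) : ℂ) * G k
          ∂(gpi (α * L) (fun p : primesLe y => log p / L)) =
        (c₀ : ℂ) * ∑ n ∈ Sxy x y, G (vecN y n) := by
  obtain ⟨A, hA⟩ := @exists_eq _ (α * L)
  have hA0 : 0 < A := by rw [hA]; positivity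
  obtain ⟨l, hld⟩ : ∃ l : primesLe y → ℝ, l = fun p : primesLe y => log p / L := ⟨_, rfl⟩
  have hl : ∀ p, 0 < l p := fun p => by
    rw [hld]; exact div_pos (log_pos_of_mem_primesLe p.2) hL
  have hX := Xs_eq hy hα hL h
  rw [← hA, ← hld] at hX ⊢
  have hXle : ∀ k, Xs A l k ≤ 0 ↔ ((∏ p : primesLe y, (p : ℕ) ^ k p : ℕ) : ℝ) ≤ x := by
    intro k
    have hpos : (0 : ℝ) < ((∏ p : primesLe y, (p : ℕ) ^ k p : ℕ) : ℝ) := by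
      rw [Nat.cast_pos]; exact prod_pos fun p _ => pow_pos ((mem_primesLe hy).1 p.2).1.pos _
    rw [hX, div_le_iff₀ hL, zero_mul, sub_nonpos, Real.log_le_log_iff hpos hx]
  refine ⟨(∏ p, (1 - qq A (l p))) * rexp (-(A * ∑ p, l p * qq A (l p) / (1 - qq A (l p)))),
    mul_pos (prod_pos fun p _ => sub_pos.2 (qq_lt_one hA0 (hl p))) (exp_pos _), fun G => ?_⟩
  have hsing : ∀ k, Xs A l k ≤ 0 → (gpi A l).real {k} * wc A (Xs A l k) =
      (∏ p, (1 - qq A (l p))) * rexp (-(A * ∑ p, l p * qq A (l p) / (1 - qq A (l p)))) := by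
    intro k hk; rw [wc, if_pos hk, Measure.real, gpi, Measure.pi_singleton, ENNReal.toReal_prod]
    have : ∀ p, ((geo A (l p)) {k p}).toReal = (1 - qq A (l p)) * qq A (l p) ^ k p :=
      fun p => geo_singleton hA0 (hl p) (k p)
    simp only [this]; rw [prod_mul_distrib, mul_assoc]; congr 1
    have h2 : ∏ p, qq A (l p) ^ k p = rexp (-(A * ∑ p, l p * k p)) := by
      rw [mul_sum, ← sum_neg_distrib, Real.exp_sum]; refine prod_congr rfl fun p _ => ?_
      rw [qq, ← Real.exp_nat_mul]; congr 1; ring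
    rw [h2, ← Real.exp_add]; congr 1; unfold Xs xk; rw [sum_sub_distrib]; ring
  obtain ⟨K, hK⟩ : ∃ K : Finset (primesLe y → ℕ), K = (Sxy x y).image (vecN y) := ⟨_, rfl⟩
  have hprodN : ∀ n ∈ Sxy x y, (∏ p : primesLe y, (p : ℕ) ^ vecN y n p) = n := fun n hn => by
    rw [prod_vecN hy hn (fun p k => p ^ k) (fun p => pow_zero p)]
    refine Nat.prod_factorization_pow_eq_self ?_
    have := (mem_Icc.1 (mem_filter.1 hn).1).1; omega
  have hzero : ∀ k, k ∉ (K : Set (primesLe y → ℕ)) → ((wc A (Xs A l k) : ℝ) : ℂ) * G k = 0 := by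
    intro k hk; rw [wc, if_neg, ofReal_zero, zero_mul]; intro h1; apply hk
    rw [hK, mem_coe, mem_image]; exact ⟨_, prod_mem_Sxy hy k ((hXle k).1 h1), vecN_prod hy k⟩
  have hio : IntegrableOn (fun k => ((wc A (Xs A l k) : ℝ) : ℂ) * G k) K (gpi A l) := by
    have := fun p => isProb_geo hA0 (hl p)
    have : IsProbabilityMeasure (gpi A l) := by unfold gpi; infer_instance
    exact IntegrableOn.finset
  rw [← setIntegral_eq_integral_of_forall_compl_eq_zero hzero, setIntegral_finset _ hio, hK,
    sum_image, mul_sum]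
  · refine sum_congr rfl fun n hn => ?_
    have h1 : Xs A l (vecN y n) ≤ 0 := by
      rw [hXle, hprodN n hn]; exact (Nat.le_floor_iff hx.le).1 (mem_Icc.1 (mem_filter.1 hn).1).2
    rw [← hsing _ h1, real_smul]; push_cast; ring
  · intro a ha b hb hab
    rw [← hprodN a ha, ← hprodN b hb, hab]

/-- The average of `(d/√n)^{ζ/L}` over the divisors of `n`. -/
def Tn (L : ℝ) (ζ : ℂ) (n : ℕ) : ℂ :=
  ((n.divisors.card : ℝ) : ℂ)⁻¹ * ∑ d ∈ n.divisors, cexp (ζ * (((log d - log n / 2) / L : ℝ) : ℂ))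

lemma sum_divisors_eq_prod (ξ : ℂ) {n : ℕ} (hn : n ≠ 0) :
    ∑ d ∈ n.divisors, cexp (ξ * ((log d - log n / 2 : ℝ) : ℂ)) =
      n.factorization.prod fun p k => ∑ j ∈ range (k + 1),
        cexp (ξ * ((log p * (j - k / 2) : ℝ) : ℂ)) := by
  induction n using Nat.recOnPosPrimePosCoprime with
  | zero => exact absurd rfl hn
  | one => simp
  | prime_pow p k hp hk =>
    rw [Nat.sum_divisors_prime_pow hp, hp.factorization_pow, Finsupp.prod_single_index (by simp)]
    refine sum_congr rfl fun j _ => ?_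
    congr 3; push_cast; rw [log_pow, log_pow]; ring
  | coprime a b ha hb hab iha ihb =>
    rw [Nat.factorization_mul_of_coprime hab, Finsupp.prod_add_index_of_disjoint
      (by simpa using hab.disjoint_primeFactors), ← iha (by omega), ← ihb (by omega),
      Nat.divisors_mul, mul_def, sum_image hab.mul_injOn_divisors, sum_mul_sum, sum_product]
    refine sum_congr rfl fun d hd => sum_congr rfl fun e he => ?_
    have h1 : (d : ℝ) ≠ 0 := Nat.cast_ne_zero.2 (Nat.pos_of_mem_divisors hd).ne'
    have h2 : (e : ℝ) ≠ 0 := Nat.cast_ne_zero.2 (Nat.pos_of_mem_divisors he).ne'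
    have h3 : (a : ℝ) ≠ 0 := Nat.cast_ne_zero.2 (by omega)
    have h4 : (b : ℝ) ≠ 0 := Nat.cast_ne_zero.2 (by omega)
    rw [← Complex.exp_add]; congr 1; push_cast; rw [Real.log_mul h1 h2, Real.log_mul h3 h4]
    push_cast; ring

lemma Tn_eq_prod (hy : 0 ≤ y) (ζ : ℂ) {n : ℕ} (hn : n ∈ Sxy x y) :
    Tn L ζ n = ∏ p : primesLe y, Tk (log p / L) ζ (vecN y n p) := by
  have hn0 : n ≠ 0 := by have := (mem_Icc.1 (mem_filter.1 hn).1).1; omega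
  rw [prod_vecN hy hn (fun p k => Tk (log p / L) ζ k) (fun p => by simp [Tk])]
  unfold Tn Tk
  have h1 := sum_divisors_eq_prod (ζ / L) hn0
  rw [Finsupp.prod_mul]; congr 1
  · rw [Nat.card_divisors hn0, Finsupp.prod, Nat.support_factorization, prod_inv_distrib]
    push_cast; rfl
  · have e1 : ∀ r : ℝ, ζ * ((r / L : ℝ) : ℂ) = ζ / L * (r : ℂ) := fun r => by push_cast; ring
    have e2 : ∀ a b : ℝ, a / L * b = a * b / L := fun a b => by ring
    simp only [e1, e2]; exact h1

lemma sum_rl2_eq (hα : 0 < α) (hL : 0 < L) :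
    ∑ p : primesLe y, rl2 (α * L) (log p / L) = (rhoXY y α / L) ^ 2 := by
  have key : ∀ p ∈ primesLe y, rl2 (α * L) (log p / L) =
      (1 / (4 * L ^ 2)) * (log p ^ 2 * (p : ℝ) ^ α / ((p : ℝ) ^ α - 1) ^ 2 -
        log p ^ 2 / ((p : ℝ) ^ α - 1) ^ 2 / 3) := by
    intro p hp
    have hp2 := two_le_of_mem_primesLe hp
    have hp1 : (1 : ℝ) < (p : ℕ) := mod_cast hp2
    have hp3 : 1 < (p : ℝ) ^ α := one_lt_rpow hp1 hα
    have : qq (α * L) (log p / L) = ((p : ℝ) ^ α)⁻¹ := by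
      rw [← rpow_neg (by linarith), rpow_neg_eq_exp (by linarith)]
      unfold qq; congr 2; field_simp
    unfold rl2; rw [this]
    have h5 : (p : ℝ) ^ α - 1 ≠ 0 := by linarith
    have h7 : 1 - ((p : ℝ) ^ α)⁻¹ = ((p : ℝ) ^ α - 1) / (p : ℝ) ^ α := by field_simp
    rw [h7]; field_simp
  have hsum : ∑ p : primesLe y, rl2 (α * L) (log p / L) =
      1 / (4 * L ^ 2) * (sigma2 y α - sigma2t y α / 3) := by
    rw [sum_coe_sort (primesLe y) (fun p : ℕ => rl2 (α * L) (log p / L)),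
      sum_congr rfl key, ← mul_sum, sum_sub_distrib, sigma2, sigma2t, sum_div]
  have hnn : 0 ≤ ∑ p : primesLe y, rl2 (α * L) (log p / L) := by
    refine sum_nonneg fun p _ => ?_
    have hq := qq_lt_one (by positivity : 0 < α * L) (div_pos (log_pos_of_mem_primesLe p.2) hL)
    have hq0 := qq_pos (α * L) (log p / L)
    unfold rl2
    have : 0 ≤ qq (α * L) (log p / L) - qq (α * L) (log p / L) ^ 2 / 3 := by nlinarith
    positivity
  have h0 : 0 ≤ sigma2 y α - sigma2t y α / 3 := by
    rw [hsum] at hnn; exact nonneg_of_mul_nonneg_right hnn (by positivity)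
  rw [hsum, rhoXY, div_pow, mul_pow, sq_sqrt h0]; ring

lemma integrable_phi (v : ℝ) :
    Integrable (fun z : ℝ => rexp (-z ^ 2 / 2) / √(2 * π)) (volume.restrict (Set.Ioi v)) := by
  have h := integrable_exp_neg_mul_sq (by norm_num : (0 : ℝ) < 1 / 2)
  refine Integrable.restrict ?_; refine (h.div_const (√(2 * π))).congr (.of_forall fun z => ?_)
  simp only; congr 2; ring

/-- Lower bound for the Gaussian tail. -/
lemma PhiGauss_ge {v : ℝ} (hv : 0 ≤ v) :
    rexp (-v ^ 2 / 2) / (1 + v) ≤ 15 * PhiGauss v := by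
  obtain ⟨h, hh⟩ := @exists_eq _ (1 / (1 + v))
  have hh0 : 0 < h := by rw [hh]; positivity
  have hh1 : h ≤ 1 := by rw [hh, div_le_one (by linarith)]; linarith
  have hvh : v * h ≤ 1 := by rw [hh, mul_one_div, div_le_one (by linarith)]; linarith
  have hsq : √(2 * π) ≤ 3 := by rw [Real.sqrt_le_left (by norm_num)]; nlinarith [Real.pi_lt_d2]
  have hsq0 : 0 < √(2 * π) := by positivity
  have he : rexp (3 / 2) ≤ 5 := by
    have h1 : rexp (3 / 2) ^ 2 = rexp 1 ^ 3 := by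
      rw [← Real.exp_nat_mul, ← Real.exp_nat_mul]; norm_num
    have h2 : rexp 1 ^ 3 ≤ 2.72 ^ 3 := by gcongr; linarith [exp_one_lt_d9]
    nlinarith [exp_pos (3 / 2)]
  have h1 : ∫ z in Set.Ioc v (v + h), (rexp (-v ^ 2 / 2) / 15 : ℝ) ≤
      ∫ z in Set.Ioc v (v + h), rexp (-z ^ 2 / 2) / √(2 * π) := by
    refine setIntegral_mono_on (integrableOn_const (by simp)) ?_ measurableSet_Ioc fun z hz => ?_
    · exact IntegrableOn.mono_set (integrable_phi v) fun z hz => hz.1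
    · have h2 : rexp (-v ^ 2 / 2) ≤ rexp (3 / 2) * rexp (-z ^ 2 / 2) := by
        rw [← Real.exp_add]; apply exp_le_exp.2
        have : z ^ 2 ≤ (v + h) ^ 2 := by
          have := hz.1; gcongr
          · linarith
          · exact hz.2
        nlinarith
      rw [div_le_div_iff₀ (by norm_num) hsq0]
      have h3 : 0 < rexp (-z ^ 2 / 2) := exp_pos _
      calc _ ≤ (5 * rexp (-z ^ 2 / 2)) * 3 := by
            refine mul_le_mul (h2.trans ?_) hsq hsq0.le (by positivity)
            gcongr
        _ = _ := by ring
  have h2 : ∫ z in Set.Ioc v (v + h), rexp (-z ^ 2 / 2) / √(2 * π) ≤ PhiGauss v :=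
    setIntegral_mono_set (integrable_phi v)
      (.of_forall fun z => by simp only [Pi.zero_apply]; positivity)
      (.of_forall fun z hz => hz.1)
  rw [setIntegral_const] at h1
  simp only [Real.volume_real_Ioc, add_sub_cancel_left, smul_eq_mul, max_eq_left hh0.le] at h1
  have h3 : rexp (-v ^ 2 / 2) / (1 + v) = 15 * (h * (rexp (-v ^ 2 / 2) / 15)) := by rw [hh]; ring
  rw [h3]; linarith

lemma gaussianReal_Ici (hσ : 0 < σ) (v : ℝ) :
    (gaussianReal 0 (toNNReal (σ ^ 2))).real (Set.Ici (v * σ)) = PhiGauss v := by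
  have h1 : gaussianReal 0 (toNNReal (σ ^ 2)) = (gaussianReal 0 1).map (σ * ·) := by
    rw [ProbabilityTheory.gaussianReal_map_const_mul]; congr 1
    · simp
    · rw [mul_one]; ext; simp [sq_nonneg]
  rw [h1, map_measureReal_apply (by fun_prop) measurableSet_Ici]
  have h2 : (fun x => σ * x) ⁻¹' Set.Ici (v * σ) = Set.Ici v := by
    ext z; simp only [Set.mem_preimage, Set.mem_Ici]; rw [mul_comm, mul_le_mul_iff_right₀ hσ]
  rw [h2, measureReal_def, ProbabilityTheory.gaussianReal_apply_eq_integral _ one_ne_zero,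
    ENNReal.toReal_ofReal, PhiGauss, integral_Ici_eq_integral_Ioi]
  · congr 1; funext z
    rw [gaussianPDFReal]; simp only [NNReal.coe_one, mul_one, sub_zero]; ring
  · exact integral_nonneg fun z => ProbabilityTheory.gaussianPDFReal_nonneg _ _ _

lemma integral_wc_tail (μ : Measure ℝ) (s a : ℝ) :
    ∫ z, ((wc s (a - z) : ℝ) : ℂ) * ((rexp (s * z) : ℝ) : ℂ) ∂μ =
      ((rexp (s * a) * μ.real (Set.Ici a) : ℝ) : ℂ) := by
  have h : ∀ z, ((wc s (a - z) : ℝ) : ℂ) * ((rexp (s * z) : ℝ) : ℂ) =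
      ((Set.indicator (Set.Ici a) (fun _ => rexp (s * a)) z : ℝ) : ℂ) := by
    intro z; rw [← ofReal_mul]; congr 1; unfold wc
    by_cases hz : a ≤ z
    · rw [if_pos (by linarith), Set.indicator_of_mem (Set.mem_Ici.2 hz), ← Real.exp_add]
      congr 1; ring
    · rw [if_neg (by linarith), Set.indicator_of_notMem (by simpa using hz), zero_mul]
  simp only [h]
  rw [integral_complex_ofReal, integral_indicator measurableSet_Ici, setIntegral_const, smul_eq_mul,
    mul_comm]

lemma integral_osc_laplace (μ : Measure ℝ) (s a t : ℝ) :
    ∫ z, osc t (a - z) * ((rexp (s * z) : ℝ) : ℂ) ∂μ =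
      osc t a * ∫ z, cexp (((s : ℂ) + ((-t : ℝ) : ℂ) * I) * (z : ℂ)) ∂μ := by
  rw [← integral_const_mul]; congr 1; funext z; unfold osc
  rw [ofReal_exp, ← Complex.exp_add, ← Complex.exp_add]; congr 1; push_cast; ring

/-- Comparison of tails through Laplace transforms on a vertical line. -/
lemma laplace_compare (μ ν : Measure ℝ) [IsProbabilityMeasure μ] [IsProbabilityMeasure ν]
    {s a M e₁ τ : ℝ} (hs : 0 < s) (hT : s ≤ T) (hb : 0 < b) (he₁ : 0 ≤ e₁)
    (hτ : 0 ≤ τ)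
    (hμ : Integrable (fun z : ℝ => ((rexp (s * z) : ℝ) : ℂ)) μ)
    (hν : Integrable (fun z : ℝ => ((rexp (s * z) : ℝ) : ℂ)) ν)
    (h1 : ∀ t : ℝ, rexp (-(|t| / T)) * ‖(∫ z, cexp (((s : ℂ) + (t : ℂ) * I) * (z : ℂ)) ∂μ) -
      ∫ z, cexp (((s : ℂ) + (t : ℂ) * I) * (z : ℂ)) ∂ν‖ ≤
        e₁ * rexp (-(b * t ^ 2)) + τ * rexp (-(|t| / (2 * T))))
    (h2 : ∀ t : ℝ, ‖∫ z, cexp (((s : ℂ) + (t : ℂ) * I) * (z : ℂ)) ∂ν‖ ≤ M * rexp (-(b * t ^ 2))) :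
    rexp (s * a) * |μ.real (Set.Ici a) - ν.real (Set.Ici a)| ≤
      41 / s * (e₁ * √(π / b) + τ * (4 * T)) + 80 / T * (M * √(π / b)) := by
  have hT0 : 0 < T := by linarith
  have hX : Measurable (fun z : ℝ => a - z) := by fun_prop
  have hwμ := wc_transfer μ hX hs hT hμ
  have hwν := wc_transfer ν hX hs hT hν
  have hk := integrable_ker hs hT0
  have iμ := integrable_mul_integral_osc μ hX hμ hk
  have iν := integrable_mul_integral_osc ν hX hν hk
  have hre : ∀ {ρ : Measure ℝ}, Integrable (fun z : ℝ => ((rexp (s * z) : ℝ) : ℂ)) ρ →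
      Integrable (fun z : ℝ => rexp (s * z)) ρ := fun h => by
    simpa only [RCLike.re_to_complex, ofReal_re] using h.re
  have oμ := wo_transfer μ hX hs hT (hre hμ)
  have oν := wo_transfer ν hX hs hT (hre hν)
  have hnorm : ∀ z, ‖((rexp (s * z) : ℝ) : ℂ)‖ = rexp (s * z) := fun z => by
    rw [norm_real, norm_eq_abs, abs_of_pos (exp_pos _)]
  simp only [integral_wc_tail, hnorm, integral_osc_laplace] at hwμ hwν iμ iν oμ oν
  obtain ⟨F, hF⟩ : ∃ F : ℝ → ℂ, F = fun t : ℝ =>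
    ∫ z, cexp (((s : ℂ) + (t : ℂ) * I) * (z : ℂ)) ∂μ := ⟨_, rfl⟩
  obtain ⟨G, hG⟩ : ∃ G : ℝ → ℂ, G = fun t : ℝ =>
    ∫ z, cexp (((s : ℂ) + (t : ℂ) * I) * (z : ℂ)) ∂ν := ⟨_, rfl⟩
  have hF' : ∀ t : ℝ, ∫ z, cexp (((s : ℂ) + ((-t : ℝ) : ℂ) * I) * (z : ℂ)) ∂μ = F (-t) :=
    fun t => by rw [hF]
  have hG' : ∀ t : ℝ, ∫ z, cexp (((s : ℂ) + ((-t : ℝ) : ℂ) * I) * (z : ℂ)) ∂ν = G (-t) :=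
    fun t => by rw [hG]
  have h1' : ∀ t, rexp (-(|t| / T)) * ‖F (-t) - G (-t)‖ ≤
      e₁ * rexp (-(b * t ^ 2)) + τ * rexp (-(|t| / (2 * T))) := fun t => by
    have := h1 (-t); rw [abs_neg, neg_sq] at this; rw [hF, hG]; exact this
  have h2' : ∀ t, ‖G (-t)‖ ≤ M * rexp (-(b * t ^ 2)) := fun t => by
    have := h2 (-t); rw [neg_sq] at this; rw [hG]; exact this
  simp only [hF', hG'] at hwμ hwν iμ iν oμ oν; clear h1 h2
  have hle1 : ∀ t : ℝ, rexp (-(|t| / T)) ≤ 1 := fun t => by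
    rw [exp_le_one_iff]; have : 0 ≤ |t| / T := by positivity
    linarith
  have main : ‖(1 / (2 * π) : ℂ) * (∫ t, ker s T t * (osc t a * F (-t))) -
      (1 / (2 * π) : ℂ) * ∫ t, ker s T t * (osc t a * G (-t))‖ ≤
      1 / s * (e₁ * √(π / b) + τ * (4 * T)) := by
    rw [← mul_sub, ← integral_sub iμ iν, norm_mul]
    have b1 : ‖∫ t, (ker s T t * (osc t a * F (-t)) - ker s T t * (osc t a * G (-t)))‖ ≤
        (2 / s * e₁) * √(π / b) + (2 / s * τ) * (4 * T) := by
      refine norm_integral_le_gauss_tail hb hT0 fun t => ?_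
      rw [← mul_sub, ← mul_sub, norm_mul, norm_mul, norm_osc, one_mul]
      calc _ ≤ 2 * rexp (-(|t| / T)) / s * ‖F (-t) - G (-t)‖ :=
            mul_le_mul_of_nonneg_right (norm_ker_le hs hT0 t) (norm_nonneg _)
        _ = 2 / s * (rexp (-(|t| / T)) * ‖F (-t) - G (-t)‖) := by ring
        _ ≤ 2 / s * (e₁ * rexp (-(b * t ^ 2)) + τ * rexp (-(|t| / (2 * T)))) :=
            mul_le_mul_of_nonneg_left (h1' t) (by positivity)
        _ = _ := by ring
    have b2 : ‖(1 / (2 * π) : ℂ)‖ ≤ 1 / 2 := by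
      rw [norm_div, norm_one, norm_mul, norm_real, norm_of_nonneg pi_pos.le]
      simp only [Complex.norm_ofNat]
      have := pi_gt_three
      gcongr; linarith
    calc _ ≤ 1 / 2 * ((2 / s * e₁) * √(π / b) + (2 / s * τ) * (4 * T)) :=
          mul_le_mul b2 b1 (norm_nonneg _) (by norm_num)
      _ = _ := by ring
  have bG : ∫ t, rexp (-(|t| / T)) * ‖osc t a * G (-t)‖ ≤ M * √(π / b) := by
    have := norm_integral_le_gauss_tail (g := fun t => rexp (-(|t| / T)) * ‖osc t a * G (-t)‖)
      (a := M) (τ := 0) hb hT0 (fun t => by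
        rw [norm_mul, norm_norm, norm_mul, norm_osc, one_mul, zero_mul, add_zero,
          norm_of_nonneg (exp_nonneg _)]
        calc _ ≤ 1 * (M * rexp (-(b * t ^ 2))) :=
              mul_le_mul (hle1 t) (h2' t) (norm_nonneg _) zero_le_one
          _ = _ := one_mul _)
    refine (le_norm_self _).trans (this.trans (le_of_eq (by ring)))
  have bF : ∫ t, rexp (-(|t| / T)) * ‖osc t a * F (-t)‖ ≤ (e₁ + M) * √(π / b) + τ * (4 * T) := by
    refine (le_norm_self _).trans (norm_integral_le_gauss_tail hb hT0 fun t => ?_)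
    rw [norm_mul, norm_norm, norm_mul, norm_osc, one_mul, norm_of_nonneg (exp_nonneg _)]
    have b3 : ‖F (-t)‖ ≤ ‖F (-t) - G (-t)‖ + ‖G (-t)‖ := by
      simpa using norm_add_le (F (-t) - G (-t)) (G (-t))
    calc _ ≤ rexp (-(|t| / T)) * (‖F (-t) - G (-t)‖ + ‖G (-t)‖) :=
          mul_le_mul_of_nonneg_left b3 (exp_nonneg _)
      _ = rexp (-(|t| / T)) * ‖F (-t) - G (-t)‖ + rexp (-(|t| / T)) * ‖G (-t)‖ := by ring
      _ ≤ (e₁ * rexp (-(b * t ^ 2)) + τ * rexp (-(|t| / (2 * T)))) +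
          1 * (M * rexp (-(b * t ^ 2))) :=
          add_le_add (h1' t) (mul_le_mul (hle1 t) (h2' t) (norm_nonneg _) zero_le_one)
      _ = _ := by ring
  have hlhs : rexp (s * a) * |μ.real (Set.Ici a) - ν.real (Set.Ici a)| =
      ‖((rexp (s * a) * μ.real (Set.Ici a) : ℝ) : ℂ) -
        ((rexp (s * a) * ν.real (Set.Ici a) : ℝ) : ℂ)‖ := by
    rw [← ofReal_sub, norm_real, ← mul_sub, norm_eq_abs, abs_mul, abs_of_pos (exp_pos _)]
  obtain ⟨P, hP⟩ := @exists_eq _ (e₁ * √(π / b) + τ * (4 * T))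
  obtain ⟨Q, hQ⟩ := @exists_eq _ (M * √(π / b))
  have hP0 : 0 ≤ P := by rw [hP]; positivity
  rw [← hP] at main
  have bF' : ∫ t, rexp (-(|t| / T)) * ‖osc t a * F (-t)‖ ≤ P + Q := by rw [hP, hQ]; linarith
  rw [← hQ] at bG; rw [hlhs, ← hP, ← hQ]
  have hTs : 1 / T * P ≤ 1 / s * P := by gcongr
  have oμ' := oμ.trans (mul_le_mul_of_nonneg_left bF' (by positivity))
  have oν' := oν.trans (mul_le_mul_of_nonneg_left bG (by positivity))
  have tri : ∀ u v w z : ℂ, ‖u - v‖ ≤ ‖u - w‖ + ‖w - z‖ + ‖v - z‖ := fun u v w z => by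
    have e : u - v = (u - w) + (w - z) - (v - z) := by ring
    rw [e]; exact (norm_sub_le _ _).trans (add_le_add_left (norm_add_le _ _) _)
  refine (tri _ _ _ _).trans ((add_le_add (add_le_add hwμ main) hwν).trans ?_)
  have e41 : 41 / s * P = 41 * (1 / s * P) := by ring
  have e80 : 80 / T * Q = 80 * (1 / T * Q) := by ring
  have e3 : 1 / T * (P + Q) = 1 / T * P + 1 / T * Q := by ring
  rw [e41, e80]; rw [e3] at oμ'; linarith

/-! ### The Laplace transform of the divisor distribution -/

section Laplace

variable {ι : Type} [Fintype ι] {A : ℝ} {l : ι → ℝ}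

/-- The total mass of the weight. -/
def Jw (A : ℝ) (l : ι → ℝ) : ℝ := ∫ k, wc A (Xs A l k) ∂(gpi A l)

/-- The unnormalised Laplace transform of the divisor distribution. -/
def Rw (A : ℝ) (l : ι → ℝ) (ζ : ℂ) : ℂ :=
  ∫ k, ((wc A (Xs A l k) : ℝ) : ℂ) * ∏ p, Tk (l p) ζ (k p) ∂(gpi A l)

lemma norm_wc_mul_le (hA : 1 ≤ A) (x : ℝ) (z : ℂ) : ‖((wc A x : ℝ) : ℂ) * z‖ ≤ ‖z‖ := by
  rw [norm_mul, norm_real, norm_eq_abs, abs_of_nonneg (wc_nonneg _ _)]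
  exact mul_le_of_le_one_left (norm_nonneg _) (wc_le_one (by linarith) _)

lemma norm_Rw_le (hA : 1 ≤ A) (hl : ∀ p, 0 < l p ∧ l p ≤ 1) {s : ℝ} (hs : 0 ≤ s) (hs1 : s ≤ 1 / 8)
    (t : ℝ) : ‖Rw A l (s + t * I)‖ ≤ ∏ p, ∫ k, ‖Tk (l p) (s + t * I) k‖ ∂(geo A (l p)) := by
  have hi : Integrable (fun k : ι → ℕ => ∏ p, ‖Tk (l p) (s + t * I) (k p)‖) (gpi A l) :=
    Integrable.fintype_prod_dep fun p => (Tk_integrable hA (hl p).1 (hl p).2 hs hs1 t).norm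
  have he : ∫ k, ∏ p, ‖Tk (l p) (s + t * I) (k p)‖ ∂(gpi A l) =
      ∏ p, ∫ k, ‖Tk (l p) (s + t * I) k‖ ∂(geo A (l p)) :=
    integral_fintype_prod_eq_prod (fun p k => ‖Tk (l p) (s + t * I) k‖)
  rw [← he]; refine norm_integral_le_of_norm_le hi (.of_forall fun k => ?_)
  refine (norm_wc_mul_le hA _ _).trans ?_; rw [norm_prod]

lemma norm_Tk_le_real (l s t : ℝ) (k : ℕ) :
    ∃ r : ℝ, Tk l s k = (r : ℂ) ∧ ‖Tk l (s + t * I) k‖ ≤ r := by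
  refine ⟨((k : ℝ) + 1)⁻¹ * ∑ j ∈ range (k + 1), rexp (s * (l * (j - k / 2))), ?_, ?_⟩
  · unfold Tk
    push_cast
    rfl
  · have hk : ‖((k : ℂ) + 1)⁻¹‖ = ((k : ℝ) + 1)⁻¹ := by
      rw [norm_inv, ← Nat.cast_succ, Complex.norm_natCast, Nat.cast_succ]
    rw [Tk, norm_mul, hk]
    refine mul_le_mul_of_nonneg_left ((norm_sum_le _ _).trans_eq ?_) (by positivity)
    refine sum_congr rfl fun j _ => ?_
    rw [norm_exp, re_mul_ofReal]; simp

lemma norm_Rw_le_real (hA : 1 ≤ A) (hl : ∀ p, 0 < l p ∧ l p ≤ 1) {s : ℝ} (hs : 0 ≤ s)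
    (hs1 : s ≤ 1 / 8) (t : ℝ) : ‖Rw A l (s + t * I)‖ ≤ ‖Rw A l s‖ := by
  choose r hr hr' using fun p => fun k => norm_Tk_le_real (l p) s t k
  have hi : Integrable (fun k : ι → ℕ => ((wc A (Xs A l k) : ℝ) : ℂ) *
      ∏ p, Tk (l p) s (k p)) (gpi A l) := by
    refine integrable_wc_mul _ measurable_Xs (by linarith) (integrable_gpi_prod fun p => ?_)
    have := Tk_integrable hA (hl p).1 (hl p).2 hs hs1 0
    simpa using this
  have hf : (fun k : ι → ℕ => ((wc A (Xs A l k) : ℝ) : ℂ) * ∏ p, Tk (l p) s (k p)) =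
      fun k => ((wc A (Xs A l k) * ∏ p, r p (k p) : ℝ) : ℂ) := by
    funext k; push_cast; exact congrArg _ (prod_congr rfl fun p _ => hr p _)
  rw [hf] at hi
  have hi' : Integrable (fun k : ι → ℕ => wc A (Xs A l k) * ∏ p, r p (k p)) (gpi A l) := by
    simpa only [RCLike.re_to_complex, ofReal_re] using hi.re
  have hR : Rw A l s = ((∫ k, wc A (Xs A l k) * ∏ p, r p (k p) ∂(gpi A l) : ℝ) : ℂ) := by
    rw [Rw, hf, integral_complex_ofReal]
  rw [hR, norm_real, norm_eq_abs]
  refine (norm_integral_le_of_norm_le hi' (.of_forall fun k => ?_)).trans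
    (le_abs_self _)
  rw [norm_mul, norm_real, norm_eq_abs, abs_of_nonneg (wc_nonneg _ _), norm_prod]
  refine mul_le_mul_of_nonneg_left ?_ (wc_nonneg _ _)
  exact Finset.prod_le_prod (fun p _ => norm_nonneg _) fun p _ => hr' p _

lemma norm_Tk_abs (l t : ℝ) (k : ℕ) : ‖Tk l (((|t| : ℝ) : ℂ) * I) k‖ = ‖Tk l (t * I) k‖ := by
  rcases abs_choice t with h | h
  · rw [h]
  · rw [h, ← RCLike.norm_conj (Tk l (t * I) k)]
    congr 1
    simp only [Tk, map_mul, map_sum, map_inv₀, map_add, map_one, conj_natCast,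
      ← exp_conj, conj_ofReal, conj_I]
    push_cast; simp only [mul_neg, neg_mul]

end Laplace

lemma rl2_bounds (hA : 0 < A) (hl : 0 < l) :
    mm A l / 6 ≤ rl2 A l ∧ rl2 A l ≤ mm A l / 4 := by
  have h0 := qq_pos A l
  have h1 := qq_lt_one hA hl
  have e1 : mm A l = l ^ 2 / (1 - qq A l) ^ 2 * qq A l := by unfold mm; ring
  have e2 : rl2 A l = l ^ 2 / (1 - qq A l) ^ 2 * ((qq A l - qq A l ^ 2 / 3) / 4) := by
    unfold rl2; field_simp
  have h3 : 0 ≤ l ^ 2 / (1 - qq A l) ^ 2 := by positivity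
  rw [e1, e2, mul_div_assoc, mul_div_assoc]
  constructor <;> refine mul_le_mul_of_nonneg_left ?_ h3 <;> nlinarith

lemma SysHyp.sum_rl2 {s : Finset ℕ} {l : ℕ → ℝ} (h : SysHyp s l A N Y c κ) :
    c * N / 6 ≤ ∑ p : s, rl2 A (l p) ∧ ∑ p : s, rl2 A (l p) ≤ N / 2 := by
  have hb := fun p : s => rl2_bounds (A := A) (by linarith [h.hA]) (h.hl' p).1
  have h1 := sum_le_sum fun (p : s) (_ : p ∈ univ) => (hb p).1
  have h2 := sum_le_sum fun (p : s) (_ : p ∈ univ) => (hb p).2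
  rw [← sum_div] at h1 h2
  have := h.sum_mm
  constructor <;> linarith

/-- The Laplace transform near the real axis. -/
lemma SysHyp.Rw_near {κ₁ : ℝ} (hc : 0 < c) (hc1 : c ≤ 1) (hκ₁ : 0 ≤ κ₁) (hκ : κ₁ ≤ κ)
    (hκ1 : κ < 1) :
    ∃ C N₀ c₁ : ℝ, 0 < C ∧ 0 < c₁ ∧ ∀ (s : Finset ℕ) (l : ℕ → ℝ) (A N Y : ℝ),
      SysHyp s l A N Y c κ₁ → N₀ ≤ N → c₁ / (A * √N) ≤ Jw A l⇂s ∧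
      ∀ ζ : ℂ, ‖ζ‖ ≤ 1 / 100 → N * ‖ζ‖ ^ 2 ≤ N ^ κ → ‖Rw A l⇂s ζ -
          cexp (ζ ^ 2 / 2 * ((∑ p : s, rl2 A (l p) : ℝ) : ℂ)) * (Jw A l⇂s : ℂ)‖ ≤
        C * ‖cexp (ζ ^ 2 / 2 * ((∑ p : s, rl2 A (l p) : ℝ) : ℂ))‖ *
          ((1 / N + N * ‖ζ‖ ^ 4) * rexp (C * (N * ‖ζ‖ ^ 4))) * Jw A l⇂s := by
  obtain ⟨C, C', N₀, c₁, hC, hC', hc₁, H⟩ := SysHyp.twist hc hc1 hκ₁ hκ hκ1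
  refine ⟨C + C' + 60000, max N₀ 1, c₁, by positivity, hc₁, fun s l A N Y h hN => ?_⟩
  obtain ⟨hJ, H⟩ := H s l A N Y h ((le_max_left _ _).trans hN)
  have hN1 : 1 ≤ N := (le_max_right _ _).trans hN
  refine ⟨hJ, fun ζ hζ hNζ => ?_⟩
  have hJ0 : 0 ≤ Jw A l⇂s := integral_nonneg fun k => wc_nonneg _ _
  have H2 := H (‖ζ‖ ^ 2) (fun p => Tk (l p) ζ) (by positivity) hNζ fun p =>
    Tk_LF (h.hl' p).1 (hζ.trans (by norm_num))
  have hm : ∃ e : ℂ, ∏ p : s, ∫ j, Tk (l p) ζ j ∂(geo A (l p)) =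
      (∏ p : s, (1 : ℂ)) * cexp ((∑ p : s, ζ ^ 2 / 2 * (rl2 A (l p) : ℂ)) + e) ∧
      ‖e‖ ≤ 30000 * ‖ζ‖ ^ 4 * ∑ p : s, mm A (l p) :=
    prod_exp_form fun p => by simpa using Tk_mean_exp h.hA (h.hl' p).1 (h.hl' p).2 hζ
  obtain ⟨e, he, he'⟩ := hm
  have hsum : (∑ p : s, ζ ^ 2 / 2 * (rl2 A (l p) : ℂ)) =
      ζ ^ 2 / 2 * ((∑ p : s, rl2 A (l p) : ℝ) : ℂ) := by
    push_cast; rw [mul_sum]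
  rw [prod_const_one, one_mul, hsum, Complex.exp_add] at he; rw [he] at H2
  change ‖Rw A l⇂s ζ - _ * (Jw A l⇂s : ℂ)‖ ≤
    _ * Jw A l⇂s at H2
  obtain ⟨G, hG⟩ := @exists_eq _ (cexp (ζ ^ 2 / 2 * ((∑ p : s, rl2 A (l p) : ℝ) : ℂ)))
  obtain ⟨J, hJJ⟩ := @exists_eq _ (Jw A l⇂s)
  obtain ⟨w, hw⟩ := @exists_eq _ (N * ‖ζ‖ ^ 4)
  have hw' : N * (‖ζ‖ ^ 2) ^ 2 = w := by rw [hw]; ring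
  rw [← hG, ← hJJ, hw'] at H2; rw [← hG, ← hJJ, ← hw]; rw [← hJJ] at hJ0
  have hw0 : 0 ≤ w := by rw [hw]; positivity
  have hew : ‖e‖ ≤ 60000 * w := by
    refine he'.trans ?_; rw [hw]
    nlinarith [mul_le_mul_of_nonneg_left h.sum_mm.2 (by positivity : 0 ≤ 30000 * ‖ζ‖ ^ 4)]
  have h1 : ‖cexp e‖ ≤ rexp (60000 * w) :=
    (norm_exp_le_exp_norm e).trans (exp_le_exp.2 hew)
  have h2 : ‖cexp e - 1‖ ≤ 60000 * w * rexp (60000 * w) :=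
    (norm_exp_sub_one_le_mul e).trans (by gcongr)
  have hN0 : 0 ≤ 1 / N := by positivity
  have e3 : Rw A l⇂s ζ - G * (J : ℂ) =
      (Rw A l⇂s ζ - G * cexp e * (J : ℂ)) + G * (cexp e - 1) * (J : ℂ) := by ring
  have e4 : ‖G * (cexp e - 1) * (J : ℂ)‖ = ‖G‖ * ‖cexp e - 1‖ * J := by
    rw [norm_mul, norm_mul, norm_real, norm_eq_abs, abs_of_nonneg hJ0]
  have e5 : ‖G * cexp e‖ = ‖G‖ * ‖cexp e‖ := norm_mul _ _
  have hE1 : rexp (60000 * w) * rexp (C' * w) ≤ rexp ((C + C' + 60000) * w) := by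
    rw [← Real.exp_add]; exact exp_le_exp.2 (by nlinarith [mul_nonneg hC.le hw0])
  have hE2 : rexp (60000 * w) ≤ rexp ((C + C' + 60000) * w) :=
    exp_le_exp.2 (by nlinarith [mul_nonneg hC.le hw0, mul_nonneg hC'.le hw0])
  obtain ⟨E, hE⟩ := @exists_eq _ (rexp ((C + C' + 60000) * w))
  rw [← hE] at hE1 hE2 ⊢
  have hE0 : 0 ≤ E := hE ▸ (exp_pos _).le
  calc _ ≤ C * (‖G‖ * ‖cexp e‖) * ((1 / N + w) * rexp (C' * w)) * J + ‖G‖ * ‖cexp e - 1‖ * J := by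
        rw [e3]; refine (norm_add_le _ _).trans (add_le_add ?_ e4.le); rw [← e5]; exact H2
    _ ≤ C * (‖G‖ * rexp (60000 * w)) * ((1 / N + w) * rexp (C' * w)) * J +
        ‖G‖ * (60000 * w * rexp (60000 * w)) * J := by gcongr
    _ = C * ‖G‖ * (1 / N + w) * J * (rexp (60000 * w) * rexp (C' * w)) +
        60000 * ‖G‖ * w * J * rexp (60000 * w) := by ring
    _ ≤ C * ‖G‖ * (1 / N + w) * J * E + 60000 * ‖G‖ * w * J * E := by gcongr
    _ ≤ (C + C' + 60000) * ‖G‖ * ((1 / N + w) * E) * J := by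
        have h5 : 0 ≤ ‖G‖ * J * E := by positivity
        nlinarith [mul_nonneg (mul_nonneg hC'.le (add_nonneg hN0 hw0)) h5, mul_nonneg hN0 h5]

/-- Decay of the Laplace transform at moderate height. -/
lemma SysHyp.norm_Rw_le_small {s : Finset ℕ} {l : ℕ → ℝ} (h : SysHyp s l A N Y c κ)
    (hc : 0 < c) (hN : 0 < N) (hr : 0 ≤ r) (hr1 : r ≤ 1 / 1000)
    (ht : t ^ 2 ≤ c / 10 ^ 7) (hc1 : c ≤ 1) :
    ‖Rw A l⇂s (r + t * I)‖ ≤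
      rexp (r ^ 2 * (∑ p : s, rl2 A (l p)) / 2 + 80000 * (N * r ^ 4) - c / 24 * (N * t ^ 2)) := by
  have hns : ‖(r : ℂ) + t * I‖ ^ 2 = r ^ 2 + t ^ 2 := by rw [← normSq_eq_norm_sq, normSq_add_mul_I]
  have hn8 : ‖(r : ℂ) + t * I‖ ≤ 1 / 8 := by
    refine abs_le_of_sq_le_sq' ?_ (by norm_num) |>.2
    rw [hns]; nlinarith
  have hre : (((r : ℂ) + t * I) ^ 2).re = r ^ 2 - t ^ 2 := by simp [sq]
  have hp := prod_le_exp_of_gap (a := fun p : s => ∫ k, ‖Tk (l p) (r + t * I) k‖ ∂(geo A (l p)))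
    (g := fun p : s => -((r ^ 2 - t ^ 2) / 2 * rl2 A (l p))) (m := fun p : s => mm A (l p))
    (B := 20000 * ‖(r : ℂ) + t * I‖ ^ 4) (fun p => integral_nonneg fun _ => norm_nonneg _) fun p => by
      have := Tk_mean_norm h.hA (h.hl' p).1 (h.hl' p).2 hn8
      rw [hre] at this; linarith
  refine (norm_Rw_le h.hA h.hl' hr (by linarith) t).trans (hp.trans (exp_le_exp.2 ?_))
  rw [sum_neg_distrib, ← mul_sum]; obtain ⟨h1, h2⟩ := h.sum_rl2
  have h3 := h.sum_mm.2
  have e4 : ‖(r : ℂ) + t * I‖ ^ 4 = (r ^ 2 + t ^ 2) ^ 2 := by rw [← hns]; ring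
  rw [e4]
  have h4 : (r ^ 2 + t ^ 2) ^ 2 ≤ 2 * r ^ 4 + 2 * (c / 10 ^ 7) * t ^ 2 := by
    nlinarith [sq_nonneg (r ^ 2 - t ^ 2), mul_le_mul_of_nonneg_right ht (sq_nonneg t)]
  have h5 : 20000 * (r ^ 2 + t ^ 2) ^ 2 * ∑ p : s, mm A (l p) ≤
      20000 * (2 * r ^ 4 + 2 * (c / 10 ^ 7) * t ^ 2) * (2 * N) :=
    mul_le_mul (by linarith) h3 (le_trans (by positivity) h.sum_mm.1) (by positivity)
  have h6 := mul_le_mul_of_nonneg_left h1 (sq_nonneg t)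
  have h7 : 0 ≤ c * (N * t ^ 2) := by positivity
  nlinarith

lemma SysHyp.norm_Rw_le_gap {s : Finset ℕ} {l : ℕ → ℝ} (h : SysHyp s l A N Y c κ)
    (hc : 0 < c) (hc1 : c ≤ 1) (hN : 3 ≤ N) (hη : 0 < η) (hη1 : η ≤ 1) (ht : η < |t|)
    (htY : |t| ≤ Y) (hr : 0 ≤ r) (hr1 : r ≤ 1 / 8) :
    ‖Rw A l⇂s (r + t * I)‖ ≤
      rexp (28 * r * N - c * η ^ 2 / 3 * rexp (-(8 / η + 1)) * (N / log N ^ 2)) := by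
  have hlog : 1 ≤ log N := by
    rw [le_log_iff_exp_le (by linarith)]
    linarith [exp_one_lt_d9]
  obtain ⟨E, hE⟩ := @exists_eq _ (rexp (-(8 / η + 1)))
  have hE0 : 0 < E := hE ▸ exp_pos _
  have hE1 : E ≤ 1 := hE ▸ exp_le_one_iff.2 (by
    have : 0 < 8 / η := by positivity
    linarith)
  have hg : ∃ g : s → ℝ, (∀ p : s, ∫ k, ‖Tk (l p) (t * I) k‖ ∂(geo A (l p)) ≤ 1 - g p) ∧
      c * η ^ 2 / 3 * E * (N / log N ^ 2) ≤ ∑ p, g p := by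
    simp_rw [← norm_Tk_abs _ t]
    rcases h.hdich |t| (hη.trans ht) htY with h1 | ⟨hA1, h2, h3⟩
    · refine ⟨_, fun p => Tk_I_gap h.hA (h.hl p p.2).1 |t|, ?_⟩
      rw [← mul_sum, sum_coe_sort s (fun p => qq A (l p) * sin (|t| * l p / 2) ^ 2)]
      have hm : η ^ 2 ≤ min 1 (|t| ^ 2) := le_min (by nlinarith) (by gcongr)
      have h4 : c * η ^ 2 * (N / log N ^ 2) ≤ c * min 1 (|t| ^ 2) * (N / log N ^ 2) := by gcongr
      have h0 : 0 ≤ c * η ^ 2 * (N / log N ^ 2) := by positivity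
      nlinarith [mul_le_mul_of_nonneg_right hE1 h0]
    · subst hA1
      refine ⟨fun _ => 1 / 2 * E, fun p => hE ▸ Tk_I_gap' (h.hl p p.2).1 (h.hl p p.2).2 hη ht.le
        (h2 p p.2), ?_⟩
      simp only [sum_const, card_univ, Fintype.card_coe, nsmul_eq_mul]
      have hle : N / log N ^ 2 ≤ N := div_le_self (by linarith) (by nlinarith)
      have hη2 : η ^ 2 ≤ 1 := by nlinarith
      calc _ ≤ 1 * 1 / 2 * E * N := by gcongr; norm_num
        _ ≤ 1 * 1 / 2 * E * s.card := by gcongr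
        _ = _ := by ring
  obtain ⟨g, hg, hg'⟩ := hg
  have hp := prod_le_exp_of_gap (a := fun p : s => ∫ k, ‖Tk (l p) (r + t * I) k‖ ∂(geo A (l p)))
    (g := g) (m := fun p : s => l p * qq A (l p) / (1 - qq A (l p)))
    (B := 28 * r) (fun p => integral_nonneg fun _ => norm_nonneg _) fun p => by
      linarith [integral_norm_Tk_le h.hA (h.hl' p).1 (h.hl' p).2 hr hr1 t, hg p]
  refine (norm_Rw_le h.hA h.hl' hr hr1 t).trans (hp.trans (exp_le_exp.2 ?_))
  rw [sum_coe_sort s (fun p => l p * qq A (l p) / (1 - qq A (l p))), ← hE]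
  have := mul_le_mul_of_nonneg_left h.hmean (by positivity : 0 ≤ 28 * r)
  linarith

lemma eventually_saving_rpow {D κ₁ : ℝ} (hc : 0 < c) (hκ₁ : 0 ≤ κ₁) (hκ : κ₁ < κ) :
    ∀ᶠ N : ℝ in atTop, D * N ^ κ₁ + D * log N + D ≤ c * N ^ κ := by
  filter_upwards [eventually_const_le_rpow (3 * |D| / c) (κ - κ₁) (by linarith),
    eventually_const_le_rpow (3 * |D| / c) κ (by linarith),
    eventually_log_le_rpow (c / (3 * (|D| + 1))) κ (by positivity) (by linarith),
    eventually_ge_atTop 1] with N h1 h2 h3 h4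
  have hN : 0 < N := by linarith
  have hp : 0 < N ^ κ₁ := by positivity
  have e : N ^ κ = N ^ (κ - κ₁) * N ^ κ₁ := by rw [← rpow_add hN]; congr 1; ring
  rw [div_le_iff₀ hc] at h1 h2
  have h5 : (3 * (|D| + 1)) * log N ≤ c * N ^ κ := by
    rw [div_mul_eq_mul_div, le_div_iff₀ (by positivity)] at h3
    linarith
  have h6 := mul_le_mul_of_nonneg_right h1 hp.le
  have hl := log_nonneg h4
  have a1 := mul_le_mul_of_nonneg_right (le_abs_self D) hp.le
  have a2 := mul_le_mul_of_nonneg_right (le_abs_self D) hl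
  have a3 := le_abs_self D
  rw [e] at h2 h5 ⊢; nlinarith

lemma exp_sub_le_inv_sq {a : ℝ} (hN : 0 < N) (h : a + 2 * log N ≤ b) :
    rexp (a - b) ≤ 1 / N ^ 2 := by
  have e : 1 / N ^ 2 = rexp (-(2 * log N)) := by
    rw [Real.exp_neg, two_mul, Real.exp_add, Real.exp_log hN, one_div, sq]
  rw [e]; exact exp_le_exp.2 (by linarith)

lemma near_bound {C B v : ℝ} (hc : 0 < c) (hC : 0 < C) (hN : 0 < N)
    (hσ : c * N / 6 ≤ σ ^ 2) (hrσ : r * σ = 1 + v) (hv : 0 ≤ v)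
    (hB : (1 + v) ^ 4 ≤ B * N) (ht : t ^ 2 ≤ c / (96 * C)) :
    C * ((1 / N + N * (r ^ 2 + t ^ 2) ^ 2) * rexp (C * (N * (r ^ 2 + t ^ 2) ^ 2))) *
        rexp (-(σ ^ 2 * t ^ 2 / 2)) ≤
      256 * C * (1 + 2 * (36 / c ^ 2)) * rexp (2 * C * (36 / c ^ 2) * B) * ((1 + v ^ 4) / N) *
        rexp (-(σ ^ 2 / 8 * t ^ 2)) := by
  obtain ⟨P, hP⟩ := @exists_eq _ (36 / c ^ 2)
  obtain ⟨U, hU⟩ := @exists_eq _ (σ ^ 2 * t ^ 2)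
  have hP0 : 0 < P := by rw [hP]; positivity
  have hU0 : 0 ≤ U := by rw [hU]; positivity
  have hσ4 : N ^ 2 ≤ P * σ ^ 4 := by
    have h1 : (c * N / 6) ^ 2 ≤ (σ ^ 2) ^ 2 := by gcongr
    rw [hP, div_mul_eq_mul_div, le_div_iff₀ (by positivity)]
    nlinarith
  have h1 : N * r ^ 4 ≤ P * (1 + v) ^ 4 / N := by
    rw [le_div_iff₀ hN, ← hrσ]
    nlinarith [mul_le_mul_of_nonneg_right hσ4 (by positivity : 0 ≤ r ^ 4)]
  have h2 : N * t ^ 4 ≤ P * U ^ 2 / N := by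
    rw [le_div_iff₀ hN, hU]; nlinarith [mul_le_mul_of_nonneg_right hσ4 (by positivity : 0 ≤ t ^ 4)]
  have h3 : 2 * C * (N * t ^ 4) ≤ U / 8 := by
    have h4 := mul_le_mul_of_nonneg_right hσ (sq_nonneg t)
    rw [← hU] at h4
    have h5 : t ^ 2 * (96 * C) ≤ c := by rwa [le_div_iff₀ (by positivity)] at ht
    have h6 := mul_le_mul_of_nonneg_right h5 (by positivity : 0 ≤ N * t ^ 2)
    nlinarith
  have h4 : P * (1 + v) ^ 4 / N ≤ P * B := by rw [div_le_iff₀ hN]; nlinarith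
  obtain ⟨w, hw⟩ := @exists_eq _ (N * (r ^ 2 + t ^ 2) ^ 2)
  have hw2 : w ≤ 2 * (N * r ^ 4) + 2 * (N * t ^ 4) := by
    rw [hw]; nlinarith [mul_nonneg hN.le (sq_nonneg (r ^ 2 - t ^ 2))]
  have h5 : 1 / N + w ≤ (1 + 2 * P) * (8 * (1 + v ^ 4)) * (1 + U ^ 2) / N := by
    have hv4 : (1 + v) ^ 4 ≤ 8 * (1 + v ^ 4) := by
      nlinarith [sq_nonneg (v - 1), sq_nonneg (v ^ 2 - 1), sq_nonneg (v ^ 2 - v)]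
    have hv1 : 1 ≤ (1 + v) ^ 4 := one_le_pow₀ (by linarith)
    calc _ ≤ 1 / N + (2 * (P * (1 + v) ^ 4 / N) + 2 * (P * U ^ 2 / N)) := by linarith
      _ = (1 + 2 * P * (1 + v) ^ 4 + 2 * P * U ^ 2) / N := by ring
      _ ≤ (1 + 2 * P) * (1 + v) ^ 4 * (1 + U ^ 2) / N := by
          gcongr
          nlinarith [mul_nonneg (mul_nonneg hP0.le (sq_nonneg U)) (sub_nonneg.2 hv1),
            mul_nonneg (sq_nonneg U) (zero_le_one.trans hv1)]
      _ ≤ _ := by gcongr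
  have h6 : rexp (C * w) ≤ rexp (2 * C * P * B) * rexp (U / 8) := by
    rw [← Real.exp_add]; apply exp_le_exp.2
    nlinarith [mul_le_mul_of_nonneg_left hw2 hC.le, mul_le_mul_of_nonneg_left (h1.trans h4) hC.le]
  have h7 : 1 + U ^ 2 ≤ 32 * rexp (U / 4) := by
    have := Real.quadratic_le_exp_of_nonneg (by positivity : 0 ≤ U / 4)
    nlinarith
  have e1 : rexp (U / 4) * rexp (U / 8) * rexp (-(U / 2)) = rexp (-(U / 8)) := by
    rw [← Real.exp_add, ← Real.exp_add]; congr 1; ring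
  have e2 : σ ^ 2 / 8 * t ^ 2 = U / 8 := by rw [hU]; ring
  rw [← hw, ← hU, ← hP, e2, ← e1]
  calc _ ≤ C * (((1 + 2 * P) * (8 * (1 + v ^ 4)) * (32 * rexp (U / 4)) / N) *
        (rexp (2 * C * P * B) * rexp (U / 8))) * rexp (-(U / 2)) := by
        gcongr; refine h5.trans ?_; gcongr
    _ = _ := by ring

lemma norm_gauss_transform (σ r t : ℝ) :
    ‖cexp (((r : ℂ) + t * I) ^ 2 / 2 * ((σ ^ 2 : ℝ) : ℂ))‖ =
      rexp ((r * σ) ^ 2 / 2) * rexp (-(σ ^ 2 * t ^ 2 / 2)) := by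
  rw [norm_exp, re_mul_ofReal, ← Real.exp_add]; congr 1
  rw [show ((r : ℂ) + t * I) ^ 2 / 2 = (((r ^ 2 - t ^ 2) / 2 : ℝ) : ℂ) + ((r * t : ℝ) : ℂ) * I by
    push_cast; linear_combination (t : ℂ) ^ 2 / 2 * I_sq]
  simp only [add_re, ofReal_re, re_ofReal_mul, I_re, mul_zero, add_zero]; ring

lemma norm_add_mul_I_sq (r t : ℝ) : ‖(r : ℂ) + t * I‖ ^ 2 = r ^ 2 + t ^ 2 := by
  rw [← normSq_eq_norm_sq, normSq_add_mul_I]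

set_option maxHeartbeats 4000000 in
/-- The Laplace transform of the divisor distribution is close to that of a Gaussian. -/
theorem SysHyp.laplace {κ₁ K : ℝ} (hc : 0 < c) (hc1 : c ≤ 1) (hκ₁ : 0 ≤ κ₁) (hκ₁1 : κ₁ < 1)
    (hK : 0 < K) :
    ∃ C N₀ : ℝ, 0 < C ∧ ∀ (s : Finset ℕ) (l : ℕ → ℝ) (A N Y : ℝ), SysHyp s l A N Y c κ₁ → N₀ ≤ N →
      0 < Jw A l⇂s ∧
      ∀ v σ r t : ℝ, 0 ≤ v → v ≤ K * N ^ (1 / 4 : ℝ) → 0 < σ → σ ^ 2 = ∑ p : s, rl2 A (l p) →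
      r * σ = 1 + v → rexp (-(|t| / (N / σ))) * ‖Rw A l⇂s (r + t * I) / Jw A l⇂s -
          cexp (((r : ℂ) + t * I) ^ 2 / 2 * ((σ ^ 2 : ℝ) : ℂ))‖ ≤
        rexp ((1 + v) ^ 2 / 2) * (C * ((1 + v ^ 4) / N)) * rexp (-(σ ^ 2 / 8 * t ^ 2)) +
        rexp ((1 + v) ^ 2 / 2) * (C / N ^ 2) * rexp (-(|t| / (2 * (N / σ)))) := by
  obtain ⟨κ, hκ⟩ := @exists_eq _ (max ((1 + κ₁) / 2) (3 / 4))
  have hκa : κ₁ < κ := hκ ▸ lt_of_lt_of_le (by linarith) (le_max_left _ _)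
  have hκb : 3 / 4 ≤ κ := hκ ▸ le_max_right _ _
  have hκc : κ < 1 := hκ ▸ max_lt (by linarith) (by norm_num)
  obtain ⟨C, N₁, c₁, hC, hc₁, H⟩ := SysHyp.Rw_near hc hc1 hκ₁ hκa.le hκc
  obtain ⟨P, hP⟩ := @exists_eq _ (36 / c ^ 2)
  have hP0 : 0 < P := by rw [hP]; positivity
  obtain ⟨B, hB⟩ := @exists_eq _ ((1 + K) ^ 4)
  have hB0 : 0 < B := by rw [hB]; positivity
  obtain ⟨D, hD⟩ := @exists_eq _ (6 * (1 + K) ^ 2 / c)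
  have hD1 : 1 ≤ D := by rw [hD, le_div_iff₀ hc]; nlinarith only [hc1, hK]
  obtain ⟨ε, hε⟩ := @exists_eq _ (min (c / (96 * C)) (1 / 10 ^ 6))
  have hε0 : 0 < ε := by rw [hε]; positivity
  obtain ⟨C₁, hC₁⟩ := @exists_eq _ (256 * C * (1 + 2 * P) * rexp (2 * C * P * B))
  have hC₁0 : 0 < C₁ := by rw [hC₁]; positivity
  obtain ⟨η, hη⟩ := @exists_eq _ (c / 10 ^ 4)
  have hη0 : 0 < η := by rw [hη]; positivity
  have hη1 : η ≤ 1 := by rw [hη]; linarith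
  obtain ⟨c₃, hc₃⟩ := @exists_eq _ (c * η ^ 2 / 3 * rexp (-(8 / η + 1)))
  have hc₃0 : 0 < c₃ := by rw [hc₃]; positivity
  have hev : ∀ᶠ N : ℝ in atTop, N₁ ≤ N ∧ 3 ≤ N ∧ 2 * D ≤ N ^ (κ - 1 / 2) ∧ 1 / ε ≤ N ^ (1 - κ) ∧
      (3 + 1 / c₁ + 80000 * (P * B)) * N ^ κ₁ + (3 + 1 / c₁ + 80000 * (P * B)) * log N +
        (3 + 1 / c₁ + 80000 * (P * B)) ≤ c / 48 * N ^ κ ∧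
      (28 * D + 3 + 1 / c₁) * N ^ κ + (28 * D + 3 + 1 / c₁) * log N + (28 * D + 3 + 1 / c₁) ≤
        c₃ * (N / log N ^ 2) ∧ 2 * N ^ (0 : ℝ) + 2 * log N + 2 ≤ c / 12 * N ^ (1 / 100 : ℝ) := by
    filter_upwards [eventually_ge_atTop N₁, eventually_ge_atTop 3,
      eventually_const_le_rpow (2 * D) (κ - 1 / 2) (by linarith),
      eventually_const_le_rpow (1 / ε) (1 - κ) (by linarith),
      eventually_saving_rpow (D := 3 + 1 / c₁ + 80000 * (P * B)) (by positivity : 0 < c / 48) hκ₁ hκa,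
      eventually_saving (D := 28 * D + 3 + 1 / c₁) hc₃0 (by linarith) hκc,
      eventually_saving_rpow (D := 2) (by positivity : 0 < c / 12) le_rfl
        (by norm_num : (0 : ℝ) < 1 / 100)] with N h1 h2 h3 h4 h5 h6 h7
    exact ⟨h1, h2, h3, h4, h5, h6, h7⟩
  obtain ⟨N₀, hN₀⟩ := eventually_atTop.1 hev
  refine ⟨C₁ * (1 + K ^ 4) + C₁ + 2, N₀, by positivity, fun s l A N Y h hN => ?_⟩
  obtain ⟨hNN₁, hN3, hND, hNε, hNs, hNg, hNt⟩ := hN₀ N hN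
  have hN0 : 0 < N := by linarith
  have hA := h.hA
  obtain ⟨hJ, H⟩ := H s l A N Y h hNN₁
  obtain ⟨J, hJJ⟩ := @exists_eq _ (Jw A l⇂s)
  rw [← hJJ] at hJ H ⊢
  have hsN : 0 < √N := Real.sqrt_pos.2 hN0
  have hJ0 : 0 < J := lt_of_lt_of_le (by positivity) hJ
  refine ⟨hJ0, fun v σ r t hv hvK hσ hσ2 hrσ => ?_⟩
  rw [← hσ2] at H
  have hσN : c * N / 6 ≤ σ ^ 2 := hσ2 ▸ h.sum_rl2.1
  have hr0 : 0 < r := pos_of_mul_pos_left (by rw [hrσ]; positivity) hσ.le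
  obtain ⟨b, hb⟩ := @exists_eq _ (N ^ (1 / 4 : ℝ))
  have hb1 : 1 ≤ b := hb ▸ Real.one_le_rpow (by linarith) (by norm_num)
  have hb2 : b ^ 2 = N ^ (1 / 2 : ℝ) := by rw [hb, ← rpow_natCast, ← rpow_mul hN0.le]; norm_num
  have hb3 : b ^ 3 = N ^ (3 / 4 : ℝ) := by rw [hb, ← rpow_natCast, ← rpow_mul hN0.le]; norm_num
  have hb4 : b ^ 4 = N := by rw [hb, ← rpow_natCast, ← rpow_mul hN0.le]; norm_num
  rw [← hb] at hvK
  have hvb : 1 + v ≤ (1 + K) * b := by linarith only [hvK, hb1]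
  have hv4 : (1 + v) ^ 4 ≤ B * N := by rw [hB, ← hb4, ← mul_pow]; gcongr
  have hNr2 : N * r ^ 2 ≤ D * b ^ 2 := by
    have h1 : (1 + v) ^ 2 ≤ (1 + K) ^ 2 * b ^ 2 := by rw [← mul_pow]; gcongr
    have h2 := mul_le_mul_of_nonneg_right hσN (sq_nonneg r)
    have h3 : σ ^ 2 * r ^ 2 = (1 + v) ^ 2 := by rw [← hrσ]; ring
    rw [hD, div_mul_eq_mul_div, le_div_iff₀ hc]; linarith
  have hNκ0 : 0 < N ^ κ := by positivity
  have hNr : N * r ^ 2 ≤ N ^ κ / 2 := by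
    have e : N ^ κ = N ^ (κ - 1 / 2) * b ^ 2 := by rw [hb2, ← rpow_add hN0]; congr 1; ring
    have := mul_le_mul_of_nonneg_right hND (sq_nonneg b)
    linarith
  have hNκ : N ^ κ ≤ ε * N := by
    have e : N = N ^ (1 - κ) * N ^ κ := by rw [← rpow_add hN0, sub_add_cancel, rpow_one]
    have := mul_le_mul_of_nonneg_right hNε hNκ0.le
    rw [← e, one_div, inv_mul_le_iff₀ hε0] at this; exact this
  have hr2 : r ^ 2 ≤ 1 / 10 ^ 6 := by
    have h1 : N * r ^ 2 ≤ N * ε := by linarith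
    exact (le_of_mul_le_mul_left h1 hN0).trans (hε ▸ min_le_right _ _)
  have hr1 : r ≤ 1 / 1000 := abs_le_of_sq_le_sq' (by linarith) (by norm_num) |>.2
  have hrN : r * N ≤ D * N ^ κ := by
    have h1 : r * N ≤ D * b ^ 3 := by
      refine abs_le_of_sq_le_sq' ?_ (by positivity) |>.2
      have h2 : (r * N) ^ 2 ≤ D * b ^ 6 := by
        calc _ = N * (N * r ^ 2) := by ring
          _ ≤ N * (D * b ^ 2) := by gcongr
          _ = _ := by rw [← hb4]; ring
      have h3 : 0 ≤ D * b ^ 6 := by positivity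
      linarith only [h2, mul_nonneg (sub_nonneg.2 hD1) h3]
    refine h1.trans (mul_le_mul_of_nonneg_left ?_ (by positivity))
    rw [hb3]; exact rpow_le_rpow_of_exponent_le (by linarith) hκb
  obtain ⟨M, hM⟩ := @exists_eq _ (rexp ((1 + v) ^ 2 / 2))
  have hM1 : 1 ≤ M := hM ▸ one_le_exp (by positivity)
  have hM0 : 0 < M := by linarith
  have hG : ∀ t : ℝ, ‖cexp (((r : ℂ) + t * I) ^ 2 / 2 * ((σ ^ 2 : ℝ) : ℂ))‖ =
      M * rexp (-(σ ^ 2 * t ^ 2 / 2)) := fun t => by rw [norm_gauss_transform, hrσ, hM]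
  -- the bound near the real axis
  have hI : ∀ t : ℝ, N * (r ^ 2 + t ^ 2) ≤ N ^ κ → ‖Rw A l⇂s (r + t * I) / J -
        cexp (((r : ℂ) + t * I) ^ 2 / 2 * ((σ ^ 2 : ℝ) : ℂ))‖ ≤
      M * (C₁ * ((1 + v ^ 4) / N)) * rexp (-(σ ^ 2 / 8 * t ^ 2)) := fun t ht => by
    have ht2 : r ^ 2 + t ^ 2 ≤ ε :=
      le_of_mul_le_mul_left (by linarith : N * (r ^ 2 + t ^ 2) ≤ N * ε) hN0
    have hns := norm_add_mul_I_sq r t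
    have hn4 : ‖(r : ℂ) + t * I‖ ^ 4 = (r ^ 2 + t ^ 2) ^ 2 := by rw [← hns]; ring
    have hn : ‖(r : ℂ) + t * I‖ ≤ 1 / 100 := by
      refine abs_le_of_sq_le_sq' ?_ (by norm_num) |>.2
      have : ε ≤ 1 / 10 ^ 6 := hε ▸ min_le_right _ _
      rw [hns]; linarith
    have H1 := H (r + t * I) hn (by rw [hns]; exact ht)
    have H2 := near_bound hc hC hN0 hσN hrσ hv hv4
      ((le_add_of_nonneg_left (sq_nonneg r)).trans ht2 |>.trans (hε ▸ min_le_left _ _))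
    rw [← hP, ← hC₁] at H2; rw [hG, hn4] at H1
    have hJc : (J : ℂ) ≠ 0 := mod_cast hJ0.ne'
    rw [div_sub' hJc, norm_div, norm_real, norm_eq_abs, abs_of_pos hJ0,
      div_le_iff₀ hJ0, mul_comm (J : ℂ)]
    refine H1.trans (mul_le_mul_of_nonneg_right ?_ hJ0.le)
    have := mul_le_mul_of_nonneg_left H2 hM0.le
    linarith
  obtain ⟨F, hF⟩ := @exists_eq _ (rexp (-(|t| / (2 * (N / σ)))))
  have hF0 : 0 < F := hF ▸ exp_pos _
  have hFF : rexp (-(|t| / (N / σ))) = F * F := by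
    rw [hF, ← Real.exp_add]; congr 1; field_simp; ring
  have hF1 : F ≤ 1 := hF ▸ exp_le_one_iff.2 (by
    have : 0 ≤ |t| / (2 * (N / σ)) := by positivity
    linarith)
  rw [← hM, ← hF, hFF]
  by_cases hreg : N * (r ^ 2 + t ^ 2) ≤ N ^ κ
  · calc _ ≤ 1 * (M * (C₁ * ((1 + v ^ 4) / N)) * rexp (-(σ ^ 2 / 8 * t ^ 2))) := by
          gcongr
          · exact mul_le_one₀ hF1 hF0.le hF1
          · exact hI t hreg
      _ ≤ M * ((C₁ * (1 + K ^ 4) + C₁ + 2) * ((1 + v ^ 4) / N)) * rexp (-(σ ^ 2 / 8 * t ^ 2)) := by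
          rw [one_mul]; gcongr; linarith only [mul_nonneg hC₁0.le (by positivity : 0 ≤ K ^ 4), hC₁0]
      _ ≤ _ := le_add_of_nonneg_right (by positivity)
  · push Not at hreg
    have hNt2 : N ^ κ / 2 ≤ N * t ^ 2 := by linarith
    have hgauss : rexp (-(σ ^ 2 * t ^ 2 / 2)) ≤ 1 / N ^ 2 := by
      have h1 := mul_le_mul_of_nonneg_right hσN (sq_nonneg t)
      have h2 := mul_le_mul_of_nonneg_left hNt2 hc.le
      have h3 : 0 < N ^ κ₁ := by positivity
      have h4 : 0 ≤ log N := log_nonneg (by linarith)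
      have h5 : 0 ≤ 1 / c₁ + 80000 * (P * B) := by positivity
      rw [← zero_sub]; refine exp_sub_le_inv_sq hN0 ?_
      linarith only [hNs, h1, h2, h3, h4, h5, mul_nonneg h5 h3.le, mul_nonneg h5 h4]
    have hJinv : 1 / J ≤ rexp (N ^ κ₁ + log N + 1 / c₁) := by
      have h1 : 1 / J ≤ A * √N * (1 / c₁) := by
        rw [div_le_iff₀ hJ0]; rw [div_le_iff₀ (by positivity)] at hJ
        calc (1 : ℝ) = c₁ * (1 / c₁) := by field_simp
          _ ≤ J * (A * √N) * (1 / c₁) := by gcongr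
          _ = _ := by ring
      refine h1.trans ?_; rw [Real.exp_add, Real.exp_add, Real.exp_log hN0]; gcongr
      · exact h.hAexp
      · rw [Real.sqrt_le_left hN0.le]; nlinarith only [hN3]
      · linarith [add_one_le_exp (1 / c₁)]
    have hfar : F * (‖Rw A l⇂s (r + t * I)‖ * (1 / J)) ≤
        M * ((C₁ * (1 + K ^ 4) + C₁ + 1) / N ^ 2) := by
      have hfin : ∀ X : ℝ, X ≤ M * (1 / N ^ 2) → F * X ≤ M * ((C₁ * (1 + K ^ 4) + C₁ + 1) / N ^ 2) := by
        intro X hX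
        calc F * X ≤ F * (M * (1 / N ^ 2)) := by gcongr
          _ ≤ 1 * (M * (1 / N ^ 2)) := by gcongr
          _ ≤ _ := by
            rw [one_mul]; gcongr
            linarith only [mul_nonneg hC₁0.le (by positivity : 0 ≤ K ^ 4), hC₁0]
      have hκle : N ^ κ₁ ≤ N ^ κ := rpow_le_rpow_of_exponent_le (by linarith) hκa.le
      have h3 : 0 < N ^ κ₁ := by positivity
      have h4 : 0 ≤ log N := log_nonneg (by linarith)
      have h5 : 0 < 1 / c₁ := by positivity
      have h6 : 0 < P * B := by positivity
      by_cases htη : |t| ≤ η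
      · apply hfin
        have ht2 : t ^ 2 ≤ c / 10 ^ 7 := by
          rw [← sq_abs]
          calc |t| ^ 2 ≤ η ^ 2 := by gcongr
            _ ≤ _ := by rw [hη]; nlinarith only [hc, hc1]
        have h1 := h.norm_Rw_le_small hc hN0 hr0.le hr1 ht2 hc1
        rw [← hσ2] at h1
        have h2 : N * r ^ 4 ≤ P * B := by
          have hD2 : D ^ 2 = P * B := by rw [hD, hP, hB]; ring
          have h7 : (N * r ^ 2) ^ 2 ≤ (D * b ^ 2) ^ 2 := by gcongr
          have h8 : N * (N * r ^ 4) ≤ N * (P * B) := by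
            calc _ = (N * r ^ 2) ^ 2 := by ring
              _ ≤ _ := h7
              _ = b ^ 4 * D ^ 2 := by ring
              _ = _ := by rw [hb4, hD2]
          exact le_of_mul_le_mul_left h8 hN0
        have h9 := mul_le_mul_of_nonneg_left hNt2 (by positivity : 0 ≤ c / 24)
        calc _ ≤ _ := mul_le_mul h1 hJinv (by positivity) (exp_pos _).le
          _ ≤ M * rexp ((80000 * (P * B) + (N ^ κ₁ + log N + 1 / c₁)) - c / 48 * N ^ κ) := by
              rw [hM, ← Real.exp_add, ← Real.exp_add, ← hrσ]; apply exp_le_exp.2; linarith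
          _ ≤ _ := by
              gcongr; refine exp_sub_le_inv_sq hN0 (le_trans ?_ hNs)
              linarith only [h3, h4, mul_pos h5 h3, mul_nonneg h5.le h4, mul_pos h6 h3, mul_nonneg h6.le h4]
      · push Not at htη
        by_cases htY : |t| ≤ Y
        · apply hfin
          have h1 := h.norm_Rw_le_gap hc hc1 hN3 hη0 hη1 htη htY hr0.le (hr1.trans (by norm_num))
          rw [← hc₃] at h1
          calc _ ≤ _ := mul_le_mul h1 hJinv (by positivity) (exp_pos _).le
            _ ≤ 1 * rexp ((28 * D * N ^ κ + (N ^ κ + log N + 1 / c₁)) - c₃ * (N / log N ^ 2)) := by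
                rw [one_mul, ← Real.exp_add]; apply exp_le_exp.2; linarith
            _ ≤ _ := by
                gcongr; refine exp_sub_le_inv_sq hN0 (le_trans ?_ hNg)
                linarith only [hNκ0, h4, hD1, mul_pos h5 hNκ0, mul_nonneg h5.le h4,
                  mul_nonneg (zero_le_one.trans hD1) h4]
        · push Not at htY
          have h1 := norm_Rw_le_real hA h.hl' hr0.le (hr1.trans (by norm_num)) t
          have h2 := hI 0 (by linarith)
          have h7 := hG 0
          simp only [ofReal_zero, zero_mul, add_zero] at h2 h7
          rw [show σ ^ 2 / 8 * (0 : ℝ) ^ 2 = 0 by ring, neg_zero, Real.exp_zero, mul_one] at h2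
          rw [show σ ^ 2 * (0 : ℝ) ^ 2 / 2 = 0 by ring, neg_zero, Real.exp_zero, mul_one] at h7
          have h8 := norm_sub_norm_le (Rw A l⇂s r / J)
            (cexp ((r : ℂ) ^ 2 / 2 * ((σ ^ 2 : ℝ) : ℂ)))
          rw [norm_div, norm_real, norm_eq_abs, abs_of_pos hJ0, h7] at h8
          have hv4' : (1 + v ^ 4) / N ≤ 1 + K ^ 4 := by
            rw [div_le_iff₀ hN0]
            have : v ^ 4 ≤ (K * b) ^ 4 := by gcongr
            rw [mul_pow, hb4] at this; linarith only [this, hN3]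
          have h9 : ‖Rw A l⇂s (r + t * I)‖ * (1 / J) ≤ M * (C₁ * (1 + K ^ 4) + 1) := by
            calc _ ≤ ‖Rw A l⇂s r‖ * (1 / J) := by gcongr
              _ = ‖Rw A l⇂s r‖ / J := by ring
              _ ≤ M + M * (C₁ * ((1 + v ^ 4) / N)) := by linarith
              _ ≤ M + M * (C₁ * (1 + K ^ 4)) := by gcongr
              _ = _ := by ring
          have hFN : F ≤ 1 / N ^ 2 := by
            rw [hF, ← zero_sub]; refine exp_sub_le_inv_sq hN0 ?_
            have hN100 : N ^ (1 / 100 : ℝ) ≤ (A * N) ^ (1 / 100 : ℝ) := by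
              gcongr; exact le_mul_of_one_le_left hN0.le hA
            have hNσ : c / 6 * √N ≤ σ := by
              refine abs_le_of_sq_le_sq' ?_ hσ.le |>.2; rw [mul_pow, sq_sqrt hN0.le]
              refine le_trans ?_ hσN
              nlinarith only [mul_nonneg (mul_nonneg hc.le (sub_nonneg.2 hc1)) hN0.le, mul_pos hc hN0]
            have hp : 0 < N ^ (1 / 100 : ℝ) := by positivity
            have hYN : √N * N ^ (1 / 100 : ℝ) ≤ |t| := by
              refine le_trans ?_ (h.hY.trans htY.le)
              have h10 : √N ≤ A * √N := le_mul_of_one_le_left hsN.le hA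
              exact mul_le_mul h10 hN100 hp.le (by positivity)
            have : c / 12 * N ^ (1 / 100 : ℝ) ≤ |t| / (2 * (N / σ)) := by
              rw [le_div_iff₀ (by positivity)]
              have h11 : c / 12 * N ^ (1 / 100 : ℝ) * (2 * (N / σ)) =
                  c / 6 * √N * (√N * N ^ (1 / 100 : ℝ)) / σ := by
                linear_combination (-(c / 6 * N ^ (1 / 100 : ℝ) / σ)) * Real.mul_self_sqrt hN0.le
              rw [h11, div_le_iff₀ hσ, mul_comm |t|]; exact mul_le_mul hNσ hYN (by positivity) hσ.le
            rw [Real.rpow_zero] at hNt; linarith only [hNt, this]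
          calc _ ≤ 1 / N ^ 2 * (M * (C₁ * (1 + K ^ 4) + 1)) := by gcongr
            _ = M * ((C₁ * (1 + K ^ 4) + 1) / N ^ 2) := by ring
            _ ≤ _ := by gcongr; linarith
    have hnorm : ‖Rw A l⇂s (r + t * I) / J - cexp (((r : ℂ) + t * I) ^ 2 / 2 * ((σ ^ 2 : ℝ) : ℂ))‖ ≤
        ‖Rw A l⇂s (r + t * I)‖ * (1 / J) + M * (1 / N ^ 2) := by
      refine (norm_sub_le _ _).trans ?_
      rw [hG, norm_div, norm_real, norm_eq_abs, abs_of_pos hJ0, mul_one_div]; gcongr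
    calc _ ≤ F * F * (‖Rw A l⇂s (r + t * I)‖ * (1 / J) + M * (1 / N ^ 2)) := by gcongr
      _ = F * (F * (‖Rw A l⇂s (r + t * I)‖ * (1 / J))) + F * (F * (M * (1 / N ^ 2))) := by ring
      _ ≤ F * (M * ((C₁ * (1 + K ^ 4) + C₁ + 1) / N ^ 2)) + F * (1 * (M * (1 / N ^ 2))) := by gcongr
      _ = M * ((C₁ * (1 + K ^ 4) + C₁ + 2) / N ^ 2) * F := by ring
      _ ≤ _ := le_add_of_nonneg_left (by positivity)

/-! ### The divisor distribution as a measure -/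

lemma exists_discrete_measure {β : Type*} (Q : Finset β) (w z : β → ℝ) (hw : ∀ i, 0 ≤ w i)
    (hsum : ∑ i ∈ Q, w i = 1) : ∃ μ : Measure ℝ, IsProbabilityMeasure μ ∧
      (∀ f : ℝ → ℂ, Integrable f μ ∧ ∫ a, f a ∂μ = ∑ i ∈ Q, (w i : ℂ) * f (z i)) ∧
      ∀ a, μ.real (Set.Ici a) = ∑ i ∈ Q, w i * if a ≤ z i then 1 else 0 := by
  have hap : ∀ S : Set ℝ, MeasurableSet S →
      (∑ i ∈ Q, ENNReal.ofReal (w i) • Measure.dirac (z i)) S =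
      ENNReal.ofReal (∑ i ∈ Q, w i * if z i ∈ S then 1 else 0) := fun S hS => by
    rw [ENNReal.ofReal_sum_of_nonneg fun i _ => mul_nonneg (hw i) (by split_ifs <;> norm_num),
      Measure.finsetSum_apply]
    refine sum_congr rfl fun i _ => ?_
    rw [Measure.smul_apply, Measure.dirac_apply' _ hS, smul_eq_mul, ENNReal.ofReal_mul (hw i)]
    by_cases h : z i ∈ S <;> simp [h]
  have hi : ∀ (f : ℝ → ℂ) (i : β), Integrable f (ENNReal.ofReal (w i) • Measure.dirac (z i)) :=
    fun f i => (integrable_dirac (by simp [enorm])).smul_measure ENNReal.ofReal_ne_top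
  refine ⟨∑ i ∈ Q, ENNReal.ofReal (w i) • Measure.dirac (z i), ⟨?_⟩, fun f => ⟨?_, ?_⟩, fun a => ?_⟩
  · rw [hap _ MeasurableSet.univ]
    simp [hsum]
  · exact integrable_finsetSum_measure.2 fun i _ => hi f i
  · rw [integral_finsetSum_measure fun i _ => hi f i]
    refine sum_congr rfl fun i _ => ?_
    rw [integral_smul_measure, integral_dirac, ENNReal.toReal_ofReal (hw i), real_smul]
  · rw [Measure.real, hap _ measurableSet_Ici, ENNReal.toReal_ofReal]
    · simp only [Set.mem_Ici]
    · exact sum_nonneg fun i _ => mul_nonneg (hw i) (by split_ifs <;> norm_num)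

lemma Psi_pos (hx : 1 ≤ x) : 0 < (Psi x y : ℝ) := by
  refine Nat.cast_pos.2 (card_pos.2 ⟨1, mem_filter.2 ⟨?_, fun p hp h => ?_⟩⟩)
  · exact mem_Icc.2 ⟨le_rfl, Nat.le_floor (by simpa using hx)⟩
  · exact absurd (Nat.dvd_one.1 h) hp.one_lt.ne'

/-- The law of `(log d - log n / 2) / L` for a random friable integer `n` and a random divisor `d`. -/
lemma exists_divisor_measure (y : ℝ) (hx : 1 ≤ x) (hL : 0 < L) :
    ∃ μ : Measure ℝ, IsProbabilityMeasure μ ∧ (∀ f : ℝ → ℂ, Integrable f μ) ∧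
      (∀ ζ : ℂ, ∫ z : ℝ, cexp (ζ * (z : ℂ)) ∂μ = (Psi x y : ℂ)⁻¹ * ∑ n ∈ Sxy x y, Tn L ζ n) ∧
      ∀ γ, μ.real (Set.Ici (γ / L)) = Dxy x y γ := by
  have hΨ := Psi_pos (y := y) hx
  have hn0 : ∀ n ∈ Sxy x y, n ≠ 0 := fun n hn => by
    have := (mem_Icc.1 (mem_filter.1 hn).1).1; omega
  obtain ⟨μ, hμ, hf, hI⟩ := exists_discrete_measure ((Sxy x y).sigma fun n => n.divisors)
    (fun i => (Psi x y : ℝ)⁻¹ * (i.1.divisors.card : ℝ)⁻¹)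
    (fun i => (log i.2 - log i.1 / 2) / L) (fun i => by positivity) (by
      rw [sum_sigma]
      have h1 : ∀ n ∈ Sxy x y, ∑ _d ∈ n.divisors, (Psi x y : ℝ)⁻¹ * (n.divisors.card : ℝ)⁻¹ =
          (Psi x y : ℝ)⁻¹ := fun n hn => by
        have : (n.divisors.card : ℝ) ≠ 0 := by simp [hn0 n hn]
        rw [sum_const, nsmul_eq_mul]; field_simp
      rw [sum_congr rfl h1, sum_const, nsmul_eq_mul]
      exact mul_inv_cancel₀ hΨ.ne')
  refine ⟨μ, hμ, fun f => (hf f).1, fun ζ => ?_, fun γ => ?_⟩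
  · rw [(hf _).2, sum_sigma, mul_sum]
    refine sum_congr rfl fun n _ => ?_
    rw [Tn, mul_sum, mul_sum]; refine sum_congr rfl fun d _ => ?_
    push_cast; ring
  · rw [hI, sum_sigma, Dxy, mul_sum]
    refine sum_congr rfl fun n hn => ?_
    have himg : (n.divisors >>= fun a => pure (a : ℝ)) = n.divisors.image (Nat.cast : ℕ → ℝ) := by
      ext a; simp [Finset.bind_def, eq_comm]
    rw [himg, natCast_card_filter, sum_image Nat.cast_injective.injOn, mul_sum, mul_sum]
    refine sum_congr rfl fun d hd => ?_
    have hnp : (0 : ℝ) < n := mod_cast Nat.pos_of_ne_zero (hn0 n hn)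
    have hdp : (0 : ℝ) < d := mod_cast Nat.pos_of_mem_divisors hd
    have hiff : γ / L ≤ (log d - log n / 2) / L ↔ √(n : ℝ) * rexp γ ≤ d := by
      rw [div_le_div_iff_of_pos_right hL, ← Real.log_le_log_iff (by positivity) hdp,
        Real.log_mul (by positivity) (exp_pos _).ne', Real.log_exp, Real.log_sqrt hnp.le]
      constructor <;> intro h <;> linarith
    simp only [hiff]; push_cast; ring

lemma Rw_div_Jw (hy : 0 ≤ y) (hx : 1 ≤ x) (hα : 0 < α) (hL : 0 < L)
    (h : saddleEq x y α) (ζ : ℂ) :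
    Rw (α * L) (fun p : primesLe y => log p / L) ζ /
      (Jw (α * L) (fun p : primesLe y => log p / L) : ℂ) =
      (Psi x y : ℂ)⁻¹ * ∑ n ∈ Sxy x y, Tn L ζ n := by
  obtain ⟨c₀, hc₀, H⟩ := integral_wc_eq_sum hy (by linarith : 0 < x) hα hL h
  have hJ : (Jw (α * L) (fun p : primesLe y => log p / L) : ℂ) = c₀ * Psi x y := by
    have := H fun _ => 1
    simp only [mul_one, sum_const, nsmul_eq_mul] at this; rw [integral_complex_ofReal] at this
    exact this
  have hR : Rw (α * L) (fun p : primesLe y => log p / L) ζ = c₀ * ∑ n ∈ Sxy x y, Tn L ζ n := by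
    rw [Rw, H fun k => ∏ p : primesLe y, Tk (log p / L) ζ (k p)]
    congr 1; exact sum_congr rfl fun n hn => (Tn_eq_prod hy ζ hn).symm
  have hc : (c₀ : ℂ) ≠ 0 := mod_cast hc₀.ne'
  rw [hR, hJ, mul_div_mul_left _ _ hc, div_eq_inv_mul]

lemma final_bound {v C Δ Φ : ℝ} (hN : 0 < N) (hσ : 0 < σ) (hv : 0 ≤ v) (hC : 0 < C)
    (hrσ : r * σ = 1 + v) (hΦ : rexp (-v ^ 2 / 2) / (1 + v) ≤ 15 * Φ) (hΦ0 : 0 ≤ Φ)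
    (h : rexp (r * (v * σ)) * Δ ≤
      41 / r * (rexp ((1 + v) ^ 2 / 2) * (C * ((1 + v ^ 4) / N)) * √(π / (σ ^ 2 / 8)) +
        rexp ((1 + v) ^ 2 / 2) * (C / N ^ 2) * (4 * (N / σ))) +
      80 / (N / σ) * (rexp ((1 + v) ^ 2 / 2) * √(π / (σ ^ 2 / 8)))) :
    Δ ≤ 30 * (410 * C + 960) * Φ * (1 + v ^ 4) / N := by
  have hs : √(π / (σ ^ 2 / 8)) ≤ 6 / σ := by
    rw [Real.sqrt_le_left (by positivity), div_div_eq_mul_div, div_pow]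
    gcongr; linarith [Real.pi_lt_four]
  have hr : r = (1 + v) / σ := by rw [eq_div_iff hσ.ne', hrσ]
  obtain ⟨V, hV⟩ := @exists_eq _ ((1 + v ^ 4) / N)
  have hV1 : 1 / N ≤ V := by rw [hV]; gcongr; linarith [pow_nonneg hv 4]
  have hV2 : 1 / N ≤ 2 * V / (1 + v) := by
    rw [hV, mul_div_assoc', div_div, div_le_div_iff₀ hN (by positivity)]
    have : 1 + v ≤ 2 * (1 + v ^ 4) := by nlinarith [sq_nonneg (v ^ 2 - 1), sq_nonneg (v - 1)]
    nlinarith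
  have hV0 : 0 ≤ V := le_trans (by positivity) hV1
  have e1 : rexp (r * (v * σ)) = rexp ((1 + v) ^ 2 / 2) * (rexp (-(1 / 2)) * rexp (v ^ 2 / 2)) := by
    rw [← Real.exp_add, ← Real.exp_add]; congr 1
    linear_combination v * hrσ
  obtain ⟨M, hM⟩ := @exists_eq _ (rexp ((1 + v) ^ 2 / 2))
  have hM0 : 0 < M := hM ▸ exp_pos _
  rw [e1, ← hM, ← hV] at h
  have h2 : M * (rexp (-(1 / 2)) * rexp (v ^ 2 / 2)) * Δ ≤ M * ((410 * C + 960) * V / (1 + v)) := by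
    refine h.trans ?_
    calc _ ≤ 41 / r * (M * (C * V) * (6 / σ) + M * (C / N ^ 2) * (4 * (N / σ))) +
          80 / (N / σ) * (M * (6 / σ)) := by
          have : 0 < r := by rw [hr]; positivity
          gcongr
      _ = M * (41 * C / (1 + v) * (6 * V + 4 * (1 / N)) + 480 * (1 / N)) := by
          rw [hr]; field_simp; ring
      _ ≤ M * (41 * C / (1 + v) * (6 * V + 4 * V) + 480 * (2 * V / (1 + v))) := by gcongr
      _ = _ := by ring
  rw [mul_assoc] at h2
  have h3 := le_of_mul_le_mul_left h2 hM0
  have hE : 1 / 2 ≤ rexp (-(1 / 2)) := by linarith [add_one_le_exp (-(1 / 2) : ℝ)]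
  rcases le_or_gt Δ 0 with hΔ | hΔ
  · exact hΔ.trans (by positivity)
  have h4 : rexp (v ^ 2 / 2) * Δ ≤ 2 * ((410 * C + 960) * V / (1 + v)) := by
    have := mul_le_mul_of_nonneg_right hE (by positivity : 0 ≤ rexp (v ^ 2 / 2) * Δ)
    linarith
  have e2 : rexp (-v ^ 2 / 2) * rexp (v ^ 2 / 2) = 1 := by rw [← Real.exp_add]; ring_nf; simp
  calc Δ = rexp (-v ^ 2 / 2) * (rexp (v ^ 2 / 2) * Δ) := by rw [← mul_assoc, e2, one_mul]
    _ ≤ rexp (-v ^ 2 / 2) * (2 * ((410 * C + 960) * V / (1 + v))) := by gcongr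
    _ = 2 * (410 * C + 960) * V * (rexp (-v ^ 2 / 2) / (1 + v)) := by ring
    _ ≤ 2 * (410 * C + 960) * V * (15 * Φ) := by gcongr
    _ = _ := by rw [hV]; ring

lemma Dxy_mem_Icc (hx : 1 ≤ x) (y γ : ℝ) : 0 ≤ Dxy x y γ ∧ Dxy x y γ ≤ 1 := by
  obtain ⟨μ, hμ, -, -, hD⟩ := exists_divisor_measure y hx one_pos
  rw [← hD]; exact ⟨measureReal_nonneg, measureReal_le_one⟩

lemma PhiGauss_mem_Icc (v : ℝ) : 0 ≤ PhiGauss v ∧ PhiGauss v ≤ 1 := by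
  rw [← gaussianReal_Ici one_pos v]; exact ⟨measureReal_nonneg, measureReal_le_one⟩

/-- The Gaussian approximation once `ū` is large. -/
lemma exists_bound_of_large {ε K : ℝ} (hε : 0 < ε) (hK : 0 < K) :
    ∃ C U : ℝ, 0 < C ∧ ∀ x y v α : ℝ, 3 ≤ x → 2 ≤ y →
      y ≤ rexp (log x / (log (log x)) ^ (1 + ε)) → 0 < α → saddleEq x y α →
      0 ≤ v → v ≤ K * (ubar x y) ^ ((1 : ℝ) / 4) → U ≤ ubar x y →
      |Dxy x y (v * rhoXY y α) - PhiGauss v| ≤ C * PhiGauss v * (1 + v ^ 4) / ubar x y := by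
  obtain ⟨y₀, hy₀⟩ := eventually_atTop.1 (eventually_sys hε)
  obtain ⟨C, N₀, hC, H⟩ := SysHyp.laplace (c := 1 / 10 ^ 24) (κ₁ := 1 / (1 + ε)) (by norm_num)
    (by norm_num) (by positivity) ((div_lt_one (by positivity)).2 (by linarith)) hK
  obtain ⟨N₁, hN₁⟩ := eventually_atTop.1
    (eventually_const_le_rpow (1 + K) (3 / 4) (by norm_num))
  refine ⟨30 * (410 * C + 960), max (max y₀ N₀) (max N₁ 100000), by positivity,
    fun x y v α hx hy hyx hα hsad hv hvK hU => ?_⟩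
  obtain ⟨⟨hUy, hUN⟩, hUN₁, hU5⟩ := by simpa only [max_le_iff] using hU
  have hy0 : 0 ≤ y := by linarith
  have hsys := hy₀ y (hUy.trans (ubar_le_self hy0)) x α hx hyx hα hsad hU5
  have hL : 0 < Lsc y α := lt_of_lt_of_le (by positivity) (le_max_left _ _)
  obtain ⟨L, hLL⟩ := @exists_eq _ (Lsc y α)
  rw [← hLL] at hsys hL; obtain ⟨N, hN⟩ := @exists_eq _ (ubar x y)
  rw [← hN] at hsys hU5 hUN hUN₁ hvK ⊢
  have hN0 : 0 < N := by linarith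
  obtain ⟨-, H⟩ := H _ _ _ _ _ hsys hUN
  obtain ⟨σ, hσ⟩ := @exists_eq _ (rhoXY y α / L)
  have hσ2 : σ ^ 2 = ∑ p : primesLe y, rl2 (α * L) (log p / L) := by rw [hσ, sum_rl2_eq hα hL]
  have hσ0 : 0 < σ := by
    have h1 : 0 < σ ^ 2 := by rw [hσ2]; exact lt_of_lt_of_le (by positivity) hsys.sum_rl2.1
    have h2 : 0 ≤ σ := by rw [hσ]; unfold rhoXY; positivity
    exact lt_of_le_of_ne h2 fun h => by rw [← h] at h1; norm_num at h1
  obtain ⟨r, hr⟩ := @exists_eq _ ((1 + v) / σ)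
  have hrσ : r * σ = 1 + v := by rw [hr]; field_simp
  have hr0 : 0 < r := by rw [hr]; positivity
  obtain ⟨μ, hμ, hitg, htr, hD⟩ := exists_divisor_measure y (by linarith : 1 ≤ x) hL
  have hrT : r ≤ N / σ := by
    rw [hr]; gcongr
    have e : N = N ^ (3 / 4 : ℝ) * N ^ (1 / 4 : ℝ) := by rw [← rpow_add hN0]; norm_num
    have h1 := hN₁ N hUN₁
    have h2 : 1 ≤ N ^ (1 / 4 : ℝ) := Real.one_le_rpow (by linarith) (by norm_num)
    rw [e]; nlinarith
  have hν : ∀ ζ : ℂ, ∫ z : ℝ, cexp (ζ * (z : ℂ))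
      ∂(gaussianReal 0 (toNNReal (σ ^ 2))) = cexp (ζ ^ 2 / 2 * ((σ ^ 2 : ℝ) : ℂ)) := fun ζ => by
    have := ProbabilityTheory.complexMGF_id_gaussianReal (μ := 0) (v := toNNReal (σ ^ 2)) ζ
    simp only [complexMGF, id] at this
    have e : ((toNNReal (σ ^ 2) : NNReal) : ℝ) = σ ^ 2 := Real.coe_toNNReal _ (sq_nonneg σ)
    rw [this, e]; congr 1; push_cast; ring
  have key := laplace_compare μ (gaussianReal 0 (toNNReal (σ ^ 2)))
    (s := r) (T := N / σ) (a := v * σ) (b := σ ^ 2 / 8) (M := rexp ((1 + v) ^ 2 / 2))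
    (e₁ := rexp ((1 + v) ^ 2 / 2) * (C * ((1 + v ^ 4) / N)))
    (τ := rexp ((1 + v) ^ 2 / 2) * (C / N ^ 2)) hr0 hrT (by positivity) (by positivity)
    (by positivity) (hitg _)
    (integrable_exp_mul_gaussianReal r).ofReal
    (fun t => by
      rw [htr, hν, ← Rw_div_Jw hy0 (by linarith) hα hL hsad]
      exact H v σ r t hv hvK hσ0 hσ2 hrσ)
    (fun t => by
      rw [hν, norm_gauss_transform, hrσ]; gcongr
      nlinarith [mul_nonneg (sq_nonneg σ) (sq_nonneg t)])
  have ha : v * σ = v * rhoXY y α / L := by rw [hσ]; ring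
  rw [gaussianReal_Ici hσ0] at key
  nth_rewrite 2 [ha] at key
  rw [hD] at key; exact final_bound hN0 hσ0 hv hC hrσ (PhiGauss_ge hv) (PhiGauss_mem_Icc v).1 key

lemma ubar_pos (hx : 3 ≤ x) (hy : 2 ≤ y) : 0 < ubar x y := by
  refine lt_min (div_pos (log_pos (by linarith)) (log_pos (by linarith))) ?_
  refine Nat.cast_pos.2 (card_pos.2 ⟨2, mem_filter.2 ⟨?_, Nat.prime_two⟩⟩)
  exact mem_Iic.2 (Nat.le_floor (by simpa using hy))

/-- For every `ε > 0` and `K > 0` there is `C > 0` such that for all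
`x ≥ 3`, `2 ≤ y ≤ exp((log x)/(log log x)^{1+ε})` and `0 ≤ v ≤ K ū^{1/4}`,
`|D(x,y;v) − Φ(v)| ≤ C Φ(v) (1+v⁴)/ū`. -/
theorem stmt0 :
    ∀ ε > (0 : ℝ), ∀ K > (0 : ℝ), ∃ C > (0 : ℝ), ∀ x y v α : ℝ,
      3 ≤ x → 2 ≤ y →
      y ≤ Real.exp (Real.log x / (Real.log (Real.log x)) ^ (1 + ε)) →
      0 < α → saddleEq x y α →
      0 ≤ v → v ≤ K * (ubar x y) ^ ((1 : ℝ) / 4) →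
      |Dxy x y (v * rhoXY y α) - PhiGauss v| ≤
        C * PhiGauss v * (1 + v ^ 4) / ubar x y := by
  intro ε hε K hK; obtain ⟨C, U, hC, H⟩ := exists_bound_of_large hε hK
  obtain ⟨U', hU'⟩ := @exists_eq _ (max U 1)
  have hU1 : 1 ≤ U' := hU' ▸ le_max_right _ _
  obtain ⟨V, hV⟩ := @exists_eq _ (K * U' ^ ((1 : ℝ) / 4))
  have hV0 : 0 ≤ V := by rw [hV]; positivity
  obtain ⟨φ, hφ⟩ := @exists_eq _ (rexp (-V ^ 2 / 2) / (1 + V) / 15)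
  have hφ0 : 0 < φ := by rw [hφ]; positivity
  refine ⟨C + U' / φ, by positivity, fun x y v α hx hy hyx hα hsad hv hvK => ?_⟩
  have hu := ubar_pos hx hy
  have hΦ := PhiGauss_mem_Icc v
  have hv4 : 0 ≤ v ^ 4 := by positivity
  by_cases hU : U ≤ ubar x y
  · refine (H x y v α hx hy hyx hα hsad hv hvK hU).trans ?_
    have hp := hΦ.1
    gcongr; exact le_add_of_nonneg_right (by positivity)
  · have hle : ubar x y ≤ U' := (not_le.1 hU).le.trans (hU' ▸ le_max_left _ _)
    have hvV : v ≤ V := hvK.trans (by rw [hV]; gcongr)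
    have hφΦ : φ ≤ PhiGauss v := by
      have h1 : rexp (-V ^ 2 / 2) / (1 + V) ≤ rexp (-v ^ 2 / 2) / (1 + v) := by gcongr
      have := PhiGauss_ge hv
      rw [hφ]; linarith
    have hD := Dxy_mem_Icc (by linarith : 1 ≤ x) y (v * rhoXY y α)
    have h1 : |Dxy x y (v * rhoXY y α) - PhiGauss v| ≤ 1 := by rw [abs_le]; constructor <;> linarith
    refine h1.trans ?_; rw [le_div_iff₀ hu, one_mul]
    calc ubar x y ≤ U' := hle
      _ = U' / φ * φ * 1 := by field_simp
      _ ≤ (C + U' / φ) * PhiGauss v * (1 + v ^ 4) := by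
        gcongr
        · exact mul_nonneg (by positivity) hΦ.1
        · exact le_add_of_nonneg_left hC.le
        · linarith

end
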